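/- Let ω ∈ ℝ^r satisfy the Diophantine condition with constants C₀ > 0 and τ₀ ≥ r−1, and let f : ℝ^r × ℝ^s → ℝ be real analytic and 2π-periodic in each of its d = r+s variables. Let β₀ ∈ ℝ^s be such that ∇f₀(β₀) = 0 and assume that the Hessian matrix ∂²f₀(β₀) has s pairwise distinct, strictly positive eigenvalues. Then there exist ε̄ > 0 and a measurable set ℰ ⊆ (0, ε̄) such that: (i) for every ε ∈ ℰ there exist real-analytic functions a : ℝ^r → ℝ^r and b : ℝ^r → ℝ^s, 2π-periodic in each variable, such that for every ψ ∈ ℝ^r the curves α(t) = ψ + ωt + a(ψ + ωt) and β(t) = β₀ + b(ψ + ωt) satisfy the equations of motion α̈(t) = −ε ∇_α f(α(t), β(t)) and β̈(t) = −ε ∇_β f(α(t), β(t)) for all t ∈ ℝ; and (ii) Leb(ℰ ∩ (0, ε))/ε → 1 as ε → 0⁺. -/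

import Mathlib

open MeasureTheory Real Filter

namespace KAM

def LB (D : Set ℝ) (s : ℝ) (c : ℝ → ℂ) (C : ℝ) : Prop :=
  ∀ σ ∈ D, ∀ σ' ∈ D, ‖c σ‖ + |s| * (‖c σ - c σ'‖ / |σ - σ'|) ≤ C

def nrm {r : ℕ} (ν : Fin r → ℤ) : ℝ := ∑ k, |(ν k : ℝ)|

noncomputable def ch {r : ℕ} (ν : Fin r → ℤ) (ψ : Fin r → ℝ) : ℂ :=
  Complex.exp (Complex.I * ((∑ k, (ν k : ℝ) * ψ k : ℝ) : ℂ))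

lemma nrm_nonneg {r : ℕ} (ν : Fin r → ℤ) : 0 ≤ nrm ν :=
  Finset.sum_nonneg fun _ _ => abs_nonneg _

lemma nrm_add {r : ℕ} (ν μ : Fin r → ℤ) : nrm (ν + μ) ≤ nrm ν + nrm μ := by
  unfold nrm
  rw [← Finset.sum_add_distrib]
  refine Finset.sum_le_sum fun k _ => ?_
  simp only [Pi.add_apply, Int.cast_add]
  exact abs_add_le _ _

@[simp] lemma nrm_zero {r : ℕ} : nrm (0 : Fin r → ℤ) = 0 := by simp [nrm]

@[simp] lemma nrm_neg {r : ℕ} (ν : Fin r → ℤ) : nrm (-ν) = nrm ν := by simp [nrm]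

@[simp] lemma ch_zero {r : ℕ} (ψ : Fin r → ℝ) : ch 0 ψ = 1 := by simp [ch]

lemma ch_add {r : ℕ} (ν μ : Fin r → ℤ) (ψ : Fin r → ℝ) : ch (ν + μ) ψ = ch ν ψ * ch μ ψ := by
  unfold ch
  rw [← Complex.exp_add, ← mul_add, ← Complex.ofReal_add, ← Finset.sum_add_distrib]
  simp only [Pi.add_apply, Int.cast_add, add_mul]

@[simp] lemma norm_ch {r : ℕ} (ν : Fin r → ℤ) (ψ : Fin r → ℝ) : ‖ch ν ψ‖ = 1 := by
  unfold ch
  rw [mul_comm]; exact Complex.norm_exp_ofReal_mul_I _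

lemma ch_neg {r : ℕ} (ν : Fin r → ℤ) (ψ : Fin r → ℝ) :
    ch (-ν) ψ = (starRingEnd ℂ) (ch ν ψ) := by
  unfold ch
  rw [← Complex.exp_conj, map_mul, Complex.conj_I, Complex.conj_ofReal]
  congr 1
  simp

namespace LB

variable {D : Set ℝ} {s : ℝ} {c c' : ℝ → ℂ} {C C' : ℝ}

lemma norm_le (h : LB D s c C) {σ : ℝ} (hσ : σ ∈ D) : ‖c σ‖ ≤ C := by
  have := h σ hσ σ hσ
  simpa using this

lemma lip (h : LB D s c C) {σ σ' : ℝ} (hσ : σ ∈ D) (hσ' : σ' ∈ D) :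
    |s| * ‖c σ - c σ'‖ ≤ C * |σ - σ'| := by
  by_cases he : σ = σ'
  · simp [he]
  have h0 : 0 < |σ - σ'| := abs_pos.mpr (sub_ne_zero.mpr he)
  have := h σ hσ σ' hσ'
  have h1 : |s| * (‖c σ - c σ'‖ / |σ - σ'|) ≤ C := by linarith [norm_nonneg (c σ)]
  rw [← mul_div_assoc, div_le_iff₀ h0] at h1
  exact h1

lemma of_le {A B : ℝ} (hA : ∀ σ ∈ D, ‖c σ‖ ≤ A) (hB0 : 0 ≤ B)
    (hB : ∀ σ ∈ D, ∀ σ' ∈ D, |s| * ‖c σ - c σ'‖ ≤ B * |σ - σ'|) : LB D s c (A + B) := by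
  intro σ hσ σ' hσ'
  by_cases he : σ = σ'
  · subst he
    simp only [sub_self, norm_zero, zero_div, mul_zero, abs_zero, add_zero]
    linarith [hA σ hσ]
  have h0 : 0 < |σ - σ'| := abs_pos.mpr (sub_ne_zero.mpr he)
  have : |s| * (‖c σ - c σ'‖ / |σ - σ'|) ≤ B := by
    rw [← mul_div_assoc, div_le_iff₀ h0]; exact hB σ hσ σ' hσ'
  linarith [hA σ hσ]

lemma mono (h : LB D s c C) (hC : C ≤ C') : LB D s c C' :=
  fun σ hσ σ' hσ' => (h σ hσ σ' hσ').trans hC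

lemma mono_set {D' : Set ℝ} (h : LB D s c C) (hD : D' ⊆ D) : LB D' s c C :=
  fun σ hσ σ' hσ' => h σ (hD hσ) σ' (hD hσ')

lemma congr (h : LB D s c C) (hc : ∀ σ ∈ D, c' σ = c σ) : LB D s c' C := by
  intro σ hσ σ' hσ'
  rw [hc σ hσ, hc σ' hσ']
  exact h σ hσ σ' hσ'

lemma const (z : ℂ) : LB D s (fun _ => z) ‖z‖ := by
  intro σ _ σ' _
  simp

lemma add (h : LB D s c C) (h' : LB D s c' C') : LB D s (fun σ => c σ + c' σ) (C + C') := by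
  intro σ hσ σ' hσ'
  have e1 := h σ hσ σ' hσ'
  have e2 := h' σ hσ σ' hσ'
  have : ‖c σ + c' σ - (c σ' + c' σ')‖ / |σ - σ'| ≤
      ‖c σ - c σ'‖ / |σ - σ'| + ‖c' σ - c' σ'‖ / |σ - σ'| := by
    rw [← add_div]
    gcongr
    rw [add_sub_add_comm]
    exact norm_add_le _ _
  have := mul_le_mul_of_nonneg_left this (abs_nonneg s)
  have := norm_add_le (c σ) (c' σ)
  nlinarith

lemma neg (h : LB D s c C) : LB D s (fun σ => -c σ) C := by
  intro σ hσ σ' hσ'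
  have e1 := h σ hσ σ' hσ'
  rwa [← neg_sub', norm_neg, norm_neg]

lemma mul (h : LB D s c C) (h' : LB D s c' C') : LB D s (fun σ => c σ * c' σ) (C * C') := by
  intro σ hσ σ' hσ'
  have e1 := h σ hσ σ' hσ'
  have e2 := h' σ hσ σ' hσ'
  have e3 := h' σ' hσ' σ hσ
  have e4 := h'.norm_le hσ'
  set a := |s| * (‖c σ - c σ'‖ / |σ - σ'|) with ha
  set b := |s| * (‖c' σ - c' σ'‖ / |σ - σ'|) with hb
  have ha0 : 0 ≤ a := by positivity
  have hb0 : 0 ≤ b := by positivity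
  have : |s| * (‖c σ * c' σ - c σ' * c' σ'‖ / |σ - σ'|) ≤ ‖c σ‖ * b + a * ‖c' σ'‖ := by
    have e : c σ * c' σ - c σ' * c' σ' = c σ * (c' σ - c' σ') + (c σ - c σ') * c' σ' := by ring
    have : ‖c σ * c' σ - c σ' * c' σ'‖ ≤ ‖c σ‖ * ‖c' σ - c' σ'‖ + ‖c σ - c σ'‖ * ‖c' σ'‖ := by
      rw [e]; refine (norm_add_le _ _).trans ?_
      rw [norm_mul, norm_mul]
    calc _ ≤ |s| * ((‖c σ‖ * ‖c' σ - c' σ'‖ + ‖c σ - c σ'‖ * ‖c' σ'‖) / |σ - σ'|) := by gcongr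
      _ = _ := by rw [ha, hb]; ring
  rw [norm_mul]
  have h5 : a * ‖c' σ'‖ ≤ a * C' := by gcongr
  have h6 : ‖c σ‖ * (‖c' σ‖ + b) ≤ ‖c σ‖ * C' := by gcongr
  have hC' : 0 ≤ C' := (norm_nonneg _).trans e4
  have h7 : (‖c σ‖ + a) * C' ≤ C * C' := by gcongr
  nlinarith

lemma const_mul (z : ℂ) (h : LB D s c C) : LB D s (fun σ => z * c σ) (‖z‖ * C) :=
  (const z).mul h

lemma conj (h : LB D s c C) : LB D s (fun σ => (starRingEnd ℂ) (c σ)) C := by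
  intro σ hσ σ' hσ'
  have e1 := h σ hσ σ' hσ'
  rwa [← map_sub, RCLike.norm_conj, RCLike.norm_conj]

lemma re (h : LB D s c C) : LB D s (fun σ => ((c σ).re : ℂ)) C := by
  intro σ hσ σ' hσ'
  refine le_trans ?_ (h σ hσ σ' hσ')
  rw [← Complex.ofReal_sub, ← Complex.sub_re, Complex.norm_real, Complex.norm_real]
  gcongr <;> exact Complex.abs_re_le_norm _

lemma im (h : LB D s c C) : LB D s (fun σ => ((c σ).im : ℂ)) C := by
  intro σ hσ σ' hσ'
  refine le_trans ?_ (h σ hσ σ' hσ')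
  rw [← Complex.ofReal_sub, ← Complex.sub_im, Complex.norm_real, Complex.norm_real]
  gcongr <;> exact Complex.abs_im_le_norm _

lemma sum {ι : Type*} (S : Finset ι) {c : ι → ℝ → ℂ} {C : ι → ℝ}
    (h : ∀ i ∈ S, LB D s (c i) (C i)) : LB D s (fun σ => ∑ i ∈ S, c i σ) (∑ i ∈ S, C i) := by
  classical
  induction S using Finset.induction_on with
  | empty => intro σ _ σ' _; simp
  | insert a S ha ih =>
    simp only [Finset.sum_insert ha]
    exact (h a (by simp)).add (ih fun i hi => h i (by simp [hi]))

lemma tsum {ι : Type*} {c : ι → ℝ → ℂ} {C : ι → ℝ} {u : ℝ → ℂ} {S : ℝ}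
    (h : ∀ i, LB D s (c i) (C i)) (hS : HasSum C S)
    (hu : ∀ σ ∈ D, HasSum (fun i => c i σ) (u σ)) : LB D s u S := by
  intro σ hσ σ' hσ'
  have h1 := hu σ hσ
  have h2 := hu σ' hσ'
  have t1 : Tendsto (fun F : Finset ι => ‖∑ i ∈ F, c i σ‖ +
      |s| * (‖∑ i ∈ F, c i σ - ∑ i ∈ F, c i σ'‖ / |σ - σ'|)) atTop
      (nhds (‖u σ‖ + |s| * (‖u σ - u σ'‖ / |σ - σ'|))) := by
    have h3 := (Tendsto.norm (Tendsto.sub h1 h2))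
    exact (Tendsto.norm h1).add ((h3.div_const _).const_mul _)
  exact le_of_tendsto_of_tendsto' t1 hS fun F => LB.sum F (fun i _ => h i) σ hσ σ' hσ'

end LB

def Bd {r : ℕ} (D : Set ℝ) (s ρ : ℝ) (u : ℝ → (Fin r → ℝ) → ℂ) (C : ℝ) : Prop :=
  ∃ (P : Type) (_ : Countable P) (φ : P → Fin r → ℤ) (c : P → ℝ → ℂ) (K : P → ℝ) (S : ℝ),
    (∀ p, 0 ≤ K p) ∧ (∀ p, LB D s (c p) (K p)) ∧
    HasSum (fun p => K p * exp (|ρ| * nrm (φ p))) S ∧ S ≤ C ∧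
    ∀ σ ∈ D, ∀ ψ, HasSum (fun p => c p σ * ch (φ p) ψ) (u σ ψ)

namespace Bd

variable {r : ℕ} {D : Set ℝ} {s ρ : ℝ} {u v : ℝ → (Fin r → ℝ) → ℂ} {C C' : ℝ}

lemma le_wt (ρ : ℝ) (ν : Fin r → ℤ) {K : ℝ} (hK : 0 ≤ K) : K ≤ K * exp (|ρ| * nrm ν) :=
  le_mul_of_one_le_right hK (one_le_exp (mul_nonneg (abs_nonneg _) (nrm_nonneg _)))

lemma summ {P : Type*} {φ : P → Fin r → ℤ} {K : P → ℝ} {S : ℝ} (hK : ∀ p, 0 ≤ K p)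
    (h : HasSum (fun p => K p * exp (|ρ| * nrm (φ p))) S) : Summable K :=
  Summable.of_nonneg_of_le hK (fun p => le_wt ρ (φ p) (hK p)) h.summable

lemma nonneg (h : Bd D s ρ u C) : 0 ≤ C := by
  obtain ⟨P, _, φ, c, K, S, hK, -, hS, hSC, -⟩ := h
  exact (hS.nonneg fun p => mul_nonneg (hK p) (exp_pos _).le).trans hSC

lemma mono (h : Bd D s ρ u C) (hC : C ≤ C') : Bd D s ρ u C' := by
  obtain ⟨P, hP, φ, c, K, S, hK, hc, hS, hSC, hu⟩ := h
  exact ⟨P, hP, φ, c, K, S, hK, hc, hS, hSC.trans hC, hu⟩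

lemma mono_set {D' : Set ℝ} (h : Bd D s ρ u C) (hD : D' ⊆ D) : Bd D' s ρ u C := by
  obtain ⟨P, hP, φ, c, K, S, hK, hc, hS, hSC, hu⟩ := h
  exact ⟨P, hP, φ, c, K, S, hK, fun p => (hc p).mono_set hD, hS, hSC,
    fun σ hσ => hu σ (hD hσ)⟩

lemma congr (h : Bd D s ρ u C) (hv : ∀ σ ∈ D, ∀ ψ, v σ ψ = u σ ψ) : Bd D s ρ v C := by
  obtain ⟨P, hP, φ, c, K, S, hK, hc, hS, hSC, hu⟩ := h
  refine ⟨P, hP, φ, c, K, S, hK, hc, hS, hSC, fun σ hσ ψ => ?_⟩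
  rw [hv σ hσ]; exact hu σ hσ ψ

lemma mono_rho {ρ' : ℝ} (h : Bd D s ρ u C) (h0 : 0 ≤ ρ') (hρ : ρ' ≤ ρ) : Bd D s ρ' u C := by
  obtain ⟨P, hP, φ, c, K, S, hK, hc, hS, hSC, hu⟩ := h
  have hle : ∀ p, K p * exp (|ρ'| * nrm (φ p)) ≤ K p * exp (|ρ| * nrm (φ p)) := by
    intro p
    have := hK p
    have := nrm_nonneg (φ p)
    rw [abs_of_nonneg h0, abs_of_nonneg (h0.trans hρ)]
    gcongr
  have hs : Summable (fun p => K p * exp (|ρ'| * nrm (φ p))) :=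
    Summable.of_nonneg_of_le (fun p => mul_nonneg (hK p) (exp_pos _).le) hle hS.summable
  exact ⟨P, hP, φ, c, K, _, hK, hc, hs.hasSum, (hasSum_le hle hs.hasSum hS).trans hSC, hu⟩

lemma single {c : ℝ → ℂ} {K : ℝ} (hc : LB D s c K) (hK : 0 ≤ K) (ν : Fin r → ℤ) :
    Bd D s ρ (fun σ ψ => c σ * ch ν ψ) (K * exp (|ρ| * nrm ν)) := by
  refine ⟨Unit, inferInstance, fun _ => ν, fun _ => c, fun _ => K, _, fun _ => hK, fun _ => hc,
    ?_, le_rfl, fun σ _ ψ => ?_⟩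
  · convert hasSum_fintype (fun _ : Unit => K * exp (|ρ| * nrm ν)) using 1; simp
  · convert hasSum_fintype (fun _ : Unit => c σ * ch ν ψ) using 1; simp

lemma ofLB {c : ℝ → ℂ} {K : ℝ} (hc : LB D s c K) (hK : 0 ≤ K) :
    Bd D s ρ (fun σ (_ : Fin r → ℝ) => c σ) K := by
  have := (single (ρ := ρ) hc hK (0 : Fin r → ℤ)).congr (v := fun σ _ => c σ)
    (fun σ _ ψ => by simp)
  simpa using this

lemma const (z : ℂ) : Bd D s ρ (fun _ (_ : Fin r → ℝ) => z) ‖z‖ :=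
  ofLB (LB.const z) (norm_nonneg _)

lemma zero : Bd D s ρ (fun _ (_ : Fin r → ℝ) => 0) 0 := by
  simpa using (const 0 : Bd D s ρ (fun _ (_ : Fin r → ℝ) => 0) _)

lemma neg (h : Bd D s ρ u C) : Bd D s ρ (fun σ ψ => -u σ ψ) C := by
  obtain ⟨P, hP, φ, c, K, S, hK, hc, hS, hSC, hu⟩ := h
  refine ⟨P, hP, φ, fun p σ => -c p σ, K, S, hK, fun p => (hc p).neg, hS, hSC, fun σ hσ ψ => ?_⟩
  simpa using (hu σ hσ ψ).neg

lemma conj (h : Bd D s ρ u C) : Bd D s ρ (fun σ ψ => (starRingEnd ℂ) (u σ ψ)) C := by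
  obtain ⟨P, hP, φ, c, K, S, hK, hc, hS, hSC, hu⟩ := h
  refine ⟨P, hP, fun p => -φ p, fun p σ => (starRingEnd ℂ) (c p σ), K, S, hK,
    fun p => (hc p).conj, by simpa using hS, hSC, fun σ hσ ψ => ?_⟩
  have := (hu σ hσ ψ).map (starRingEnd ℂ) Complex.continuous_conj
  simpa [Function.comp_def, ch_neg] using this

lemma tsum {ι : Type} [Countable ι] {u : ι → ℝ → (Fin r → ℝ) → ℂ} {C : ι → ℝ} {T : ℝ}
    (h : ∀ i, Bd D s ρ (u i) (C i)) (hC : HasSum C T)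
    (hv : ∀ σ ∈ D, ∀ ψ, HasSum (fun i => u i σ ψ) (v σ ψ)) : Bd D s ρ v T := by
  choose P hP φ c K S hK hc hS hSC hu using h
  have hw : ∀ i p, 0 ≤ K i p * exp (|ρ| * nrm (φ i p)) :=
    fun i p => mul_nonneg (hK i p) (exp_pos _).le
  have hS0 : ∀ i, 0 ≤ S i := fun i => (hS i).nonneg (hw i)
  have hSs : Summable S := Summable.of_nonneg_of_le hS0 hSC hC.summable
  have hsum : Summable (fun x : Σ i, P i => K x.1 x.2 * exp (|ρ| * nrm (φ x.1 x.2))) := by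
    rw [summable_sigma_of_nonneg (fun x => hw x.1 x.2)]
    refine ⟨fun i => (hS i).summable, ?_⟩
    simpa only [fun i => (hS i).tsum_eq] using hSs
  have hT : HasSum (fun x : Σ i, P i => K x.1 x.2 * exp (|ρ| * nrm (φ x.1 x.2))) (∑' i, S i) :=
    HasSum.sigma_of_hasSum hSs.hasSum hS hsum
  refine ⟨Σ i, P i, inferInstance, fun x => φ x.1 x.2, fun x => c x.1 x.2, fun x => K x.1 x.2,
    _, fun x => hK _ _, fun x => hc _ _, hT, hasSum_le hSC hSs.hasSum hC, fun σ hσ ψ => ?_⟩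
  refine HasSum.sigma_of_hasSum (hv σ hσ ψ) (fun i => hu i σ hσ ψ) ?_
  refine Summable.of_norm_bounded hsum fun x => ?_
  rw [norm_mul, norm_ch, mul_one]
  exact ((hc x.1 x.2).norm_le hσ).trans (le_wt _ _ (hK _ _))

lemma sum {ι : Type} (S : Finset ι) {u : ι → ℝ → (Fin r → ℝ) → ℂ} {C : ι → ℝ}
    (h : ∀ i ∈ S, Bd D s ρ (u i) (C i)) :
    Bd D s ρ (fun σ ψ => ∑ i ∈ S, u i σ ψ) (∑ i ∈ S, C i) := by
  have := tsum (ι := S) (u := fun i => u i) (C := fun i => C i) (fun i => h i i.2)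
    (hasSum_fintype _) (v := fun σ ψ => ∑ i : S, u i σ ψ) (fun σ _ ψ => hasSum_fintype _)
  rw [Finset.sum_coe_sort S] at this
  refine this.congr fun σ _ ψ => ?_
  rw [Finset.sum_coe_sort S (fun i => u i σ ψ)]

lemma add (h : Bd D s ρ u C) (h' : Bd D s ρ v C') :
    Bd D s ρ (fun σ ψ => u σ ψ + v σ ψ) (C + C') := by
  have := sum (Finset.univ : Finset Bool) (u := fun b => if b then u else v)
    (C := fun b => if b then C else C') (D := D) (s := s) (ρ := ρ) (by
      intro b _; cases b <;> simpa)
  simpa using this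

lemma sub (h : Bd D s ρ u C) (h' : Bd D s ρ v C') :
    Bd D s ρ (fun σ ψ => u σ ψ - v σ ψ) (C + C') := by
  simpa [sub_eq_add_neg] using h.add h'.neg

lemma mul (h : Bd D s ρ u C) (h' : Bd D s ρ v C') :
    Bd D s ρ (fun σ ψ => u σ ψ * v σ ψ) (C * C') := by
  have hC := h.nonneg
  obtain ⟨P, hP, φ, c, K, S, hK, hc, hS, hSC, hu⟩ := h
  obtain ⟨P', hP', φ', c', K', S', hK', hc', hS', hSC', hu'⟩ := h'
  have hw : ∀ p, 0 ≤ K p * exp (|ρ| * nrm (φ p)) := fun p => mul_nonneg (hK p) (exp_pos _).le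
  have hw' : ∀ p, 0 ≤ K' p * exp (|ρ| * nrm (φ' p)) := fun p => mul_nonneg (hK' p) (exp_pos _).le
  have hpr : HasSum (fun x : P × P' => K x.1 * exp (|ρ| * nrm (φ x.1)) *
      (K' x.2 * exp (|ρ| * nrm (φ' x.2)))) (S * S') :=
    hS.mul hS' (hS.summable.mul_of_nonneg hS'.summable hw hw')
  have hle : ∀ x : P × P', K x.1 * K' x.2 * exp (|ρ| * nrm (φ x.1 + φ' x.2)) ≤
      K x.1 * exp (|ρ| * nrm (φ x.1)) * (K' x.2 * exp (|ρ| * nrm (φ' x.2))) := by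
    intro x
    have h1 := nrm_add (φ x.1) (φ' x.2)
    have h2 := hK x.1
    have h3 := hK' x.2
    calc _ ≤ K x.1 * K' x.2 * exp (|ρ| * (nrm (φ x.1) + nrm (φ' x.2))) := by gcongr
      _ = _ := by rw [mul_add, exp_add]; ring
  have h0 : ∀ x : P × P', 0 ≤ K x.1 * K' x.2 * exp (|ρ| * nrm (φ x.1 + φ' x.2)) :=
    fun x => mul_nonneg (mul_nonneg (hK _) (hK' _)) (exp_pos _).le
  have hs := Summable.of_nonneg_of_le h0 hle hpr.summable
  refine ⟨P × P', inferInstance, fun x => φ x.1 + φ' x.2, fun x σ => c x.1 σ * c' x.2 σ,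
    fun x => K x.1 * K' x.2, _, fun x => mul_nonneg (hK _) (hK' _),
    fun x => (hc _).mul (hc' _), hs.hasSum, ?_, fun σ hσ ψ => ?_⟩
  · refine (hasSum_le hle hs.hasSum hpr).trans ?_
    have := hS'.nonneg hw'
    gcongr
  · have hn : ∀ x : P × P', c x.1 σ * c' x.2 σ * ch (φ x.1 + φ' x.2) ψ =
        c x.1 σ * ch (φ x.1) ψ * (c' x.2 σ * ch (φ' x.2) ψ) := by
      intro x; rw [ch_add]; ring
    have e : (fun x : P × P' => c x.1 σ * c' x.2 σ * ch (φ x.1 + φ' x.2) ψ) =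
        fun x : P × P' => c x.1 σ * ch (φ x.1) ψ * (c' x.2 σ * ch (φ' x.2) ψ) := funext hn
    have hsm : Summable (fun x : P × P' => c x.1 σ * c' x.2 σ * ch (φ x.1 + φ' x.2) ψ) := ?_
    · rw [e] at hsm ⊢
      exact HasSum.mul (f := fun p => c p σ * ch (φ p) ψ) (g := fun p => c' p σ * ch (φ' p) ψ)
        (hu σ hσ ψ) (hu' σ hσ ψ) hsm
    refine Summable.of_norm_bounded hs fun x => ?_
    rw [norm_mul, norm_ch, mul_one]
    refine (((hc x.1).mul (hc' x.2)).norm_le hσ).trans ?_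
    exact le_wt _ _ (mul_nonneg (hK _) (hK' _))

lemma const_mul (z : ℂ) (h : Bd D s ρ u C) : Bd D s ρ (fun σ ψ => z * u σ ψ) (‖z‖ * C) :=
  (const z).mul h

lemma pow (h : Bd D s ρ u C) (n : ℕ) : Bd D s ρ (fun σ ψ => u σ ψ ^ n) (C ^ n) := by
  induction n with
  | zero => simpa using (const 1 : Bd D s ρ (fun _ (_ : Fin r → ℝ) => (1:ℂ)) _)
  | succ n ih => simpa only [pow_succ] using ih.mul h

lemma norm_le (h : Bd D s ρ u C) {σ : ℝ} (hσ : σ ∈ D) (ψ) : ‖u σ ψ‖ ≤ C := by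
  obtain ⟨P, hP, φ, c, K, S, hK, hc, hS, hSC, hu⟩ := h
  refine le_trans ?_ hSC
  refine (hu σ hσ ψ).norm_le_of_bounded hS fun p => ?_
  rw [norm_mul, norm_ch, mul_one]
  exact ((hc p).norm_le hσ).trans (le_wt _ _ (hK _))

lemma toLB (h : Bd D s ρ u C) (ψ) : LB D s (fun σ => u σ ψ) C := by
  obtain ⟨P, hP, φ, c, K, S, hK, hc, hS, hSC, hu⟩ := h
  refine LB.mono ?_ hSC
  refine LB.tsum (c := fun p σ => c p σ * ch (φ p) ψ) (fun p => ?_) hS fun σ hσ => hu σ hσ ψ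
  have := (hc p).mul (LB.const (D := D) (s := s) (ch (φ p) ψ))
  rw [norm_ch, mul_one] at this
  exact this.mono (le_wt _ _ (hK _))

lemma re (h : Bd D s ρ u C) : Bd D s ρ (fun σ ψ => ((u σ ψ).re : ℂ)) C := by
  have := (h.add h.conj).const_mul (1 / 2)
  refine (this.congr fun σ _ ψ => ?_).mono (by norm_num; linarith)
  rw [Complex.re_eq_add_conj]; ring

lemma im (h : Bd D s ρ u C) : Bd D s ρ (fun σ ψ => ((u σ ψ).im : ℂ)) C := by
  have := (h.const_mul (-Complex.I)).re
  refine (this.congr fun σ _ ψ => ?_).mono (by simp)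
  simp

open scoped Nat in
lemma expRem (h : Bd D s ρ u C) (k : ℕ) :
    Bd D s ρ (fun σ ψ => Complex.exp (u σ ψ) - ∑ i ∈ Finset.range k, u σ ψ ^ i / (i ! : ℂ))
      (C ^ k * exp C) := by
  have hC := h.nonneg
  have h1 : ∀ i, Bd D s ρ (fun σ ψ => u σ ψ ^ (i + k) / ((i + k)! : ℂ)) (C ^ (i + k) / (i + k)!) := by
    intro i
    have := (h.pow (i + k)).const_mul (1 / ((i + k)! : ℂ))
    refine (this.congr fun σ _ ψ => by ring).mono (le_of_eq ?_)
    rw [norm_div, norm_one, Complex.norm_natCast]; ring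
  have h2 : ∀ i, C ^ (i + k) / (i + k)! ≤ C ^ k * (C ^ i / i !) := by
    intro i
    rw [pow_add, mul_comm (C ^ i), mul_div_assoc]
    have h4 : (i ! : ℝ) ≤ (i + k)! := by exact_mod_cast Nat.factorial_le (Nat.le_add_right i k)
    have h5 : (0:ℝ) < i ! := by exact_mod_cast Nat.factorial_pos i
    gcongr
  have h3 : HasSum (fun i => C ^ k * (C ^ i / i !)) (C ^ k * exp C) := by
    have := NormedSpace.expSeries_div_hasSum_exp C
    rw [← Real.exp_eq_exp_ℝ] at this
    exact HasSum.mul_left (C ^ k) this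
  refine tsum (u := fun i σ ψ => u σ ψ ^ (i + k) / ((i + k)! : ℂ))
    (fun i => (h1 i).mono (h2 i)) h3 fun σ _ ψ => ?_
  have := NormedSpace.expSeries_div_hasSum_exp (u σ ψ)
  rw [← Complex.exp_eq_exp_ℂ] at this
  exact (hasSum_nat_add_iff' k).mpr this

end Bd

end KAM


open MeasureTheory Real Filter

namespace KAM

lemma hsc {ι : Type*} {f g : ι → ℂ} {a b : ℂ} (h : HasSum g b) (hf : ∀ i, f i = g i)
    (hab : a = b) : HasSum f a := by
  obtain rfl : f = g := funext hf
  rw [hab]; exact h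

def dt {r : ℕ} (ν : Fin r → ℤ) (v : Fin r → ℝ) : ℝ := ∑ k, (ν k : ℝ) * v k

lemma ch_eq {r : ℕ} (ν : Fin r → ℤ) (ψ : Fin r → ℝ) :
    ch ν ψ = Complex.exp (Complex.I * (dt ν ψ : ℂ)) := rfl

lemma dt_add_smul {r : ℕ} (ν : Fin r → ℤ) (ψ v : Fin r → ℝ) (t : ℝ) :
    dt ν (ψ + t • v) = dt ν ψ + t * dt ν v := by
  unfold dt
  rw [Finset.mul_sum, ← Finset.sum_add_distrib]
  refine Finset.sum_congr rfl fun k _ => ?_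
  simp only [Pi.add_apply, Pi.smul_apply, smul_eq_mul]; ring

lemma abs_dt_le {r : ℕ} (ν : Fin r → ℤ) (v : Fin r → ℝ) {V : ℝ} (hV : ∀ k, |v k| ≤ V) :
    |dt ν v| ≤ V * nrm ν := by
  unfold dt nrm
  rw [Finset.mul_sum]
  refine (Finset.abs_sum_le_sum_abs _ _).trans (Finset.sum_le_sum fun k _ => ?_)
  rw [abs_mul, mul_comm]
  exact mul_le_mul_of_nonneg_right (hV k) (abs_nonneg _)

lemma ch_hasDerivAt {r : ℕ} (ν : Fin r → ℤ) (ψ v : Fin r → ℝ) (t : ℝ) :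
    HasDerivAt (fun t : ℝ => ch ν (ψ + t • v))
      (Complex.I * (dt ν v : ℂ) * ch ν (ψ + t • v)) t := by
  have h1 : HasDerivAt (fun t : ℝ => dt ν (ψ + t • v)) (dt ν v) t := by
    simp only [dt_add_smul]
    simpa using ((hasDerivAt_id t).mul_const (dt ν v)).const_add (dt ν ψ)
  have h2 := (h1.ofReal_comp.const_mul Complex.I).cexp
  simp only [ch_eq]
  convert h2 using 1
  ring

def HL {r : ℕ} {E : Type*} [NormedAddCommGroup E] [NormedSpace ℝ E] (D : Set ℝ)
    (v : Fin r → ℝ) (u u' : ℝ → (Fin r → ℝ) → E) : Prop :=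
  ∀ σ ∈ D, ∀ ψ, HasDerivAt (fun t : ℝ => u σ (ψ + t • v)) (u' σ ψ) 0

namespace HL

variable {r : ℕ} {E : Type*} [NormedAddCommGroup E] [NormedSpace ℝ E] {D : Set ℝ}
  {v : Fin r → ℝ} {u u' w w' : ℝ → (Fin r → ℝ) → E}

lemma unique (h : HL D v u u') (h' : HL D v u w') {σ : ℝ} (hσ : σ ∈ D) (ψ) :
    u' σ ψ = w' σ ψ := (h σ hσ ψ).unique (h' σ hσ ψ)

lemma congr (h : HL D v u u') (h1 : ∀ σ ∈ D, ∀ ψ, w σ ψ = u σ ψ)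
    (h2 : ∀ σ ∈ D, ∀ ψ, w' σ ψ = u' σ ψ) : HL D v w w' := by
  intro σ hσ ψ
  simp only [h1 σ hσ, h2 σ hσ]
  exact h σ hσ ψ

lemma mono_set {D' : Set ℝ} (h : HL D v u u') (hD : D' ⊆ D) : HL D' v u u' :=
  fun σ hσ => h σ (hD hσ)

lemma add (h : HL D v u u') (h' : HL D v w w') :
    HL D v (fun σ ψ => u σ ψ + w σ ψ) (fun σ ψ => u' σ ψ + w' σ ψ) :=
  fun σ hσ ψ => (h σ hσ ψ).add (h' σ hσ ψ)

lemma sub (h : HL D v u u') (h' : HL D v w w') :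
    HL D v (fun σ ψ => u σ ψ - w σ ψ) (fun σ ψ => u' σ ψ - w' σ ψ) :=
  fun σ hσ ψ => (h σ hσ ψ).sub (h' σ hσ ψ)

lemma neg (h : HL D v u u') :
    HL D v (fun σ ψ => -u σ ψ) (fun σ ψ => -u' σ ψ) :=
  fun σ hσ ψ => (h σ hσ ψ).neg

lemma const (c : ℝ → E) : HL D v (fun σ (_ : Fin r → ℝ) => c σ) (fun _ _ => 0) :=
  fun σ _ _ => hasDerivAt_const _ _

lemma sum {ι : Type*} (S : Finset ι) {u u' : ι → ℝ → (Fin r → ℝ) → E}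
    (h : ∀ i ∈ S, HL D v (u i) (u' i)) :
    HL D v (fun σ ψ => ∑ i ∈ S, u i σ ψ) (fun σ ψ => ∑ i ∈ S, u' i σ ψ) :=
  fun σ hσ ψ => HasDerivAt.fun_sum fun i hi => h i hi σ hσ ψ

lemma mul {A : Type*} [NormedRing A] [NormedAlgebra ℝ A] {u u' w w' : ℝ → (Fin r → ℝ) → A}
    (h : HL D v u u') (h' : HL D v w w') :
    HL D v (fun σ ψ => u σ ψ * w σ ψ) (fun σ ψ => u' σ ψ * w σ ψ + u σ ψ * w' σ ψ) := by
  intro σ hσ ψ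
  have := (h σ hσ ψ).fun_mul (h' σ hσ ψ)
  refine this.congr_deriv ?_
  simp

lemma ofReal {u u' : ℝ → (Fin r → ℝ) → ℝ} (h : HL D v u u') :
    HL D v (fun σ ψ => (u σ ψ : ℂ)) (fun σ ψ => (u' σ ψ : ℂ)) :=
  fun σ hσ ψ => (h σ hσ ψ).ofReal_comp

lemma clm {F : Type*} [NormedAddCommGroup F] [NormedSpace ℝ F] (L : E →L[ℝ] F)
    (h : HL D v u u') : HL D v (fun σ ψ => L (u σ ψ)) (fun σ ψ => L (u' σ ψ)) :=
  fun σ hσ ψ => L.hasFDerivAt.comp_hasDerivAt (x := (0:ℝ)) (h σ hσ ψ)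

lemma re {u u' : ℝ → (Fin r → ℝ) → ℂ} (h : HL D v u u') :
    HL D v (fun σ ψ => (u σ ψ).re) (fun σ ψ => (u' σ ψ).re) := h.clm Complex.reCLM

lemma im {u u' : ℝ → (Fin r → ℝ) → ℂ} (h : HL D v u u') :
    HL D v (fun σ ψ => (u σ ψ).im) (fun σ ψ => (u' σ ψ).im) := h.clm Complex.imCLM

end HL

def bx (r : ℕ) : Set (Fin r → ℝ) := Set.univ.pi fun _ => Set.Icc (0 : ℝ) (2 * π)

noncomputable def avg {r : ℕ} {E : Type*} [NormedAddCommGroup E] [NormedSpace ℝ E]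
    (u : (Fin r → ℝ) → E) : E := ((2 * π) ^ r)⁻¹ • ∫ ψ in bx r, u ψ

lemma isCompact_bx (r : ℕ) : IsCompact (bx r) := isCompact_univ_pi fun _ => isCompact_Icc

lemma vol_bx (r : ℕ) : (volume.real (bx r)) = (2 * π) ^ r := by
  unfold bx
  rw [Measure.real, volume_pi, Measure.pi_pi]
  simp [pi_pos.le]

lemma avg_const {r : ℕ} {E : Type*} [NormedAddCommGroup E] [NormedSpace ℝ E] [CompleteSpace E]
    (z : E) : avg (fun _ : Fin r → ℝ => z) = z := by
  unfold avg
  rw [setIntegral_const, vol_bx, smul_smul, inv_mul_cancel₀ (by positivity), one_smul]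

lemma avg_ofReal {r : ℕ} (u : (Fin r → ℝ) → ℝ) : avg (fun ψ => (u ψ : ℂ)) = ((avg u : ℝ) : ℂ) := by
  unfold avg
  rw [integral_complex_ofReal]
  simp

lemma continuous_ch {r : ℕ} (ν : Fin r → ℤ) : Continuous (ch ν) := by
  unfold ch
  fun_prop

lemma avg_ch {r : ℕ} (ν : Fin r → ℤ) : avg (ch ν) = if ν = 0 then 1 else 0 := by
  split_ifs with h
  · subst h
    have : (ch (0 : Fin r → ℤ)) = fun _ => 1 := funext fun ψ => ch_zero ψ
    rw [this, avg_const]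
  · obtain ⟨k, hk⟩ := Function.ne_iff.mp h
    have hk' : ν k ≠ 0 := hk
    unfold avg bx
    rw [volume_pi, Measure.restrict_pi_pi]
    have : ∀ ψ : Fin r → ℝ, ch ν ψ = ∏ k, Complex.exp ((Complex.I * (ν k : ℂ)) * (ψ k : ℂ)) := by
      intro ψ
      unfold ch
      rw [← Complex.exp_sum]
      congr 1
      push_cast
      rw [Finset.mul_sum]
      refine Finset.sum_congr rfl fun k _ => by ring
    simp_rw [this]
    rw [integral_fintype_prod_eq_prod (𝕜 := ℂ)
      (fun k (x : ℝ) => Complex.exp ((Complex.I * (ν k : ℂ)) * (x : ℂ)))]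
    rw [Finset.prod_eq_zero (Finset.mem_univ k), smul_zero]
    rw [integral_Icc_eq_integral_Ioc, ← intervalIntegral.integral_of_le (by positivity)]
    have hc : Complex.I * (ν k : ℂ) ≠ 0 :=
      mul_ne_zero Complex.I_ne_zero (by exact_mod_cast hk')
    rw [integral_exp_mul_complex hc]
    have : Complex.I * (ν k : ℂ) * ((2 * π : ℝ) : ℂ) = (ν k : ℂ) * (2 * π * Complex.I) := by
      push_cast; ring
    rw [this, Complex.exp_int_mul_two_pi_mul_I]
    simp

def Rp {r : ℕ} (D : Set ℝ) (s ρ : ℝ) {P : Type} (φ : P → Fin r → ℤ) (c : P → ℝ → ℂ) (K : P → ℝ)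
    (u : ℝ → (Fin r → ℝ) → ℂ) : Prop :=
  (∀ p, 0 ≤ K p) ∧ (∀ p, LB D s (c p) (K p)) ∧
    Summable (fun p => K p * exp (|ρ| * nrm (φ p))) ∧
    ∀ σ ∈ D, ∀ ψ, HasSum (fun p => c p σ * ch (φ p) ψ) (u σ ψ)

section Rp

variable {r : ℕ} {D : Set ℝ} {s ρ : ℝ} {u v : ℝ → (Fin r → ℝ) → ℂ} {C C' : ℝ}
  {P : Type} {φ : P → Fin r → ℤ} {c : P → ℝ → ℂ} {K : P → ℝ}

lemma Bd.rp (h : Bd D s ρ u C) : ∃ (P : Type) (_ : Countable P) (φ : P → Fin r → ℤ)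
    (c : P → ℝ → ℂ) (K : P → ℝ), Rp D s ρ φ c K u ∧
      ∑' p, K p * exp (|ρ| * nrm (φ p)) ≤ C := by
  obtain ⟨P, hP, φ, c, K, S, hK, hc, hS, hSC, hu⟩ := h
  exact ⟨P, hP, φ, c, K, ⟨hK, hc, hS.summable, hu⟩, by rwa [hS.tsum_eq]⟩

lemma Rp.bd [hP : Countable P] (h : Rp D s ρ φ c K u)
    (hC : ∑' p, K p * exp (|ρ| * nrm (φ p)) ≤ C) : Bd D s ρ u C :=
  ⟨P, hP, φ, c, K, _, h.1, h.2.1, h.2.2.1.hasSum, hC, h.2.2.2⟩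

lemma Rp.summK (h : Rp D s ρ φ c K u) : Summable K :=
  Summable.of_nonneg_of_le h.1 (fun p => Bd.le_wt ρ (φ p) (h.1 p)) h.2.2.1

lemma Rp.norm_le (h : Rp D s ρ φ c K u) {σ : ℝ} (hσ : σ ∈ D) (ψ) (p) :
    ‖c p σ * ch (φ p) ψ‖ ≤ K p := by
  rw [norm_mul, norm_ch, mul_one]; exact (h.2.1 p).norm_le hσ

lemma Rp.deriv (h : Rp D s ρ φ c K u) {ρ' δ V : ℝ} (h0 : 0 ≤ ρ') (hδ : 0 < δ) (hρ : ρ' + δ ≤ ρ)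
    {w : Fin r → ℝ} (hV : ∀ k, |w k| ≤ V) (hV0 : 0 ≤ V) :
    ∃ u', HL D w u u' ∧
      Rp D s ρ' φ (fun p σ => (Complex.I * (dt (φ p) w : ℂ)) * c p σ)
        (fun p => |dt (φ p) w| * K p) u' ∧
      ∑' p, (|dt (φ p) w| * K p) * exp (|ρ'| * nrm (φ p)) ≤
        V / δ * ∑' p, K p * exp (|ρ| * nrm (φ p)) := by
  obtain ⟨hK, hc, hS, hu⟩ := h
  have hle : ∀ p, (|dt (φ p) w| * K p) * exp (|ρ'| * nrm (φ p)) ≤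
      V / δ * (K p * exp (|ρ| * nrm (φ p))) := by
    intro p
    have h1 := abs_dt_le (φ p) w hV
    have hn := nrm_nonneg (φ p)
    have h2 : nrm (φ p) ≤ exp (δ * nrm (φ p)) / δ := by
      rw [le_div_iff₀ hδ]
      have := add_one_le_exp (δ * nrm (φ p)); nlinarith
    rw [abs_of_nonneg h0, abs_of_nonneg (by linarith : 0 ≤ ρ)]
    have hKp := hK p
    calc _ ≤ (V * (exp (δ * nrm (φ p)) / δ)) * K p * exp (ρ' * nrm (φ p)) := by
          gcongr
          exact h1.trans (by gcongr)
      _ = V / δ * (K p * exp ((ρ' + δ) * nrm (φ p))) := by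
          rw [add_mul, exp_add]; ring
      _ ≤ _ := by gcongr
  have hS' : Summable fun p => (|dt (φ p) w| * K p) * exp (|ρ'| * nrm (φ p)) :=
    Summable.of_nonneg_of_le (fun p => by have := hK p; positivity) hle (hS.mul_left _)
  have hK' : ∀ p, 0 ≤ |dt (φ p) w| * K p := fun p => mul_nonneg (abs_nonneg _) (hK p)
  have hS2 : Summable fun p => |dt (φ p) w| * K p :=
    Summable.of_nonneg_of_le hK' (fun p => Bd.le_wt ρ' (φ p) (hK' p)) hS'
  have hn : ∀ p, ∀ σ ∈ D, ∀ ψ, ‖(Complex.I * (dt (φ p) w : ℂ)) * c p σ * ch (φ p) ψ‖ ≤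
      |dt (φ p) w| * K p := by
    intro p σ hσ ψ
    rw [norm_mul, norm_ch, norm_mul, norm_mul, Complex.norm_I, Complex.norm_real, one_mul, mul_one]
    exact mul_le_mul_of_nonneg_left ((hc p).norm_le hσ) (abs_nonneg _)
  refine ⟨fun σ ψ => ∑' p, (Complex.I * (dt (φ p) w : ℂ)) * c p σ * ch (φ p) ψ, ?_,
    ⟨hK', fun p => ?_, hS', fun σ hσ ψ => ?_⟩, ?_⟩
  · intro σ hσ ψ
    have := hasDerivAt_tsum (g := fun p (t : ℝ) => c p σ * ch (φ p) (ψ + t • w))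
      (g' := fun p t => (Complex.I * (dt (φ p) w : ℂ)) * c p σ * ch (φ p) (ψ + t • w))
      (y₀ := 0) hS2 (fun p t => ?_) (fun p t => hn p σ hσ _) (hu σ hσ _).summable 0
    · have e : (fun t : ℝ => u σ (ψ + t • w)) =
          fun t : ℝ => ∑' p, c p σ * ch (φ p) (ψ + t • w) :=
        funext fun t => (hu σ hσ _).tsum_eq.symm
      rw [e]
      simpa using this
    · have := (ch_hasDerivAt (φ p) ψ w t).const_mul (c p σ)
      exact this.congr_deriv (by ring)
  · have := (hc p).const_mul (Complex.I * (dt (φ p) w : ℂ))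
    simpa using this
  · exact (Summable.of_norm_bounded hS2 fun p => hn p σ hσ ψ).hasSum
  · rw [← tsum_mul_left]
    exact hS'.tsum_le_tsum hle (hS.mul_left _)

lemma Bd.deriv (h : Bd D s ρ u C) {ρ' δ V : ℝ} (h0 : 0 ≤ ρ') (hδ : 0 < δ) (hρ : ρ' + δ ≤ ρ)
    {w : Fin r → ℝ} (hV : ∀ k, |w k| ≤ V) (hV0 : 0 ≤ V) :
    ∃ u', HL D w u u' ∧ Bd D s ρ' u' (V / δ * C) := by
  obtain ⟨P, hP, φ, c, K, hR, hC⟩ := h.rp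
  obtain ⟨u', h1, h2, h3⟩ := hR.deriv h0 hδ hρ hV hV0
  refine ⟨u', h1, h2.bd (h3.trans ?_)⟩
  gcongr

lemma Bd.deriv_bd (h : Bd D s ρ u C) {ρ' δ V : ℝ} (h0 : 0 ≤ ρ') (hδ : 0 < δ) (hρ : ρ' + δ ≤ ρ)
    {w : Fin r → ℝ} (hV : ∀ k, |w k| ≤ V) (hV0 : 0 ≤ V) {u' : ℝ → (Fin r → ℝ) → ℂ}
    (hu' : HL D w u u') : Bd D s ρ' u' (V / δ * C) := by
  obtain ⟨u2, h1, h2⟩ := h.deriv h0 hδ hρ hV hV0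
  exact h2.congr fun σ hσ ψ => hu'.unique h1 hσ ψ

lemma exV (w : Fin r → ℝ) : ∃ V : ℝ, 0 ≤ V ∧ ∀ k, |w k| ≤ V :=
  ⟨∑ k, |w k|, Finset.sum_nonneg fun _ _ => abs_nonneg _, fun k =>
    Finset.single_le_sum (f := fun k => |w k|) (fun _ _ => abs_nonneg _) (Finset.mem_univ k)⟩

lemma Bd.comm (h : Bd D s ρ u C) (hρ : 0 < ρ) {w w' : Fin r → ℝ}
    {u1 u2 u12 u21 : ℝ → (Fin r → ℝ) → ℂ} (h1 : HL D w u u1) (h2 : HL D w' u u2)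
    (h12 : HL D w' u1 u12) (h21 : HL D w u2 u21) {σ : ℝ} (hσ : σ ∈ D) (ψ) :
    u12 σ ψ = u21 σ ψ := by
  obtain ⟨V, hV0, hV⟩ := exV w
  obtain ⟨V', hV0', hV'⟩ := exV w'
  obtain ⟨P, hP, φ, c, K, hR, hC⟩ := h.rp
  obtain ⟨a, ha, hRa, -⟩ := hR.deriv (ρ' := ρ / 2) (δ := ρ / 2) (by linarith) (by linarith)
    (by linarith) hV hV0
  obtain ⟨a', ha', hRa', -⟩ := hR.deriv (ρ' := ρ / 2) (δ := ρ / 2) (by linarith) (by linarith)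
    (by linarith) hV' hV0'
  obtain ⟨b, hb, hRb, -⟩ := hRa.deriv (ρ' := 0) (δ := ρ / 2) (by linarith) (by linarith)
    (by linarith) hV' hV0'
  obtain ⟨b', hb', hRb', -⟩ := hRa'.deriv (ρ' := 0) (δ := ρ / 2) (by linarith) (by linarith)
    (by linarith) hV hV0
  have e1 : HL D w' a u12 := h12.congr (fun σ hσ ψ => ha.unique h1 hσ ψ) fun _ _ _ => rfl
  have e2 : HL D w a' u21 := h21.congr (fun σ hσ ψ => ha'.unique h2 hσ ψ) fun _ _ _ => rfl
  rw [e1.unique hb hσ, e2.unique hb' hσ]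
  refine (hRb.2.2.2 σ hσ ψ).unique ?_
  exact hsc (hRb'.2.2.2 σ hσ ψ) (fun p => by ring) rfl

lemma Rp.continuous (h : Rp D s ρ φ c K u) {σ : ℝ} (hσ : σ ∈ D) : Continuous (u σ) := by
  have e : u σ = fun ψ => ∑' p, c p σ * ch (φ p) ψ :=
    funext fun ψ => (h.2.2.2 σ hσ ψ).tsum_eq.symm
  rw [e]
  exact continuous_tsum (fun p => continuous_const.mul (continuous_ch _)) h.summK
    fun p ψ => h.norm_le hσ ψ p

lemma Bd.continuous (h : Bd D s ρ u C) {σ : ℝ} (hσ : σ ∈ D) : Continuous (u σ) := by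
  obtain ⟨P, hP, φ, c, K, hR, hC⟩ := h.rp
  exact hR.continuous hσ

lemma Rp.avg [Countable P] (h : Rp D s ρ φ c K u) {σ : ℝ} (hσ : σ ∈ D) :
    HasSum (fun p => if φ p = 0 then c p σ else 0) (KAM.avg (u σ)) := by
  have hint : ∀ p, Integrable (fun ψ => c p σ * ch (φ p) ψ) (volume.restrict (bx r)) := fun p =>
    (continuous_const.mul (continuous_ch _)).continuousOn.integrableOn_compact (isCompact_bx r)
  have hsum : Summable fun p => ∫ ψ in bx r, ‖c p σ * ch (φ p) ψ‖ := by
    have : ∀ p, ∫ ψ in bx r, ‖c p σ * ch (φ p) ψ‖ = (2 * π) ^ r * ‖c p σ‖ := by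
      intro p
      simp only [norm_mul, norm_ch, mul_one]
      rw [setIntegral_const, vol_bx, smul_eq_mul]
    simp only [this]
    refine Summable.mul_left _ (Summable.of_nonneg_of_le (fun _ => norm_nonneg _) (fun p => ?_) h.summK)
    exact (h.2.1 p).norm_le hσ
  have := (hasSum_integral_of_summable_integral_norm hint hsum).const_smul (((2 * π) ^ r)⁻¹ : ℝ)
  refine hsc this (fun p => ?_) ?_
  · have h2 : ((2 * π) ^ r : ℝ)⁻¹ • ∫ ψ in bx r, c p σ * ch (φ p) ψ = c p σ * KAM.avg (ch (φ p)) := by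
      rw [integral_const_mul, KAM.avg, mul_smul_comm]
    rw [h2, avg_ch]
    split_ifs <;> simp
  · unfold KAM.avg
    congr 2
    funext ψ
    exact (h.2.2.2 σ hσ ψ).tsum_eq.symm

lemma Bd.avgLB (h : Bd D s ρ u C) : LB D s (fun σ => avg (u σ)) C := by
  obtain ⟨P, hP, φ, c, K, hR, hC⟩ := h.rp
  have h1 : LB D s (fun σ => avg (u σ)) (∑' p, K p) := by
    refine LB.tsum (c := fun p σ => if φ p = 0 then c p σ else 0) (fun p => ?_) hR.summK.hasSum
      fun σ hσ => hR.avg hσ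
    split_ifs
    · exact hR.2.1 p
    · exact (LB.const 0).mono (by simpa using hR.1 p)
  refine h1.mono (le_trans ?_ hC)
  exact hR.summK.tsum_le_tsum (fun p => Bd.le_wt ρ (φ p) (hR.1 p)) hR.2.2.1

lemma Bd.avgBd (h : Bd D s ρ u C) : Bd D s ρ (fun σ (_ : Fin r → ℝ) => avg (u σ)) C :=
  Bd.ofLB h.avgLB h.nonneg

lemma Bd.avg_deriv (h : Bd D s ρ u C) (hρ : 0 < ρ) {w : Fin r → ℝ} {u' : ℝ → (Fin r → ℝ) → ℂ}
    (h1 : HL D w u u') {σ : ℝ} (hσ : σ ∈ D) : avg (u' σ) = 0 := by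
  obtain ⟨V, hV0, hV⟩ := exV w
  obtain ⟨P, hP, φ, c, K, hR, hC⟩ := h.rp
  obtain ⟨a, ha, hRa, -⟩ := hR.deriv (ρ' := 0) (δ := ρ) (by linarith) (by linarith)
    (by linarith) hV hV0
  have e : u' σ = a σ := funext fun ψ => h1.unique ha hσ ψ
  rw [e]
  refine (hRa.avg hσ).unique ?_
  refine hsc hasSum_zero (fun p => ?_) rfl
  split_ifs with hp
  · simp [hp, dt]
  · rfl

lemma Bd.integrable (h : Bd D s ρ u C) {σ : ℝ} (hσ : σ ∈ D) :
    Integrable (u σ) (volume.restrict (bx r)) :=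
  (h.continuous hσ).continuousOn.integrableOn_compact (isCompact_bx r)

lemma Bd.avg_add (h : Bd D s ρ u C) (h' : Bd D s ρ v C') {σ : ℝ} (hσ : σ ∈ D) :
    avg (fun ψ => u σ ψ + v σ ψ) = avg (u σ) + avg (v σ) := by
  unfold avg
  rw [integral_add (h.integrable hσ) (h'.integrable hσ), smul_add]

lemma avg_smul {E : Type*} [NormedAddCommGroup E] [NormedSpace ℝ E] (a : ℝ)
    (u : (Fin r → ℝ) → E) : avg (fun ψ => a • u ψ) = a • avg u := by
  unfold avg
  rw [integral_smul, smul_comm]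

lemma avg_cmul (a : ℂ) (u : (Fin r → ℝ) → ℂ) : avg (fun ψ => a * u ψ) = a * avg u := by
  unfold avg
  rw [integral_const_mul, mul_smul_comm]

lemma Rp.coef [Countable P] (h : Rp D s ρ φ c K u) {σ : ℝ} (hσ : σ ∈ D) (ν : Fin r → ℤ) :
    HasSum (fun p => if φ p = ν then c p σ else 0) (KAM.avg fun ψ => u σ ψ * ch (-ν) ψ) := by
  have h2 : Rp D s 0 (fun p => φ p + -ν) c K (fun σ ψ => u σ ψ * ch (-ν) ψ) := by
    refine ⟨h.1, h.2.1, by simpa using h.summK, fun σ hσ ψ => ?_⟩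
    refine hsc ((h.2.2.2 σ hσ ψ).mul_right (ch (-ν) ψ)) (fun p => ?_) rfl
    rw [ch_add]; ring
  refine hsc (h2.avg hσ) (fun p => ?_) rfl
  simp only [add_neg_eq_zero]

lemma Bd.fourier (h : Bd D s ρ u C) {σ : ℝ} (hσ : σ ∈ D) (ψ) :
    HasSum (fun ν => (avg fun ψ => u σ ψ * ch (-ν) ψ) * ch ν ψ) (u σ ψ) := by
  obtain ⟨P, hP, φ, c, K, hR, hC⟩ := h.rp
  have h1 := (Equiv.sigmaFiberEquiv φ).hasSum_iff.mpr (hR.2.2.2 σ hσ ψ)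
  refine HasSum.sigma h1 fun ν => ?_
  have h2 := (hR.coef hσ ν).mul_right (ch ν ψ)
  have h3 := (hasSum_subtype_iff_indicator (f := fun p => c p σ * ch ν ψ)
    (s := {p | φ p = ν}) (a := (avg fun ψ => u σ ψ * ch (-ν) ψ) * ch ν ψ)).mpr (by
      refine hsc h2 (fun p => ?_) rfl
      by_cases hp : φ p = ν <;> simp [hp])
  refine hsc h3 (fun x => ?_) rfl
  have := x.2
  simp only [Function.comp, Equiv.sigmaFiberEquiv_apply]
  rw [this]

lemma Bd.coef_deriv (h : Bd D s ρ u C) (hρ : 0 < ρ) {w : Fin r → ℝ} {u' : ℝ → (Fin r → ℝ) → ℂ}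
    (h1 : HL D w u u') {σ : ℝ} (hσ : σ ∈ D) (ν : Fin r → ℤ) :
    (avg fun ψ => u' σ ψ * ch (-ν) ψ) =
      Complex.I * (dt ν w : ℂ) * avg fun ψ => u σ ψ * ch (-ν) ψ := by
  obtain ⟨V, hV0, hV⟩ := exV w
  obtain ⟨P, hP, φ, c, K, hR, hC⟩ := h.rp
  obtain ⟨a, ha, hRa, -⟩ := hR.deriv (ρ' := 0) (δ := ρ) (by linarith) (by linarith)
    (by linarith) hV hV0
  have e : u' σ = a σ := funext fun ψ => h1.unique ha hσ ψ
  rw [e]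
  refine (hRa.coef hσ ν).unique ?_
  refine hsc ((hR.coef hσ ν).mul_left (Complex.I * (dt ν w : ℂ))) (fun p => ?_) rfl
  split_ifs with hp
  · rw [hp]
  · simp

end Rp

end KAM


open MeasureTheory Real Filter

namespace KAM

def SD {r : ℕ} (ω : Fin r → ℝ) (D : Set ℝ) (s : ℝ) (θ : ℝ → ℝ) (δ Q : ℝ) : Prop :=
  ∀ ν : Fin r → ℤ, LB D s (fun σ => (Complex.I * ((dt ν ω - σ * θ σ : ℝ) : ℂ))⁻¹)
    (Q * exp (δ * nrm ν))

section solve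

variable {r : ℕ} {D : Set ℝ} {s ρ : ℝ} {g v : ℝ → (Fin r → ℝ) → ℂ} {C C' : ℝ} {ω : Fin r → ℝ}
  {θ : ℝ → ℝ} {δ Q ρ' : ℝ}

lemma dt_zero (ω : Fin r → ℝ) : dt 0 ω = 0 := by simp [dt]

lemma Bd.solve_aux (hg : Bd D s ρ g C) (hSD : SD ω D s θ δ Q) (hQ : 0 ≤ Q) (hδ : 0 ≤ δ)
    (h0 : 0 < ρ') (hρ : ρ' + δ ≤ ρ) :
    ∃ v v', Bd D s ρ' v (Q * C) ∧ HL D ω v v' ∧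
    ∀ σ ∈ D, ((∀ ν, dt ν ω - σ * θ σ ≠ 0) →
        ∀ ψ, v' σ ψ = Complex.I * ((σ * θ σ : ℝ) : ℂ) * v σ ψ + g σ ψ) ∧
      (θ σ = 0 → (∀ ν, ν ≠ 0 → dt ν ω ≠ 0) →
        avg (v σ) = 0 ∧ ∀ ψ, v' σ ψ = g σ ψ - avg (g σ)) := by
  obtain ⟨P, hP, φ, c, K, hR, hC⟩ := hg.rp
  obtain ⟨hK, hc, hS, hu⟩ := hR
  set a : P → ℝ → ℂ := fun p σ => (Complex.I * ((dt (φ p) ω - σ * θ σ : ℝ) : ℂ))⁻¹ * c p σ with ha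
  have hle : ∀ p, Q * exp (δ * nrm (φ p)) * K p * exp (|ρ'| * nrm (φ p)) ≤
      Q * (K p * exp (|ρ| * nrm (φ p))) := by
    intro p
    have hn := nrm_nonneg (φ p)
    have hKp := hK p
    rw [abs_of_pos h0, abs_of_pos (by linarith)]
    calc _ = Q * (K p * exp ((ρ' + δ) * nrm (φ p))) := by rw [add_mul, exp_add]; ring
      _ ≤ _ := by gcongr
  have h0' : ∀ p, 0 ≤ Q * exp (δ * nrm (φ p)) * K p := fun p =>
    mul_nonneg (mul_nonneg hQ (exp_pos _).le) (hK p)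
  have hS' : Summable fun p => Q * exp (δ * nrm (φ p)) * K p * exp (|ρ'| * nrm (φ p)) :=
    Summable.of_nonneg_of_le (fun p => mul_nonneg (h0' p) (exp_pos _).le) hle (hS.mul_left _)
  have hLB : ∀ p, LB D s (a p) (Q * exp (δ * nrm (φ p)) * K p) := fun p => (hSD (φ p)).mul (hc p)
  have hRv : Rp D s ρ' φ a (fun p => Q * exp (δ * nrm (φ p)) * K p)
      (fun σ ψ => ∑' p, a p σ * ch (φ p) ψ) := by
    refine ⟨h0', hLB, hS', fun σ hσ ψ => Summable.hasSum ?_⟩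
    refine Summable.of_norm_bounded hS' fun p => ?_
    rw [norm_mul, norm_ch, mul_one]
    exact ((hLB p).norm_le hσ).trans (Bd.le_wt _ _ (h0' p))
  obtain ⟨V, hV0, hV⟩ := exV ω
  obtain ⟨v', hv', hRv', -⟩ := hRv.deriv (ρ' := 0) (δ := ρ') (by linarith) (by linarith)
    (by linarith) hV hV0
  refine ⟨_, v', hRv.bd ?_, hv', fun σ hσ => ⟨fun hne ψ => ?_, fun hθ hne => ⟨?_, fun ψ => ?_⟩⟩⟩
  · refine (hS'.tsum_le_tsum hle (hS.mul_left _)).trans ?_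
    rw [tsum_mul_left]; gcongr
  · refine (hRv'.2.2.2 σ hσ ψ).unique ?_
    refine hsc (((hRv.2.2.2 σ hσ ψ).mul_left (Complex.I * ((σ * θ σ : ℝ) : ℂ))).add (hu σ hσ ψ))
      (fun p => ?_) rfl
    have h1 : ((dt (φ p) ω - σ * θ σ : ℝ) : ℂ) ≠ 0 := by exact_mod_cast hne (φ p)
    have h2 : c p σ = Complex.I * ((dt (φ p) ω - σ * θ σ : ℝ) : ℂ) * a p σ := by
      simp only [ha]
      rw [mul_inv_cancel_left₀ (mul_ne_zero Complex.I_ne_zero h1)]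
    rw [h2]
    push_cast
    ring
  · refine (hRv.avg hσ).unique ?_
    refine hsc hasSum_zero (fun p => ?_) rfl
    split_ifs with hp
    · simp [ha, hp, hθ, dt_zero]
    · rfl
  · refine (hRv'.2.2.2 σ hσ ψ).unique ?_
    refine hsc ((hu σ hσ ψ).sub (Rp.avg (show Rp D s ρ φ c K g from ⟨hK, hc, hS, hu⟩) hσ)) (fun p => ?_) rfl
    by_cases hp : φ p = 0
    · simp [hp, dt_zero]
    · have h1 : ((dt (φ p) ω : ℝ) : ℂ) ≠ 0 := by exact_mod_cast hne (φ p) hp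
      simp only [ha, hθ, mul_zero, sub_zero, if_neg hp]
      rw [mul_inv_cancel_left₀ (mul_ne_zero Complex.I_ne_zero h1)]

lemma Bd.solveN (hg : Bd D s ρ g C) (hSD : SD ω D s θ δ Q) (hQ : 0 ≤ Q) (hδ : 0 ≤ δ)
    (h0 : 0 < ρ') (hρ : ρ' + δ ≤ ρ) (hne : ∀ σ ∈ D, ∀ ν, dt ν ω - σ * θ σ ≠ 0) :
    ∃ v, Bd D s ρ' v (Q * C) ∧
      HL D ω v (fun σ ψ => Complex.I * ((σ * θ σ : ℝ) : ℂ) * v σ ψ + g σ ψ) := by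
  obtain ⟨v, v', h1, h2, h3⟩ := hg.solve_aux hSD hQ hδ h0 hρ
  exact ⟨v, h1, h2.congr (fun _ _ _ => rfl) fun σ hσ ψ => ((h3 σ hσ).1 (hne σ hσ) ψ).symm⟩

lemma Bd.solve0 (hg : Bd D s ρ g C) (hSD : SD ω D s (fun _ => 0) δ Q) (hQ : 0 ≤ Q) (hδ : 0 ≤ δ)
    (h0 : 0 < ρ') (hρ : ρ' + δ ≤ ρ) (hne : ∀ ν : Fin r → ℤ, ν ≠ 0 → dt ν ω ≠ 0) :
    ∃ v, Bd D s ρ' v (Q * C) ∧ (∀ σ ∈ D, avg (v σ) = 0) ∧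
      HL D ω v (fun σ ψ => g σ ψ - avg (g σ)) := by
  obtain ⟨v, v', h1, h2, h3⟩ := hg.solve_aux hSD hQ hδ h0 hρ
  exact ⟨v, h1, fun σ hσ => ((h3 σ hσ).2 rfl hne).1,
    h2.congr (fun _ _ _ => rfl) fun σ hσ ψ => (((h3 σ hσ).2 rfl hne).2 ψ).symm⟩

lemma Bd.uniqN (hv : Bd D s ρ v C) (h0 : 0 < ρ) (hne : ∀ σ ∈ D, ∀ ν, dt ν ω - σ * θ σ ≠ 0)
    (h : HL D ω v (fun σ ψ => Complex.I * ((σ * θ σ : ℝ) : ℂ) * v σ ψ)) {σ : ℝ} (hσ : σ ∈ D) (ψ) :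
    v σ ψ = 0 := by
  refine (hv.fourier hσ ψ).unique ?_
  refine hsc hasSum_zero (fun ν => ?_) rfl
  have h1 := hv.coef_deriv h0 h hσ ν
  simp only [mul_assoc] at h1
  rw [avg_cmul, avg_cmul, ← sub_eq_zero, ← mul_sub, ← sub_mul, ← mul_assoc] at h1
  have h2 : ((σ * θ σ : ℝ) : ℂ) - (dt ν ω : ℂ) ≠ 0 := by
    rw [← Complex.ofReal_sub]
    have := hne σ hσ ν
    exact_mod_cast fun h => this (by linarith)
  have h3 := (mul_eq_zero.mp h1).resolve_left (mul_ne_zero Complex.I_ne_zero h2)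
  rw [h3, zero_mul]

lemma Bd.uniq0 (hv : Bd D s ρ v C) (h0 : 0 < ρ) (hne : ∀ ν : Fin r → ℤ, ν ≠ 0 → dt ν ω ≠ 0)
    (h : HL D ω v (fun _ _ => 0)) {σ : ℝ} (hσ : σ ∈ D) (ψ) :
    v σ ψ = avg (v σ) := by
  refine (hv.fourier hσ ψ).unique ?_
  have h1 := hasSum_ite_eq (0 : Fin r → ℤ) (avg (v σ))
  refine hsc h1 (fun ν => ?_) rfl
  split_ifs with hν
  · subst hν
    simp
  · have h1 := hv.coef_deriv h0 h hσ ν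
    simp only [zero_mul] at h1
    rw [avg_const] at h1
    have h2 : ((dt ν ω : ℝ) : ℂ) ≠ 0 := by exact_mod_cast hne ν hν
    rw [(mul_eq_zero.mp h1.symm).resolve_left (mul_ne_zero Complex.I_ne_zero h2), zero_mul]

lemma Bd.apriN (hg : Bd D s ρ g C) (hSD : SD ω D s θ δ Q) (hQ : 0 ≤ Q) (hδ : 0 ≤ δ)
    (h0 : 0 < ρ') (hρ : ρ' + δ ≤ ρ) (hne : ∀ σ ∈ D, ∀ ν, dt ν ω - σ * θ σ ≠ 0)
    (hv : Bd D s ρ' v C')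
    (h : HL D ω v (fun σ ψ => Complex.I * ((σ * θ σ : ℝ) : ℂ) * v σ ψ + g σ ψ)) :
    Bd D s ρ' v (Q * C) := by
  obtain ⟨w, h1, h2⟩ := hg.solveN hSD hQ hδ h0 hρ hne
  refine h1.congr fun σ hσ ψ => ?_
  have h3 := (hv.sub h1).uniqN h0 hne ((h.sub h2).congr (fun _ _ _ => rfl)
    fun σ _ ψ => by ring) hσ ψ
  exact sub_eq_zero.mp h3

lemma Bd.apri0 (hg : Bd D s ρ g C) (hSD : SD ω D s (fun _ => 0) δ Q) (hQ : 0 ≤ Q) (hδ : 0 ≤ δ)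
    (h0 : 0 < ρ') (hρ : ρ' + δ ≤ ρ) (hne : ∀ ν : Fin r → ℤ, ν ≠ 0 → dt ν ω ≠ 0)
    (hv : Bd D s ρ' v C') (h : HL D ω v g) :
    Bd D s ρ' (fun σ ψ => v σ ψ - avg (v σ)) (Q * C) := by
  obtain ⟨w, h1, hw, h2⟩ := hg.solve0 hSD hQ hδ h0 hρ hne
  refine h1.congr fun σ hσ ψ => ?_
  have hg0 : ∀ σ ∈ D, avg (g σ) = 0 := fun σ hσ => hv.avg_deriv h0 h hσ
  have hvw := hv.sub h1
  have h3 := hvw.uniq0 h0 hne ((h.sub h2).congr (fun _ _ _ => rfl)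
    fun σ hσ ψ => by rw [hg0 σ hσ]; ring) hσ ψ
  have h4 := (Bd.avg_add hvw h1 hσ)
  simp only [sub_add_cancel] at h4
  rw [hw σ hσ, add_zero] at h4
  rw [h4, ← h3]
  ring

end solve

def RB {r : ℕ} (D : Set ℝ) (s ρ : ℝ) (u : ℝ → (Fin r → ℝ) → ℝ) (C : ℝ) : Prop :=
  Bd D s ρ (fun σ ψ => (u σ ψ : ℂ)) C

def LR (D : Set ℝ) (s : ℝ) (c : ℝ → ℝ) (C : ℝ) : Prop := LB D s (fun σ => (c σ : ℂ)) C

namespace LR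

variable {D : Set ℝ} {s : ℝ} {c c' : ℝ → ℝ} {C C' : ℝ}

lemma mono (h : LR D s c C) (hC : C ≤ C') : LR D s c C' := LB.mono h hC

lemma congr (h : LR D s c C) (hc : ∀ σ ∈ D, c' σ = c σ) : LR D s c' C :=
  LB.congr h fun σ hσ => by rw [hc σ hσ]

lemma add (h : LR D s c C) (h' : LR D s c' C') : LR D s (fun σ => c σ + c' σ) (C + C') :=
  (LB.add h h').congr fun σ _ => by push_cast; rfl

lemma neg (h : LR D s c C) : LR D s (fun σ => -c σ) C :=
  (LB.neg h).congr fun σ _ => by push_cast; rfl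

lemma sub (h : LR D s c C) (h' : LR D s c' C') : LR D s (fun σ => c σ - c' σ) (C + C') :=
  (h.add h'.neg).congr fun σ _ => sub_eq_add_neg _ _

lemma mul (h : LR D s c C) (h' : LR D s c' C') : LR D s (fun σ => c σ * c' σ) (C * C') :=
  (LB.mul h h').congr fun σ _ => by push_cast; rfl

lemma const (z : ℝ) : LR D s (fun _ => z) |z| := by
  simpa [LR] using (LB.const (D := D) (s := s) (z : ℂ))

lemma abs_le (h : LR D s c C) {σ : ℝ} (hσ : σ ∈ D) : |c σ| ≤ C := by
  simpa using LB.norm_le h hσ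

lemma lip (h : LR D s c C) {σ σ' : ℝ} (hσ : σ ∈ D) (hσ' : σ' ∈ D) :
    |s| * |c σ - c σ'| ≤ C * |σ - σ'| := by
  have := LB.lip h hσ hσ'
  rwa [← Complex.ofReal_sub, Complex.norm_real] at this

lemma of_le {A B : ℝ} (hA : ∀ σ ∈ D, |c σ| ≤ A) (hB0 : 0 ≤ B)
    (hB : ∀ σ ∈ D, ∀ σ' ∈ D, |s| * |c σ - c σ'| ≤ B * |σ - σ'|) : LR D s c (A + B) :=
  LB.of_le (fun σ hσ => by simpa using hA σ hσ) hB0 fun σ hσ σ' hσ' => by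
    rw [← Complex.ofReal_sub, Complex.norm_real]; exact hB σ hσ σ' hσ'

end LR

namespace RB

variable {r : ℕ} {D : Set ℝ} {s ρ : ℝ} {u v : ℝ → (Fin r → ℝ) → ℝ} {C C' : ℝ}

lemma nonneg (h : RB D s ρ u C) : 0 ≤ C := Bd.nonneg h

lemma mono (h : RB D s ρ u C) (hC : C ≤ C') : RB D s ρ u C' := Bd.mono h hC

lemma mono_set {D' : Set ℝ} (h : RB D s ρ u C) (hD : D' ⊆ D) : RB D' s ρ u C := Bd.mono_set h hD

lemma mono_rho {ρ' : ℝ} (h : RB D s ρ u C) (h0 : 0 ≤ ρ') (hρ : ρ' ≤ ρ) : RB D s ρ' u C :=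
  Bd.mono_rho h h0 hρ

lemma congr (h : RB D s ρ u C) (hv : ∀ σ ∈ D, ∀ ψ, v σ ψ = u σ ψ) : RB D s ρ v C :=
  Bd.congr h fun σ hσ ψ => by rw [hv σ hσ ψ]

lemma ofLR {c : ℝ → ℝ} {K : ℝ} (hc : LR D s c K) (hK : 0 ≤ K) :
    RB D s ρ (fun σ (_ : Fin r → ℝ) => c σ) K := Bd.ofLB hc hK

lemma const (z : ℝ) : RB D s ρ (fun _ (_ : Fin r → ℝ) => z) |z| := by
  simpa [RB] using (Bd.const (D := D) (s := s) (ρ := ρ) (r := r) (z : ℂ))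

lemma zero : RB D s ρ (fun _ (_ : Fin r → ℝ) => 0) 0 := by
  simpa using (const 0 : RB D s ρ (fun _ (_ : Fin r → ℝ) => 0) _)

lemma neg (h : RB D s ρ u C) : RB D s ρ (fun σ ψ => -u σ ψ) C :=
  (Bd.neg h).congr fun σ _ ψ => by push_cast; rfl

lemma add (h : RB D s ρ u C) (h' : RB D s ρ v C') :
    RB D s ρ (fun σ ψ => u σ ψ + v σ ψ) (C + C') :=
  (Bd.add h h').congr fun σ _ ψ => by push_cast; rfl

lemma sub (h : RB D s ρ u C) (h' : RB D s ρ v C') :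
    RB D s ρ (fun σ ψ => u σ ψ - v σ ψ) (C + C') :=
  (Bd.sub h h').congr fun σ _ ψ => by push_cast; rfl

lemma mul (h : RB D s ρ u C) (h' : RB D s ρ v C') :
    RB D s ρ (fun σ ψ => u σ ψ * v σ ψ) (C * C') :=
  (Bd.mul h h').congr fun σ _ ψ => by push_cast; rfl

lemma const_mul (z : ℝ) (h : RB D s ρ u C) : RB D s ρ (fun σ ψ => z * u σ ψ) (|z| * C) :=
  (const z).mul h

lemma sum {ι : Type} (S : Finset ι) {u : ι → ℝ → (Fin r → ℝ) → ℝ} {C : ι → ℝ}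
    (h : ∀ i ∈ S, RB D s ρ (u i) (C i)) :
    RB D s ρ (fun σ ψ => ∑ i ∈ S, u i σ ψ) (∑ i ∈ S, C i) :=
  (Bd.sum S h).congr fun σ _ ψ => by push_cast; rfl

lemma tsum {ι : Type} [Countable ι] {u : ι → ℝ → (Fin r → ℝ) → ℝ} {C : ι → ℝ} {T : ℝ}
    (h : ∀ i, RB D s ρ (u i) (C i)) (hC : HasSum C T)
    (hv : ∀ σ ∈ D, ∀ ψ, HasSum (fun i => u i σ ψ) (v σ ψ)) : RB D s ρ v T :=
  Bd.tsum h hC fun σ hσ ψ => by exact_mod_cast (hv σ hσ ψ)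

lemma abs_le (h : RB D s ρ u C) {σ : ℝ} (hσ : σ ∈ D) (ψ) : |u σ ψ| ≤ C := by
  simpa using Bd.norm_le h hσ ψ

lemma ofRe {u : ℝ → (Fin r → ℝ) → ℂ} (h : Bd D s ρ u C) : RB D s ρ (fun σ ψ => (u σ ψ).re) C :=
  h.re

lemma ofIm {u : ℝ → (Fin r → ℝ) → ℂ} (h : Bd D s ρ u C) : RB D s ρ (fun σ ψ => (u σ ψ).im) C :=
  h.im

lemma deriv (h : RB D s ρ u C) {ρ' δ V : ℝ} (h0 : 0 ≤ ρ') (hδ : 0 < δ) (hρ : ρ' + δ ≤ ρ)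
    {w : Fin r → ℝ} (hV : ∀ k, |w k| ≤ V) (hV0 : 0 ≤ V) :
    ∃ u', HL D w u u' ∧ RB D s ρ' u' (V / δ * C) := by
  obtain ⟨u', h1, h2⟩ := Bd.deriv h h0 hδ hρ hV hV0
  exact ⟨_, by simpa using h1.re, ofRe h2⟩

lemma deriv_bd (h : RB D s ρ u C) {ρ' δ V : ℝ} (h0 : 0 ≤ ρ') (hδ : 0 < δ) (hρ : ρ' + δ ≤ ρ)
    {w : Fin r → ℝ} (hV : ∀ k, |w k| ≤ V) (hV0 : 0 ≤ V) {u' : ℝ → (Fin r → ℝ) → ℝ}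
    (hu' : HL D w u u') : RB D s ρ' u' (V / δ * C) :=
  Bd.deriv_bd h h0 hδ hρ hV hV0 hu'.ofReal

lemma comm (h : RB D s ρ u C) (hρ : 0 < ρ) {w w' : Fin r → ℝ}
    {u1 u2 u12 u21 : ℝ → (Fin r → ℝ) → ℝ} (h1 : HL D w u u1) (h2 : HL D w' u u2)
    (h12 : HL D w' u1 u12) (h21 : HL D w u2 u21) {σ : ℝ} (hσ : σ ∈ D) (ψ) :
    u12 σ ψ = u21 σ ψ := by
  have := Bd.comm h hρ h1.ofReal h2.ofReal h12.ofReal h21.ofReal hσ ψ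
  exact_mod_cast this

lemma avgLR (h : RB D s ρ u C) : LR D s (fun σ => avg (u σ)) C := by
  have := Bd.avgLB h
  exact this.congr fun σ _ => (avg_ofReal _).symm

lemma avgRB (h : RB D s ρ u C) : RB D s ρ (fun σ (_ : Fin r → ℝ) => avg (u σ)) C :=
  ofLR h.avgLR h.nonneg

lemma avg_deriv (h : RB D s ρ u C) (hρ : 0 < ρ) {w : Fin r → ℝ} {u' : ℝ → (Fin r → ℝ) → ℝ}
    (h1 : HL D w u u') {σ : ℝ} (hσ : σ ∈ D) : avg (u' σ) = 0 := by
  have := Bd.avg_deriv h hρ h1.ofReal hσ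
  rw [avg_ofReal] at this
  exact_mod_cast this

lemma avg_add (h : RB D s ρ u C) (h' : RB D s ρ v C') {σ : ℝ} (hσ : σ ∈ D) :
    avg (fun ψ => u σ ψ + v σ ψ) = avg (u σ) + avg (v σ) := by
  have := Bd.avg_add h h' hσ
  simp only [← Complex.ofReal_add, avg_ofReal] at this
  exact_mod_cast this

lemma avg_mul (a : ℝ) (u : (Fin r → ℝ) → ℝ) : avg (fun ψ => a * u ψ) = a * avg u := avg_smul a u

lemma avg_neg (u : (Fin r → ℝ) → ℝ) : avg (fun ψ => -u ψ) = -avg u := by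
  simpa using avg_mul (-1) u

lemma avg_sub (h : RB D s ρ u C) (h' : RB D s ρ v C') {σ : ℝ} (hσ : σ ∈ D) :
    avg (fun ψ => u σ ψ - v σ ψ) = avg (u σ) - avg (v σ) := by
  have := h.avg_add h'.neg hσ
  simpa only [sub_eq_add_neg, avg_neg] using this

lemma avg_sum {ι : Type} (S : Finset ι) {u : ι → ℝ → (Fin r → ℝ) → ℝ} {C : ι → ℝ}
    (h : ∀ i ∈ S, RB D s ρ (u i) (C i)) {σ : ℝ} (hσ : σ ∈ D) :
    avg (fun ψ => ∑ i ∈ S, u i σ ψ) = ∑ i ∈ S, avg (u i σ) := by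
  classical
  induction S using Finset.induction_on with
  | empty => simp [avg]
  | insert a S ha ih =>
    simp only [Finset.sum_insert ha]
    rw [← ih fun i hi => h i (by simp [hi])]
    exact avg_add (h a (by simp)) (sum S fun i hi => h i (by simp [hi])) hσ

lemma solve0 {g : ℝ → (Fin r → ℝ) → ℝ} {ω : Fin r → ℝ} {δ Q ρ' : ℝ}
    (hg : RB D s ρ g C) (hSD : SD ω D s (fun _ => 0) δ Q) (hQ : 0 ≤ Q) (hδ : 0 ≤ δ)
    (h0 : 0 < ρ') (hρ : ρ' + δ ≤ ρ) (hne : ∀ ν : Fin r → ℤ, ν ≠ 0 → dt ν ω ≠ 0) :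
    ∃ v, RB D s ρ' v (Q * C) ∧ (∀ σ ∈ D, avg (v σ) = 0) ∧
      HL D ω v (fun σ ψ => g σ ψ - avg (g σ)) := by
  obtain ⟨v, h1, h2, h3⟩ := Bd.solve0 hg hSD hQ hδ h0 hρ hne
  refine ⟨fun σ ψ => (v σ ψ).re, ofRe h1, fun σ hσ => ?_, ?_⟩
  · have h4 := h2 σ hσ
    unfold avg at h4 ⊢
    have h5 := congrArg Complex.re h4
    rw [Complex.smul_re] at h5
    have : (∫ ψ in bx r, v σ ψ).re = ∫ ψ in bx r, (v σ ψ).re := by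
      have := integral_re (h1.integrable hσ)
      exact this.symm
    rw [this] at h5
    simpa using h5
  · refine h3.re.congr (fun _ _ _ => rfl) fun σ _ ψ => ?_
    rw [avg_ofReal]
    simp

lemma apri0 {g : ℝ → (Fin r → ℝ) → ℝ} {ω : Fin r → ℝ} {δ Q ρ' : ℝ}
    (hg : RB D s ρ g C) (hSD : SD ω D s (fun _ => 0) δ Q) (hQ : 0 ≤ Q) (hδ : 0 ≤ δ)
    (h0 : 0 < ρ') (hρ : ρ' + δ ≤ ρ) (hne : ∀ ν : Fin r → ℤ, ν ≠ 0 → dt ν ω ≠ 0)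
    (hv : RB D s ρ' v C') (h : HL D ω v g) :
    RB D s ρ' (fun σ ψ => v σ ψ - avg (v σ)) (Q * C) := by
  have := Bd.apri0 hg hSD hQ hδ h0 hρ hne hv h.ofReal
  refine Bd.congr this fun σ _ ψ => ?_
  rw [avg_ofReal]; push_cast; rfl

end RB

end KAM


open MeasureTheory Real Filter

namespace KAM

abbrev JJ (r l : ℕ) := Fin r ⊕ Fin l

section FE

variable {r l : ℕ}

def l1 (ℓ : JJ r l → ℝ) : ℝ := ∑ j, |ℓ j|

lemma l1_nonneg (ℓ : JJ r l → ℝ) : 0 ≤ l1 ℓ := Finset.sum_nonneg fun _ _ => abs_nonneg _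

lemma abs_le_l1 (ℓ : JJ r l → ℝ) (j) : |ℓ j| ≤ l1 ℓ :=
  Finset.single_le_sum (f := fun j => |ℓ j|) (fun _ _ => abs_nonneg _) (Finset.mem_univ j)

noncomputable def ec (ℓ : JJ r l → ℝ) (y : JJ r l → ℝ) : ℂ :=
  Complex.exp (Complex.I * ((∑ j, ℓ j * y j : ℝ) : ℂ))

lemma norm_ec (ℓ y : JJ r l → ℝ) : ‖ec ℓ y‖ = 1 := by
  unfold ec; rw [mul_comm]; exact Complex.norm_exp_ofReal_mul_I _

def FE (κ : ℝ) (g : (JJ r l → ℝ) → ℝ) (C : ℝ) : Prop :=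
  ∃ (P : Type) (_ : Countable P) (ℓ : P → JJ r l → ℝ) (ν : P → Fin r → ℤ) (c : P → ℂ),
    (∀ p k, ℓ p (Sum.inl k) = ν p k) ∧
    Summable (fun p => ‖c p‖ * exp (κ * l1 (ℓ p))) ∧
    ∑' p, ‖c p‖ * exp (κ * l1 (ℓ p)) ≤ C ∧
    ∀ y, HasSum (fun p => c p * ec (ℓ p) y) (g y : ℂ)

lemma hasSum_partial {g : (JJ r l → ℝ) → ℝ} (hg : Differentiable ℝ g) {P : Type}
    {ℓ : P → JJ r l → ℝ} {c : P → ℂ} {i : JJ r l}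
    (hS2 : Summable fun p => ‖Complex.I * (ℓ p i : ℂ) * c p‖)
    (hg' : ∀ y, HasSum (fun p => c p * ec (ℓ p) y) (g y : ℂ)) (y : JJ r l → ℝ) :
    HasSum (fun p => Complex.I * (ℓ p i : ℂ) * c p * ec (ℓ p) y)
      ((fderiv ℝ g y (Pi.single i 1) : ℝ) : ℂ) := by
  classical
  set e : JJ r l → ℝ := Pi.single i 1 with he
  have hd : ∀ p t, HasDerivAt (fun t : ℝ => c p * ec (ℓ p) (y + t • e))
      (Complex.I * (ℓ p i : ℂ) * c p * ec (ℓ p) (y + t • e)) t := by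
    intro p t
    have h1 : HasDerivAt (fun t : ℝ => ∑ j, ℓ p j * (y + t • e) j) (ℓ p i) t := by
      have e : (fun t : ℝ => ∑ j, ℓ p j * (y + t • e) j) =
          fun t => ∑ j, ℓ p j * y j + t * ℓ p i := by
        funext t
        simp only [he, Pi.add_apply, Pi.smul_apply, smul_eq_mul, mul_add, Finset.sum_add_distrib,
          Pi.single_apply, mul_ite, mul_one, mul_zero, Finset.sum_ite_eq', Finset.mem_univ,
          if_true]
        ring
      rw [e]
      simpa using ((hasDerivAt_id t).mul_const (ℓ p i)).const_add (∑ j, ℓ p j * y j)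
    have h2 := ((h1.ofReal_comp.const_mul Complex.I).cexp).const_mul (c p)
    exact h2.congr_deriv (by unfold ec; ring)
  have hn : ∀ p (t : ℝ), ‖Complex.I * (ℓ p i : ℂ) * c p * ec (ℓ p) (y + t • e)‖ ≤
      ‖Complex.I * (ℓ p i : ℂ) * c p‖ := fun p t => by rw [norm_mul, norm_ec, mul_one]
  have h3 := hasDerivAt_tsum (y₀ := (0:ℝ)) hS2 hd hn (hg' _).summable 0
  have e1 : (fun t : ℝ => ∑' p, c p * ec (ℓ p) (y + t • e)) =
      fun t : ℝ => (g (y + t • e) : ℂ) := funext fun t => (hg' _).tsum_eq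
  rw [e1] at h3
  have h4 : HasDerivAt (fun t : ℝ => g (y + t • e)) (fderiv ℝ g y e) 0 := by
    have h5 : HasDerivAt (fun t : ℝ => y + t • e) e 0 := by
      simpa using ((hasDerivAt_id (0:ℝ)).smul_const e).const_add y
    have h6 : HasFDerivAt g (fderiv ℝ g y) (y + (0:ℝ) • e) := by
      simpa using (hg y).hasFDerivAt
    exact h6.comp_hasDerivAt (0:ℝ) h5
  have h7 := h3.unique h4.ofReal_comp
  simp only [zero_smul, add_zero] at h7
  rw [← h7]
  exact (Summable.of_norm (hS2.congr fun p => by rw [norm_mul _ (ec _ _), norm_ec, mul_one])).hasSum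

lemma FE.partial {κ C κ' δ : ℝ} {g : (JJ r l → ℝ) → ℝ} (h : FE κ g C) (hg : Differentiable ℝ g)
    (hδ : 0 < δ) (hκ : κ' + δ ≤ κ) (hκ' : 0 ≤ κ') (i : JJ r l) :
    FE κ' (fun y => fderiv ℝ g y (Pi.single i 1)) (C / δ) := by
  classical
  obtain ⟨P, hP, ℓ, ν, c, hν, hS, hC, hg'⟩ := h
  have hle : ∀ p, ‖Complex.I * (ℓ p i : ℂ) * c p‖ * exp (κ' * l1 (ℓ p)) ≤
      ‖c p‖ * exp (κ * l1 (ℓ p)) / δ := by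
    intro p
    have hn := l1_nonneg (ℓ p)
    have h2 : l1 (ℓ p) ≤ exp (δ * l1 (ℓ p)) / δ := by
      rw [le_div_iff₀ hδ]
      have := add_one_le_exp (δ * l1 (ℓ p)); nlinarith
    rw [norm_mul, norm_mul, Complex.norm_I, one_mul, Complex.norm_real, Real.norm_eq_abs]
    calc _ ≤ (exp (δ * l1 (ℓ p)) / δ) * ‖c p‖ * exp (κ' * l1 (ℓ p)) := by
          gcongr; exact (abs_le_l1 _ i).trans h2
      _ = ‖c p‖ * exp ((κ' + δ) * l1 (ℓ p)) / δ := by rw [add_mul, exp_add]; ring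
      _ ≤ _ := by gcongr
  have hS' := Summable.of_nonneg_of_le (fun p => by positivity) hle (hS.div_const δ)
  refine ⟨P, hP, ℓ, ν, fun p => Complex.I * (ℓ p i : ℂ) * c p, hν, hS', ?_, fun y => ?_⟩
  · refine (hS'.tsum_le_tsum hle (hS.div_const δ)).trans ?_
    rw [tsum_div_const]; gcongr
  · have hS2 : Summable fun p => ‖Complex.I * (ℓ p i : ℂ) * c p‖ := by
      refine Summable.of_nonneg_of_le (fun p => norm_nonneg _) (fun p => ?_) hS'
      exact le_mul_of_one_le_right (norm_nonneg _)
        (one_le_exp (mul_nonneg hκ' (l1_nonneg _)))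
    exact hasSum_partial hg hS2 hg' y

def em (q : ℝ → (Fin r → ℝ) → JJ r l → ℝ) (σ : ℝ) (ψ : Fin r → ℝ) : JJ r l → ℝ :=
  fun j => Sum.elim ψ (fun _ => 0) j + q σ ψ j

lemma ec_add (ℓ y h : JJ r l → ℝ) : ec ℓ (y + h) = ec ℓ y * ec ℓ h := by
  unfold ec
  rw [← Complex.exp_add, ← mul_add, ← Complex.ofReal_add, ← Finset.sum_add_distrib]
  simp only [Pi.add_apply, mul_add]

open scoped Nat in
lemma FE.core {κ C δ η X ρ : ℝ} {D : Set ℝ} {s : ℝ} {P : Type} [Countable P]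
    {ℓ : P → JJ r l → ℝ} {ν : P → Fin r → ℤ} {c : P → ℂ} (hν : ∀ p k, ℓ p (Sum.inl k) = ν p k)
    (hS : Summable (fun p => ‖c p‖ * exp (κ * l1 (ℓ p))))
    (hC : ∑' p, ‖c p‖ * exp (κ * l1 (ℓ p)) ≤ C)
    {q h : ℝ → (Fin r → ℝ) → JJ r l → ℝ}
    (hq : ∀ j, RB D s ρ (fun σ ψ => q σ ψ j) η) (hη : 0 ≤ η)
    (hh : ∀ j, RB D s ρ (fun σ ψ => h σ ψ j) X) (hX : 0 ≤ X)
    (hδ : 0 < δ) (hρ : 0 ≤ ρ) (hκ : ρ + η + X + δ ≤ κ) (k : ℕ)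
    {w : ℝ → (Fin r → ℝ) → ℂ}
    (hw : ∀ σ ∈ D, ∀ ψ, HasSum (fun p => c p * ec (ℓ p) (em q σ ψ) *
      (ec (ℓ p) (h σ ψ) - ∑ i ∈ Finset.range k,
        (Complex.I * ((∑ j, ℓ p j * h σ ψ j : ℝ) : ℂ)) ^ i / (i ! : ℂ))) (w σ ψ)) :
    Bd D s ρ w (C * k ! * (X / δ) ^ k) := by
  have lin : ∀ p {q : ℝ → (Fin r → ℝ) → JJ r l → ℝ} {η : ℝ},
      (∀ j, RB D s ρ (fun σ ψ => q σ ψ j) η) →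
      Bd D s ρ (fun σ ψ => Complex.I * ((∑ j, ℓ p j * q σ ψ j : ℝ) : ℂ)) (l1 (ℓ p) * η) := by
    intro p q η hq
    have := (RB.sum Finset.univ fun j _ => (hq j).const_mul (ℓ p j))
    have := Bd.const_mul Complex.I this
    rw [Complex.norm_I, one_mul, ← Finset.sum_mul] at this
    exact this
  have hterm : ∀ p, Bd D s ρ (fun σ ψ => c p * ec (ℓ p) (em q σ ψ) *
      (ec (ℓ p) (h σ ψ) - ∑ i ∈ Finset.range k,
        (Complex.I * ((∑ j, ℓ p j * h σ ψ j : ℝ) : ℂ)) ^ i / (i ! : ℂ)))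
      (‖c p‖ * exp (κ * l1 (ℓ p)) * (k ! * (X / δ) ^ k)) := by
    intro p
    have hn := l1_nonneg (ℓ p)
    have b1 := (lin p hq).expRem 0
    have b2 := (lin p hh).expRem k
    have b3 := Bd.single (ρ := ρ) (LB.const (D := D) (s := s) (c p)) (norm_nonneg _) (ν p)
    have hnu : nrm (ν p) ≤ l1 (ℓ p) := by
      unfold nrm l1
      rw [Fintype.sum_sum_type]
      simp only [hν]
      exact le_add_of_nonneg_right (Finset.sum_nonneg fun _ _ => abs_nonneg _)
    refine (((b3.mul b1).mul b2).congr fun σ _ ψ => ?_).mono ?_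
    · congr 1
      rw [mul_assoc]
      congr 1
      simp only [Finset.range_zero, Finset.sum_empty, sub_zero]
      unfold ec ch em
      rw [← Complex.exp_add, ← mul_add, ← Complex.ofReal_add]
      congr 3
      simp only [mul_add, Finset.sum_add_distrib]
      congr 1
      simp [Fintype.sum_sum_type, hν]
    · rw [pow_zero, one_mul, abs_of_nonneg hρ]
      have hfac : (l1 (ℓ p) * X) ^ k ≤ k ! * (X / δ) ^ k * exp (δ * l1 (ℓ p)) := by
        have h1 := Real.pow_div_factorial_le_exp (δ * l1 (ℓ p)) (by positivity) k
        have h2 : (0:ℝ) < k ! := by exact_mod_cast Nat.factorial_pos k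
        rw [div_le_iff₀ h2] at h1
        calc (l1 (ℓ p) * X) ^ k = (X / δ) ^ k * (δ * l1 (ℓ p)) ^ k := by
              rw [← mul_pow]; congr 1; field_simp
          _ ≤ (X / δ) ^ k * (exp (δ * l1 (ℓ p)) * k !) := by gcongr
          _ = _ := by ring
      have hk : (0:ℝ) ≤ k ! * (X / δ) ^ k := by positivity
      calc _ ≤ ‖c p‖ * exp (ρ * l1 (ℓ p)) * exp (l1 (ℓ p) * η) *
            (k ! * (X / δ) ^ k * exp (δ * l1 (ℓ p)) * exp (l1 (ℓ p) * X)) := by gcongr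
        _ = ‖c p‖ * exp ((ρ + η + X + δ) * l1 (ℓ p)) * (k ! * (X / δ) ^ k) := by
            rw [show (ρ + η + X + δ) * l1 (ℓ p) = ρ * l1 (ℓ p) + l1 (ℓ p) * η + l1 (ℓ p) * X +
              δ * l1 (ℓ p) by ring, exp_add, exp_add, exp_add]
            ring
        _ ≤ _ := by gcongr
  refine (Bd.tsum hterm (hS.mul_right _).hasSum hw).mono ?_
  rw [tsum_mul_right, mul_assoc]
  gcongr

variable {D : Set ℝ} {s ρ κ C δ η X : ℝ} {g : (JJ r l → ℝ) → ℝ}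
  {q h : ℝ → (Fin r → ℝ) → JJ r l → ℝ}

lemma FE.comp (hg : FE κ g C) (hq : ∀ j, RB D s ρ (fun σ ψ => q σ ψ j) η) (hη : 0 ≤ η)
    (hρ : 0 ≤ ρ) (hκ : ρ + η < κ) : RB D s ρ (fun σ ψ => g (em q σ ψ)) C := by
  obtain ⟨P, hP, ℓ, ν, c, hν, hS, hC, hg'⟩ := hg
  have := FE.core (D := D) (s := s) (h := fun _ _ _ => 0) (X := 0) (δ := κ - ρ - η) hν hS hC hq hη
    (fun j => RB.zero) le_rfl (by linarith) hρ (by linarith) 0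
    (w := fun σ ψ => (g (em q σ ψ) : ℂ)) (fun σ hσ ψ => by
      refine hsc (hg' (em q σ ψ)) (fun p => ?_) rfl
      simp [ec])
  exact Bd.mono this (by simp)

lemma FE.diff (hg : FE κ g C) (hq : ∀ j, RB D s ρ (fun σ ψ => q σ ψ j) η) (hη : 0 ≤ η)
    (hh : ∀ j, RB D s ρ (fun σ ψ => h σ ψ j) X) (hX : 0 ≤ X)
    (hδ : 0 < δ) (hρ : 0 ≤ ρ) (hκ : ρ + η + X + δ ≤ κ) :
    RB D s ρ (fun σ ψ => g (em q σ ψ + h σ ψ) - g (em q σ ψ)) (C * (X / δ)) := by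
  obtain ⟨P, hP, ℓ, ν, c, hν, hS, hC, hg'⟩ := hg
  have := FE.core (D := D) (s := s) hν hS hC hq hη hh hX hδ hρ hκ 1
    (w := fun σ ψ => ((g (em q σ ψ + h σ ψ) - g (em q σ ψ) : ℝ) : ℂ)) (fun σ hσ ψ => by
      refine hsc ((hg' (em q σ ψ + h σ ψ)).sub (hg' (em q σ ψ))) (fun p => ?_) (by push_cast; rfl)
      rw [ec_add]; simp; ring)
  exact Bd.mono this (by simp)

lemma hasFDeriv_sum {g : (JJ r l → ℝ) → ℝ} (y v : JJ r l → ℝ) :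
    fderiv ℝ g y v = ∑ j, v j * fderiv ℝ g y (Pi.single j 1) := by
  conv_lhs => rw [← Finset.univ_sum_single v]
  rw [map_sum]
  refine Finset.sum_congr rfl fun j _ => ?_
  have : (Pi.single j (v j) : JJ r l → ℝ) = v j • Pi.single j 1 := by
    rw [← Pi.single_smul]; simp
  rw [this, map_smul, smul_eq_mul]

lemma FE.rem (hg : FE κ g C) (hgd : Differentiable ℝ g)
    (hq : ∀ j, RB D s ρ (fun σ ψ => q σ ψ j) η) (hη : 0 ≤ η)
    (hh : ∀ j, RB D s ρ (fun σ ψ => h σ ψ j) X) (hX : 0 ≤ X)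
    (hδ : 0 < δ) (hρ : 0 ≤ ρ) (hκ : ρ + η + X + δ ≤ κ) :
    RB D s ρ (fun σ ψ => g (em q σ ψ + h σ ψ) - g (em q σ ψ) -
      ∑ j, fderiv ℝ g (em q σ ψ) (Pi.single j 1) * h σ ψ j) (C * 2 * (X / δ) ^ 2) := by
  classical
  obtain ⟨P, hP, ℓ, ν, c, hν, hS, hC, hg'⟩ := hg
  have hκ0 : 0 ≤ κ := by linarith
  have hS2 : ∀ y j, HasSum (fun p => Complex.I * (ℓ p j : ℂ) * c p * ec (ℓ p) y)
      ((fderiv ℝ g y (Pi.single j 1) : ℝ) : ℂ) := by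
    intro y j
    have hle : ∀ p, ‖Complex.I * (ℓ p j : ℂ) * c p‖ ≤ ‖c p‖ * exp (κ * l1 (ℓ p)) / δ := by
      intro p
      have hn := l1_nonneg (ℓ p)
      have h2 : l1 (ℓ p) ≤ exp (κ * l1 (ℓ p)) / δ := by
        rw [le_div_iff₀ hδ]
        have := add_one_le_exp (κ * l1 (ℓ p)); nlinarith
      rw [norm_mul, norm_mul, Complex.norm_I, one_mul, Complex.norm_real, Real.norm_eq_abs,
        mul_comm, mul_div_assoc]
      gcongr; exact (abs_le_l1 _ j).trans h2
    have hS2 : Summable fun p => ‖Complex.I * (ℓ p j : ℂ) * c p‖ :=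
      Summable.of_nonneg_of_le (fun p => norm_nonneg _) hle (hS.div_const δ)
    exact hasSum_partial hgd hS2 hg' y
  have := FE.core (D := D) (s := s) hν hS hC hq hη hh hX hδ hρ hκ 2
    (w := fun σ ψ => ((g (em q σ ψ + h σ ψ) - g (em q σ ψ) -
      ∑ j, fderiv ℝ g (em q σ ψ) (Pi.single j 1) * h σ ψ j : ℝ) : ℂ)) (fun σ hσ ψ => by
      refine hsc (((hg' (em q σ ψ + h σ ψ)).sub (hg' (em q σ ψ))).sub
        (hasSum_sum fun j (_ : j ∈ Finset.univ) => (hS2 (em q σ ψ) j).mul_right (h σ ψ j : ℂ)))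
        (fun p => ?_) (by push_cast; rfl)
      rw [ec_add]
      have : ∑ j, Complex.I * (ℓ p j : ℂ) * c p * ec (ℓ p) (em q σ ψ) * (h σ ψ j : ℂ) =
        c p * ec (ℓ p) (em q σ ψ) * (Complex.I * ((∑ j, ℓ p j * h σ ψ j : ℝ) : ℂ)) := by
        push_cast
        rw [Finset.mul_sum, Finset.mul_sum]
        exact Finset.sum_congr rfl fun j _ => by ring
      rw [this]
      simp [Finset.sum_range_succ]; ring)
  exact Bd.mono this (by simp)

end FE

end KAM


open MeasureTheory Real Filter

namespace KAM

abbrev MF (r : ℕ) (ι κ : Type) := ℝ → (Fin r → ℝ) → Matrix ι κ ℝ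

def MB {r : ℕ} {ι κ : Type} (D : Set ℝ) (s ρ : ℝ) (M : MF r ι κ) (C : ℝ) : Prop :=
  0 ≤ C ∧ ∀ i k, RB D s ρ (fun σ ψ => M σ ψ i k) C

def HM {r : ℕ} {ι κ : Type} (D : Set ℝ) (v : Fin r → ℝ) (M M' : MF r ι κ) : Prop :=
  ∀ i k, HL D v (fun σ ψ => M σ ψ i k) (fun σ ψ => M' σ ψ i k)

section MBs

variable {r : ℕ} {ι κ μ : Type} {D : Set ℝ} {s ρ C C' : ℝ} {M M1 : MF r ι κ} {v : Fin r → ℝ}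

namespace MB

lemma nonneg (h : MB D s ρ M C) : 0 ≤ C := h.1

lemma mono (h : MB D s ρ M C) (hC : C ≤ C') : MB D s ρ M C' :=
  ⟨h.1.trans hC, fun i k => (h.2 i k).mono hC⟩

lemma mono_set {D' : Set ℝ} (h : MB D s ρ M C) (hD : D' ⊆ D) : MB D' s ρ M C :=
  ⟨h.1, fun i k => (h.2 i k).mono_set hD⟩

lemma mono_rho {ρ' : ℝ} (h : MB D s ρ M C) (h0 : 0 ≤ ρ') (hρ : ρ' ≤ ρ) : MB D s ρ' M C :=
  ⟨h.1, fun i k => (h.2 i k).mono_rho h0 hρ⟩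

lemma congr (h : MB D s ρ M C) (hv : ∀ σ ∈ D, ∀ ψ, M1 σ ψ = M σ ψ) : MB D s ρ M1 C :=
  ⟨h.1, fun i k => (h.2 i k).congr fun σ hσ ψ => by rw [hv σ hσ ψ]⟩

lemma neg (h : MB D s ρ M C) : MB D s ρ (fun σ ψ => -M σ ψ) C :=
  ⟨h.1, fun i k => (h.2 i k).neg⟩

lemma add (h : MB D s ρ M C) (h' : MB D s ρ M1 C') :
    MB D s ρ (fun σ ψ => M σ ψ + M1 σ ψ) (C + C') :=
  ⟨add_nonneg h.1 h'.1, fun i k => (h.2 i k).add (h'.2 i k)⟩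

lemma sub (h : MB D s ρ M C) (h' : MB D s ρ M1 C') :
    MB D s ρ (fun σ ψ => M σ ψ - M1 σ ψ) (C + C') :=
  ⟨add_nonneg h.1 h'.1, fun i k => (h.2 i k).sub (h'.2 i k)⟩

lemma zero : MB D s ρ (fun _ _ => (0 : Matrix ι κ ℝ)) (0 : ℝ) (r := r) :=
  ⟨le_rfl, fun _ _ => RB.zero⟩

lemma mul [Fintype κ] {M1 : MF r κ μ} (h : MB D s ρ M C) (h' : MB D s ρ M1 C') :
    MB D s ρ (fun σ ψ => M σ ψ * M1 σ ψ) (Fintype.card κ * (C * C')) := by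
  refine ⟨by have := h.1; have := h'.1; positivity, fun i k => ?_⟩
  have := RB.sum Finset.univ fun j (_ : j ∈ Finset.univ) => (h.2 i j).mul (h'.2 j k)
  rw [Finset.sum_const, Finset.card_univ, nsmul_eq_mul] at this
  exact this

lemma tr (h : MB D s ρ M C) : MB D s ρ (fun σ ψ => (M σ ψ).transpose) C :=
  ⟨h.1, fun i k => h.2 k i⟩

lemma smulL {c : ℝ → ℝ} {K : ℝ} (h : MB D s ρ M C) (hc : LR D s c K) (hK : 0 ≤ K) :
    MB D s ρ (fun σ ψ => c σ • M σ ψ) (K * C) :=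
  ⟨mul_nonneg hK h.1, fun i k => (RB.ofLR hc hK).mul (h.2 i k)⟩

lemma csmul (h : MB D s ρ M C) (c : ℝ) : MB D s ρ (fun σ ψ => c • M σ ψ) (|c| * C) :=
  h.smulL (LR.const c) (abs_nonneg c)

lemma one [DecidableEq ι] : MB D s ρ (fun _ _ => (1 : Matrix ι ι ℝ)) (1 : ℝ) (r := r) :=
  ⟨zero_le_one, fun i k => (RB.const _).mono (by
    rw [Matrix.one_apply]; split_ifs <;> simp)⟩

lemma ofConst {A : ℝ → Matrix ι κ ℝ} (hC : 0 ≤ C) (h : ∀ i k, LR D s (fun σ => A σ i k) C) :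
    MB D s ρ (fun σ _ => A σ) C (r := r) :=
  ⟨hC, fun i k => RB.ofLR (h i k) hC⟩

lemma addQ {Q X : ℝ} {m n k : ℕ} (hQ : 2 ≤ Q) (hX : 0 ≤ X) (h : MB D s ρ M (Q ^ m * X))
    (h' : MB D s ρ M1 (Q ^ n * X)) (hm : m + 1 ≤ k) (hn : n + 1 ≤ k) :
    MB D s ρ (fun σ ψ => M σ ψ + M1 σ ψ) (Q ^ k * X) := by
  refine (h.add h').mono ?_
  have e1 : Q ^ m * 2 ≤ Q ^ k := (mul_le_mul_of_nonneg_left hQ (by positivity)).trans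
    (by rw [← pow_succ]; exact pow_le_pow_right₀ (by linarith) hm)
  have e2 : Q ^ n * 2 ≤ Q ^ k := (mul_le_mul_of_nonneg_left hQ (by positivity)).trans
    (by rw [← pow_succ]; exact pow_le_pow_right₀ (by linarith) hn)
  nlinarith

lemma subQ {Q X : ℝ} {m n k : ℕ} (hQ : 2 ≤ Q) (hX : 0 ≤ X) (h : MB D s ρ M (Q ^ m * X))
    (h' : MB D s ρ M1 (Q ^ n * X)) (hm : m + 1 ≤ k) (hn : n + 1 ≤ k) :
    MB D s ρ (fun σ ψ => M σ ψ - M1 σ ψ) (Q ^ k * X) := by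
  simpa only [sub_eq_add_neg] using h.addQ hQ hX h'.neg hm hn

lemma upQ {Q X Y : ℝ} {m k : ℕ} (h : MB D s ρ M (Q ^ m * X)) (hQ : 2 ≤ Q) (hm : m ≤ k)
    (hX : 0 ≤ X) (hXY : X ≤ Y) : MB D s ρ M (Q ^ k * Y) := by
  refine h.mono ?_
  have : 0 ≤ Q := by linarith
  gcongr
  linarith

lemma mulQ [Fintype κ] {M1 : MF r κ μ} {Q X Y Z : ℝ} {m n k : ℕ} (h : MB D s ρ M (Q ^ m * X))
    (h' : MB D s ρ M1 (Q ^ n * Y)) (hQ : 2 ≤ Q) (hκ : (Fintype.card κ : ℝ) ≤ Q) (hX : 0 ≤ X)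
    (hY : 0 ≤ Y) (hk : m + n + 1 ≤ k) (hZ : X * Y ≤ Z) :
    MB D s ρ (fun σ ψ => M σ ψ * M1 σ ψ) (Q ^ k * Z) := by
  refine (h.mul h').mono ?_
  have h0 : 0 ≤ Q := by linarith
  calc (Fintype.card κ : ℝ) * (Q ^ m * X * (Q ^ n * Y)) ≤ Q * (Q ^ m * X * (Q ^ n * Y)) := by
        gcongr
    _ = Q ^ (m + n + 1) * (X * Y) := by ring
    _ ≤ Q ^ k * Z := by gcongr; linarith

lemma deriv (h : MB D s ρ M C) {ρ' δ V : ℝ} (h0 : 0 ≤ ρ') (hδ : 0 < δ) (hρ : ρ' + δ ≤ ρ)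
    (hV : ∀ k, |v k| ≤ V) (hV0 : 0 ≤ V) : ∃ M', HM D v M M' ∧ MB D s ρ' M' (V / δ * C) := by
  choose f hf hf' using fun i k => (h.2 i k).deriv h0 hδ hρ hV hV0
  exact ⟨fun σ ψ i k => f i k σ ψ, hf, by have := h.1; positivity, hf'⟩

lemma deriv_bd (h : MB D s ρ M C) {ρ' δ V : ℝ} (h0 : 0 ≤ ρ') (hδ : 0 < δ) (hρ : ρ' + δ ≤ ρ)
    (hV : ∀ k, |v k| ≤ V) (hV0 : 0 ≤ V) (hd : HM D v M M1) : MB D s ρ' M1 (V / δ * C) :=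
  ⟨by have := h.1; positivity, fun i k => (h.2 i k).deriv_bd h0 hδ hρ hV hV0 (hd i k)⟩

end MB

namespace HM

variable {M' M1' : MF r ι κ}

lemma congr (h : HM D v M M') (h1 : ∀ σ ∈ D, ∀ ψ, M1 σ ψ = M σ ψ)
    (h2 : ∀ σ ∈ D, ∀ ψ, M1' σ ψ = M' σ ψ) : HM D v M1 M1' := fun i k =>
  (h i k).congr (fun σ hσ ψ => by rw [h1 σ hσ ψ]) (fun σ hσ ψ => by rw [h2 σ hσ ψ])

lemma congr' (h : HM D v M M') (h2 : ∀ σ ∈ D, ∀ ψ, M1' σ ψ = M' σ ψ) : HM D v M M1' :=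
  h.congr (fun _ _ _ => rfl) h2

lemma unique (h : HM D v M M') (h' : HM D v M M1') {σ : ℝ} (hσ : σ ∈ D) (ψ) :
    M' σ ψ = M1' σ ψ := by
  ext i k; exact (h i k).unique (h' i k) hσ ψ

lemma mono_set {D' : Set ℝ} (h : HM D v M M') (hD : D' ⊆ D) : HM D' v M M' :=
  fun i k => (h i k).mono_set hD

lemma add (h : HM D v M M') (h' : HM D v M1 M1') :
    HM D v (fun σ ψ => M σ ψ + M1 σ ψ) (fun σ ψ => M' σ ψ + M1' σ ψ) :=
  fun i k => (h i k).add (h' i k)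

lemma sub (h : HM D v M M') (h' : HM D v M1 M1') :
    HM D v (fun σ ψ => M σ ψ - M1 σ ψ) (fun σ ψ => M' σ ψ - M1' σ ψ) :=
  fun i k => (h i k).sub (h' i k)

lemma neg (h : HM D v M M') : HM D v (fun σ ψ => -M σ ψ) (fun σ ψ => -M' σ ψ) :=
  fun i k => (h i k).neg

lemma tr (h : HM D v M M') :
    HM D v (fun σ ψ => (M σ ψ).transpose) (fun σ ψ => (M' σ ψ).transpose) :=
  fun i k => h k i

lemma const (A : ℝ → Matrix ι κ ℝ) : HM D v (fun σ (_ : Fin r → ℝ) => A σ) (fun _ _ => 0) :=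
  fun i k => HL.const fun σ => A σ i k

lemma mul [Fintype κ] {N N' : MF r κ μ} (h : HM D v M M') (h' : HM D v N N') :
    HM D v (fun σ ψ => M σ ψ * N σ ψ) (fun σ ψ => M' σ ψ * N σ ψ + M σ ψ * N' σ ψ) :=
  fun i k => (HL.sum Finset.univ fun j _ => (h i j).mul (h' j k)).congr
    (fun σ _ ψ => Matrix.mul_apply) fun σ _ ψ => by
      beta_reduce
      rw [Matrix.add_apply, Matrix.mul_apply, Matrix.mul_apply, ← Finset.sum_add_distrib]

lemma csmul (c : ℝ → ℝ) (h : HM D v M M') :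
    HM D v (fun σ ψ => c σ • M σ ψ) (fun σ ψ => c σ • M' σ ψ) := fun i k =>
  ((HL.const c).mul (h i k)).congr (fun _ _ _ => rfl) fun σ _ ψ => by simp

end HM

lemma MB.neumann [Fintype ι] [DecidableEq ι] {M : MF r ι ι} (h : MB D s ρ M C)
    (hC : Fintype.card ι * C ≤ 1 / 2) :
    ∃ Y : MF r ι ι, (∀ σ ∈ D, ∀ ψ, (1 - M σ ψ) * Y σ ψ = 1) ∧
      MB D s ρ (fun σ ψ => Y σ ψ - 1) (2 * C) := by
  have hC0 := h.1
  have hp : ∀ n : ℕ, MB D s ρ (fun σ ψ => M σ ψ ^ (n + 1)) ((1 / 2) ^ n * C) := by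
    intro n
    induction n with
    | zero => simpa using h
    | succ n ih =>
      simp only [pow_succ _ (n + 1)]
      refine (ih.mul h).mono ?_
      calc (Fintype.card ι : ℝ) * ((1 / 2) ^ n * C * C) = (Fintype.card ι * C) * ((1 / 2) ^ n * C) := by
            ring
        _ ≤ 1 / 2 * ((1 / 2) ^ n * C) := by gcongr
        _ = _ := by ring
  have hsum : ∀ σ ∈ D, ∀ ψ i k, Summable fun n : ℕ => (M σ ψ ^ (n + 1)) i k := by
    intro σ hσ ψ i k
    refine Summable.of_norm_bounded (summable_geometric_two.mul_right C) fun n => ?_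
    exact ((hp n).2 i k).abs_le hσ ψ
  refine ⟨fun σ ψ => 1 + Matrix.of fun i k => ∑' n : ℕ, (M σ ψ ^ (n + 1)) i k,
    fun σ hσ ψ => ?_, by positivity, fun i k => ?_⟩
  · set Z : Matrix ι ι ℝ := Matrix.of fun i k => ∑' n : ℕ, (M σ ψ ^ (n + 1)) i k with hZ
    have hz : Z = M σ ψ + M σ ψ * Z := by
      ext i k
      rw [Matrix.add_apply, Matrix.mul_apply]
      have h1 : HasSum (fun n : ℕ => (M σ ψ ^ (n + 1 + 1)) i k) (∑ j, M σ ψ i j * Z j k) := by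
        have := hasSum_sum fun j (_ : j ∈ Finset.univ) =>
          ((hsum σ hσ ψ j k).hasSum).mul_left (M σ ψ i j)
        refine this.congr_fun ?_ 
        intro n
        rw [pow_succ' _ (n + 1), Matrix.mul_apply]
      have h2 := (hsum σ hσ ψ i k).tsum_eq_zero_add
      rw [h1.tsum_eq] at h2
      rw [hZ, Matrix.of_apply, h2, ← hZ]
      simp
    rw [sub_mul, one_mul, mul_add, mul_one, ← hz, add_sub_cancel_right]
  · simp only [add_sub_cancel_left, Matrix.of_apply]
    have hg : HasSum (fun n : ℕ => (1 / 2 : ℝ) ^ n * C) (2 * C) := hasSum_geometric_two.mul_right C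
    exact RB.tsum (fun n => (hp n).2 i k) hg fun σ hσ ψ => (hsum σ hσ ψ i k).hasSum

end MBs

end KAM


open MeasureTheory Real Filter

set_option linter.unusedSimpArgs false

namespace KAM

abbrev II (r l : ℕ) := JJ r l ⊕ JJ r l

section alg

variable {R : Type*} [Ring R]

lemma cayley_alg {Y Yp K K' B E dB P A Ap Eh : R} (hY : (1 - K) * Y = 1) (hY' : Y * (1 - K) = 1)
    (hYp : (1 + K) * Yp = 1) (hA : Ap * P = A * P + P * (Eh - E)) :
    (A * P - P * B + P * Eh) * (Y + Y - 1) + P * (Y * K' * Y + Y * K' * Y) =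
      Ap * (P * (Y + Y - 1)) - P * (Y + Y - 1) * (B + dB) + P * (Y + Y - 1) *
      (Yp * (K' + K' - B * (K + K) + (K + K) * B + E + dB + (K * dB - dB * K) + (E * K - K * E)
        - K * (dB + E) * K) * Y) := by
  set W := K' + K' - B * (K + K) + (K + K) * B + E + dB + (K * dB - dB * K) + (E * K - K * E)
        - K * (dB + E) * K with hW
  have h1 : Y + Y - 1 = Y * (1 + K) := by
    have : Y * (1 + K) = Y + Y - Y * (1 - K) := by noncomm_ring
    rw [this, hY']
  have h2 : (1 + K) * Y = Y + Y - 1 := by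
    have : (1 + K) * Y = Y + Y - (1 - K) * Y := by noncomm_ring
    rw [this, hY]
  have h3 : (Y + Y - 1) * Yp = Y := by rw [h1, mul_assoc, hYp, mul_one]
  have h4 : P * (Y + Y - 1) * (Yp * W * Y) = P * (Y * W * Y) := by
    rw [mul_assoc, ← mul_assoc (Y + Y - 1), ← mul_assoc (Y + Y - 1), h3]
  rw [h4, ← mul_assoc Ap, hA]
  have h5 : W = (K' + K') + (1 - K) * (E - B) * (1 + K) + (1 + K) * (B + dB) * (1 - K) := by
    rw [hW]; noncomm_ring
  have h6 : Y * W * Y = Y * (K' + K') * Y + (E - B) * (Y + Y - 1) + (Y + Y - 1) * (B + dB) := by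
    rw [h5]
    calc _ = Y * (K' + K') * Y + (Y * (1 - K)) * (E - B) * ((1 + K) * Y)
        + (Y * (1 + K)) * (B + dB) * ((1 - K) * Y) := by noncomm_ring
      _ = _ := by rw [hY', hY, h2, ← h1, one_mul, mul_one]
  rw [h6]; noncomm_ring

end alg

section symp

variable {r l : ℕ}

def Jm (r l : ℕ) : Matrix (II r l) (II r l) ℝ := Matrix.fromBlocks 0 1 (-1) 0

lemma Jm_sq : Jm r l * Jm r l = -1 := by
  rw [Jm, Matrix.fromBlocks_multiply]
  conv_rhs => rw [← Matrix.fromBlocks_one, Matrix.fromBlocks_neg]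
  simp only [mul_one, mul_zero, zero_mul, zero_add, add_zero, one_mul, neg_zero]

lemma Jm_tr : (Jm r l).transpose = -Jm r l := by
  rw [Jm, Matrix.fromBlocks_transpose, Matrix.fromBlocks_neg]; simp

lemma Jm_inl {κ : Type} (M : Matrix (II r l) κ ℝ) (j k) : (Jm r l * M) (Sum.inl j) k = M (Sum.inr j) k := by
  simp [Jm, Matrix.mul_apply, Fintype.sum_sum_type, Matrix.one_apply]

lemma Jm_inr {κ : Type} (M : Matrix (II r l) κ ℝ) (j k) : (Jm r l * M) (Sum.inr j) k = -M (Sum.inl j) k := by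
  simp [Jm, Matrix.mul_apply, Fintype.sum_sum_type, Matrix.one_apply]

lemma mul_Jm {κ : Type} (M : Matrix κ (II r l) ℝ) : M * Jm r l = -((Jm r l * M.transpose).transpose) := by
  rw [Matrix.transpose_mul, Matrix.transpose_transpose, Jm_tr, Matrix.mul_neg, neg_neg]

def Sp (A : Matrix (II r l) (II r l) ℝ) : Prop := A.transpose * Jm r l + Jm r l * A = 0

def pin (P : Matrix (II r l) (II r l) ℝ) : Matrix (II r l) (II r l) ℝ := -(Jm r l * P.transpose * Jm r l)

lemma pin_mul {P : Matrix (II r l) (II r l) ℝ} (h : P.transpose * Jm r l * P = Jm r l) : pin P * P = 1 := by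
  have : pin P * P = -(Jm r l * (P.transpose * Jm r l * P)) := by unfold pin; noncomm_ring
  rw [this, h, Jm_sq, neg_neg]

lemma mul_pin {P : Matrix (II r l) (II r l) ℝ} (h : P.transpose * Jm r l * P = Jm r l) : P * pin P = 1 :=
  mul_eq_one_comm.mp (pin_mul h)

lemma Sp.tr {A : Matrix (II r l) (II r l) ℝ} (h : Sp A) : A.transpose * Jm r l = -(Jm r l * A) :=
  eq_neg_of_add_eq_zero_left h

lemma Sp.jm {A : Matrix (II r l) (II r l) ℝ} (h : Sp A) : A.transpose = Jm r l * A * Jm r l := by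
  have := congrArg (fun X => -(X * Jm r l)) h.tr
  simpa [mul_assoc, Jm_sq] using this

noncomputable def spp (A : Matrix (II r l) (II r l) ℝ) : Matrix (II r l) (II r l) ℝ :=
  (1 / 2 : ℝ) • (A + Jm r l * A.transpose * Jm r l)

lemma spp_sp (A : Matrix (II r l) (II r l) ℝ) : Sp (spp A) := by
  unfold Sp spp
  simp only [Matrix.transpose_smul, Matrix.transpose_add, Matrix.transpose_mul, Jm_tr,
    Matrix.transpose_transpose, Matrix.smul_mul, Matrix.mul_smul, ← smul_add]
  have e : Jm r l * (Jm r l * A.transpose * Jm r l) = - (A.transpose * Jm r l) := by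
    rw [← mul_assoc, ← mul_assoc, Jm_sq]; simp
  have e2 : -Jm r l * (A * -Jm r l) * Jm r l = -(Jm r l * A) := by
    rw [mul_neg, neg_mul_neg, mul_assoc, mul_assoc, Jm_sq]; simp
  rw [add_mul, mul_add, e, e2]
  simp

lemma spp_of {A : Matrix (II r l) (II r l) ℝ} (h : Sp A) : spp A = A := by
  unfold spp
  rw [h.jm]
  have : Jm r l * (Jm r l * A * Jm r l) * Jm r l = A := by
    rw [← mul_assoc, ← mul_assoc, Jm_sq, mul_assoc, Jm_sq]; simp
  rw [this, ← two_smul ℝ A, smul_smul]; norm_num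

lemma spp_add (A A' : Matrix (II r l) (II r l) ℝ) : spp (A + A') = spp A + spp A' := by
  unfold spp
  rw [Matrix.transpose_add, ← smul_add]
  congr 1; noncomm_ring

lemma spp_neg (A : Matrix (II r l) (II r l) ℝ) : spp (-A) = -spp A := by
  unfold spp
  rw [Matrix.transpose_neg, ← smul_neg]
  congr 1; noncomm_ring

lemma spp_comm {B A : Matrix (II r l) (II r l) ℝ} (h : Sp B) :
    spp (B * A - A * B) = B * spp A - spp A * B := by
  unfold spp
  rw [Matrix.mul_smul, Matrix.smul_mul, ← smul_sub]
  congr 1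
  rw [Matrix.transpose_sub, Matrix.transpose_mul, Matrix.transpose_mul, h.jm]
  have e : Jm r l * (A.transpose * (Jm r l * B * Jm r l) - Jm r l * B * Jm r l * A.transpose) * Jm r l =
    Jm r l * A.transpose * Jm r l * B * (Jm r l * Jm r l) - (Jm r l * Jm r l) * B * (Jm r l * A.transpose * Jm r l) := by noncomm_ring
  rw [e, Jm_sq]; noncomm_ring

lemma cayley_sp {K Y : Matrix (II r l) (II r l) ℝ} (h : Sp K) (hY : (1 - K) * Y = 1) :
    (Y + Y - 1).transpose * Jm r l * (Y + Y - 1) = Jm r l := by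
  have h2 : (1 + K) * Y = Y + Y - 1 := by
    have : (1 + K) * Y = Y + Y - (1 - K) * Y := by noncomm_ring
    rw [this, hY]
  have e1 : (1 + K).transpose * Jm r l = Jm r l * (1 - K) := by
    rw [Matrix.transpose_add, Matrix.transpose_one, add_mul, h.tr]; noncomm_ring
  have e2 : (1 - K).transpose * Jm r l = Jm r l * (1 + K) := by
    rw [Matrix.transpose_sub, Matrix.transpose_one, sub_mul, h.tr]; noncomm_ring
  rw [← h2, Matrix.transpose_mul]
  calc _ = Y.transpose * ((1 + K).transpose * Jm r l) * ((1 + K) * Y) := by noncomm_ring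
    _ = Y.transpose * (Jm r l * (1 + K)) * ((1 - K) * Y) := by rw [e1]; noncomm_ring
    _ = ((1 - K) * Y).transpose * Jm r l := by
      rw [hY, mul_one, ← e2, ← mul_assoc, ← Matrix.transpose_mul, hY]
    _ = _ := by rw [hY]; simp

def BB (r : ℕ) {l : ℕ} (w : Fin l → ℝ → ℝ) (σ : ℝ) : Matrix (II r l) (II r l) ℝ :=
  Matrix.fromBlocks 0 (Matrix.diagonal (Sum.elim (fun _ => σ) fun j => σ * w j σ))
    (Matrix.diagonal (Sum.elim (fun _ => 0) fun j => -(σ * w j σ))) 0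

variable {w : Fin l → ℝ → ℝ} {σ : ℝ} {κ : Type}

lemma BB_sp : Sp (BB r w σ) := by
  unfold Sp BB Jm
  rw [Matrix.fromBlocks_transpose, Matrix.fromBlocks_multiply, Matrix.fromBlocks_multiply,
    Matrix.fromBlocks_add]
  simp

lemma BB_a (M : Matrix (II r l) κ ℝ) (i k) :
    (BB r w σ * M) (Sum.inl (Sum.inl i)) k = σ * M (Sum.inr (Sum.inl i)) k := by
  simp [BB, Matrix.mul_apply, Fintype.sum_sum_type, Matrix.diagonal_apply]

lemma BB_b (M : Matrix (II r l) κ ℝ) (i k) :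
    (BB r w σ * M) (Sum.inl (Sum.inr i)) k = σ * w i σ * M (Sum.inr (Sum.inr i)) k := by
  simp [BB, Matrix.mul_apply, Fintype.sum_sum_type, Matrix.diagonal_apply]

lemma BB_e (M : Matrix (II r l) κ ℝ) (i k) :
    (BB r w σ * M) (Sum.inr (Sum.inl i)) k = 0 := by
  simp [BB, Matrix.mul_apply, Fintype.sum_sum_type, Matrix.diagonal_apply]

lemma BB_p (M : Matrix (II r l) κ ℝ) (i k) :
    (BB r w σ * M) (Sum.inr (Sum.inr i)) k = -(σ * w i σ) * M (Sum.inl (Sum.inr i)) k := by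
  simp [BB, Matrix.mul_apply, Fintype.sum_sum_type, Matrix.diagonal_apply]

lemma mBB_a (M : Matrix κ (II r l) ℝ) (i k) :
    (M * BB r w σ) k (Sum.inl (Sum.inl i)) = 0 := by
  simp [BB, Matrix.mul_apply, Fintype.sum_sum_type, Matrix.diagonal_apply]

lemma mBB_b (M : Matrix κ (II r l) ℝ) (i k) :
    (M * BB r w σ) k (Sum.inl (Sum.inr i)) = -(σ * w i σ) * M k (Sum.inr (Sum.inr i)) := by
  simp [BB, Matrix.mul_apply, Fintype.sum_sum_type, Matrix.diagonal_apply, mul_comm]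

lemma mBB_e (M : Matrix κ (II r l) ℝ) (i k) :
    (M * BB r w σ) k (Sum.inr (Sum.inl i)) = σ * M k (Sum.inl (Sum.inl i)) := by
  simp [BB, Matrix.mul_apply, Fintype.sum_sum_type, Matrix.diagonal_apply, mul_comm]

lemma mBB_p (M : Matrix κ (II r l) ℝ) (i k) :
    (M * BB r w σ) k (Sum.inr (Sum.inr i)) = σ * w i σ * M k (Sum.inl (Sum.inr i)) := by
  simp [BB, Matrix.mul_apply, Fintype.sum_sum_type, Matrix.diagonal_apply, mul_comm]

end symp

section sympMB

variable {r l : ℕ} {κ : Type} {D : Set ℝ} {s ρ C : ℝ} {v : Fin r → ℝ}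

lemma MB.jm {M : MF r (II r l) κ} (h : MB D s ρ M C) : MB D s ρ (fun σ ψ => Jm r l * M σ ψ) C := by
  refine ⟨h.1, fun i k => ?_⟩
  rcases i with j | j
  · exact (h.2 (Sum.inr j) k).congr fun σ _ ψ => Jm_inl _ _ _
  · exact (h.2 (Sum.inl j) k).neg.congr fun σ _ ψ => Jm_inr _ _ _

lemma MB.mjm {M : MF r κ (II r l)} (h : MB D s ρ M C) : MB D s ρ (fun σ ψ => M σ ψ * Jm r l) C :=
  h.tr.jm.tr.neg.congr fun _ _ _ => mul_Jm _

lemma MB.pin {M : MF r (II r l) (II r l)} (h : MB D s ρ M C) : MB D s ρ (fun σ ψ => pin (M σ ψ)) C :=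
  h.tr.jm.mjm.neg

lemma MB.spp {M : MF r (II r l) (II r l)} (h : MB D s ρ M C) : MB D s ρ (fun σ ψ => spp (M σ ψ)) C :=
  ((h.add h.tr.jm.mjm).csmul (1 / 2)).mono (le_of_eq (by rw [abs_of_pos (by norm_num)]; ring))

lemma HM.jm {M M' : MF r (II r l) κ} (h : HM D v M M') :
    HM D v (fun σ ψ => Jm r l * M σ ψ) (fun σ ψ => Jm r l * M' σ ψ) :=
  ((HM.const fun _ => (Jm r l)).mul h).congr' fun σ _ ψ => by simp

lemma HM.mjm {M M' : MF r κ (II r l)} (h : HM D v M M') :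
    HM D v (fun σ ψ => M σ ψ * Jm r l) (fun σ ψ => M' σ ψ * Jm r l) :=
  (h.mul (HM.const fun _ => (Jm r l))).congr' fun σ _ ψ => by simp

lemma HM.spp {M M' : MF r (II r l) (II r l)} (h : HM D v M M') :
    HM D v (fun σ ψ => spp (M σ ψ)) (fun σ ψ => spp (M' σ ψ)) :=
  (h.add h.tr.jm.mjm).csmul fun _ => 1 / 2

variable {P A B E : MF r (II r l) (II r l)}

lemma pin_deriv (hP : ∀ σ ∈ D, ∀ ψ, (P σ ψ).transpose * Jm r l * P σ ψ = Jm r l)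
    (hd : HM D v P (fun σ ψ => A σ ψ * P σ ψ - P σ ψ * B σ ψ + P σ ψ * E σ ψ)) :
    HM D v (fun σ ψ => pin (P σ ψ))
      (fun σ ψ => -(pin (P σ ψ) * A σ ψ) + B σ ψ * pin (P σ ψ) - E σ ψ * pin (P σ ψ)) := by
  have h1 := hd.tr.jm.mjm.neg
  refine h1.congr' fun σ hσ ψ => ?_
  have h2 := (h1.mul hd).unique ((HM.const (D := D) (v := v) fun _ => (1 : Matrix (II r l) (II r l) ℝ)).congr
    (fun σ hσ ψ => pin_mul (hP σ hσ ψ)) fun _ _ _ => rfl) hσ ψ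
  have h3 := congrArg (· * pin (P σ ψ)) h2
  beta_reduce at h3
  rw [zero_mul, add_mul, mul_assoc _ (P σ ψ), mul_pin (hP σ hσ ψ), mul_one] at h3
  have h4 := eq_neg_of_add_eq_zero_left h3
  rw [h4]
  change _ = -(pin (P σ ψ) * _ * _)
  rw [mul_assoc]
  have e := pin_mul (hP σ hσ ψ)
  have e' := mul_pin (hP σ hσ ψ)
  have : pin (P σ ψ) * ((A σ ψ * P σ ψ - P σ ψ * B σ ψ + P σ ψ * E σ ψ) * pin (P σ ψ)) =
    pin (P σ ψ) * A σ ψ * (P σ ψ * pin (P σ ψ)) - (pin (P σ ψ) * P σ ψ) * B σ ψ * pin (P σ ψ)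
      + (pin (P σ ψ) * P σ ψ) * E σ ψ * pin (P σ ψ) := by noncomm_ring
  rw [this, e, e']; noncomm_ring

lemma sp_of_frame (hP : ∀ σ ∈ D, ∀ ψ, (P σ ψ).transpose * Jm r l * P σ ψ = Jm r l)
    (hd : HM D v P (fun σ ψ => A σ ψ * P σ ψ - P σ ψ * B σ ψ + P σ ψ * E σ ψ))
    (hA : ∀ σ ∈ D, ∀ ψ, Sp (A σ ψ)) (hB : ∀ σ ∈ D, ∀ ψ, Sp (B σ ψ)) {σ : ℝ} (hσ : σ ∈ D) (ψ) :
    Sp (E σ ψ) := by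
  have h2 := (hd.tr.mjm.mul hd).unique ((HM.const (D := D) (v := v) fun _ =>
    Jm r l).congr (fun σ hσ ψ => hP σ hσ ψ) fun _ _ _ => rfl) hσ ψ
  have a1 := (hA σ hσ ψ).tr
  have b1 := (hB σ hσ ψ).tr
  have p1 := hP σ hσ ψ
  simp only [Matrix.transpose_add, Matrix.transpose_sub, Matrix.transpose_mul] at h2
  unfold Sp
  have : ((P σ ψ).transpose * (A σ ψ).transpose - (B σ ψ).transpose * (P σ ψ).transpose +
      (E σ ψ).transpose * (P σ ψ).transpose) * Jm r l * P σ ψ + (P σ ψ).transpose * Jm r l *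
      (A σ ψ * P σ ψ - P σ ψ * B σ ψ + P σ ψ * E σ ψ) =
      (P σ ψ).transpose * ((A σ ψ).transpose * Jm r l) * P σ ψ + (P σ ψ).transpose * (Jm r l * A σ ψ) * P σ ψ
      - (B σ ψ).transpose * ((P σ ψ).transpose * Jm r l * P σ ψ) - ((P σ ψ).transpose * Jm r l * P σ ψ) * B σ ψ
      + (E σ ψ).transpose * ((P σ ψ).transpose * Jm r l * P σ ψ)
      + ((P σ ψ).transpose * Jm r l * P σ ψ) * E σ ψ := by noncomm_ring
  rw [this, p1, a1, b1] at h2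
  rw [← h2]; noncomm_ring

lemma cayley {K K' E' dB Ap : MF r (II r l) (II r l)}
    (hP : ∀ σ ∈ D, ∀ ψ, (P σ ψ).transpose * Jm r l * P σ ψ = Jm r l)
    (hd : HM D v P (fun σ ψ => A σ ψ * P σ ψ - P σ ψ * B σ ψ + P σ ψ * E σ ψ))
    (hK : MB D s ρ K C) (hKd : HM D v K K') (hKs : ∀ σ ∈ D, ∀ ψ, Sp (K σ ψ))
    (hC : Fintype.card (II r l) * C ≤ 1 / 2) (hρ : 0 < ρ)
    (hA : ∀ σ ∈ D, ∀ ψ, Ap σ ψ * P σ ψ = A σ ψ * P σ ψ + P σ ψ * (E σ ψ - E' σ ψ)) :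
    ∃ Y Yp : MF r (II r l) (II r l), MB D s ρ (fun σ ψ => Y σ ψ - 1) (2 * C) ∧
      MB D s ρ (fun σ ψ => Yp σ ψ - 1) (2 * C) ∧
      (∀ σ ∈ D, ∀ ψ, (P σ ψ * (Y σ ψ + Y σ ψ - 1)).transpose * Jm r l *
        (P σ ψ * (Y σ ψ + Y σ ψ - 1)) = Jm r l) ∧
      HM D v (fun σ ψ => P σ ψ * (Y σ ψ + Y σ ψ - 1)) (fun σ ψ =>
        Ap σ ψ * (P σ ψ * (Y σ ψ + Y σ ψ - 1)) - P σ ψ * (Y σ ψ + Y σ ψ - 1) * (B σ ψ + dB σ ψ)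
        + P σ ψ * (Y σ ψ + Y σ ψ - 1) * (Yp σ ψ * (K' σ ψ + K' σ ψ - B σ ψ * (K σ ψ + K σ ψ)
          + (K σ ψ + K σ ψ) * B σ ψ + E' σ ψ + dB σ ψ + (K σ ψ * dB σ ψ - dB σ ψ * K σ ψ)
          + (E' σ ψ * K σ ψ - K σ ψ * E' σ ψ) - K σ ψ * (dB σ ψ + E' σ ψ) * K σ ψ) * Y σ ψ)) := by
  obtain ⟨Y, hY, hYb⟩ := hK.neumann hC
  obtain ⟨Yp, hYp, hYpb⟩ := hK.neg.neumann hC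
  have hY2 : ∀ σ ∈ D, ∀ ψ, Y σ ψ * (1 - K σ ψ) = 1 := fun σ hσ ψ =>
    mul_eq_one_comm.mp (hY σ hσ ψ)
  refine ⟨Y, Yp, hYb, hYpb, fun σ hσ ψ => ?_, ?_⟩
  · have := cayley_sp (hKs σ hσ ψ) (hY σ hσ ψ)
    rw [Matrix.transpose_mul]
    calc _ = (Y σ ψ + Y σ ψ - 1).transpose * ((P σ ψ).transpose * Jm r l * P σ ψ)
        * (Y σ ψ + Y σ ψ - 1) := by noncomm_ring
      _ = _ := by rw [hP σ hσ ψ, this]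
  · obtain ⟨V, hV0, hV⟩ := exV v
    obtain ⟨Z, hZ, -⟩ := hYb.deriv (ρ' := 0) le_rfl hρ (by simp) hV hV0
    have hZ' : HM D v Y Z := (hZ.add (HM.const fun _ => 1)).congr (fun _ _ _ => by simp)
      fun _ _ _ => by simp
    have hYd : HM D v Y (fun σ ψ => Y σ ψ * K' σ ψ * Y σ ψ) := by
      refine hZ'.congr' fun σ hσ ψ => ?_
      have h2 := (((HM.const (D := D) (v := v) fun _ => (1 : Matrix (II r l) (II r l) ℝ)).sub
        hKd).mul hZ').unique ((HM.const (D := D) (v := v) fun _ =>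
        (1 : Matrix (II r l) (II r l) ℝ)).congr (fun σ hσ ψ => hY σ hσ ψ) fun _ _ _ => rfl) hσ ψ
      have h3 := congrArg (Y σ ψ * ·) h2
      beta_reduce at h3
      rw [mul_zero, mul_add, ← mul_assoc _ (1 - K σ ψ), hY2 σ hσ ψ, one_mul] at h3
      rw [eq_neg_of_add_eq_zero_right h3]; noncomm_ring
    refine (hd.mul ((hYd.add hYd).sub (HM.const fun _ => 1))).congr' fun σ hσ ψ => ?_
    have := cayley_alg (K' := K' σ ψ) (B := B σ ψ) (dB := dB σ ψ) (hY σ hσ ψ) (hY2 σ hσ ψ)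
      (Yp := Yp σ ψ) (by simpa using hYp σ hσ ψ) (hA σ hσ ψ)
    rw [← this, sub_zero]

end sympMB

end KAM


open MeasureTheory Real Filter

namespace KAM

def Go {r : ℕ} (ω : Fin r → ℝ) (D : Set ℝ) (s δ Q : ℝ) (θ : ℝ → ℝ) : Prop :=
  SD ω D s θ δ (Q / s) ∧ ∀ σ ∈ D, ∀ ν, dt ν ω - σ * θ σ ≠ 0

abbrev Tl (l : ℕ) := Fin l ⊕ (Fin l × Fin l) ⊕ (Fin l × Fin l)

def th {l : ℕ} (w : Fin l → ℝ → ℝ) : Tl l → ℝ → ℝ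
  | Sum.inl j => fun σ => -w j σ
  | Sum.inr (Sum.inl p) => fun σ => -(w p.1 σ + w p.2 σ)
  | Sum.inr (Sum.inr p) => if p.1 = p.2 then fun σ => -w p.1 σ else fun σ => w p.1 σ - w p.2 σ

structure Cx {r l : ℕ} (ω : Fin r → ℝ) (D : Set ℝ) (s δ Q : ℝ) (w : Fin l → ℝ → ℝ) : Prop where
  s0 : 0 < s
  s1 : s ≤ 1
  Ds : D ⊆ Set.Icc s (2 * s)
  Q8 : 8 ≤ Q
  card : (Fintype.card (II r l) : ℝ) ≤ Q
  d0 : 0 < δ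
  dQ : 1 ≤ Q * δ
  om : ∀ k, |ω k| ≤ Q * δ
  w1 : ∀ j, LR D s (w j) Q
  ne0 : ∀ ν : Fin r → ℤ, ν ≠ 0 → dt ν ω ≠ 0
  sd0 : SD ω D s (fun _ => 0) δ (Q / s)
  go : ∀ t, Go ω D s δ Q (th w t)

section

variable {r l : ℕ} {κ : Type} {ω : Fin r → ℝ} {D : Set ℝ} {s δ Q : ℝ} {w : Fin l → ℝ → ℝ}
  {ρ ρ' Y : ℝ}

namespace Cx

variable (cx : Cx ω D s δ Q w)
include cx

lemma Q0 : 0 ≤ Q := by linarith [cx.Q8]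

lemma Q2 : 2 ≤ Q := by linarith [cx.Q8]

lemma pos {σ : ℝ} (h : σ ∈ D) : 0 < σ := cx.s0.trans_le (cx.Ds h).1

lemma LRs : LR D s (fun σ => σ) (3 * s) := by
  have := LR.of_le (D := D) (s := s) (c := fun σ => σ) (A := 2 * s) (B := s)
    (fun σ h => by rw [abs_of_pos (cx.pos h)]; exact (cx.Ds h).2) cx.s0.le
    (fun σ _ σ' _ => by rw [abs_of_pos cx.s0])
  exact this.mono (by linarith)

lemma LRi : LR D s (fun σ => σ⁻¹) (2 / s) := by
  have := LR.of_le (D := D) (s := s) (c := fun σ => σ⁻¹) (A := 1 / s) (B := 1 / s)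
    (fun σ h => by
      rw [abs_of_pos (inv_pos.mpr (cx.pos h)), inv_eq_one_div]
      exact one_div_le_one_div_of_le cx.s0 (cx.Ds h).1) (by have := cx.s0; positivity)
    (fun σ h σ' h' => by
      have h0 := cx.s0
      have h1 := cx.pos h
      have h2 := cx.pos h'
      have h3 := (cx.Ds h).1
      have h4 := (cx.Ds h').1
      have : σ⁻¹ - σ'⁻¹ = (σ' - σ) / (σ * σ') := by field_simp
      rw [this, abs_of_pos h0, abs_div, abs_of_pos (mul_pos h1 h2), abs_sub_comm, ← mul_div_assoc,
        div_mul_eq_mul_div, one_mul, div_le_div_iff₀ (by positivity) h0]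
      nlinarith [mul_le_mul h3 h4 h0.le h1.le, abs_nonneg (σ - σ')])
  exact this.mono (le_of_eq (by ring))

lemma smul {u : ℝ → (Fin r → ℝ) → ℝ} (h : RB D s ρ u Y) : RB D s ρ (fun σ ψ => σ * u σ ψ) (s * (3 * Y)) :=
  ((RB.ofLR cx.LRs (by have := cx.s0; positivity)).mul h).mono (le_of_eq (by ring))

lemma smulC {u : ℝ → (Fin r → ℝ) → ℂ} (h : Bd D s ρ u Y) :
    Bd D s ρ (fun σ ψ => (σ : ℂ) * u σ ψ) (s * (3 * Y)) :=
  ((Bd.ofLB cx.LRs (by have := cx.s0; positivity)).mul h).mono (le_of_eq (by ring))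

lemma Qs (Y : ℝ) : Q / s * (s * Y) = Q * Y := by have := cx.s0.ne'; field_simp

lemma Qs0 : 0 ≤ Q / s := div_nonneg cx.Q0 cx.s0.le

lemma solN {g : ℝ → (Fin r → ℝ) → ℂ} (hg : Bd D s ρ g (s * Y)) (t : Tl l) {θ : ℝ → ℝ}
    (ht : th w t = θ) (h0 : 0 < ρ') (hρ : ρ' + δ ≤ ρ) :
    ∃ v, Bd D s ρ' v (Q * Y) ∧
      HL D ω v (fun σ ψ => Complex.I * ((σ * θ σ : ℝ) : ℂ) * v σ ψ + g σ ψ) := by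
  subst ht
  have := hg.solveN (cx.go t).1 cx.Qs0 cx.d0.le h0 hρ (cx.go t).2
  rwa [cx.Qs] at this

lemma sol0 {g : ℝ → (Fin r → ℝ) → ℝ} (hg : RB D s ρ g (s * Y)) (h0 : 0 < ρ') (hρ : ρ' + δ ≤ ρ) :
    ∃ v, RB D s ρ' v (Q * Y) ∧ (∀ σ ∈ D, avg (v σ) = 0) ∧
      HL D ω v (fun σ ψ => g σ ψ - avg (g σ)) := by
  have := hg.solve0 cx.sd0 cx.Qs0 cx.d0.le h0 hρ cx.ne0
  rwa [cx.Qs] at this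

lemma solNormal {g g' : ℝ → (Fin r → ℝ) → ℝ} (hg : RB D s ρ g (s * Y)) (hg' : RB D s ρ g' (s * Y))
    (i : Fin l) (h0 : 0 < ρ') (hρ : ρ' + δ ≤ ρ) :
    ∃ b p, RB D s ρ' b (Q * (2 * Y)) ∧ RB D s ρ' p (Q * (2 * Y)) ∧
      HL D ω b (fun σ ψ => σ * w i σ * p σ ψ + g σ ψ) ∧
      HL D ω p (fun σ ψ => -(σ * w i σ) * b σ ψ + g' σ ψ) := by
  have h1 : Bd D s ρ (fun σ ψ => (g σ ψ : ℂ) + Complex.I * g' σ ψ) (s * (2 * Y)) :=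
    (Bd.add hg (Bd.const_mul Complex.I hg')).mono (le_of_eq (by simp; ring))
  obtain ⟨v, hv, hv'⟩ := cx.solN h1 (Sum.inl i) rfl h0 hρ
  refine ⟨_, _, RB.ofRe hv, RB.ofIm hv, hv'.re.congr (fun _ _ _ => rfl) fun σ _ ψ => ?_,
    hv'.im.congr (fun _ _ _ => rfl) fun σ _ ψ => ?_⟩
  · simp [th]
  · simp [th]

end Cx

noncomputable def etaA (g : MF r (II r l) κ) (σ : ℝ) : Matrix (II r l) κ ℝ := fun i k =>
  match i with
  | Sum.inr (Sum.inl i) => avg fun ψ => g σ ψ (Sum.inr (Sum.inl i)) k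
  | _ => 0

lemma Cx.solV0 (cx : Cx ω D s δ Q w) {g : MF r (II r l) κ} (hg : MB D s ρ g (s * Y)) (h0 : 0 < ρ')
    (hρ : ρ' + 2 * δ ≤ ρ) :
    ∃ ξ : MF r (II r l) κ, MB D s ρ' ξ (Q ^ 3 * Y) ∧
      (∀ σ ∈ D, ∀ i k, σ * avg (fun ψ => ξ σ ψ (Sum.inr (Sum.inl i)) k) =
        -avg fun ψ => g σ ψ (Sum.inl (Sum.inl i)) k) ∧
      HM D ω ξ (fun σ ψ => BB r w σ * ξ σ ψ + g σ ψ - etaA g σ) := by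
  have hY : 0 ≤ Y := nonneg_of_mul_nonneg_right (hg.1) cx.s0
  have hd := cx.d0
  have hQ := cx.Q8
  choose e0 he0 hea hed using fun i k => cx.sol0 (ρ' := ρ' + δ) (hg.2 (Sum.inr (Sum.inl i)) k)
    (by linarith) (by linarith)
  let c : Fin r → κ → ℝ → ℝ := fun i k σ => σ⁻¹ * -avg (fun ψ => g σ ψ (Sum.inl (Sum.inl i)) k)
  have hc : ∀ i k, LR D s (c i k) (2 * Y) := fun i k =>
    (cx.LRi.mul (hg.2 (Sum.inl (Sum.inl i)) k).avgLR.neg).mono (le_of_eq (by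
      have := cx.s0.ne'; field_simp))
  let e : Fin r → κ → ℝ → (Fin r → ℝ) → ℝ := fun i k σ ψ => e0 i k σ ψ + c i k σ
  have hcR : ∀ i k, RB D s (ρ' + δ) (fun σ (_ : Fin r → ℝ) => c i k σ) (2 * Y) := fun i k =>
    RB.ofLR (hc i k) (by linarith)
  have he : ∀ i k, RB D s (ρ' + δ) (e i k) (Q * Y + 2 * Y) := fun i k => (he0 i k).add (hcR i k)
  have hem : ∀ i k, ∀ σ ∈ D, σ * avg (e i k σ) = -avg fun ψ => g σ ψ (Sum.inl (Sum.inl i)) k := by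
    intro i k σ hσ
    have := (he0 i k).avg_add (hcR i k) hσ
    change avg (e i k σ) = _ at this
    rw [this, hea i k σ hσ, zero_add, avg_const, ← mul_assoc, mul_inv_cancel₀ (cx.pos hσ).ne', one_mul]
  have hg2 : ∀ i k, RB D s (ρ' + δ) (fun σ ψ => g σ ψ i k) (s * Y) := fun i k =>
    (hg.2 i k).mono_rho (by linarith) (by linarith)
  have hag : ∀ i k, RB D s (ρ' + δ) (fun σ ψ => σ * e i k σ ψ + g σ ψ (Sum.inl (Sum.inl i)) k)
      (s * (3 * (Q * Y + 2 * Y) + Y)) := fun i k =>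
    ((cx.smul (he i k)).add (hg2 (Sum.inl (Sum.inl i)) k)).mono (le_of_eq (by ring))
  choose a ha haa had using fun i k => cx.sol0 (hag i k) h0 le_rfl
  choose b p hb hp hbd hpd using fun i k => cx.solNormal (ρ' := ρ') (hg2 (Sum.inl (Sum.inr i)) k)
    (hg2 (Sum.inr (Sum.inr i)) k) i h0 (by linarith)
  have q1 : Q * Y + 2 * Y ≤ Q ^ 3 * Y := by nlinarith [mul_nonneg hY (sq_nonneg Q), mul_nonneg hY (sq_nonneg (Q-1)), mul_nonneg (mul_nonneg hY (sq_nonneg Q)) (sub_nonneg.2 hQ)]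
  have q2 : Q * (3 * (Q * Y + 2 * Y) + Y) ≤ Q ^ 3 * Y := by
    nlinarith [mul_nonneg hY (sq_nonneg Q), mul_nonneg (mul_nonneg hY (by linarith : 0 ≤ Q)) (sub_nonneg.2 hQ), mul_nonneg (mul_nonneg hY (sq_nonneg Q)) (sub_nonneg.2 hQ)]
  have q3 : Q * (2 * Y) ≤ Q ^ 3 * Y := by
    nlinarith [mul_nonneg hY (by linarith : 0 ≤ Q), mul_nonneg hY (sq_nonneg Q), mul_nonneg (mul_nonneg hY (by linarith : 0 ≤ Q)) (sub_nonneg.2 hQ), mul_nonneg (mul_nonneg hY (sq_nonneg Q)) (sub_nonneg.2 hQ)]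
  refine ⟨fun σ ψ => Matrix.of fun i k => Sum.elim (Sum.elim (fun i => a i k σ ψ)
    (fun i => b i k σ ψ)) (Sum.elim (fun i => e i k σ ψ) (fun i => p i k σ ψ)) i, ⟨by positivity, fun i k => ?_⟩,
    fun σ hσ i k => hem i k σ hσ, fun i k => ?_⟩
  · rcases i with (i | i) | (i | i)
    · exact (ha i k).mono q2
    · exact (hb i k).mono q3
    · exact ((he i k).mono q1).mono_rho h0.le (by linarith)
    · exact (hp i k).mono q3
  · rcases i with (i | i) | (i | i)
    · refine (had i k).congr (fun _ _ _ => rfl) fun σ hσ ψ => ?_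
      beta_reduce
      rw [Matrix.sub_apply, Matrix.add_apply, BB_a]
      have h1 := ((cx.smul (he i k)).avg_add (hg2 (Sum.inl (Sum.inl i)) k) hσ)
      have h2 := hem i k σ hσ
      rw [← RB.avg_mul] at h2
      rw [h1, h2]
      simp [etaA]
    · refine (hbd i k).congr (fun _ _ _ => rfl) fun σ hσ ψ => ?_
      beta_reduce
      rw [Matrix.sub_apply, Matrix.add_apply, BB_b]; simp [etaA]
    · refine ((hed i k).add (HL.const (c i k))).congr (fun _ _ _ => rfl) fun σ hσ ψ => ?_
      beta_reduce
      rw [Matrix.sub_apply, Matrix.add_apply, BB_e]; simp [etaA]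
    · refine (hpd i k).congr (fun _ _ _ => rfl) fun σ hσ ψ => ?_
      beta_reduce
      rw [Matrix.sub_apply, Matrix.add_apply, BB_p]; simp [etaA]

end

end KAM


open MeasureTheory Real Filter

namespace KAM

section

variable {r l : ℕ} {ω : Fin r → ℝ} {D : Set ℝ} {s δ Q : ℝ} {w : Fin l → ℝ → ℝ} {ρ ρ' Y : ℝ}

lemma Cx.solZ (cx : Cx ω D s δ Q w) {G : ℝ → (Fin r → ℝ) → ℂ} (hG : Bd D s ρ G (s * Y)) (h0 : 0 < ρ')
    (hρ : ρ' + δ ≤ ρ) (i j : Fin l) :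
    ∃ z, Bd D s ρ' z (Q * Y) ∧
      HL D ω z (fun σ ψ => Complex.I * ((σ * (w i σ - w j σ) : ℝ) : ℂ) * z σ ψ + G σ ψ -
        if i = j then avg (G σ) else 0) := by
  by_cases h : i = j
  · subst h
    have := hG.solve0 cx.sd0 cx.Qs0 cx.d0.le h0 hρ cx.ne0
    rw [cx.Qs] at this
    obtain ⟨z, hz, -, hz'⟩ := this
    exact ⟨z, hz, hz'.congr (fun _ _ _ => rfl) fun σ _ ψ => by simp⟩
  · obtain ⟨z, hz, hz'⟩ := cx.solN (θ := fun σ => w i σ - w j σ) hG (Sum.inr (Sum.inr (i, j)))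
      (by simp [th, h]) h0 hρ
    exact ⟨z, hz, hz'.congr (fun _ _ _ => rfl) fun σ _ ψ => by simp [h]⟩

noncomputable def mu (g : MF r (II r l) (II r l)) (j : Fin l) (σ : ℝ) : ℝ :=
  avg fun ψ => g σ ψ (Sum.inl (Sum.inr j)) (Sum.inr (Sum.inr j)) -
    g σ ψ (Sum.inr (Sum.inr j)) (Sum.inl (Sum.inr j))

noncomputable def wN (w : Fin l → ℝ → ℝ) (g : MF r (II r l) (II r l)) (j : Fin l) (σ : ℝ) : ℝ :=
  w j σ + σ⁻¹ * (mu g j σ / 2)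

noncomputable def Rm (g : MF r (II r l) (II r l)) (σ : ℝ) : Matrix (II r l) (II r l) ℝ := fun i k =>
  match i, k with
  | Sum.inr (Sum.inl i), Sum.inl (Sum.inl k) => avg fun ψ => g σ ψ (Sum.inr (Sum.inl i)) (Sum.inl (Sum.inl k))
  | Sum.inr (Sum.inl i), Sum.inr (Sum.inl k) =>
    (avg fun ψ => g σ ψ (Sum.inr (Sum.inl i)) (Sum.inr (Sum.inl k))) +
      avg fun ψ => g σ ψ (Sum.inl (Sum.inl i)) (Sum.inl (Sum.inl k))
  | _, _ => 0

lemma Cx.solC (cx : Cx ω D s δ Q w) {g : MF r (II r l) (II r l)} (hg : MB D s ρ g (s * Y)) (h0 : 0 < ρ')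
    (hρ : ρ' + 2 * δ ≤ ρ) (j : Fin l)
    (hgs : ∀ σ ∈ D, ∀ ψ, g σ ψ (Sum.inr (Sum.inr j)) (Sum.inr (Sum.inr j)) =
      -g σ ψ (Sum.inl (Sum.inr j)) (Sum.inl (Sum.inr j))) :
    ∃ b p : MF r (II r l) Unit, MB D s ρ' b (Q ^ 3 * Y) ∧ MB D s ρ' p (Q ^ 3 * Y) ∧
      (∀ i, HL D ω (fun σ ψ => b σ ψ i ()) (fun σ ψ => (BB r w σ * b σ ψ) i () + σ * w j σ * p σ ψ i ()
        + g σ ψ i (Sum.inl (Sum.inr j)) + if i = Sum.inr (Sum.inr j) then mu g j σ / 2 else 0)) ∧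
      ∀ i, HL D ω (fun σ ψ => p σ ψ i ()) (fun σ ψ => (BB r w σ * p σ ψ) i () - σ * w j σ * b σ ψ i ()
        + g σ ψ i (Sum.inr (Sum.inr j)) - if i = Sum.inl (Sum.inr j) then mu g j σ / 2 else 0) := by
  have hY : 0 ≤ Y := nonneg_of_mul_nonneg_right (hg.1) cx.s0
  have hd := cx.d0
  have hQ := cx.Q8
  let G : II r l → ℝ → (Fin r → ℝ) → ℂ := fun i σ ψ =>
    (g σ ψ i (Sum.inl (Sum.inr j)) : ℂ) + Complex.I * g σ ψ i (Sum.inr (Sum.inr j))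
  have hG : ∀ i, Bd D s (ρ' + δ + δ) (G i) (s * (2 * Y)) := fun i =>
    ((Bd.add (hg.2 i _) (Bd.const_mul Complex.I (hg.2 i _))).mono (le_of_eq (by simp; ring))).mono_rho
      (by linarith) (by linarith)
  choose e he hed using fun i : Fin r => cx.solN (ρ' := ρ' + δ) (hG (Sum.inr (Sum.inl i))) (Sum.inl j) rfl
    (by linarith) (by linarith)
  choose a ha had using fun i : Fin r => cx.solN (ρ' := ρ') (Y := 3 * (Q * (2 * Y)) + 2 * Y)
    (((cx.smulC (he i)).add ((hG (Sum.inl (Sum.inl i))).mono_rho (by linarith) (by linarith))).mono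
      (le_of_eq (by ring))) (Sum.inl j) rfl h0 (by linarith)
  have hG1 : ∀ i, Bd D s (ρ' + δ) (G i) (s * (2 * Y)) := fun i =>
    (hG i).mono_rho (by linarith) (by linarith)
  choose z hz hzd using fun i : Fin l => cx.solN (ρ' := ρ') (Y := 4 * Y)
    ((Bd.add (hG1 (Sum.inl (Sum.inr i))) (Bd.const_mul Complex.I (hG1 (Sum.inr (Sum.inr i))))).mono
      (le_of_eq (by simp; ring))) (Sum.inr (Sum.inl (i, j))) rfl h0 (by linarith)
  choose y hy hyd using fun i : Fin l => cx.solZ (ρ' := ρ') (Y := 4 * Y)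
    ((Bd.sub (hG1 (Sum.inl (Sum.inr i))) (Bd.const_mul Complex.I (hG1 (Sum.inr (Sum.inr i))))).mono
      (le_of_eq (by simp; ring))) h0 (by linarith) i j
  have hmu : ∀ σ ∈ D, avg (fun ψ => G (Sum.inl (Sum.inr j)) σ ψ - Complex.I * G (Sum.inr (Sum.inr j)) σ ψ)
      = Complex.I * mu g j σ := by
    intro σ hσ
    rw [mu, ← avg_ofReal, ← avg_cmul]
    congr 1; ext1 ψ
    simp only [G, hgs σ hσ ψ]
    push_cast
    linear_combination (-(g σ ψ (Sum.inl (Sum.inr j)) (Sum.inl (Sum.inr j)) : ℂ)) * Complex.I_mul_I * (-1)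
  let mb : Fin l → ℝ → (Fin r → ℝ) → ℂ := fun i σ ψ => (1 / 2 : ℂ) * (z i σ ψ + y i σ ψ)
  let mp : Fin l → ℝ → (Fin r → ℝ) → ℂ := fun i σ ψ => (-Complex.I / 2) * (z i σ ψ - y i σ ψ)
  let m : II r l → ℝ → (Fin r → ℝ) → ℂ := Sum.elim (Sum.elim a mb) (Sum.elim e mp)
  have q1 : 4 * Q * Y ≤ Q ^ 3 * Y := by nlinarith [mul_nonneg hY (by linarith : 0 ≤ Q), mul_nonneg hY (sq_nonneg Q), mul_nonneg (mul_nonneg hY (by linarith : 0 ≤ Q)) (sub_nonneg.2 hQ), mul_nonneg (mul_nonneg hY (sq_nonneg Q)) (sub_nonneg.2 hQ)]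
  have q2 : Q * (3 * (Q * (2 * Y)) + 2 * Y) ≤ Q ^ 3 * Y := by
    nlinarith [mul_nonneg hY (by linarith : 0 ≤ Q), mul_nonneg hY (sq_nonneg Q), mul_nonneg (mul_nonneg hY (by linarith : 0 ≤ Q)) (sub_nonneg.2 hQ), mul_nonneg (mul_nonneg hY (sq_nonneg Q)) (sub_nonneg.2 hQ)]
  have hmB : ∀ i, Bd D s ρ' (m i) (Q ^ 3 * Y) := by
    have n2 : ‖(1 / 2 : ℂ)‖ = 1 / 2 := by simp
    have n3 : ‖(-Complex.I / 2 : ℂ)‖ = 1 / 2 := by simp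
    rintro ((i | i) | (i | i))
    · exact (ha i).mono q2
    · exact (((hz i).add (hy i)).const_mul (1 / 2)).mono (by rw [n2]; linarith)
    · exact ((he i).mono_rho h0.le (by linarith)).mono (by
        nlinarith [mul_nonneg hY (by linarith : 0 ≤ Q)])
    · exact (((hz i).sub (hy i)).const_mul (-Complex.I / 2)).mono (by rw [n3]; linarith)
  have hmb : ∀ i, HL D ω (mb i) (fun σ ψ => (σ * w i σ : ℝ) * mp i σ ψ - Complex.I * (σ * w j σ : ℝ) * mb i σ ψ
      + G (Sum.inl (Sum.inr i)) σ ψ - if i = j then Complex.I * (mu g j σ / 2) else 0) := fun i => by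
    refine ((HL.const fun _ => (1 / 2 : ℂ)).mul ((hzd i).add (hyd i))).congr (fun _ _ _ => rfl) fun σ hσ ψ => ?_
    have := hmu σ hσ
    simp only [mb, mp, th]
    split_ifs with h
    · subst h
      rw [this]; push_cast; ring
    · push_cast; ring
  have hmp : ∀ i, HL D ω (mp i) (fun σ ψ => -(σ * w i σ : ℝ) * mb i σ ψ - Complex.I * (σ * w j σ : ℝ) * mp i σ ψ
      + G (Sum.inr (Sum.inr i)) σ ψ + if i = j then (mu g j σ / 2 : ℂ) else 0) := fun i => by
    refine ((HL.const fun _ => (-Complex.I / 2 : ℂ)).mul ((hzd i).sub (hyd i))).congr (fun _ _ _ => rfl)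
      fun σ hσ ψ => ?_
    have := hmu σ hσ
    have hI := Complex.I_mul_I
    simp only [mb, mp, th]
    split_ifs with h
    · subst h
      rw [this]; push_cast
      linear_combination (G (Sum.inr (Sum.inr i)) σ ψ + (mu g i σ : ℂ) / 2 - σ * w i σ * z i σ ψ * (1 / 2) - σ * w i σ * y i σ ψ * (1 / 2)) * hI
    · push_cast
      linear_combination (G (Sum.inr (Sum.inr i)) σ ψ - σ * w i σ * z i σ ψ * (1 / 2) - σ * w i σ * y i σ ψ * (1 / 2)) * hI
  refine ⟨fun σ ψ => Matrix.of fun i _ => (m i σ ψ).re, fun σ ψ => Matrix.of fun i _ => (m i σ ψ).im,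
    ⟨by positivity, fun i _ => RB.ofRe (hmB i)⟩, ⟨by positivity, fun i _ => RB.ofIm (hmB i)⟩,
    fun i => ?_, fun i => ?_⟩
  · rcases i with (i | i) | (i | i)
    · refine (had i).re.congr (fun _ _ _ => rfl) fun σ hσ ψ => ?_
      beta_reduce
      simp only [Matrix.add_apply, Matrix.sub_apply, BB_a]
      simp [th, m, G]; ring
    · refine (hmb i).re.congr (fun _ _ _ => rfl) fun σ hσ ψ => ?_
      beta_reduce
      simp only [Matrix.add_apply, Matrix.sub_apply, BB_b]
      by_cases h : i = j <;> simp [h, th, m, G] <;> ring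
    · refine (hed i).re.congr (fun _ _ _ => rfl) fun σ hσ ψ => ?_
      beta_reduce
      simp only [Matrix.add_apply, Matrix.sub_apply, BB_e]
      simp [th, m, G]
    · refine (hmp i).re.congr (fun _ _ _ => rfl) fun σ hσ ψ => ?_
      beta_reduce
      simp only [Matrix.add_apply, Matrix.sub_apply, BB_p]
      by_cases h : i = j <;> simp [h, th, m, G] <;> ring
  · rcases i with (i | i) | (i | i)
    · refine (had i).im.congr (fun _ _ _ => rfl) fun σ hσ ψ => ?_
      beta_reduce
      simp only [Matrix.add_apply, Matrix.sub_apply, BB_a]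
      simp [th, m, G]; ring
    · refine (hmb i).im.congr (fun _ _ _ => rfl) fun σ hσ ψ => ?_
      beta_reduce
      simp only [Matrix.add_apply, Matrix.sub_apply, BB_b]
      by_cases h : i = j <;> simp [h, th, m, G] <;> ring
    · refine (hed i).im.congr (fun _ _ _ => rfl) fun σ hσ ψ => ?_
      beta_reduce
      simp only [Matrix.add_apply, Matrix.sub_apply, BB_e]
      simp [th, m, G]
    · refine (hmp i).im.congr (fun _ _ _ => rfl) fun σ hσ ψ => ?_
      beta_reduce
      simp only [Matrix.add_apply, Matrix.sub_apply, BB_p]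
      by_cases h : i = j <;> simp [h, th, m, G] <;> ring

lemma Cx.solM (cx : Cx ω D s δ Q w) {g : MF r (II r l) (II r l)} (hg : MB D s ρ g (s * Y)) (h0 : 0 < ρ')
    (hρ : ρ' + 4 * δ ≤ ρ)
    (hgs : ∀ σ ∈ D, ∀ ψ, ∀ j, g σ ψ (Sum.inr (Sum.inr j)) (Sum.inr (Sum.inr j)) =
      -g σ ψ (Sum.inl (Sum.inr j)) (Sum.inl (Sum.inr j))) :
    ∃ M : MF r (II r l) (II r l), MB D s ρ' M (Q ^ 7 * Y) ∧
      HM D ω M (fun σ ψ => BB r w σ * M σ ψ - M σ ψ * BB r w σ + g σ ψ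
        - (BB r (wN w g) σ - BB r w σ) - Rm g σ) := by
  have hY : 0 ≤ Y := nonneg_of_mul_nonneg_right (hg.1) cx.s0
  have hd := cx.d0
  have hQ := cx.Q8
  obtain ⟨x, hx, hxa, hxd⟩ := cx.solV0 (κ := Fin r) (ρ' := ρ' + 2 * δ)
    (g := fun σ ψ => Matrix.of fun i k => g σ ψ i (Sum.inl (Sum.inl k)))
    ⟨hg.1, fun i k => hg.2 i _⟩ (by linarith) (by linarith)
  have hy1 : MB D s (ρ' + 2 * δ) (fun σ ψ => Matrix.of fun i k => g σ ψ i (Sum.inr (Sum.inl k)) - σ * x σ ψ i k)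
      (s * (Y + 3 * (Q ^ 3 * Y))) := by
    refine ⟨by have := cx.s0; positivity, fun i k => ?_⟩
    exact (((hg.2 i (Sum.inr (Sum.inl k))).mono_rho (by linarith) (by linarith)).sub
      (cx.smul (hx.2 i k))).mono (le_of_eq (by ring))
  obtain ⟨y, hy, -, hyd⟩ := cx.solV0 (κ := Fin r) (ρ' := ρ') hy1 h0 le_rfl
  choose b p hb hp hbd hpd using fun j => cx.solC (ρ' := ρ') hg h0 (by linarith) j
    fun σ hσ ψ => hgs σ hσ ψ j
  have q0 : 8 ≤ Q ^ 3 := by nlinarith [mul_nonneg (by linarith : 0 ≤ Q) (sub_nonneg.2 hQ), mul_nonneg (sq_nonneg Q) (sub_nonneg.2 hQ)]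
  have q1 : Q ^ 3 * Y ≤ Q ^ 7 * Y := by gcongr <;> [linarith; norm_num]
  have q2 : Q ^ 3 * (Y + 3 * (Q ^ 3 * Y)) ≤ Q ^ 7 * Y := by
    have e1 : Q ^ 7 * Y = Q * (Q ^ 3 * (Q ^ 3 * Y)) := by ring
    have e2 : Q ^ 3 * Y ≤ Q ^ 3 * (Q ^ 3 * Y) := by
      have : Y ≤ Q ^ 3 * Y := by nlinarith
      gcongr
    have e3 : 0 ≤ Q ^ 3 * (Q ^ 3 * Y) := by positivity
    nlinarith
  refine ⟨fun σ ψ => Matrix.of fun i k => Sum.elim (Sum.elim (x σ ψ i) fun j => b j σ ψ i ())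
    (Sum.elim (y σ ψ i) fun j => p j σ ψ i ()) k, ⟨by positivity, fun i k => ?_⟩, fun i k => ?_⟩
  · rcases k with (k | k) | (k | k)
    · exact ((hx.2 i k).mono_rho h0.le (by linarith)).mono q1
    · exact ((hb k).2 i ()).mono q1
    · exact (hy.2 i k).mono q2
    · exact ((hp k).2 i ()).mono q1
  · rcases k with (k | k) | (k | k)
    · refine (hxd i k).congr (fun _ _ _ => rfl) fun σ hσ ψ => ?_
      beta_reduce
      simp only [Matrix.add_apply, Matrix.sub_apply, mBB_a]
      rcases i with (i | i) | (i | i) <;> simp only [BB_a, BB_b, BB_e, BB_p] <;> simp [etaA, Rm, BB, Matrix.diagonal_apply]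
    · refine (hbd k i).congr (fun _ _ _ => rfl) fun σ hσ ψ => ?_
      have := cx.pos hσ
      beta_reduce
      simp only [Matrix.add_apply, Matrix.sub_apply, mBB_b]
      rcases i with (i | i) | (i | i) <;> simp only [BB_a, BB_b, BB_e, BB_p]
      · simp [Rm, BB]
      · simp [Rm, BB]
      · simp [Rm, BB]
      · by_cases h : i = k
        · subst h; simp [Rm, BB, wN]; field_simp; ring
        · simp [Rm, BB, h]
    · refine (hyd i k).congr (fun _ _ _ => rfl) fun σ hσ ψ => ?_
      have h1 := hxa σ hσ
      have h2 : ∀ i, (avg fun ψ => g σ ψ (Sum.inr (Sum.inl i)) (Sum.inr (Sum.inl k)) - σ * x σ ψ (Sum.inr (Sum.inl i)) k)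
          = Rm g σ (Sum.inr (Sum.inl i)) (Sum.inr (Sum.inl k)) := fun i => by
        rw [RB.avg_sub ((hg.2 (Sum.inr (Sum.inl i)) (Sum.inr (Sum.inl k))).mono_rho (ρ' := ρ' + 2 * δ) (by linarith)
          (by linarith)) (cx.smul (hx.2 (Sum.inr (Sum.inl i)) k)) hσ, RB.avg_mul, h1 i k]
        simp [Rm]
      beta_reduce
      simp only [Matrix.add_apply, Matrix.sub_apply, mBB_e]
      rcases i with (i | i) | (i | i) <;> simp only [BB_a, BB_b, BB_e, BB_p]
      · simp [Rm, BB, etaA, Matrix.diagonal_apply]; ring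
      · simp [Rm, BB, etaA, Matrix.diagonal_apply]; ring
      · simp [BB, etaA, Matrix.diagonal_apply, h2]; ring
      · simp [Rm, BB, etaA, Matrix.diagonal_apply]; ring
    · refine (hpd k i).congr (fun _ _ _ => rfl) fun σ hσ ψ => ?_
      have := cx.pos hσ
      beta_reduce
      simp only [Matrix.add_apply, Matrix.sub_apply, mBB_p]
      rcases i with (i | i) | (i | i) <;> simp only [BB_a, BB_b, BB_e, BB_p]
      · simp [Rm, BB]
      · by_cases h : i = k
        · subst h; simp [Rm, BB, wN]; field_simp; ring
        · simp [Rm, BB, h]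
      · simp [Rm, BB]
      · simp [Rm, BB]

end

end KAM


open MeasureTheory Real Filter

namespace KAM

section

variable {r l : ℕ} {ω : Fin r → ℝ} {D : Set ℝ} {s δ Q : ℝ} {w : Fin l → ℝ → ℝ} {ρ ρ' X : ℝ}

lemma RB.avg_bracket {u u1 u2 v v1 v2 : ℝ → (Fin r → ℝ) → ℝ} {C C' : ℝ} {a b : Fin r → ℝ}
    (hu : RB D s ρ u C) (hv : RB D s ρ v C') (hρ : 0 < ρ) (hu1 : HL D a u u1) (hu2 : HL D b u u2)
    (hv1 : HL D a v v1) (hv2 : HL D b v v2) {σ : ℝ} (hσ : σ ∈ D) :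
    avg (fun ψ => u1 σ ψ * v2 σ ψ - u2 σ ψ * v1 σ ψ) = 0 := by
  obtain ⟨A, hA0, hA⟩ := exV a
  obtain ⟨B, hB0, hB⟩ := exV b
  have h1 : 0 < ρ / 2 := by linarith
  have h2 : 0 < ρ / 4 := by linarith
  have r1 := hv.deriv_bd h1.le h1 (by linarith) hA hA0 hv1
  have r2 := hv.deriv_bd h1.le h1 (by linarith) hB hB0 hv2
  have r3 := hu.deriv_bd h1.le h1 (by linarith) hA hA0 hu1
  have r4 := hu.deriv_bd h1.le h1 (by linarith) hB hB0 hu2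
  obtain ⟨v12, k12, b12⟩ := r1.deriv h2.le h2 (by linarith) hB hB0
  obtain ⟨v21, k21, b21⟩ := r2.deriv h2.le h2 (by linarith) hA hA0
  have hc : ∀ ψ, v12 σ ψ = v21 σ ψ := fun ψ => hv.comm hρ hv1 hv2 k12 k21 hσ ψ
  have hu' := hu.mono_rho h2.le (by linarith : ρ / 4 ≤ ρ)
  have p1 := (hu.mono_rho h1.le (by linarith : ρ / 2 ≤ ρ)).mul r2
  have p2 := (hu.mono_rho h1.le (by linarith : ρ / 2 ≤ ρ)).mul r1
  have e1 := p1.avg_deriv h1 (hu1.mul k21) hσ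
  have e2 := p2.avg_deriv h1 (hu2.mul k12) hσ
  have d4 : ρ / 4 ≤ ρ / 2 := by linarith
  have e3 := ((((r3.mono_rho h2.le d4).mul (r2.mono_rho h2.le d4)).add (hu'.mul b21))).avg_sub
    ((((r4.mono_rho h2.le d4).mul (r1.mono_rho h2.le d4)).add (hu'.mul b12))) hσ
  rw [e1, e2, sub_zero] at e3
  rw [← e3]
  congr 1; ext1 ψ
  rw [hc ψ]; ring

lemma absorb {y z : Fin r → ℝ → ℝ} {t : Fin r → Fin r → ℝ → ℝ} {C Z c : ℝ} (hC : ∀ k, LR D s (y k) C)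
    (hz : ∀ k, LR D s (z k) Z)
    (ht : ∀ i k, LR D s (fun σ => t i k σ - if i = k then 1 else 0) c) (hc : r * c ≤ 1 / 2)
    (he : ∀ σ ∈ D, ∀ k, ∑ i, y i σ * t i k σ = z k σ) (k : Fin r) : LR D s (y k) (2 * Z) := by
  rcases D.eq_empty_or_nonempty with rfl | ⟨σ₀, hσ₀⟩
  · exact fun σ hσ => absurd hσ (Set.notMem_empty σ)
  have h1 : ∀ C, (∀ k, LR D s (y k) C) → ∀ k, LR D s (y k) (Z + C / 2) := by
    intro C hC k
    have hs : LR D s (fun σ => ∑ i, y i σ * (t i k σ - if i = k then 1 else 0)) (∑ _i : Fin r, C * c) := by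
      have := LB.sum (D := D) (s := s) Finset.univ fun i (_ : i ∈ Finset.univ) => LB.mul (hC i) (ht i k)
      unfold LR
      convert this using 2
      push_cast; rfl
    refine LR.mono (C := Z + ∑ _i : Fin r, C * c) (((hz k).sub hs).congr fun σ hσ => ?_) ?_
    · rw [← he σ hσ k, ← Finset.sum_sub_distrib]
      simp [mul_sub, Finset.sum_sub_distrib]
    · have : 0 ≤ C := (abs_nonneg _).trans ((hC k).abs_le hσ₀)
      rw [Finset.sum_const, Finset.card_univ, Fintype.card_fin, nsmul_eq_mul]
      nlinarith
  have h2 : ∀ n : ℕ, ∀ k, LR D s (y k) (2 * Z + (C - 2 * Z) / 2 ^ n) := by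
    intro n
    induction n with
    | zero => intro k; simpa using hC k
    | succ n ih => intro k; refine (h1 _ ih k).mono (le_of_eq ?_); rw [pow_succ]; field_simp; ring
  intro σ hσ σ' hσ'
  have h3 : Tendsto (fun n : ℕ => 2 * Z + (C - 2 * Z) / 2 ^ n) atTop (nhds (2 * Z + 0)) :=
    tendsto_const_nhds.add (tendsto_const_nhds.div_atTop (tendsto_pow_atTop_atTop_of_one_lt one_lt_two))
  rw [add_zero] at h3
  exact ge_of_tendsto' h3 fun n => h2 n k σ hσ σ' hσ'

noncomputable def tb (τ : MF r (II r l) (Fin r)) (σ : ℝ) : Matrix (II r l) (Fin r) ℝ := fun i k =>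
  match i with
  | Sum.inl (Sum.inl i) => avg fun ψ => τ σ ψ (Sum.inl (Sum.inl i)) k
  | _ => 0

lemma MB.LRQ {κ κ' : Type} {M : MF r κ κ'} {C : ℝ} (h : MB D s ρ M C) (i k) :
    LR D s (fun σ => avg fun ψ => M σ ψ i k) C := (h.2 i k).avgLR

lemma Cx.tau (cx : Cx ω D s δ Q w) {P A Eh : MF r (II r l) (II r l)} {T F τ G : MF r (II r l) (Fin r)} {n : ℕ}
    (hP : ∀ σ ∈ D, ∀ ψ, (P σ ψ).transpose * Jm r l * P σ ψ = Jm r l)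
    (hd : HM D ω P (fun σ ψ => A σ ψ * P σ ψ - P σ ψ * BB r w σ + P σ ψ * Eh σ ψ))
    (hT : HM D ω T (fun σ ψ => A σ ψ * T σ ψ + F σ ψ))
    (hτ : τ = fun σ ψ => pin (P σ ψ) * T σ ψ) (hG : G = fun σ ψ => pin (P σ ψ) * F σ ψ - Eh σ ψ * τ σ ψ)
    (bP : MB D s ρ P (Q ^ 1 * 1)) (bT : MB D s ρ T (Q ^ 1 * 1)) (bE : MB D s ρ Eh (Q ^ n * (s * X)))
    (bF : MB D s ρ F (Q ^ n * (s * X))) (hX : 0 ≤ X) (h0 : 0 < ρ') (hρ : ρ' + 2 * δ ≤ ρ) :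
    (∀ σ ∈ D, ∀ i k, avg (fun ψ => G σ ψ (Sum.inr (Sum.inl i)) k) = 0) ∧
    (∀ σ ∈ D, ∀ i k, σ * avg (fun ψ => τ σ ψ (Sum.inr (Sum.inl i)) k) =
      -avg fun ψ => G σ ψ (Sum.inl (Sum.inl i)) k) ∧
    MB D s ρ τ (Q ^ 3 * 1) ∧ MB D s ρ' (fun σ ψ => τ σ ψ - tb τ σ) (Q ^ (n + 9) * X) := by
  have hQ := cx.Q2
  have hs := cx.s0
  have hd0 := cx.d0
  have hsX : 0 ≤ s * X := by positivity
  have bτ : MB D s ρ τ (Q ^ 3 * 1) := by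
    rw [hτ]; exact bP.pin.mulQ bT hQ cx.card zero_le_one zero_le_one (by norm_num) (by norm_num)
  have bG : MB D s ρ G (Q ^ (n + 5) * (s * X)) := by
    rw [hG]
    exact (bP.pin.mulQ bF hQ cx.card zero_le_one hsX (k := n + 2) (by omega) (by rw [one_mul])).subQ hQ hsX
      (bE.mulQ bτ hQ cx.card hsX zero_le_one (k := n + 4) (by omega) (by rw [mul_one])) (by omega) (by omega)
  have dτ : HM D ω τ (fun σ ψ => BB r w σ * τ σ ψ + G σ ψ) := by
    rw [hG, hτ]
    refine ((pin_deriv hP hd).mul hT).congr' fun σ hσ ψ => ?_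
    simp only [Matrix.add_mul, Matrix.mul_add, Matrix.sub_mul, Matrix.neg_mul, Matrix.mul_assoc]
    abel
  have hρ0 : 0 < ρ := by linarith
  have hd1 : ρ' + δ + δ ≤ ρ := by linarith
  have hd2 : ρ' + δ ≤ ρ := by linarith
  have hd3 : 0 < ρ' + δ := by linarith
  have bG' : ∀ i k, RB D s (ρ' + δ) (fun σ ψ => G σ ψ i k) (Q ^ (n + 5) * (s * X)) := fun i k =>
    (bG.2 i k).mono_rho hd3.le hd2
  have bτ' : ∀ i k, RB D s (ρ' + δ) (fun σ ψ => τ σ ψ i k) (Q ^ 3 * 1) := fun i k =>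
    (bτ.2 i k).mono_rho hd3.le hd2
  have deta : ∀ i k, HL D ω (fun σ ψ => τ σ ψ (Sum.inr (Sum.inl i)) k) (fun σ ψ => G σ ψ (Sum.inr (Sum.inl i)) k) :=
    fun i k => (dτ (Sum.inr (Sum.inl i)) k).congr (fun _ _ _ => rfl) fun σ hσ ψ => by
      beta_reduce; rw [Matrix.add_apply, BB_e, zero_add]
  have da : ∀ i k, HL D ω (fun σ ψ => τ σ ψ (Sum.inl (Sum.inl i)) k) (fun σ ψ => σ * τ σ ψ (Sum.inr (Sum.inl i)) k +
      G σ ψ (Sum.inl (Sum.inl i)) k) :=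
    fun i k => (dτ (Sum.inl (Sum.inl i)) k).congr (fun _ _ _ => rfl) fun σ hσ ψ => by
      beta_reduce; rw [Matrix.add_apply, BB_a]
  have ha : ∀ σ ∈ D, ∀ i k, σ * avg (fun ψ => τ σ ψ (Sum.inr (Sum.inl i)) k) =
      -avg fun ψ => G σ ψ (Sum.inl (Sum.inl i)) k := fun σ hσ i k => by
    have h1 := (bτ.2 (Sum.inl (Sum.inl i)) k).avg_deriv hρ0 (da i k) hσ
    rw [RB.avg_add (cx.smul (bτ.2 (Sum.inr (Sum.inl i)) k)) (bG.2 _ _) hσ, RB.avg_mul] at h1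
    linarith
  refine ⟨fun σ hσ i k => (bτ.2 _ k).avg_deriv hρ0 (deta i k) hσ, ha, bτ, ?_⟩
  have hZ : ∀ {m : ℕ} {c : ℝ}, m + 1 ≤ n + 9 → c ≤ Q → c * (Q ^ m * X) ≤ Q ^ (n + 9) * X := fun {m c} hm hc => by
    calc c * (Q ^ m * X) ≤ Q * (Q ^ m * X) := by gcongr
      _ = Q ^ (m + 1) * X := by ring
      _ ≤ _ := by gcongr; linarith
  have e1 : ∀ i k, RB D s (ρ' + δ) (fun σ ψ => τ σ ψ (Sum.inr (Sum.inl i)) k) (Q ^ (n + 7) * X) := fun i k => by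
    have h1 := RB.apri0 (bG.2 (Sum.inr (Sum.inl i)) k) cx.sd0 cx.Qs0 hd0.le hd3 hd1 cx.ne0 (bτ' _ k) (deta i k)
    have h2 : LR D s (fun σ => avg fun ψ => τ σ ψ (Sum.inr (Sum.inl i)) k) (2 / s * (Q ^ (n + 5) * (s * X))) :=
      (cx.LRi.mul (bG.LRQ (Sum.inl (Sum.inl i)) k).neg).congr fun σ hσ => by
        have := cx.pos hσ
        rw [← ha σ hσ i k]; field_simp
    refine ((h1.add (RB.ofLR h2 (by positivity))).congr fun σ hσ ψ => by ring).mono ?_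
    have : Q / s * (Q ^ (n + 5) * (s * X)) + 2 / s * (Q ^ (n + 5) * (s * X)) = (Q + 2) * (Q ^ (n + 5) * X) := by
      field_simp
    rw [this]
    calc (Q + 2) * (Q ^ (n + 5) * X) ≤ (Q ^ 2) * (Q ^ (n + 5) * X) := by gcongr; nlinarith
      _ = _ := by ring
  have e2 : ∀ i k, Bd D s ρ' (fun σ ψ => (τ σ ψ (Sum.inl (Sum.inr i)) k : ℂ) + Complex.I * τ σ ψ (Sum.inr (Sum.inr i)) k)
      (2 * (Q ^ (n + 6) * X)) := fun i k => by
    have h1 : Bd D s ρ (fun σ ψ => (G σ ψ (Sum.inl (Sum.inr i)) k : ℂ) + Complex.I * G σ ψ (Sum.inr (Sum.inr i)) k)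
        (s * (2 * (Q ^ (n + 5) * X))) :=
      (Bd.add (bG.2 _ k) (Bd.const_mul Complex.I (bG.2 _ k))).mono (le_of_eq (by simp; ring))
    have h2 : Bd D s ρ' (fun σ ψ => (τ σ ψ (Sum.inl (Sum.inr i)) k : ℂ) + Complex.I * τ σ ψ (Sum.inr (Sum.inr i)) k)
        (Q ^ 3 * 1 + ‖Complex.I‖ * (Q ^ 3 * 1)) :=
      (Bd.add (bτ.2 _ k) (Bd.const_mul Complex.I (bτ.2 _ k))).mono_rho h0.le (by linarith)
    have h3 := h1.apriN (cx.go (Sum.inl i)).1 cx.Qs0 hd0.le h0 hd2 (cx.go (Sum.inl i)).2 h2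
      (((dτ (Sum.inl (Sum.inr i)) k).ofReal.add ((HL.const fun _ => Complex.I).mul (dτ (Sum.inr (Sum.inr i)) k).ofReal)).congr
        (fun _ _ _ => rfl) fun σ hσ ψ => ?_)
    · refine h3.mono ?_
      rw [cx.Qs]; exact le_of_eq (by ring)
    · beta_reduce
      rw [Matrix.add_apply, Matrix.add_apply, BB_b, BB_p]
      simp only [th]
      push_cast
      linear_combination (-(σ : ℂ) * w i σ * τ σ ψ (Sum.inr (Sum.inr i)) k) * Complex.I_mul_I
  refine ⟨by positivity, fun i k => ?_⟩
  rcases i with (i | i) | (i | i)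
  · have h1 := RB.apri0 (C := s * (Q ^ (n + 8) * X)) (((cx.smul (e1 i k)).add (bG' (Sum.inl (Sum.inl i)) k)).mono ?_) cx.sd0 cx.Qs0 hd0.le h0 le_rfl cx.ne0
      ((bτ' _ k).mono_rho h0.le (by linarith)) (da i k)
    · refine h1.mono ?_
      rw [cx.Qs]; exact le_of_eq (by ring)
    · have h8 := cx.Q8
      calc s * (3 * (Q ^ (n + 7) * X)) + Q ^ (n + 5) * (s * X)
          ≤ s * (3 * (Q ^ (n + 7) * X)) + Q ^ (n + 7) * (s * X) := by gcongr <;> first | linarith | norm_num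
        _ = s * (4 * (Q ^ (n + 7) * X)) := by ring
        _ ≤ s * (Q * (Q ^ (n + 7) * X)) := by gcongr; linarith
        _ = _ := by ring
  · refine ((RB.ofRe (e2 i k)).congr fun σ hσ ψ => ?_).mono (hZ (by omega) hQ)
    simp [tb]
  · refine RB.mono (C := Q ^ (n + 7) * X) (((e1 i k).mono_rho h0.le (by linarith)).congr fun σ hσ ψ => ?_) ?_
    · simp [tb]
    · gcongr <;> first | linarith | norm_num
  · refine ((RB.ofIm (e2 i k)).congr fun σ hσ ψ => ?_).mono (hZ (by omega) hQ)
    simp [tb]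

end

end KAM


open MeasureTheory Real Filter

namespace KAM

noncomputable section

variable {r l : ℕ} {ω : Fin r → ℝ} {D : Set ℝ} {s δ Q : ℝ} {w : Fin l → ℝ → ℝ} {ρ ρ' X κ C η : ℝ}

def Gd (V : (JJ r l → ℝ) → ℝ) (i : JJ r l) (y : JJ r l → ℝ) : ℝ := fderiv ℝ V y (Pi.single i 1)

def Fd (V : (JJ r l → ℝ) → ℝ) (i j : JJ r l) (y : JJ r l → ℝ) : ℝ := fderiv ℝ (Gd V i) y (Pi.single j 1)

def xq (x : MF r (II r l) Unit) (σ : ℝ) (ψ : Fin r → ℝ) (j : JJ r l) : ℝ := x σ ψ (Sum.inl j) ()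

def Xh (m : JJ r l → ℝ) (V : (JJ r l → ℝ) → ℝ) (x : MF r (II r l) Unit) : MF r (II r l) Unit := fun σ ψ =>
  Matrix.of fun i _ => Sum.elim (fun j => σ * (m j * x σ ψ (Sum.inr j) ()))
    (fun j => -(σ * Gd V j (em (xq x) σ ψ))) i

def Am (m : JJ r l → ℝ) (V : (JJ r l → ℝ) → ℝ) (x : MF r (II r l) Unit) : MF r (II r l) (II r l) := fun σ ψ =>
  Matrix.fromBlocks 0 (Matrix.diagonal fun j => σ * m j)
    (Matrix.of fun i j => -(σ * Fd V i j (em (xq x) σ ψ))) 0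

def Ea (r l : ℕ) : Matrix (II r l) (Fin r) ℝ := Matrix.of fun i k => if i = Sum.inl (Sum.inl k) then 1 else 0

def DX (D : Set ℝ) (x : MF r (II r l) Unit) (Tx : MF r (II r l) (Fin r)) : Prop :=
  ∀ i k, HL D (Pi.single k 1) (fun σ ψ => x σ ψ i ()) (fun σ ψ => Tx σ ψ i k)

structure Md (V : (JJ r l → ℝ) → ℝ) (m : JJ r l → ℝ) (κ C : ℝ) : Prop where
  dV : Differentiable ℝ V
  dG : ∀ i, Differentiable ℝ (Gd V i)
  fV : FE κ V C
  fG : ∀ i, FE κ (Gd V i) C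
  fF : ∀ i j, FE κ (Fd V i j) C
  sy : ∀ i j y, Fd V i j y = Fd V j i y

variable {V : (JJ r l → ℝ) → ℝ} {m : JJ r l → ℝ} {x E : MF r (II r l) Unit} {Tx : MF r (II r l) (Fin r)}

lemma Ea_sum (k : Fin r) (u : II r l → ℝ) : ∑ i, Ea r l i k * u i = u (Sum.inl (Sum.inl k)) := by
  simp [Ea]

lemma Ea_inl (k : Fin r) (j : JJ r l) : Ea r l (Sum.inl j) k = Sum.elim (Pi.single k (1 : ℝ)) (fun _ => 0) j := by
  rcases j with j | j <;> simp [Ea, Pi.single_apply]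

lemma Ea_inr (k : Fin r) (j : JJ r l) : Ea r l (Sum.inr j) k = 0 := by simp [Ea]

lemma Am_sp (hy : ∀ i j y, Fd V i j y = Fd V j i y) (σ ψ) : Sp (Am m V x σ ψ) := by
  unfold Sp Am Jm
  rw [Matrix.fromBlocks_transpose, Matrix.fromBlocks_multiply, Matrix.fromBlocks_multiply,
    Matrix.fromBlocks_add]
  have : (Matrix.of fun i j => -(σ * Fd V i j (em (xq x) σ ψ))).transpose =
      Matrix.of fun i j => -(σ * Fd V i j (em (xq x) σ ψ)) := by
    ext i j; simp [hy j i]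
  simp [this]

lemma chain {g : (JJ r l → ℝ) → ℝ} (hg : Differentiable ℝ g) {v : Fin r → ℝ} {x' : MF r (II r l) Unit}
    (hx : HM D v x x') : HL D v (fun σ ψ => g (em (xq x) σ ψ)) (fun σ ψ =>
      ∑ j, (Sum.elim v (fun _ => 0) j + x' σ ψ (Sum.inl j) ()) * fderiv ℝ g (em (xq x) σ ψ) (Pi.single j 1)) := by
  intro σ hσ ψ
  have h1 : HasDerivAt (fun t : ℝ => em (xq x) σ (ψ + t • v))
      (fun j => Sum.elim v (fun _ => 0) j + x' σ ψ (Sum.inl j) ()) 0 := by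
    rw [hasDerivAt_pi]
    intro j
    refine HasDerivAt.add ?_ (hx (Sum.inl j) () σ hσ ψ)
    rcases j with j | j
    · simpa using ((hasDerivAt_id (0 : ℝ)).mul_const (v j)).const_add (ψ j)
    · simpa using hasDerivAt_const (0 : ℝ) (0 : ℝ)
  have h2 : em (xq x) σ (ψ + (0 : ℝ) • v) = em (xq x) σ ψ := by simp
  have h3 := (hg (em (xq x) σ (ψ + (0 : ℝ) • v))).hasFDerivAt.comp_hasDerivAt (0 : ℝ) h1
  refine h3.congr_deriv ?_
  rw [h2, hasFDeriv_sum]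

lemma tJ {κ μ : Type} (M : Matrix (II r l) κ ℝ) (N : Matrix (II r l) μ ℝ) (a b) :
    (M.transpose * (Jm r l * N)) a b = ∑ j : JJ r l, (M (Sum.inl j) a * N (Sum.inr j) b -
      M (Sum.inr j) a * N (Sum.inl j) b) := by
  rw [Matrix.mul_apply, Fintype.sum_sum_type, Finset.sum_sub_distrib]
  simp only [Jm_inl, Jm_inr, Matrix.transpose_apply, mul_neg, Finset.sum_neg_distrib]
  ring

lemma avg_brk {x1 x2 : MF r (II r l) Unit} {a b : Fin r → ℝ} (bx : MB D s ρ x η) (hρ : 0 < ρ)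
    (h1 : HM D a x x1) (h2 : HM D b x x2) {σ : ℝ} (hσ : σ ∈ D) :
    avg (fun ψ => ((x1 σ ψ).transpose * (Jm r l * x2 σ ψ)) () ()) = 0 := by
  simp only [tJ]
  obtain ⟨A, hA0, hA⟩ := exV a
  obtain ⟨B, hB0, hB⟩ := exV b
  have k1 := bx.deriv_bd (ρ' := ρ / 2) (by linarith) (by linarith : 0 < ρ / 2) (by linarith) hA hA0 h1
  have k2 := bx.deriv_bd (ρ' := ρ / 2) (by linarith) (by linarith : 0 < ρ / 2) (by linarith) hB hB0 h2
  rw [RB.avg_sum Finset.univ (fun j _ => ((k1.2 (Sum.inl j) ()).mul (k2.2 (Sum.inr j) ())).sub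
    ((k1.2 (Sum.inr j) ()).mul (k2.2 (Sum.inl j) ()))) hσ]
  refine Finset.sum_eq_zero fun j _ => ?_
  rw [← RB.avg_bracket (bx.2 (Sum.inl j) ()) (bx.2 (Sum.inr j) ()) hρ (h1 _ _) (h2 _ _) (h1 _ _) (h2 _ _) hσ]
  congr 1; ext1 ψ; ring

lemma DX.hm (h : DX D x Tx) (k : Fin r) : HM D (Pi.single k 1) x (fun σ ψ => Matrix.of fun i _ => Tx σ ψ i k) :=
  fun i _ => h i k

lemma DX.bd (h : DX D x Tx) (bx : MB D s ρ x η) (h0 : 0 ≤ ρ') (hδ : 0 < δ) (hρ : ρ' + δ ≤ ρ) :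
    MB D s ρ' Tx (1 / δ * η) :=
  ⟨by have := bx.1; positivity, fun i k => (bx.2 i ()).deriv_bd h0 hδ hρ (fun j => by
    rw [Pi.single_apply]; split_ifs <;> simp) zero_le_one (h i k)⟩

lemma r1 (md : Md V m κ C) (bx : MB D s ρ x η) (hρ : 0 < ρ) (hκ : ρ + η < κ) (hT : DX D x Tx)
    (hx : HM D ω x (fun σ ψ => Xh m V x σ ψ + E σ ψ)) {σ : ℝ} (hσ : σ ∈ D) (k : Fin r) :
    avg (fun ψ => ((Ea r l + Tx σ ψ).transpose * (Jm r l * E σ ψ)) k ()) = 0 := by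
  have hr2 : 0 < ρ / 2 := by linarith
  obtain ⟨A, hA0, hA⟩ := exV ω
  have bT := hT.bd bx hr2.le hr2 (by linarith)
  have bD := bx.deriv_bd hr2.le hr2 (by linarith) hA hA0 hx
  have a1 := avg_brk bx hρ (hT.hm k) hx hσ
  have a2 := (bx.2 (Sum.inr (Sum.inl k)) ()).avg_deriv hρ (hx _ _) hσ
  have b2 : RB D s (ρ / 2) (fun σ ψ => (Xh m V x σ ψ + E σ ψ) (Sum.inr (Sum.inl k)) ()) _ := bD.2 _ _
  have b1 : RB D s (ρ / 2) (fun σ ψ => ((Tx σ ψ).transpose * (Jm r l * (Xh m V x σ ψ + E σ ψ))) k ()) _ :=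
    (MB.mul bT.tr bD.jm).2 k ()
  let H : ℝ → (Fin r → ℝ) → ℝ := fun σ ψ => (∑ j, (m j / 2) * (x σ ψ (Sum.inr j) () * x σ ψ (Sum.inr j) ())) + V (em (xq x) σ ψ)
  have hH : RB D s ρ H _ := (RB.sum Finset.univ fun j _ => ((bx.2 (Sum.inr j) ()).mul (bx.2 (Sum.inr j) ())).const_mul (m j / 2)).add
    (md.fV.comp (fun j => bx.2 (Sum.inl j) ()) bx.1 hρ.le hκ)
  have dH : HL D (Pi.single k 1) H _ := (HL.sum Finset.univ fun j _ => (HL.const fun _ => m j / 2).mul ((hT (Sum.inr j) k).mul (hT (Sum.inr j) k))).add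
    (chain md.dV (hT.hm k))
  have a3 := hH.avg_deriv hρ dH hσ
  have b3 := hH.deriv_bd (w := Pi.single k 1) hr2.le hr2 (by linarith) (fun j => by
    rw [Pi.single_apply]; split_ifs <;> simp : ∀ j, |(Pi.single k (1 : ℝ) : Fin r → ℝ) j| ≤ 1) zero_le_one dH
  have e := RB.avg_add (b2.add b1) (b3.const_mul σ) hσ
  rw [RB.avg_add b2 b1 hσ, RB.avg_mul, a2, a3] at e
  have a1' : avg (fun ψ => ((Tx σ ψ).transpose * (Jm r l * (Xh m V x σ ψ + E σ ψ))) k ()) = 0 := by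
    rw [← a1]; congr 1
  rw [a1', mul_zero, add_zero, add_zero] at e
  rw [← e]
  congr 1; ext1 ψ
  have e4 : (Xh m V x σ ψ + E σ ψ) (Sum.inr (Sum.inl k)) () =
      ∑ j : JJ r l, (Sum.elim (Pi.single k (1 : ℝ)) (fun _ => 0) j : ℝ) * (Xh m V x σ ψ + E σ ψ) (Sum.inr j) () := by
    simp [Fintype.sum_sum_type, Pi.single_apply]
  rw [tJ, tJ, e4, ← Finset.sum_add_distrib, ← Finset.sum_add_distrib, Finset.mul_sum, ← Finset.sum_add_distrib]
  refine Finset.sum_congr rfl fun j _ => ?_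
  simp only [Matrix.add_apply, Ea_inl, Ea_inr, Xh, Matrix.of_apply, Sum.elim_inl, Sum.elim_inr, Gd]
  ring

lemma iso (bx : MB D s ρ x η) (hρ : 0 < ρ) (hT : DX D x Tx) {σ : ℝ} (hσ : σ ∈ D) (k k' : Fin r) :
    avg (fun ψ => ((Ea r l + Tx σ ψ).transpose * (Jm r l * (Ea r l + Tx σ ψ))) k k') = 0 := by
  have hr2 : 0 < ρ / 2 := by linarith
  have bT := hT.bd bx hr2.le hr2 (by linarith)
  have a1 := avg_brk bx hρ (hT.hm k) (hT.hm k') hσ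
  have a2 := (bx.2 (Sum.inr (Sum.inl k)) ()).avg_deriv hρ (hT _ k') hσ
  have a3 := (bx.2 (Sum.inr (Sum.inl k')) ()).avg_deriv hρ (hT _ k) hσ
  have b1 : RB D s (ρ / 2) (fun σ ψ => ((Tx σ ψ).transpose * (Jm r l * (Tx σ ψ))) k k') _ :=
    (MB.mul bT.tr bT.jm).2 k k'
  have a1' : avg (fun ψ => ((Tx σ ψ).transpose * (Jm r l * Tx σ ψ)) k k') = 0 := by
    rw [← a1]; congr 1
  have e := ((bT.2 (Sum.inr (Sum.inl k)) k').sub (bT.2 (Sum.inr (Sum.inl k')) k)).avg_add b1 hσ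
  rw [RB.avg_sub (bT.2 _ _) (bT.2 _ _) hσ, a2, a3, a1'] at e
  rw [sub_zero, add_zero] at e
  rw [← e]
  congr 1; ext1 ψ
  have e4 : ∀ k k', Tx σ ψ (Sum.inr (Sum.inl k)) k' =
      ∑ j : JJ r l, (Sum.elim (Pi.single k (1 : ℝ)) (fun _ => 0) j : ℝ) * Tx σ ψ (Sum.inr j) k' := by
    simp [Fintype.sum_sum_type, Pi.single_apply]
  rw [tJ, tJ, e4 k, e4 k', ← Finset.sum_sub_distrib, ← Finset.sum_add_distrib]
  refine Finset.sum_congr rfl fun j _ => ?_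
  simp only [Matrix.add_apply, Ea_inl, Ea_inr]
  ring

lemma dT (md : Md V m κ C) (bx : MB D s ρ x η) (hρ : 0 < ρ) (hT : DX D x Tx) {E' : MF r (II r l) (Fin r)}
    (hx : HM D ω x (fun σ ψ => Xh m V x σ ψ + E σ ψ)) (hE : DX D E E') :
    HM D ω (fun σ ψ => Ea r l + Tx σ ψ) (fun σ ψ => Am m V x σ ψ * (Ea r l + Tx σ ψ) + E' σ ψ) := by
  intro i k
  have hr2 : 0 < ρ / 2 := by linarith
  obtain ⟨A, hA0, hA⟩ := exV ω
  have bT := hT.bd bx hr2.le hr2 (by linarith)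
  obtain ⟨u, hu, -⟩ := (bT.2 i k).deriv le_rfl hr2 (by linarith) hA hA0
  have h12 : HL D (Pi.single k 1) (fun σ ψ => (Xh m V x σ ψ + E σ ψ) i ())
      (fun σ ψ => (Am m V x σ ψ * (Ea r l + Tx σ ψ) + E' σ ψ) i k) := by
    rcases i with j | j
    · refine (((HL.const fun σ => σ * m j).mul (hT (Sum.inr j) k)).add (hE (Sum.inl j) k)).congr
        (fun σ hσ ψ => ?_) fun σ hσ ψ => ?_
      · simp [Xh, mul_assoc]
      · simp [Am, Matrix.mul_apply, Fintype.sum_sum_type, Matrix.diagonal_apply, Ea_inr]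
    · refine (((HL.const fun σ => -σ).mul (chain (md.dG j) (hT.hm k))).add (hE (Sum.inr j) k)).congr
        (fun σ hσ ψ => ?_) fun σ hσ ψ => ?_
      · simp [Xh]
      · rw [Matrix.add_apply, Matrix.mul_apply, Fintype.sum_sum_type]
        simp only [Am, Matrix.fromBlocks_apply₂₁, Matrix.fromBlocks_apply₂₂, Matrix.add_apply, Ea_inl, Ea_inr,
          Matrix.of_apply, Matrix.zero_apply, zero_mul, Finset.sum_const_zero, add_zero, zero_add, Finset.mul_sum]
        congr 1
        refine Finset.sum_congr rfl fun i _ => ?_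
        rw [Fd]; ring
  have := (HL.const (D := D) (v := ω) fun _ => Ea r l i k).add hu
  refine this.congr (fun _ _ _ => rfl) fun σ hσ ψ => ?_
  rw [zero_add]
  exact (bx.2 i ()).comm hρ (hx i ()) (hT i k) h12 hu hσ ψ

end

end KAM


open MeasureTheory Real Filter

namespace KAM

noncomputable section

variable {r l : ℕ} {ω : Fin r → ℝ} {D : Set ℝ} {s δ Q : ℝ} {w : Fin l → ℝ → ℝ} {ρ ρ' X κ C η c : ℝ}
variable {V : (JJ r l → ℝ) → ℝ} {m : JJ r l → ℝ} {x E : MF r (II r l) Unit} {Tx : MF r (II r l) (Fin r)}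
variable {P Eh : MF r (II r l) (II r l)}

structure Fr (ω : Fin r → ℝ) (m : JJ r l → ℝ) (V : (JJ r l → ℝ) → ℝ) (w : Fin l → ℝ → ℝ) (D : Set ℝ) (s ρ c : ℝ)
    (x : MF r (II r l) Unit) (Tx : MF r (II r l) (Fin r)) (P : MF r (II r l) (II r l))
    (E : MF r (II r l) Unit) (Eh : MF r (II r l) (II r l)) : Prop where
  bx : MB D s ρ x c
  hT : DX D x Tx
  bT : MB D s ρ Tx c
  hP : ∀ σ ∈ D, ∀ ψ, (P σ ψ).transpose * Jm r l * P σ ψ = Jm r l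
  bP : MB D s ρ (fun σ ψ => P σ ψ - 1) c
  hx : HM D ω x (fun σ ψ => Xh m V x σ ψ + E σ ψ)
  hd : HM D ω P (fun σ ψ => Am m V x σ ψ * P σ ψ - P σ ψ * BB r w σ + P σ ψ * Eh σ ψ)

def av {ι κ : Type} (M : MF r ι κ) (σ : ℝ) : Matrix ι κ ℝ := Matrix.of fun i k => avg fun ψ => M σ ψ i k

section av

variable {ι κ μ : Type} {M N : MF r ι κ}

lemma MB.av (h : MB D s ρ M C) : MB D s ρ (fun σ _ => av M σ) C (r := r) :=
  ⟨h.1, fun i k => (h.2 i k).avgRB⟩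

lemma MB.lr {A : ℝ → Matrix ι κ ℝ} (h : MB D s ρ (fun σ (_ : Fin r → ℝ) => A σ) C) (i k) :
    LR D s (fun σ => A σ i k) C := (h.2 i k).avgLR.congr fun σ _ => (avg_const _).symm

lemma av_add (h : MB D s ρ M C) (h' : MB D s ρ N η) {σ : ℝ} (hσ : σ ∈ D) :
    av (fun σ ψ => M σ ψ + N σ ψ) σ = av M σ + av N σ := by
  ext i k; exact (h.2 i k).avg_add (h'.2 i k) hσ

lemma av_sub (h : MB D s ρ M C) (h' : MB D s ρ N η) {σ : ℝ} (hσ : σ ∈ D) :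
    av (fun σ ψ => M σ ψ - N σ ψ) σ = av M σ - av N σ := by
  ext i k; exact (h.2 i k).avg_sub (h'.2 i k) hσ

lemma av_tr (σ : ℝ) : av (fun σ ψ => (M σ ψ).transpose) σ = (av M σ).transpose := by
  ext i k; simp [av]

lemma av_mulL [Fintype ι] (A : ℝ → Matrix μ ι ℝ) (h : MB D s ρ M C) {σ : ℝ} (hσ : σ ∈ D) :
    av (fun σ ψ => A σ * M σ ψ) σ = A σ * av M σ := by
  ext i k
  simp only [av, Matrix.mul_apply, Matrix.of_apply]
  have := RB.avg_sum Finset.univ (fun j _ => ((h.2 j k).const_mul (A σ i j))) hσ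
  simp only [RB.avg_mul] at this
  exact this

lemma av_mulR [Fintype κ] (A : ℝ → Matrix κ μ ℝ) (h : MB D s ρ M C) {σ : ℝ} (hσ : σ ∈ D) :
    av (fun σ ψ => M σ ψ * A σ) σ = av M σ * A σ := by
  have := av_mulL (fun σ => (A σ).transpose) h.tr hσ
  rw [av_tr] at this
  have h2 := congrArg Matrix.transpose this
  rw [← av_tr] at h2
  simpa only [Matrix.transpose_mul, Matrix.transpose_transpose] using h2

lemma absorbM {Y : ℝ → Matrix ι (Fin r) ℝ} {t : ℝ → Matrix (Fin r) (Fin r) ℝ} {Z : ℝ}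
    (hY : MB D s ρ (fun σ (_ : Fin r → ℝ) => Y σ) C)
    (hZ : MB D s ρ (fun σ (_ : Fin r → ℝ) => Y σ * t σ) Z)
    (ht : MB D s ρ (fun σ (_ : Fin r → ℝ) => t σ - 1) c) (hc : r * c ≤ 1 / 2) :
    MB D s ρ (fun σ (_ : Fin r → ℝ) => Y σ) (2 * Z) :=
  MB.ofConst (by have := hZ.1; positivity) fun i k => absorb (fun k => hY.lr i k) (fun k => hZ.lr i k)
    (fun i k => (ht.lr i k).congr fun σ _ => by rw [Matrix.sub_apply, Matrix.one_apply]) hc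
    (fun σ _ k => by rw [Matrix.mul_apply]) k

end av

lemma pin_one : pin (1 : Matrix (II r l) (II r l) ℝ) = 1 := by
  rw [pin, Matrix.transpose_one, mul_one, Jm_sq, neg_neg]

lemma pin_sub (A B : Matrix (II r l) (II r l) ℝ) : pin (A - B) = pin A - pin B := by
  unfold pin; rw [Matrix.transpose_sub]; noncomm_ring

def tt (τ : MF r (II r l) (Fin r)) (σ : ℝ) : Matrix (Fin r) (Fin r) ℝ :=
  Matrix.of fun i k => av τ σ (Sum.inl (Sum.inl i)) k

lemma tb_eq (τ : MF r (II r l) (Fin r)) (σ : ℝ) : tb τ σ = Ea r l * tt τ σ := by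
  ext i k
  rcases i with (i | i) | (i | i) <;> simp [tb, Ea, Matrix.mul_apply, tt, av]

lemma rcard : (r : ℝ) ≤ Fintype.card (II r l) := by
  have : r ≤ Fintype.card (II r l) := by simp only [II, JJ, Fintype.card_sum, Fintype.card_fin]; omega
  exact_mod_cast this

lemma EaJEa : (Ea r l).transpose * (Jm r l * Ea r l) = 0 := by
  ext i k; rw [tJ]; simp [Ea_inr]

lemma one_card (hr : 0 < r) : (1 : ℝ) ≤ Fintype.card (II r l) :=
  le_trans (by exact_mod_cast hr) rcard

variable (hr : 0 < r) (hc : 6 * (Fintype.card (II r l) : ℝ) ^ 2 * c ≤ 1)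
include hr hc

lemma c_le : c ≤ 1 := by
  have := one_card (l := l) hr
  nlinarith [mul_le_mul this this zero_le_one (by linarith)]

lemma Fr.near (fr : Fr ω m V w D s ρ c x Tx P E Eh) {τ : MF r (II r l) (Fin r)}
    (hτ : τ = fun σ ψ => pin (P σ ψ) * (Ea r l + Tx σ ψ)) :
    MB D s ρ (fun σ (_ : Fin r → ℝ) => tt τ σ - 1) (3 * Fintype.card (II r l) * c) ∧
      r * (3 * Fintype.card (II r l) * c) ≤ 1 / 2 := by
  have hc0 := fr.bx.1
  have hc1 := c_le hr hc
  have hN := one_card (l := l) hr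
  have hrN := rcard (r := r) (l := l)
  have bE : MB D s ρ (fun σ (_ : Fin r → ℝ) => Ea r l) 1 := MB.ofConst zero_le_one fun i k =>
    (LR.const _).mono (by rw [Ea, Matrix.of_apply]; split_ifs <;> simp)
  have h1 := ((fr.bP.pin.mul (bE.add fr.bT)).add fr.bT).av
  constructor
  · refine MB.mono (C := Fintype.card (II r l) * (c * (1 + c)) + c) ⟨by positivity, fun i k => ?_⟩ ?_
    · refine (h1.2 (Sum.inl (Sum.inl i)) k).congr fun σ hσ ψ => ?_
      have e : (fun σ ψ => pin (P σ ψ - 1) * (Ea r l + Tx σ ψ) + Tx σ ψ) = fun σ ψ => τ σ ψ - Ea r l := by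
        rw [hτ]; ext1 σ; ext1 ψ
        rw [pin_sub, pin_one, Matrix.sub_mul, Matrix.one_mul]; abel
      have h2 : MB D s ρ τ (_ + 1) := (((fr.bP.pin.mul (bE.add fr.bT)).add fr.bT).add bE).congr fun σ hσ ψ => by
        rw [congrFun (congrFun e σ) ψ, sub_add_cancel]
      beta_reduce
      rw [e, av_sub h2 bE hσ]
      simp [tt, av, Matrix.one_apply, Ea, avg_const, eq_comm]
    · nlinarith [mul_nonneg (by linarith : (0 : ℝ) ≤ Fintype.card (II r l)) (mul_nonneg hc0 (sub_nonneg.2 hc1)), mul_nonneg hc0 (sub_nonneg.2 hN)]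
  · calc (r : ℝ) * (3 * Fintype.card (II r l) * c) ≤ Fintype.card (II r l) * (3 * Fintype.card (II r l) * c) := by gcongr
      _ ≤ _ := by nlinarith

omit hr hc in
lemma Fr.symp (fr : Fr ω m V w D s ρ c x Tx P E Eh) {κ μ : Type} {σ : ℝ} (hσ : σ ∈ D) (ψ)
    (M : Matrix (II r l) κ ℝ) (N : Matrix (II r l) μ ℝ) :
    (pin (P σ ψ) * M).transpose * (Jm r l * (pin (P σ ψ) * N)) = M.transpose * (Jm r l * N) := by
  have h := fr.hP σ hσ ψ
  have h1 := mul_pin h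
  rw [Matrix.mul_assoc] at h
  conv_rhs => rw [← Matrix.one_mul M, ← Matrix.one_mul N, ← h1]
  have h' : ∀ {ν : Type} (Z : Matrix (II r l) ν ℝ), (P σ ψ).transpose * (Jm r l * (P σ ψ * Z)) = Jm r l * Z := fun Z => by
    conv_rhs => rw [← h]
    simp only [Matrix.mul_assoc]
  simp only [Matrix.transpose_mul, Matrix.mul_assoc]
  rw [h']

omit hr hc in
lemma EaT {κ : Type} (N : Matrix (II r l) κ ℝ) (i k) : ((Ea r l).transpose * N) i k = N (Sum.inl (Sum.inl i)) k := by
  rw [Matrix.mul_apply]; exact Ea_sum i fun j => N j k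

omit hr hc in
lemma EaTJ {κ : Type} (N : Matrix (II r l) κ ℝ) (i k) :
    ((Ea r l).transpose * (Jm r l * N)) i k = N (Sum.inr (Sum.inl i)) k := by rw [EaT, Jm_inl]

omit hr hc in
lemma MB.ea {μ : Type} {N : MF r (II r l) μ} (h : MB D s ρ N C) :
    MB D s ρ (fun σ ψ => (Ea r l).transpose * N σ ψ) C :=
  ⟨h.1, fun i k => (h.2 (Sum.inl (Sum.inl i)) k).congr fun σ _ ψ => EaT _ _ _⟩

omit hr hc in
lemma MB.eaR {μ : Type} {N : MF r μ (II r l)} (h : MB D s ρ N C) :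
    MB D s ρ (fun σ ψ => N σ ψ * Ea r l) C :=
  h.tr.ea.tr.congr fun σ _ ψ => by rw [Matrix.transpose_mul, Matrix.transpose_transpose, Matrix.transpose_transpose]

lemma Fr.bQ (fr : Fr ω m V w D s ρ c x Tx P E Eh) (cx : Cx ω D s δ Q w) :
    MB D s ρ P (Q ^ 1 * 1) ∧ MB D s ρ (fun σ ψ => Ea r l + Tx σ ψ) (Q ^ 1 * 1) := by
  have hc1 := c_le hr hc
  have h8 := cx.Q8
  have bE : MB D s ρ (fun σ (_ : Fin r → ℝ) => Ea r l) 1 := MB.ofConst zero_le_one fun i k =>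
    (LR.const _).mono (by rw [Ea, Matrix.of_apply]; split_ifs <;> simp)
  exact ⟨((fr.bP.add MB.one).congr fun σ _ ψ => by rw [sub_add_cancel]).mono (by linarith), (bE.add fr.bT).mono (by linarith)⟩

lemma Fr.tau (fr : Fr ω m V w D s ρ c x Tx P E Eh) (md : Md V m κ C) (cx : Cx ω D s δ Q w) {n : ℕ} {C1 : ℝ}
    (bE : MB D s ρ E C1) (hC : Q * C1 ≤ Q ^ n * (s * X)) (bEh : MB D s ρ Eh (Q ^ n * (s * X)))
    (hX : 0 ≤ X) (h0 : 0 < ρ') (hρ : ρ' + 3 * δ ≤ ρ) {τ : MF r (II r l) (Fin r)}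
    (hτ : τ = fun σ ψ => pin (P σ ψ) * (Ea r l + Tx σ ψ)) :
    ∃ (E' : MF r (II r l) (Fin r)) (G R : MF r (II r l) (Fin r)), MB D s ρ' E' (Q * C1) ∧
    (G = fun σ ψ => pin (P σ ψ) * E' σ ψ - Eh σ ψ * τ σ ψ) ∧
    (∀ σ ∈ D, (Ea r l).transpose * (Jm r l * av G σ) = 0) ∧
    (∀ σ ∈ D, σ • ((Ea r l).transpose * (Jm r l * av τ σ)) = -((Ea r l).transpose * av G σ)) ∧
    MB D s ρ' τ (Q ^ 3 * 1) ∧ MB D s ρ' R (Q ^ (n + 9) * X) ∧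
    (∀ σ ψ, τ σ ψ = Ea r l * tt τ σ + R σ ψ) := by
  have hd := cx.d0
  have hb := fr.bQ hr hc cx
  have bE1 := fun k : Fin r => bE.deriv (v := Pi.single k 1) (V := 1) (ρ' := ρ' + 2 * δ) (by linarith) hd (by linarith)
    (fun j => by rw [Pi.single_apply]; split_ifs <;> simp) zero_le_one
  choose f hf hf' using bE1
  have bE' : MB D s (ρ' + 2 * δ) (fun σ ψ => Matrix.of fun i k => f k σ ψ i ()) (Q * C1) :=
    MB.mono ⟨by have := bE.1; positivity, fun i k => (hf' k).2 i ()⟩ (mul_le_mul_of_nonneg_right (by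
      rw [div_le_iff₀ hd]; exact cx.dQ) bE.1)
  have h2 : 0 ≤ ρ' + 2 * δ := by linarith
  have h3 : ρ' + 2 * δ ≤ ρ := by linarith
  obtain ⟨a1, a2, a3, a4⟩ := cx.tau fr.hP fr.hd (dT md fr.bx (by linarith) fr.hT fr.hx fun i k => hf k i ()) hτ rfl
    (hb.1.mono_rho h2 h3) (hb.2.mono_rho h2 h3) (bEh.mono_rho h2 h3) (bE'.mono hC) hX h0 le_rfl
  refine ⟨_, _, fun σ ψ => τ σ ψ - tb τ σ, bE'.mono_rho h0.le (by linarith), rfl, fun σ hσ => ?_, fun σ hσ => ?_,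
    a3.mono_rho h0.le (by linarith), a4, fun σ ψ => by rw [← tb_eq, add_sub_cancel]⟩
  · ext i k; rw [EaTJ]; exact a1 σ hσ i k
  · ext i k; rw [Matrix.smul_apply, Matrix.neg_apply, EaTJ, EaT]; exact a2 σ hσ i k

lemma Fr.R1 (fr : Fr ω m V w D s ρ c x Tx P E Eh) (md : Md V m κ C) (cx : Cx ω D s δ Q w) (hκ : ρ + c < κ) {n : ℕ}
    (bE : MB D s ρ E (Q ^ n * (s * X))) (bEh : MB D s ρ Eh (Q ^ n * (s * X)))
    (hX : 0 ≤ X) (h0 : 0 < ρ') (hρ : ρ' + 3 * δ ≤ ρ) :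
    MB D s ρ' (fun σ _ => etaA (fun σ ψ => pin (P σ ψ) * E σ ψ) σ) (Q ^ (2 * n + 14) * (s * (X * X))) (r := r) := by
  have hd := cx.d0
  have hs := cx.s0
  have hQ := cx.Q2
  have hQ0 := cx.Q0
  have hXX : 0 ≤ s * (X * X) := by positivity
  have hb := fr.bQ hr hc cx
  obtain ⟨E', G, R, -, -, -, -, b1, b2, b3⟩ := fr.tau hr hc md cx (n := n + 1) bE (le_of_eq (by ring))
    (bEh.upQ hQ (by omega) (by positivity) le_rfl) hX h0 hρ rfl
  obtain ⟨n1, n2⟩ := fr.near hr hc rfl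
  have hρ' : ρ' ≤ ρ := by linarith
  set τ : MF r (II r l) (Fin r) := fun σ ψ => pin (P σ ψ) * (Ea r l + Tx σ ψ) with hτ
  have b3 : ∀ σ ψ, τ σ ψ = Ea r l * tt τ σ + R σ ψ := b3
  set g : MF r (II r l) Unit := fun σ ψ => pin (P σ ψ) * E σ ψ with hg
  have bg : MB D s ρ' g (Q ^ (n + 2) * (s * X)) :=
    (hb.1.pin.mulQ bE hQ cx.card zero_le_one (by positivity) (by omega) (by rw [one_mul])).mono_rho h0.le hρ'
  have b4 : MB D s ρ' (fun σ ψ => (R σ ψ).transpose * (Jm r l * g σ ψ)) (Q ^ (2 * n + 13) * (s * (X * X))) :=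
    b2.tr.mulQ bg.jm hQ cx.card hX (by positivity) (by omega) (le_of_eq (by ring))
  have key : ∀ σ ∈ D, ((Ea r l).transpose * (Jm r l * av g σ)).transpose * tt τ σ =
      (-av (fun σ ψ => (R σ ψ).transpose * (Jm r l * g σ ψ)) σ).transpose := by
    intro σ hσ
    have e1 : av (fun σ ψ => (τ σ ψ).transpose * (Jm r l * g σ ψ)) σ = 0 := by
      ext k u
      refine (congrArg avg (funext fun ψ => ?_)).trans (r1 md fr.bx (by linarith) hκ fr.hT fr.hx hσ k)
      exact congrFun (congrFun (fr.symp hσ ψ _ _) k) u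
    have e2 : (fun σ ψ => (τ σ ψ).transpose * (Jm r l * g σ ψ)) = fun σ ψ =>
        ((Ea r l * tt τ σ).transpose * Jm r l) * g σ ψ + (R σ ψ).transpose * (Jm r l * g σ ψ) := by
      ext1 σ; ext1 ψ
      conv_lhs => rw [b3 σ ψ, Matrix.transpose_add, Matrix.add_mul, ← Matrix.mul_assoc]
    have b5 : MB D s ρ' (fun σ ψ => ((Ea r l * tt τ σ).transpose * Jm r l) * g σ ψ) _ :=
      ((b1.tr.mul bg.jm).sub b4).congr fun σ _ ψ => by
        rw [congrFun (congrFun e2 σ) ψ, add_sub_cancel_right]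
    rw [e2, av_add b5 b4 hσ, av_mulL (fun σ => (Ea r l * tt τ σ).transpose * Jm r l) bg hσ, add_eq_zero_iff_eq_neg] at e1
    rw [← e1]
    simp only [Matrix.transpose_mul, Matrix.mul_assoc, Matrix.transpose_transpose]
  have b6 := absorbM (bg.av.jm.ea.tr) (b4.av.neg.tr.congr fun σ hσ _ => key σ hσ) (n1.mono_rho h0.le hρ') n2
  refine MB.mono (C := 2 * (Q ^ (2 * n + 13) * (s * (X * X)))) ⟨b6.1, fun i k => ?_⟩ ?_
  · rcases i with (i | i) | (i | i)
    any_goals exact RB.zero.mono b6.1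
    exact (b6.2 k i).congr fun σ _ ψ => (EaTJ (av g σ) i k).symm
  · rw [pow_succ _ (2 * n + 13)]
    nlinarith [mul_nonneg (pow_nonneg hQ0 (2 * n + 13)) hXX]

omit hr hc in
lemma alg3 {κ : Type} [Fintype κ] {a t U O W : Matrix κ κ ℝ} {σ : ℝ} (h1 : σ • U = a * t - O)
    (h2 : t.transpose * U - U.transpose * t + W = 0) :
    t.transpose * (a - a.transpose) * t = t.transpose * O - O.transpose * t - σ • W := by
  have e := congrArg (fun M => σ • M) h2
  simp only [smul_add, smul_sub, smul_zero] at e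
  rw [← Matrix.mul_smul, ← Matrix.smul_mul, ← Matrix.transpose_smul, h1, Matrix.transpose_sub, Matrix.transpose_mul] at e
  rw [eq_comm, ← sub_eq_zero, ← neg_eq_zero, ← e]
  noncomm_ring

set_option maxHeartbeats 400000 in
lemma Fr.R23 (fr : Fr ω m V w D s ρ c x Tx P E Eh) (md : Md V m κ C) (cx : Cx ω D s δ Q w) {a b k : ℕ}
    (bE : MB D s ρ E (Q ^ a * (s * (X * X)))) (bEh : MB D s ρ Eh (Q ^ b * (s * X)))
    (hX : 0 ≤ X) (hX1 : Q ^ (a + 1) * X ≤ 1) (h0 : 0 < ρ') (hρ : ρ' + 3 * δ ≤ ρ) (ha : a + 4 ≤ k) (hb : 2 * b + 11 ≤ k) :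
    MB D s ρ' (fun σ _ => (Ea r l).transpose * (Jm r l * (av Eh σ * Ea r l))) (Q ^ (k + 1) * (s * (X * X))) (r := r) ∧
    MB D s ρ' (fun σ _ => (Ea r l).transpose * (av Eh σ * Ea r l) - ((Ea r l).transpose * (av Eh σ * Ea r l)).transpose)
      (Q ^ (k + 18) * (s * (X * X))) (r := r) := by
  have hd := cx.d0
  have hs := cx.s0
  have hQ := cx.Q2
  have hQ0 := cx.Q0
  have hXX : 0 ≤ s * (X * X) := by positivity
  have hP := fr.bQ hr hc cx
  have hρ' : ρ' ≤ ρ := by linarith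
  have hQb : (1 : ℝ) ≤ Q ^ b := one_le_pow₀ (by linarith)
  have hrQ : (Fintype.card (Fin r) : ℝ) ≤ Q := by rw [Fintype.card_fin]; exact rcard.trans cx.card
  have hC : Q * (Q ^ a * (s * (X * X))) ≤ Q ^ b * (s * X) := by
    calc _ = (Q ^ (a + 1) * X) * (s * X) := by ring
      _ ≤ 1 * (s * X) := by gcongr
      _ ≤ _ := by gcongr
  obtain ⟨E', G, R, b1, hG, h1, h2, b2, b3, h3⟩ := fr.tau hr hc md cx bE hC bEh hX h0 hρ rfl
  obtain ⟨n1, n2⟩ := fr.near hr hc rfl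
  set τ : MF r (II r l) (Fin r) := fun σ ψ => pin (P σ ψ) * (Ea r l + Tx σ ψ) with hτ
  replace h3 : ∀ σ ψ, τ σ ψ = Ea r l * tt τ σ + R σ ψ := h3
  replace n1 := n1.mono_rho h0.le hρ'
  replace bEh := bEh.mono_rho h0.le hρ'
  have b4 : MB D s ρ' (fun σ ψ => pin (P σ ψ) * E' σ ψ) (Q ^ (a + 3) * (s * (X * X))) :=
    (hP.1.mono_rho h0.le hρ').pin.mulQ (b1.mono (le_of_eq (by ring)) : MB D s ρ' E' (Q ^ (a + 1) * (s * (X * X)))) hQ cx.card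
      zero_le_one hXX (by omega) (by rw [one_mul])
  have b5 : MB D s ρ' (fun σ ψ => Eh σ ψ * R σ ψ) (Q ^ (2 * b + 10) * (s * (X * X))) :=
    bEh.mulQ b3 hQ cx.card (by positivity) hX (by omega) (le_of_eq (by ring))
  set O : ℝ → Matrix (II r l) (Fin r) ℝ := fun σ => av (fun σ ψ => pin (P σ ψ) * E' σ ψ) σ - av (fun σ ψ => Eh σ ψ * R σ ψ) σ with hO
  have bO : MB D s ρ' (fun σ (_ : Fin r → ℝ) => O σ) (Q ^ k * (s * (X * X))) := b4.av.subQ hQ hXX b5.av (by omega) (by omega)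
  have bt : MB D s ρ' (fun σ (_ : Fin r → ℝ) => tt τ σ) (Q ^ 3 * 1) := ⟨b2.1, fun i k => b2.av.2 _ k⟩
  have eG : ∀ σ ∈ D, av G σ = O σ - av Eh σ * Ea r l * tt τ σ := by
    intro σ hσ
    have b6 : MB D s ρ' (fun σ ψ => Eh σ ψ * (Ea r l * tt τ σ)) _ := ((bEh.mul b2).sub b5).congr fun σ _ ψ => by
      conv_rhs => rw [h3 σ ψ, Matrix.mul_add, add_sub_cancel_right]
    have : G = fun σ ψ => pin (P σ ψ) * E' σ ψ - (Eh σ ψ * (Ea r l * tt τ σ) + Eh σ ψ * R σ ψ) := by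
      rw [hG]; ext1 σ; ext1 ψ
      rw [← Matrix.mul_add, ← h3 σ ψ]
    rw [this, av_sub b4 (b6.add b5) hσ, av_add b6 b5 hσ, av_mulR (fun σ => Ea r l * tt τ σ) bEh hσ, hO, Matrix.mul_assoc]
    exact sub_add_eq_sub_sub_swap _ _ _
  have two : ∀ {ι κ : Type} {M : MF r ι κ} {j : ℕ}, MB D s ρ' M (2 * (Q ^ j * (s * (X * X)))) →
      MB D s ρ' M (Q ^ (j + 1) * (s * (X * X))) := fun h => h.mono (by
    rw [pow_succ]; nlinarith [mul_nonneg (pow_nonneg hQ0 ‹ℕ›) hXX])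
  constructor
  · refine two (absorbM bEh.av.eaR.jm.ea (bO.jm.ea.congr fun σ hσ ψ => ?_) n1 n2)
    have := h1 σ hσ
    rw [eG σ hσ, Matrix.mul_sub, Matrix.mul_sub, sub_eq_zero] at this
    rw [this]; simp only [Matrix.mul_assoc]
  · have bW : MB D s ρ' (fun σ ψ => (R σ ψ).transpose * (Jm r l * R σ ψ)) (Q ^ (2 * b + 19) * (X * X)) :=
      b3.tr.mulQ b3.jm hQ cx.card hX hX (by omega) le_rfl
    have key : ∀ σ ∈ D, (tt τ σ).transpose * ((Ea r l).transpose * (Jm r l * av τ σ)) -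
        ((Ea r l).transpose * (Jm r l * av τ σ)).transpose * tt τ σ +
        av (fun σ ψ => (R σ ψ).transpose * (Jm r l * R σ ψ)) σ = 0 := by
      intro σ hσ
      have e1 : av (fun σ ψ => (τ σ ψ).transpose * (Jm r l * τ σ ψ)) σ = 0 := by
        ext k u
        refine (congrArg avg (funext fun ψ => ?_)).trans (iso fr.bx (by linarith) fr.hT hσ k u)
        exact congrFun (congrFun (fr.symp hσ ψ _ _) k) u
      have e0 := EaJEa (r := r) (l := l)
      have e2 : (fun σ ψ => (τ σ ψ).transpose * (Jm r l * τ σ ψ)) = fun σ ψ =>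
          ((tt τ σ).transpose * (Ea r l).transpose * Jm r l) * τ σ ψ - ((tt τ σ).transpose * (Ea r l).transpose * Jm r l * τ σ ψ).transpose
            + (R σ ψ).transpose * (Jm r l * R σ ψ) := by
        ext1 σ; ext1 ψ
        rw [h3 σ ψ]
        generalize R σ ψ = R'
        generalize tt τ σ = t
        have e3 : ∀ Z : Matrix (Fin r) (Fin r) ℝ, (Ea r l).transpose * (Jm r l * (Ea r l * Z)) = 0 := fun Z => by
          rw [← Matrix.mul_assoc (Jm r l), ← Matrix.mul_assoc, e0, Matrix.zero_mul]
        simp only [Matrix.transpose_add, Matrix.transpose_mul, Matrix.add_mul, Matrix.mul_add, Matrix.mul_assoc, e3,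
          Matrix.mul_zero, Matrix.transpose_zero, Jm_tr, Matrix.neg_mul, Matrix.mul_neg, Matrix.transpose_transpose, zero_add]
        simp only [zero_add, sub_eq_add_neg, neg_neg, add_assoc]
        exact add_left_comm _ _ _
      have b7 := ((bt.tr.mul b2.jm.ea).congr (M1 := fun σ ψ => (tt τ σ).transpose * (Ea r l).transpose * Jm r l * τ σ ψ) fun σ _ ψ => by
        simp only [Matrix.mul_assoc])
      rw [e2, av_add (b7.sub b7.tr) bW hσ, av_sub b7 b7.tr hσ, av_tr (M := fun σ ψ => (tt τ σ).transpose * (Ea r l).transpose * Jm r l * τ σ ψ),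
        av_mulL (fun σ => (tt τ σ).transpose * (Ea r l).transpose * Jm r l) b2 hσ] at e1
      rw [← e1]
      simp only [Matrix.transpose_mul, Matrix.mul_assoc, Matrix.transpose_transpose]
    have bZ : MB D s ρ' (fun σ (_ : Fin r → ℝ) => (tt τ σ).transpose * ((Ea r l).transpose * O σ) -
        ((Ea r l).transpose * O σ).transpose * tt τ σ - σ • av (fun σ ψ => (R σ ψ).transpose * (Jm r l * R σ ψ)) σ)
        (Q ^ (k + 16) * (s * (X * X))) := by
      have b8 := (bt.tr.mulQ bO.ea hQ hrQ zero_le_one hXX (k := k + 4) (by omega) (by rw [one_mul]))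
      have b9 := (bO.ea.tr.mulQ bt hQ hrQ hXX zero_le_one (k := k + 4) (by omega) (by rw [mul_one]))
      refine (b8.subQ hQ hXX b9 (k := k + 5) (by omega) (by omega)).subQ hQ hXX (n := 2 * b + 20)
        ((bW.av.smulL cx.LRs (by positivity)).mono ?_) (by omega) (by omega)
      have := cx.Q8
      calc 3 * s * (Q ^ (2 * b + 19) * (X * X)) ≤ Q * s * (Q ^ (2 * b + 19) * (X * X)) := by gcongr; linarith
        _ = _ := by ring
    have ba := bEh.av.eaR.ea
    obtain ⟨A, hA⟩ : ∃ A, A = fun σ => (Ea r l).transpose * (av Eh σ * Ea r l) := ⟨_, rfl⟩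
    have ba' : MB D s ρ' (fun σ (_ : Fin r → ℝ) => A σ) (Q ^ b * (s * X)) := by rw [hA]; exact ba
    have h5 : ∀ σ ∈ D, (tt τ σ).transpose * (A σ - (A σ).transpose) * tt τ σ = _ := fun σ hσ =>
      alg3 (a := A σ) (O := (Ea r l).transpose * O σ) (by
        rw [h2 σ hσ, eG σ hσ, Matrix.mul_sub, neg_sub, hA]; simp only [Matrix.mul_assoc]) (key σ hσ)
    have b10 := absorbM (Y := fun σ => (tt τ σ).transpose * (A σ - (A σ).transpose)) (t := tt τ) (bt.tr.mul (ba'.sub ba'.tr)) (bZ.congr fun σ hσ _ => h5 σ hσ) n1 n2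
    have b11 := absorbM (Y := fun σ => A σ - (A σ).transpose) (t := tt τ) (ba'.sub ba'.tr) (b10.tr.neg.congr fun σ hσ _ => by
      rw [Matrix.transpose_mul, Matrix.transpose_transpose, Matrix.transpose_sub, Matrix.transpose_transpose,
        ← Matrix.neg_mul, neg_sub]) n1 n2
    rw [hA] at b11
    refine b11.mono ?_
    have := mul_nonneg (pow_nonneg hQ0 (k + 16)) hXX
    calc 2 * (2 * (Q ^ (k + 16) * (s * (X * X)))) ≤ Q * (Q * (Q ^ (k + 16) * (s * (X * X)))) := by gcongr
      _ = _ := by ring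

end

end KAM


open MeasureTheory Real Filter

namespace KAM

noncomputable section

variable {r l : ℕ} {ω : Fin r → ℝ} {D : Set ℝ} {s δ Q : ℝ} {w : Fin l → ℝ → ℝ} {ρ ρ' X κ C η c Z : ℝ}
variable {V : (JJ r l → ℝ) → ℝ} {m : JJ r l → ℝ} {x h E : MF r (II r l) Unit} {Tx : MF r (II r l) (Fin r)}
variable {P Eh : MF r (II r l) (II r l)}

lemma em_add (σ ψ) : em (xq (fun σ ψ => x σ ψ + h σ ψ)) σ ψ = em (xq x) σ ψ + xq h σ ψ := by
  ext j; simp [em, xq, add_assoc]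

lemma Xh_rem (md : Md V m κ C) (cx : Cx ω D s δ Q w) (hC0 : 0 ≤ C) (hCQ : C ≤ Q) (bx : MB D s ρ x c)
    (bh : MB D s ρ h Z) (h0 : 0 ≤ ρ) (hκ : ρ + c + Z + δ ≤ κ) :
    MB D s ρ (fun σ ψ => Xh m V (fun σ ψ => x σ ψ + h σ ψ) σ ψ - Xh m V x σ ψ - Am m V x σ ψ * h σ ψ)
      (Q ^ 4 * (s * (Z * Z))) := by
  have hs := cx.s0
  have hd := cx.d0
  have h8 := cx.Q8
  have hQ0 := cx.Q0
  have hZ := bh.1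
  have hdQ : 1 / δ ≤ Q := by rw [div_le_iff₀ hd]; exact cx.dQ
  refine ⟨by positivity, fun i k => ?_⟩
  rcases i with j | j
  · refine (RB.zero.mono (by positivity)).congr fun σ _ ψ => ?_
    simp [Xh, Am, Matrix.mul_apply, Fintype.sum_sum_type, Matrix.diagonal_apply]
    ring
  · have := cx.smul ((md.fG j).rem (md.dG j) (fun j => bx.2 (Sum.inl j) ()) bx.1 (fun j => bh.2 (Sum.inl j) ()) hZ hd h0 hκ)
    refine (this.neg.mono ?_).congr fun σ _ ψ => ?_
    · calc s * (3 * (C * 2 * (Z / δ) ^ 2)) = 6 * C * (1 / δ) ^ 2 * (s * (Z * Z)) := by ring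
        _ ≤ Q * Q * Q ^ 2 * (s * (Z * Z)) := by gcongr; linarith
        _ = _ := by ring
    · beta_reduce
      rw [Matrix.sub_apply, Matrix.sub_apply, Matrix.mul_apply, Fintype.sum_sum_type]
      simp only [Xh, Am, Matrix.of_apply, Sum.elim_inr, em_add, Matrix.fromBlocks_apply₂₁, Matrix.fromBlocks_apply₂₂,
        Matrix.zero_apply, zero_mul, Finset.sum_const_zero, add_zero, neg_mul, Finset.sum_neg_distrib, mul_assoc, ← Finset.mul_sum, Fd]
      change _ = -(σ * (Gd V j (em (xq x) σ ψ + xq h σ ψ) - Gd V j (em (xq x) σ ψ) -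
        ∑ i, fderiv ℝ (Gd V j) (em (xq x) σ ψ) (Pi.single i 1) * h σ ψ (Sum.inl i) ()))
      rcases k
      ring

lemma Am_diff (md : Md V m κ C) (cx : Cx ω D s δ Q w) (hC0 : 0 ≤ C) (hCQ : C ≤ Q) (bx : MB D s ρ x c)
    (bh : MB D s ρ h Z) (h0 : 0 ≤ ρ) (hκ : ρ + c + Z + δ ≤ κ) :
    MB D s ρ (fun σ ψ => Am m V (fun σ ψ => x σ ψ + h σ ψ) σ ψ - Am m V x σ ψ) (Q ^ 3 * (s * Z)) := by
  have hs := cx.s0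
  have hd := cx.d0
  have h8 := cx.Q8
  have hQ0 := cx.Q0
  have hZ := bh.1
  have hdQ : 1 / δ ≤ Q := by rw [div_le_iff₀ hd]; exact cx.dQ
  refine ⟨by positivity, fun i k => ?_⟩
  rcases i with i | i
  · exact (RB.zero.mono (by positivity)).congr fun σ _ ψ => by rcases k with k | k <;> simp [Am]
  rcases k with k | k
  · have := cx.smul ((md.fF i k).diff (fun j => bx.2 (Sum.inl j) ()) bx.1 (fun j => bh.2 (Sum.inl j) ()) hZ hd h0 hκ)
    refine (this.neg.mono ?_).congr fun σ _ ψ => ?_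
    · calc s * (3 * (C * (Z / δ))) = 3 * C * (1 / δ) * (s * Z) := by ring
        _ ≤ Q * Q * Q * (s * Z) := by gcongr; linarith
        _ = _ := by ring
    · beta_reduce
      rw [Matrix.sub_apply]
      simp only [Am, Matrix.of_apply, em_add, Matrix.fromBlocks_apply₂₁]
      change _ = -(σ * (Fd V i k (em (xq x) σ ψ + xq h σ ψ) - Fd V i k (em (xq x) σ ψ)))
      ring
  · exact (RB.zero.mono (by positivity)).congr fun σ _ ψ => by simp [Am]

variable (hr : 0 < r) (hc : 6 * (Fintype.card (II r l) : ℝ) ^ 2 * c ≤ 1)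
include hr hc

lemma Fr.step1 (fr : Fr ω m V w D s ρ c x Tx P E Eh) (md : Md V m κ C) (cx : Cx ω D s δ Q w) (hC0 : 0 ≤ C) (hCQ : C ≤ Q)
    (bE : MB D s ρ E (s * X)) (bEh : MB D s ρ Eh (s * X)) (hX : 0 ≤ X) (h0 : 0 < ρ') (hρ : ρ' + 3 * δ ≤ ρ)
    (hκ : ρ + c + Q ^ 8 * X + δ ≤ κ) :
    ∃ (x' : MF r (II r l) Unit) (Tx' : MF r (II r l) (Fin r)) (E' : MF r (II r l) Unit) (Eh' : MF r (II r l) (II r l)),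
      Fr ω m V w D s ρ' (c + Q ^ 8 * X) x' Tx' P E' Eh' ∧ MB D s ρ' E' (Q ^ 20 * (s * (X * X))) ∧
      MB D s ρ' Eh' (Q ^ 15 * (s * X)) ∧ MB D s ρ' (fun σ ψ => x' σ ψ - x σ ψ) (Q ^ 8 * X) := by
  have hs := cx.s0
  have hd := cx.d0
  have h8 := cx.Q8
  have hQ0 := cx.Q0
  have hQ := cx.Q2
  have hsX : 0 ≤ s * X := by positivity
  have hXX : 0 ≤ s * (X * X) := by positivity
  have hQ7 : Q ^ 7 * X ≤ Q ^ 8 * X := by gcongr <;> linarith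
  obtain ⟨bP, bT⟩ := fr.bQ hr hc cx
  have bE0 : MB D s ρ E (Q ^ 0 * (s * X)) := by rw [pow_zero, one_mul]; exact bE
  have bEh0 : MB D s ρ Eh (Q ^ 0 * (s * X)) := by rw [pow_zero, one_mul]; exact bEh
  have bg : MB D s ρ (fun σ ψ => -(pin (P σ ψ) * E σ ψ)) (s * (Q ^ 2 * X)) :=
    (bP.pin.mulQ bE0 hQ cx.card zero_le_one hsX (k := 2) (by omega) (by rw [one_mul])).neg.mono (le_of_eq (by ring))
  obtain ⟨ξ, b1, -, d1⟩ := cx.solV0 bg (ρ' := ρ' + δ) (by linarith) (by linarith)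
  have bk : MB D s ρ' (fun σ _ => etaA (fun σ ψ => -(pin (P σ ψ) * E σ ψ)) σ) (Q ^ 14 * (s * (X * X))) (r := r) :=
    (fr.R1 hr hc md cx (n := 0) (by have : 0 ≤ Q ^ 8 * X := by positivity
                                    linarith) bE0 bEh0 hX h0 hρ).neg.congr fun σ _ _ => by
      ext i k
      rcases i with (i | i) | (i | i) <;> simp [etaA, RB.avg_neg]
  have up : ∀ {ι κ : Type} {M : MF r ι κ} {Y : ℝ}, MB D s ρ M Y → MB D s (ρ' + δ) M Y := fun h =>
    h.mono_rho (by linarith) (by linarith)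
  have up' : ∀ {ι κ : Type} {M : MF r ι κ} {Y : ℝ}, MB D s (ρ' + δ) M Y → MB D s ρ' M Y := fun h =>
    h.mono_rho h0.le (by linarith)
  replace b1 : MB D s (ρ' + δ) ξ (Q ^ 5 * X) := b1.mono (le_of_eq (by ring))
  obtain ⟨h, hh⟩ : ∃ h : MF r (II r l) Unit, h = fun σ ψ => P σ ψ * ξ σ ψ := ⟨_, rfl⟩
  have bh : MB D s (ρ' + δ) h (Q ^ 7 * X) := by
    rw [hh]; exact (up bP).mulQ b1 hQ cx.card zero_le_one hX (by omega) (by rw [one_mul])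
  have dh := fr.hd.mul d1
  rw [← hh] at dh
  have bDh := fun k : Fin r => bh.deriv (v := Pi.single k 1) (V := 1) h0.le hd le_rfl
    (fun j => by rw [Pi.single_apply]; split_ifs <;> simp) zero_le_one
  choose f hf hf' using bDh
  have hκ' : ρ' + c + Q ^ 7 * X + δ ≤ κ := by linarith
  have bX := fr.bx.mono_rho h0.le (by linarith : ρ' ≤ ρ)
  have r1 := Xh_rem md cx hC0 hCQ bX (up' bh) h0.le hκ'
  have r2 := Am_diff md cx hC0 hCQ bX (up' bh) h0.le hκ'
  have bP' := up' (up bP)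
  refine ⟨fun σ ψ => x σ ψ + h σ ψ, fun σ ψ => Tx σ ψ + Matrix.of fun i k => f k σ ψ i (),
    fun σ ψ => P σ ψ * (Eh σ ψ * ξ σ ψ) - P σ ψ * etaA (fun σ ψ => -(pin (P σ ψ) * E σ ψ)) σ -
      (Xh m V (fun σ ψ => x σ ψ + h σ ψ) σ ψ - Xh m V x σ ψ - Am m V x σ ψ * h σ ψ),
    fun σ ψ => Eh σ ψ - pin (P σ ψ) * ((Am m V (fun σ ψ => x σ ψ + h σ ψ) σ ψ - Am m V x σ ψ) * P σ ψ),
    ⟨?_, ?_, ?_, fr.hP, ?_, ?_, ?_⟩, ?_, ?_, ?_⟩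
  · exact (bX.add (up' bh)).mono (by linarith)
  · intro i k
    exact (fr.hT i k).add (hf k i ())
  · refine (up' (up fr.bT)).add (MB.mono (C := 1 / δ * (Q ^ 7 * X)) ⟨by positivity, fun i k => (hf' k).2 i ()⟩ ?_)
    calc 1 / δ * (Q ^ 7 * X) ≤ Q * (Q ^ 7 * X) := by gcongr; rw [div_le_iff₀ hd]; exact cx.dQ
      _ = _ := by ring
  · exact (up' (up fr.bP)).mono (by have : 0 ≤ Q ^ 8 * X := by positivity
                                    linarith)
  · refine (fr.hx.add dh).congr' fun σ hσ ψ => ?_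
    have e1 : P σ ψ * (pin (P σ ψ) * E σ ψ) = E σ ψ := by
      rw [← Matrix.mul_assoc, mul_pin (fr.hP σ hσ ψ), Matrix.one_mul]
    beta_reduce
    rw [hh]
    simp only [Matrix.add_mul, Matrix.sub_mul, Matrix.mul_add, Matrix.mul_sub, Matrix.mul_assoc, Matrix.mul_neg, e1]
    abel
  · refine fr.hd.congr' fun σ hσ ψ => ?_
    have e1 : ∀ Z : Matrix (II r l) (II r l) ℝ, P σ ψ * (pin (P σ ψ) * Z) = Z := fun Z => by
      rw [← Matrix.mul_assoc, mul_pin (fr.hP σ hσ ψ), Matrix.one_mul]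
    beta_reduce
    rw [Matrix.mul_sub (P σ ψ) (Eh σ ψ), e1, Matrix.sub_mul]
    abel
  · have c1 := bP'.mulQ ((up' (up bEh0)).mulQ (up' b1) hQ cx.card hsX hX (k := 6) (by omega) (Z := s * (X * X)) (le_of_eq (by ring))) hQ
      cx.card zero_le_one hXX (k := 18) (by omega) (by rw [one_mul])
    have c2 := bP'.mulQ bk hQ cx.card zero_le_one hXX (k := 18) (by omega) (by rw [one_mul])
    exact (c1.subQ hQ hXX c2 (k := 19) (by omega) (by omega)).subQ hQ hXX (n := 18) (r1.mono (le_of_eq (by ring))) (by omega) (by omega)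
  · exact (up' (up bEh0)).subQ hQ hsX (bP'.pin.mulQ ((r2.mono (le_of_eq (by ring)) : MB D s ρ' _ (Q ^ 10 * (s * X))).mulQ bP' hQ cx.card hsX
      zero_le_one (k := 12) (by omega) (by rw [mul_one])) hQ cx.card zero_le_one hsX (k := 14) (by omega) (by rw [one_mul])) (by omega) (by omega)
  · exact ((up' bh).mono hQ7).congr fun σ _ ψ => by rw [add_sub_cancel_left]

omit hr hc in
lemma Sp.ent {A : Matrix (II r l) (II r l) ℝ} (h : Sp A) (i k) : A (Sum.inr i) (Sum.inr k) = -A (Sum.inl k) (Sum.inl i) := by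
  have := congrFun (congrFun h (Sum.inl i)) (Sum.inr k)
  rw [Matrix.add_apply, Jm_inl, mul_Jm, Matrix.neg_apply, Matrix.transpose_apply, Matrix.transpose_transpose, Jm_inr] at this
  simp only [Matrix.zero_apply] at this
  linarith

omit hr hc in
lemma wN_sub (cx : Cx ω D s δ Q w) {g : MF r (II r l) (II r l)} {Y : ℝ} (hg : MB D s ρ g (s * Y)) (j) :
    LR D s (fun σ => wN w g j σ - w j σ) (2 * Y) := by
  have hs := cx.s0
  refine ((cx.LRi.mul ((((hg.2 (Sum.inl (Sum.inr j)) (Sum.inr (Sum.inr j))).sub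
    (hg.2 (Sum.inr (Sum.inr j)) (Sum.inl (Sum.inr j)))).const_mul (1 / 2)).avgLR)).mono ?_).congr fun σ _ => ?_
  · rw [abs_of_pos (by norm_num)]; field_simp; linarith
  · rw [RB.avg_mul, wN, mu]; ring

omit hr hc in
lemma BB_sub (cx : Cx ω D s δ Q w) {w' : Fin l → ℝ → ℝ} {Y : ℝ} (hY : 0 ≤ Y) (h : ∀ j, LR D s (fun σ => w' j σ - w j σ) Y) :
    MB D s ρ (fun σ (_ : Fin r → ℝ) => BB r w' σ - BB r w σ) (s * (3 * Y)) := by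
  have hs := cx.s0
  have hz : ∀ {i k}, (∀ σ, (BB r w' σ - BB r w σ) i k = 0) →
      RB D s ρ (fun σ (_ : Fin r → ℝ) => (BB r w' σ - BB r w σ) i k) (s * (3 * Y)) := fun h =>
    (RB.zero.mono (by positivity)).congr fun σ _ _ => h σ
  have hw := fun j => cx.smul (RB.ofLR (r := r) (ρ := ρ) (h j) hY)
  refine ⟨by positivity, fun i k => ?_⟩
  rcases i with (i | i) | (i | i) <;> rcases k with (k | k) | (k | k)
  all_goals first | (refine hz fun σ => ?_; simp [BB, Matrix.diagonal_apply]; done) | skip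
  · by_cases e : i = k
    · subst e; exact (hw i).congr fun σ _ _ => by simp [BB]; ring
    · exact hz fun σ => by simp [BB, Matrix.diagonal_apply, e]
  · by_cases e : i = k
    · subst e; exact (hw i).neg.congr fun σ _ _ => by simp [BB]; ring
    · exact hz fun σ => by simp [BB, Matrix.diagonal_apply, e]

lemma Fr.rm (fr : Fr ω m V w D s ρ c x Tx P E Eh) (md : Md V m κ C) (cx : Cx ω D s δ Q w)
    (bE : MB D s ρ E (Q ^ 20 * (s * (X * X)))) (bEh : MB D s ρ Eh (Q ^ 15 * (s * X)))
    (hX : 0 ≤ X) (hX1 : Q ^ 24 * X ≤ 1) (h0 : 0 < ρ') (hρ : ρ' + 3 * δ ≤ ρ) (hS : ∀ σ ∈ D, ∀ ψ, Sp (Eh σ ψ)) :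
    MB D s ρ' (fun σ _ => Rm (fun σ ψ => -Eh σ ψ) σ) (Q ^ 59 * (s * (X * X))) (r := r) := by
  have hs := cx.s0
  have hQ0 := cx.Q0
  have hQ := cx.Q2
  have hXX : 0 ≤ s * (X * X) := by positivity
  have hX1' : Q ^ (20 + 1) * X ≤ 1 := le_trans (by gcongr <;> linarith) hX1
  obtain ⟨h1, h2⟩ := fr.R23 hr hc md cx (k := 41) bE bEh hX hX1' h0 hρ (by norm_num) (by norm_num)
  have eE : ∀ {κ : Type} (A : Matrix κ (II r l) ℝ) i k, (A * Ea r l) i k = A i (Sum.inl (Sum.inl k)) := fun A i k => by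
    rw [Matrix.mul_apply]; simp [Ea]
  refine ⟨h2.1, fun i k => ?_⟩
  rcases i with (i | i) | (i | i) <;> rcases k with (k | k) | (k | k)
  any_goals exact RB.zero.mono h2.1
  · refine (((h1.upQ hQ (k := 59) (by norm_num) hXX le_rfl).2 i k).neg).congr fun σ hσ ψ => ?_
    beta_reduce
    rw [EaTJ, eE]
    exact RB.avg_neg _
  · refine ((h2.2 i k).neg).congr fun σ hσ ψ => ?_
    beta_reduce
    rw [Matrix.sub_apply, Matrix.transpose_apply, EaT, EaT, eE, eE]
    simp only [Rm, Matrix.neg_apply, RB.avg_neg, av, Matrix.of_apply]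
    have : (fun ψ => Eh σ ψ (Sum.inr (Sum.inl i)) (Sum.inr (Sum.inl k))) = fun ψ => -Eh σ ψ (Sum.inl (Sum.inl k)) (Sum.inl (Sum.inl i)) :=
      funext fun ψ => (hS σ hσ ψ).ent _ _
    rw [this, RB.avg_neg]
    ring

omit hr hc in
lemma spp_sub (A A' : Matrix (II r l) (II r l) ℝ) : spp (A - A') = spp A - spp A' := by
  rw [sub_eq_add_neg, spp_add, spp_neg, ← sub_eq_add_neg]

lemma Fr.step2 (fr : Fr ω m V w D s ρ c x Tx P E Eh) (md : Md V m κ C) (cx : Cx ω D s δ Q w)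
    (bE : MB D s ρ E (Q ^ 20 * (s * (X * X)))) (bEh : MB D s ρ Eh (Q ^ 15 * (s * X)))
    (hX : 0 ≤ X) (hX1 : Q ^ 24 * X ≤ 1) (h0 : 0 < ρ') (hρ : ρ' + 4 * δ ≤ ρ) :
    ∃ (w' : Fin l → ℝ → ℝ) (P' Eh' : MF r (II r l) (II r l)), Fr ω m V w' D s ρ' (c + Q ^ 26 * X) x Tx P' E Eh' ∧
      MB D s ρ' Eh' (Q ^ 67 * (s * (X * X))) ∧ ∀ j, LR D s (fun σ => w' j σ - w j σ) (Q ^ 16 * X) := by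
  have hs := cx.s0
  have hd := cx.d0
  have h8 := cx.Q8
  have hQ0 := cx.Q0
  have hQ := cx.Q2
  have hsX : 0 ≤ s * X := by positivity
  have hXX : 0 ≤ s * (X * X) := by positivity
  have hS : ∀ σ ∈ D, ∀ ψ, Sp (Eh σ ψ) := fun σ hσ ψ =>
    sp_of_frame fr.hP fr.hd (fun σ _ ψ => Am_sp md.sy σ ψ) (fun σ _ _ => BB_sp) hσ ψ
  have bR := (fr.rm hr hc md cx bE bEh hX hX1 h0 (by linarith) hS).spp
  have bg : MB D s ρ (fun σ ψ => -Eh σ ψ) (s * (Q ^ 15 * X)) := bEh.neg.mono (le_of_eq (by ring))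
  obtain ⟨M, bM, dM⟩ := cx.solM bg h0 hρ fun σ hσ ψ j => by
    rw [Matrix.neg_apply, (hS σ hσ ψ).ent, Matrix.neg_apply]
  have bw := wN_sub cx bg
  obtain ⟨w', hw'⟩ : ∃ w', w' = wN w (fun σ ψ => -Eh σ ψ) := ⟨_, rfl⟩
  obtain ⟨R, hR⟩ : ∃ R : ℝ → Matrix (II r l) (II r l) ℝ, R = Rm (fun σ ψ => -Eh σ ψ) := ⟨_, rfl⟩
  rw [← hw'] at dM bw
  rw [← hR] at dM bR
  have bdB := BB_sub (r := r) (ρ := ρ') cx (by positivity) bw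
  have dS := (dM.spp.csmul fun _ => 1 / 2)
  have bK : MB D s ρ' (fun σ ψ => (1 / 2 : ℝ) • spp (M σ ψ)) (1 / 2 * (Q ^ 22 * X)) :=
    (bM.spp.csmul (1 / 2)).mono (le_of_eq (by rw [abs_of_pos (by norm_num)]; ring))
  obtain ⟨K, hK⟩ : ∃ K : MF r (II r l) (II r l), K = fun σ ψ => (1 / 2 : ℝ) • spp (M σ ψ) := ⟨_, rfl⟩
  rw [← hK] at bK dS
  have hKM : ∀ σ ψ, K σ ψ + K σ ψ = spp (M σ ψ) := fun σ ψ => by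
    rw [hK]; beta_reduce; rw [← add_smul]; norm_num
  have hKs : ∀ σ ∈ D, ∀ ψ, Sp (K σ ψ) := fun σ _ ψ => by
    have := spp_sp (M σ ψ)
    rw [hK]; unfold Sp at this ⊢
    rw [Matrix.transpose_smul, Matrix.smul_mul, Matrix.mul_smul, ← smul_add, this, smul_zero]
  have hq : Q ^ 23 * X ≤ 1 := le_trans (by gcongr <;> linarith) hX1
  obtain ⟨Y, Yp, bY, bYp, hP', hd'⟩ := cayley (Ap := Am m V x) (E' := Eh) (dB := fun σ _ => BB r w' σ - BB r w σ) fr.hP fr.hd bK dS hKs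
    (by calc (Fintype.card (II r l) : ℝ) * (1 / 2 * (Q ^ 22 * X)) ≤ Q * (1 / 2 * (Q ^ 22 * X)) := by gcongr; exact cx.card
          _ ≤ 1 / 2 := by linarith) h0 (fun σ _ ψ => by rw [sub_self, mul_zero, add_zero])
  have up : ∀ {ι κ : Type} {M : MF r ι κ} {Y : ℝ}, MB D s ρ M Y → MB D s ρ' M Y := fun h =>
    h.mono_rho h0.le (by linarith)
  obtain ⟨bP, -⟩ := fr.bQ hr hc cx
  replace bP := up bP
  have hq0 : 0 ≤ Q ^ 22 * X := by positivity
  have hq1 : Q ^ 22 * X ≤ Q ^ 23 * X := by gcongr <;> linarith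
  have bY1 : MB D s ρ' Y (Q ^ 1 * 1) := ((bY.add MB.one).congr fun σ _ ψ => by rw [sub_add_cancel]).mono (by linarith)
  have bYp1 : MB D s ρ' Yp (Q ^ 1 * 1) := ((bYp.add MB.one).congr fun σ _ ψ => by rw [sub_add_cancel]).mono (by linarith)
  have bY2 : MB D s ρ' (fun σ ψ => Y σ ψ - 1) (Q ^ 22 * X) := bY.mono (by linarith)
  have hle : ∀ {a : ℝ}, a ≤ c → a ≤ c + Q ^ 26 * X := fun h => by
    have : 0 ≤ Q ^ 26 * X := by positivity
    linarith
  simp only [add_sub_cancel] at hd'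
  refine ⟨w', _, _, ⟨(up fr.bx).mono (hle le_rfl), fr.hT, (up fr.bT).mono (hle le_rfl), hP', ?_, fr.hx, hd'⟩, ?_, fun j => (bw j).mono ?_⟩
  · refine (((up fr.bP).add (bP.mulQ (bY2.addQ hQ hX bY2 (k := 23) le_rfl le_rfl) hQ cx.card zero_le_one hX (k := 26) (by omega)
      (by rw [one_mul])))).congr fun σ _ ψ => ?_
    noncomm_ring
  · have bK1 : MB D s ρ' K (Q ^ 22 * X) := bK.mono (by linarith)
    have bK0 : MB D s ρ' K (Q ^ 0 * 1) := bK1.mono (by linarith)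
    have bd : MB D s ρ' (fun σ (_ : Fin r → ℝ) => BB r w' σ - BB r w σ) (Q ^ 17 * (s * X)) := bdB.mono (by
      calc s * (3 * (2 * (Q ^ 15 * X))) = 6 * (Q ^ 15 * (s * X)) := by ring
        _ ≤ (Q * Q) * (Q ^ 15 * (s * X)) := by gcongr; nlinarith
        _ = _ := by ring)
    have bE1 := up bEh
    have c1 := (bK1.mulQ bd hQ cx.card hX hsX (k := 40) (by omega) (Z := s * (X * X)) (le_of_eq (by ring))).subQ hQ hXX
      (bd.mulQ bK1 hQ cx.card hsX hX (k := 40) (by omega) (Z := s * (X * X)) (le_of_eq (by ring))) (k := 58) (by omega) (by omega)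
    have c2 := (bE1.mulQ bK1 hQ cx.card hsX hX (k := 40) (by omega) (Z := s * (X * X)) (le_of_eq (by ring))).subQ hQ hXX
      (bK1.mulQ bE1 hQ cx.card hX hsX (k := 40) (by omega) (Z := s * (X * X)) (le_of_eq (by ring))) (k := 59) (by omega) (by omega)
    have c3 := (bK1.mulQ (bd.addQ hQ hsX bE1 (k := 18) (by omega) (by omega)) hQ cx.card hX hsX (k := 41) (by omega)
      (Z := s * (X * X)) (le_of_eq (by ring))).mulQ bK0 hQ cx.card hXX zero_le_one (k := 61) (by omega) (by rw [mul_one])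
    have cW := (((c1.subQ hQ hXX bR (k := 60) (by omega) (by omega)).addQ hQ hXX c2 (k := 61) (by omega) (by omega)).subQ hQ hXX c3 (k := 62) (by omega) (by omega))
    refine ((bYp1.mulQ cW hQ cx.card zero_le_one hXX (k := 64) (by omega) (by rw [one_mul])).mulQ bY1 hQ cx.card hXX zero_le_one (k := 67) (by omega)
      (by rw [mul_one])).congr fun σ hσ ψ => ?_
    have e1 : ∀ Z : Matrix (II r l) (II r l) ℝ, (1 / 2 : ℝ) • Z + (1 / 2 : ℝ) • Z = Z := fun Z => by rw [← add_smul]; norm_num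
    have e2 : Sp (BB r w' σ - BB r w σ) := by
      have a := BB_sp (r := r) (w := w') (σ := σ)
      have b := BB_sp (r := r) (w := w) (σ := σ)
      unfold Sp at a b ⊢
      rw [Matrix.transpose_sub, sub_mul, mul_sub, sub_add_sub_comm, a, b, sub_zero]
    beta_reduce
    rw [e1, hKM, spp_sub, spp_sub, spp_add, spp_comm BB_sp, spp_of e2, spp_neg, spp_of (hS σ hσ ψ)]
    congr 2
    noncomm_ring
  · calc 2 * (Q ^ 15 * X) ≤ Q * (Q ^ 15 * X) := by gcongr
      _ = _ := by ring

lemma Fr.step (fr : Fr ω m V w D s ρ c x Tx P E Eh) (md : Md V m κ C) (cx : Cx ω D s δ Q w) (hC0 : 0 ≤ C) (hCQ : C ≤ Q)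
    (bE : MB D s ρ E (s * X)) (bEh : MB D s ρ Eh (s * X)) (hX : 0 ≤ X) (hX1 : Q ^ 67 * X ≤ 1) (h0 : 0 < ρ') (hρ : ρ' + 7 * δ ≤ ρ)
    (hκ : ρ + c + Q ^ 67 * X + δ ≤ κ) (hc' : 6 * (Fintype.card (II r l) : ℝ) ^ 2 * (c + Q ^ 67 * X) ≤ 1) :
    ∃ (w' : Fin l → ℝ → ℝ) (x' : MF r (II r l) Unit) (Tx' : MF r (II r l) (Fin r)) (P' : MF r (II r l) (II r l))
      (E' : MF r (II r l) Unit) (Eh' : MF r (II r l) (II r l)),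
      Fr ω m V w' D s ρ' (c + Q ^ 67 * X) x' Tx' P' E' Eh' ∧ MB D s ρ' E' (s * (Q ^ 67 * (X * X))) ∧
      MB D s ρ' Eh' (s * (Q ^ 67 * (X * X))) ∧ MB D s ρ' (fun σ ψ => x' σ ψ - x σ ψ) (Q ^ 67 * X) ∧
      ∀ j, LR D s (fun σ => w' j σ - w j σ) (Q ^ 67 * X) := by
  have hs := cx.s0
  have hd := cx.d0
  have hQ0 := cx.Q0
  have hQ := cx.Q2
  have hQ1 : 1 ≤ Q := by linarith
  have hq : ∀ k ≤ 67, Q ^ k * X ≤ Q ^ 67 * X := fun k hk => by gcongr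
  have h2 : Q ^ 8 * X + Q ^ 26 * X ≤ Q ^ 67 * X := by
    have a1 : Q ^ 8 * X ≤ Q ^ 26 * X := by gcongr; norm_num
    calc Q ^ 8 * X + Q ^ 26 * X ≤ 2 * (Q ^ 26 * X) := by linarith
      _ ≤ Q * (Q ^ 26 * X) := by gcongr
      _ = Q ^ 27 * X := by ring
      _ ≤ _ := hq 27 (by norm_num)
  have hN : (0 : ℝ) ≤ Fintype.card (II r l) := by positivity
  obtain ⟨x', Tx', E', Eh', f1, b1, b2, b3⟩ := fr.step1 hr hc md cx hC0 hCQ bE bEh hX (ρ' := ρ' + 4 * δ) (by linarith) (by linarith)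
    (by linarith [hq 8 (by norm_num)])
  obtain ⟨w', P', Eh'', f2, b4, b5⟩ := f1.step2 hr (by
    refine le_trans (mul_le_mul_of_nonneg_left ?_ (by positivity)) hc'
    linarith [hq 8 (by norm_num)]) md cx b1 b2 hX ((hq 24 (by norm_num)).trans hX1) h0 le_rfl
  refine ⟨w', x', Tx', P', E', Eh'', ⟨f2.bx.mono (by linarith), f2.hT, f2.bT.mono (by linarith), f2.hP, f2.bP.mono (by linarith), f2.hx, f2.hd⟩,
    (b1.mono_rho h0.le (by linarith)).mono ?_, b4.mono (le_of_eq (by ring)), (b3.mono_rho h0.le (by linarith)).mono (hq 8 (by norm_num)),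
    fun j => (b5 j).mono (hq 16 (by norm_num))⟩
  calc Q ^ 20 * (s * (X * X)) ≤ Q ^ 67 * (s * (X * X)) := by gcongr; norm_num
    _ = _ := by ring

end

end KAM


open MeasureTheory Real Filter

namespace KAM

noncomputable section

variable {r l : ℕ} {ω : Fin r → ℝ} {D : Set ℝ} {s δ Q : ℝ} {w : Fin l → ℝ → ℝ} {ρ κ C μ g Λ Y : ℝ} {T : ℕ}
variable {V : (JJ r l → ℝ) → ℝ} {m : JJ r l → ℝ}

lemma LB_inv {u : ℝ → ℝ} {γ L : ℝ} (hγ : 0 < γ) (hL : 0 ≤ L) (h : ∀ σ ∈ D, γ ≤ |u σ|)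
    (h' : ∀ σ ∈ D, ∀ σ' ∈ D, |u σ - u σ'| ≤ L * |σ - σ'|) :
    LB D s (fun σ => (Complex.I * (u σ : ℂ))⁻¹) (1 / γ + |s| * L / γ ^ 2) := by
  refine LB.of_le (fun σ hσ => ?_) (by positivity) fun σ hσ σ' hσ' => ?_
  · rw [norm_inv, norm_mul, Complex.norm_I, one_mul, Complex.norm_real, one_div]
    exact inv_anti₀ hγ (h σ hσ)
  · have a := h σ hσ
    have b := h σ' hσ'
    have a0 : u σ ≠ 0 := fun e => by rw [e, abs_zero] at a; linarith
    have b0 : u σ' ≠ 0 := fun e => by rw [e, abs_zero] at b; linarith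
    have e : (Complex.I * (u σ : ℂ))⁻¹ - (Complex.I * (u σ' : ℂ))⁻¹ = ((u σ' - u σ : ℝ) : ℂ) / (Complex.I * ((u σ * u σ' : ℝ) : ℂ)) := by
      have := Complex.ofReal_ne_zero.mpr a0
      have := Complex.ofReal_ne_zero.mpr b0
      push_cast
      field_simp [Complex.I_ne_zero]
    rw [e, norm_div, norm_mul, Complex.norm_I, one_mul, Complex.norm_real, Complex.norm_real, Real.norm_eq_abs, Real.norm_eq_abs,
      abs_mul, abs_sub_comm, mul_div_assoc, mul_assoc, div_mul_eq_mul_div]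
    have h1 := h' σ hσ σ' hσ'
    gcongr
    nlinarith

lemma th_sub (w u : Fin l → ℝ → ℝ) (t σ) : th (fun j σ => w j σ - u j σ) t σ = th w t σ - th u t σ := by
  rcases t with j | p | p <;> simp only [th]
  · ring
  · ring
  · split_ifs <;> ring

lemma th_LR (h : ∀ j, LR D s (w j) μ) (hμ : 0 ≤ μ) (t) : LR D s (th w t) (2 * μ) := by
  rcases t with j | p | p <;> simp only [th]
  · exact (h j).neg.mono (by linarith)
  · exact ((h _).add (h _)).neg.mono (by linarith)
  · split_ifs
    · exact (h _).neg.mono (by linarith)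
    · exact ((h _).sub (h _)).mono (by linarith)

lemma th_const (la : Fin l → ℝ) (t σ) : th (fun j _ => la j) t σ = th (fun j _ => la j) t 0 := by
  rcases t with j | p | p <;> simp only [th]
  split_ifs <;> rfl

def Gs (ω : Fin r → ℝ) (w : Fin l → ℝ → ℝ) (g : ℝ) (T : ℕ) : Set ℝ :=
  {σ | ∀ t, ∀ ν : Fin r → ℤ, ν ≠ 0 → g / (1 + nrm ν) ^ T ≤ |dt ν ω - σ * th w t σ|}

structure Pm (ω : Fin r → ℝ) (la : Fin l → ℝ) (m : JJ r l → ℝ) (V : (JJ r l → ℝ) → ℝ) (κ C g Λ : ℝ) (T : ℕ) (δ Q Y s : ℝ) : Prop where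
  hr : 0 < r
  g0 : 0 < g
  g1 : g ≤ 1
  gap : ∀ t, 2 * g ≤ |th (fun j _ => la j) t 0|
  L1 : 1 ≤ Λ
  LQ : Λ ≤ Q
  la1 : ∀ j, |la j| ≤ Λ - 1
  dio : ∀ ν : Fin r → ℤ, ν ≠ 0 → g / (1 + nrm ν) ^ T ≤ |dt ν ω|
  T1 : 1 ≤ T
  md : Md V m κ C
  C0 : 0 ≤ C
  CQ : C ≤ Q
  Q8 : 8 ≤ Q
  card : (Fintype.card (II r l) : ℝ) ≤ Q
  d0 : 0 < δ
  d1 : δ ≤ 1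
  dQ : 1 ≤ Q * δ
  om : ∀ k, |ω k| ≤ Q * δ
  hQ : 7 * Λ / g ^ 2 * ((2 * T).factorial * 3) ≤ Q * δ ^ (2 * T)
  s0 : 0 < s
  s1 : s ≤ 1
  Y0 : 0 ≤ Y
  Y1 : Y ≤ 1 / 2
  Yg : 3 * Y ≤ g / 4
  YN : 6 * (Fintype.card (II r l) : ℝ) ^ 2 * (3 * Y) ≤ 1
  Yk : 16 * δ + 3 * Y ≤ κ

lemma pow_exp {x : ℝ} (hx : 0 ≤ x) (hd : 0 < δ) (hd1 : δ ≤ 1) (k : ℕ) : (1 + x) ^ k * δ ^ k ≤ k.factorial * 3 * exp (δ * x) := by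
  have h1 := Real.pow_div_factorial_le_exp (x := δ * (1 + x)) (by positivity) k
  rw [div_le_iff₀ (by positivity)] at h1
  have h3 : exp δ ≤ 3 := (exp_le_exp.mpr hd1).trans (by linarith [Real.exp_one_lt_d9])
  calc (1 + x) ^ k * δ ^ k = (δ * (1 + x)) ^ k := by rw [mul_pow, mul_comm]
    _ ≤ _ := h1
    _ = exp δ * exp (δ * x) * k.factorial := by rw [← exp_add]; ring_nf
    _ ≤ 3 * exp (δ * x) * k.factorial := by gcongr
    _ = _ := by ring

lemma nrm_nonneg' (ν : Fin r → ℤ) : 0 ≤ nrm ν := Finset.sum_nonneg fun _ _ => abs_nonneg _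

lemma mkGo {θ : ℝ → ℝ} (hs : 0 < s) (s1 : s ≤ 1) (hD : D ⊆ Set.Icc s (2 * s)) (hg : 0 < g) (g1 : g ≤ 1) (hL : 1 ≤ Λ)
    (hθ : LR D s θ (2 * Λ)) (h0 : ∀ σ ∈ D, g ≤ |θ σ|)
    (h1 : ∀ σ ∈ D, ∀ ν : Fin r → ℤ, ν ≠ 0 → g / (1 + nrm ν) ^ T ≤ |dt ν ω - σ * θ σ|)
    (hQ : ∀ x : ℝ, 0 ≤ x → 7 * Λ / g ^ 2 * (1 + x) ^ (2 * T) ≤ Q * exp (δ * x)) : Go ω D s δ Q θ := by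
  have hlip : ∀ ν : Fin r → ℤ, ∀ σ ∈ D, ∀ σ' ∈ D, |(dt ν ω - σ * θ σ) - (dt ν ω - σ' * θ σ')| ≤ 6 * Λ * |σ - σ'| := fun ν σ hσ σ' hσ' => by
    have a := hθ.lip hσ hσ'
    have b := hθ.abs_le hσ
    have c := hD hσ'
    rw [abs_of_pos hs] at a
    have e : (dt ν ω - σ * θ σ) - (dt ν ω - σ' * θ σ') = -((σ - σ') * θ σ) - σ' * (θ σ - θ σ') := by ring
    rw [e]
    refine (abs_sub _ _).trans ?_
    rw [abs_neg, abs_mul, abs_mul, abs_of_pos (hs.trans_le c.1)]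
    have : σ' * |θ σ - θ σ'| ≤ 2 * (2 * Λ * |σ - σ'|) := by
      refine (mul_le_mul_of_nonneg_right c.2 (abs_nonneg _)).trans ?_
      linarith
    nlinarith [abs_nonneg (σ - σ')]
  have key : ∀ ν : Fin r → ℤ, ∃ γ, 0 < γ ∧ (∀ σ ∈ D, γ ≤ |dt ν ω - σ * θ σ|) ∧ 1 / γ + |s| * (6 * Λ) / γ ^ 2 ≤ Q / s * exp (δ * nrm ν) := fun ν => by
    by_cases hν : ν = 0
    · refine ⟨s * g, by positivity, fun σ hσ => ?_, ?_⟩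
      · have : dt ν ω = 0 := by simp [hν, dt]
        rw [this, zero_sub, abs_neg, abs_mul, abs_of_pos (hs.trans_le (hD hσ).1)]
        exact mul_le_mul (hD hσ).1 (h0 σ hσ) hg.le (hs.trans_le (hD hσ).1).le
      · have e : nrm ν = 0 := by simp [hν, nrm]
        have := hQ 0 le_rfl
        rw [e, mul_zero, exp_zero, mul_one, abs_of_pos hs]
        rw [mul_zero, exp_zero, add_zero, one_pow, mul_one, mul_one] at this
        calc 1 / (s * g) + s * (6 * Λ) / (s * g) ^ 2 = (g + 6 * Λ) / g ^ 2 / s := by field_simp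
          _ ≤ 7 * Λ / g ^ 2 / s := by gcongr; linarith
          _ ≤ _ := by gcongr
    · have hn := nrm_nonneg' ν
      refine ⟨g / (1 + nrm ν) ^ T, by positivity, fun σ hσ => h1 σ hσ ν hν, ?_⟩
      have a : (1 : ℝ) ≤ (1 + nrm ν) ^ T := one_le_pow₀ (by linarith)
      have := hQ _ hn
      rw [pow_mul'] at this
      obtain ⟨n, hn'⟩ : ∃ n, n = (1 + nrm ν) ^ T := ⟨_, rfl⟩
      rw [← hn'] at this a ⊢
      rw [abs_of_pos hs]
      calc 1 / (g / n) + s * (6 * Λ) / (g / n) ^ 2 = (g + s * (6 * Λ) * n) * n / g ^ 2 := by field_simp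
        _ ≤ (n + 1 * (6 * Λ) * n) * n / g ^ 2 := by gcongr; linarith
        _ = (1 + 6 * Λ) / g ^ 2 * n ^ 2 := by ring
        _ ≤ 7 * Λ / g ^ 2 * n ^ 2 := by gcongr; linarith
        _ ≤ _ := this
        _ ≤ Q / s * exp (δ * nrm ν) := by
          have hq := hQ 0 le_rfl
          rw [mul_zero, exp_zero, mul_one] at hq
          have : 0 ≤ Q := le_trans (by positivity) hq
          exact mul_le_mul_of_nonneg_right (le_div_self this hs s1) (exp_pos _).le
  refine ⟨fun ν => ?_, fun σ hσ ν e => ?_⟩ <;> obtain ⟨γ, h2, h3, h4⟩ := key ν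
  · exact (LB_inv h2 (by positivity) h3 (hlip ν)).mono h4
  · have := h3 σ hσ
    rw [e, abs_zero] at this
    linarith

namespace Pm

variable {la : Fin l → ℝ} (pm : Pm ω la m V κ C g Λ T δ Q Y s)
include pm

lemma exQ (n : ℕ) {x : ℝ} (hx : 0 ≤ x) : 7 * Λ / (g / 2 ^ n) ^ 2 * (1 + x) ^ (2 * T) ≤ Q * (2 ^ (2 * T + 2)) ^ n * exp (δ / 2 ^ n * x) := by
  have hd := pm.d0
  have hL : 0 ≤ Λ := by linarith [pm.L1]
  have hg := pm.g0
  have h := pow_exp hx (δ := δ / 2 ^ n) (by positivity) ((div_le_self hd.le (one_le_pow₀ (by norm_num))).trans pm.d1) (2 * T)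
  refine le_of_mul_le_mul_right ?_ (show 0 < δ ^ (2 * T) by positivity)
  rw [div_pow, mul_div_assoc', div_le_iff₀ (by positivity)] at h
  have e : ((2 : ℝ) ^ n) ^ (2 * T) * (2 ^ n) ^ 2 = (2 ^ (2 * T + 2)) ^ n := by rw [← pow_add, ← pow_mul, ← pow_mul, mul_comm]
  calc _ = 7 * Λ / g ^ 2 * ((1 + x) ^ (2 * T) * δ ^ (2 * T)) * (2 ^ n) ^ 2 := by field_simp
    _ ≤ _ := mul_le_mul_of_nonneg_right (mul_le_mul_of_nonneg_left h (by positivity)) (by positivity)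
    _ = 7 * Λ / g ^ 2 * ((2 * T).factorial * 3) * (exp (δ / 2 ^ n * x) * (2 ^ (2 * T + 2)) ^ n) := by rw [← e]; ring
    _ ≤ _ := mul_le_mul_of_nonneg_right pm.hQ (by positivity)
    _ = _ := by ring

lemma gapw (h : ∀ j, LR D s (fun σ => w j σ - la j) (g / 4)) (t) {σ : ℝ} (hσ : σ ∈ D) : g ≤ |th w t σ| := by
  have hg := pm.g0
  have a := (th_LR h (by positivity) t).abs_le hσ
  rw [th_sub w (fun j _ => la j), th_const] at a
  have b := pm.gap t
  have c := abs_sub_abs_le_abs_sub (th (fun j _ => la j) t 0) (th w t σ)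
  rw [abs_sub_comm] at c
  linarith

lemma w1 (h : ∀ j, LR D s (fun σ => w j σ - la j) (g / 4)) (j) : LR D s (w j) Λ :=
  (((h j).add (LR.const (la j))).congr fun σ _ => by ring).mono (by linarith [pm.la1 j, pm.g1])

lemma q1 (n : ℕ) : Q ≤ Q * (2 ^ (2 * T + 2)) ^ n :=
  le_mul_of_one_le_right (by linarith [pm.Q8]) (one_le_pow₀ (one_le_pow₀ (by norm_num)))

lemma q2 (n : ℕ) : Q * δ ≤ Q * (2 ^ (2 * T + 2)) ^ n * (δ / 2 ^ n) := by
  have hd := pm.d0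
  have h8 := pm.Q8
  rw [mul_div_assoc', le_div_iff₀ (by positivity)]
  have : (2 : ℝ) ^ n ≤ (2 ^ (2 * T + 2)) ^ n := by
    gcongr
    exact le_self_pow₀ (by norm_num) (by have := pm.T1; omega)
  calc Q * δ * 2 ^ n ≤ Q * δ * (2 ^ (2 * T + 2)) ^ n := by gcongr
    _ = _ := by ring

lemma cx (n : ℕ) (hD : D ⊆ Set.Icc s (2 * s)) (hG : D ⊆ Gs ω w (g / 2 ^ n) T) (h : ∀ j, LR D s (fun σ => w j σ - la j) (g / 4)) :
    Cx ω D s (δ / 2 ^ n) (Q * (2 ^ (2 * T + 2)) ^ n) w where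
  s0 := pm.s0
  s1 := pm.s1
  Ds := hD
  Q8 := pm.Q8.trans (pm.q1 n)
  card := pm.card.trans (pm.q1 n)
  d0 := by have := pm.d0; positivity
  dQ := pm.dQ.trans (pm.q2 n)
  om k := (pm.om k).trans (pm.q2 n)
  w1 j := (pm.w1 h j).mono (pm.LQ.trans (pm.q1 n))
  ne0 ν hν e := by
    have a := pm.dio ν hν
    have := pm.g0
    have := nrm_nonneg' ν
    rw [e, abs_zero] at a
    exact absurd a (not_le.mpr (by positivity))
  sd0 ν := by
    have hg := pm.g0
    have hn := nrm_nonneg' ν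
    have hL := pm.L1
    have hs := pm.s0
    have h8 := pm.Q8.trans (pm.q1 n)
    have h2 : g / 2 ^ n ≤ g := div_le_self hg.le (one_le_pow₀ (by norm_num))
    have hq := (show 7 * Λ / g ^ 2 * (1 + nrm ν) ^ (2 * T) ≤ _ by gcongr).trans (pm.exQ n hn)
    simp only [mul_zero, sub_zero]
    have b : Q * (2 ^ (2 * T + 2)) ^ n * exp (δ / 2 ^ n * nrm ν) ≤ Q * (2 ^ (2 * T + 2)) ^ n / s * exp (δ / 2 ^ n * nrm ν) := by
      gcongr
      exact le_div_self (by linarith) hs pm.s1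
    refine LB.mono ?_ b
    by_cases hν : ν = 0
    · refine ((LB.const (s := s) (0 : ℂ)).congr fun σ _ => ?_).mono ?_
      · simp [hν, dt]
      · rw [norm_zero]; positivity
    · refine (LB_inv (u := fun _ => dt ν ω) (γ := g / (1 + nrm ν) ^ T) (by positivity) le_rfl (fun _ _ => pm.dio ν hν) (by simp)).mono (le_trans ?_ hq)
      have a : (1 : ℝ) ≤ (1 + nrm ν) ^ T := one_le_pow₀ (by linarith)
      rw [mul_zero, zero_div, add_zero, pow_mul', one_div_div, sq]
      calc (1 + nrm ν) ^ T / g ≤ (1 + nrm ν) ^ T * 1 / g ^ 2 := by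
            rw [mul_one, div_le_div_iff₀ hg (by positivity)]
            nlinarith [pm.g1, mul_nonneg (by positivity : (0 : ℝ) ≤ (1 + nrm ν) ^ T * g) (sub_nonneg.mpr pm.g1)]
        _ ≤ (1 + nrm ν) ^ T * (7 * Λ * (1 + nrm ν) ^ T) / g ^ 2 := by gcongr; nlinarith
        _ = _ := by ring
  go t := by
    have h2 : g / 2 ^ n ≤ g := div_le_self pm.g0.le (one_le_pow₀ (by norm_num))
    exact mkGo pm.s0 pm.s1 hD (div_pos pm.g0 (by positivity)) (h2.trans pm.g1) pm.L1 (th_LR (pm.w1 h) (by linarith [pm.L1]) t) (fun σ hσ => h2.trans (pm.gapw h t hσ))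
        (fun σ hσ => hG hσ t) fun x hx => pm.exQ n hx

end Pm

end

end KAM


open MeasureTheory Real Filter

namespace KAM

noncomputable section

variable {r l : ℕ} {ω : Fin r → ℝ} {D : Set ℝ} {s δ Q : ℝ} {w : Fin l → ℝ → ℝ} {ρ κ C g Λ Y c : ℝ} {T : ℕ}
variable {V : (JJ r l → ℝ) → ℝ} {m : JJ r l → ℝ} {la : Fin l → ℝ}

lemma Fr.up {x E : MF r (II r l) Unit} {Tx : MF r (II r l) (Fin r)} {P Eh : MF r (II r l) (II r l)} {D' : Set ℝ} {c' : ℝ}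
    (fr : Fr ω m V w D s ρ c x Tx P E Eh) (hD : D' ⊆ D) (hc : c ≤ c') : Fr ω m V w D' s ρ c' x Tx P E Eh :=
  ⟨(fr.bx.mono_set hD).mono hc, fun i k σ hσ => fr.hT i k σ (hD hσ), (fr.bT.mono_set hD).mono hc, fun σ hσ => fr.hP σ (hD hσ),
    (fr.bP.mono_set hD).mono hc, fr.hx.mono_set hD, fr.hd.mono_set hD⟩

structure St (r l : ℕ) where
  D : Set ℝ
  w : Fin l → ℝ → ℝ
  x : MF r (II r l) Unit
  Tx : MF r (II r l) (Fin r)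
  P : MF r (II r l) (II r l)
  E : MF r (II r l) Unit
  Eh : MF r (II r l) (II r l)

def XX (Q Y : ℝ) (T n : ℕ) : ℝ := Y ^ (n + 1) / (Q ^ 67 * ((2 ^ (2 * T + 2)) ^ 67) ^ (n + 1))

def cc (Y : ℝ) (n : ℕ) : ℝ := 3 * Y - 2 * Y * (1 / 2) ^ n

structure Inv (ω : Fin r → ℝ) (la : Fin l → ℝ) (m : JJ r l → ℝ) (V : (JJ r l → ℝ) → ℝ) (s δ Q Y : ℝ) (T n : ℕ) (S : St r l) : Prop where
  iD : S.D ⊆ Set.Icc s (2 * s)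
  fr : Fr ω m V S.w S.D s (δ + 14 * (δ / 2 ^ n)) (cc Y n) S.x S.Tx S.P S.E S.Eh
  bE : MB S.D s (δ + 14 * (δ / 2 ^ n)) S.E (s * XX Q Y T n)
  bEh : MB S.D s (δ + 14 * (δ / 2 ^ n)) S.Eh (s * XX Q Y T n)
  iw : ∀ j, LR S.D s (fun σ => S.w j σ - la j) (cc Y n)

structure Rel (ω : Fin r → ℝ) (g s δ Y : ℝ) (T n : ℕ) (S S' : St r l) : Prop where
  rD : S'.D = S.D ∩ Gs ω S.w (g / 2 ^ n) T
  rx : MB S'.D s δ (fun σ ψ => S'.x σ ψ - S.x σ ψ) (Y ^ (n + 1))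
  rw : ∀ j, LR S'.D s (fun σ => S'.w j σ - S.w j σ) (Y ^ (n + 1))

lemma cc_le (hY : 0 ≤ Y) (n : ℕ) : cc Y n ≤ 3 * Y := by
  have : 0 ≤ 2 * Y * (1 / 2) ^ n := by positivity
  unfold cc; linarith

lemma Pm.step (pm : Pm ω la m V κ C g Λ T δ Q Y s) {n : ℕ} {S : St r l} (iv : Inv ω la m V s δ Q Y T n S) :
    ∃ S', Inv ω la m V s δ Q Y T (n + 1) S' ∧ Rel ω g s δ Y T n S S' := by
  have hY := pm.Y0
  have hd := pm.d0
  have hs := pm.s0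
  have hQ : 0 < Q := by linarith [pm.Q8]
  have hY1 : Y ≤ 1 := by linarith [pm.Y1]
  obtain ⟨b, hb⟩ : ∃ b : ℝ, b = 2 ^ (2 * T + 2) := ⟨_, rfl⟩
  have hb1 : 1 ≤ b := hb ▸ one_le_pow₀ (by norm_num)
  have hX : XX Q Y T n = Y ^ (n + 1) / (Q ^ 67 * (b ^ 67) ^ (n + 1)) := by rw [hb]; rfl
  have hX' : XX Q Y T (n + 1) = Y ^ (n + 2) / (Q ^ 67 * (b ^ 67) ^ (n + 2)) := by rw [hb]; rfl
  have e1 : (Q * b ^ n) ^ 67 * XX Q Y T n = Y ^ (n + 1) / b ^ 67 := by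
    rw [hX, mul_pow, ← pow_mul, mul_comm n, pow_mul, pow_succ (b ^ 67) n]; field_simp
  have h1 : (Q * b ^ n) ^ 67 * XX Q Y T n ≤ Y ^ (n + 1) := by
    rw [e1]; exact div_le_self (by positivity) (one_le_pow₀ hb1)
  have h2 : (Q * b ^ n) ^ 67 * (XX Q Y T n * XX Q Y T n) ≤ XX Q Y T (n + 1) := by
    rw [← mul_assoc, e1, hX, hX', div_mul_div_comm, div_le_div_iff₀ (by positivity) (by positivity)]
    calc Y ^ (n + 1) * Y ^ (n + 1) * (Q ^ 67 * (b ^ 67) ^ (n + 2)) = Y ^ n * (Y ^ (n + 2) * (b ^ 67 * (Q ^ 67 * (b ^ 67) ^ (n + 1)))) := by ring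
      _ ≤ 1 * (Y ^ (n + 2) * (b ^ 67 * (Q ^ 67 * (b ^ 67) ^ (n + 1)))) := by gcongr; exact pow_le_one₀ hY hY1
      _ = _ := one_mul _
  have h3 : Y ^ (n + 1) ≤ Y * (1 / 2) ^ n := by
    rw [pow_succ, mul_comm]; gcongr; exact pm.Y1
  have h4 : cc Y n + Y ^ (n + 1) ≤ cc Y (n + 1) := by
    unfold cc; rw [pow_succ (1 / 2 : ℝ) n]; linarith
  have h5 := cc_le hY (n + 1)
  have h6 : (0 : ℝ) ≤ Y ^ (n + 1) := by positivity
  have h7 : 0 ≤ XX Q Y T n := by rw [hX]; exact div_nonneg h6 (by positivity)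
  have hdn : δ / 2 ^ n ≤ δ := div_le_self hd.le (one_le_pow₀ (by norm_num))
  have hdn' : δ / 2 ^ (n + 1) = δ / 2 ^ n / 2 := by rw [pow_succ]; field_simp
  have hd0 : 0 < δ / 2 ^ n := by positivity
  have hDD : S.D ∩ Gs ω S.w (g / 2 ^ n) T ⊆ S.D := Set.inter_subset_left
  have hw := fun j => ((iv.iw j : LB _ _ _ _).mono_set hDD : LR (S.D ∩ Gs ω S.w (g / 2 ^ n) T) s (fun σ => S.w j σ - la j) (cc Y n))
  have cx := pm.cx n (hDD.trans iv.iD) Set.inter_subset_right fun j => (hw j).mono (by linarith [pm.Yg])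
  rw [← hb] at cx
  have hN : ∀ {c}, c ≤ 3 * Y → 6 * (Fintype.card (II r l) : ℝ) ^ 2 * c ≤ 1 := fun h =>
    (mul_le_mul_of_nonneg_left h (by positivity)).trans pm.YN
  obtain ⟨w', x', Tx', P', E', Eh', f, b1, b2, b3, b4⟩ := (iv.fr.up hDD le_rfl).step pm.hr (hN (by linarith)) pm.md cx pm.C0
    (pm.CQ.trans (hb ▸ pm.q1 n)) (iv.bE.mono_set hDD) (iv.bEh.mono_set hDD) h7
    (h1.trans (pow_le_one₀ hY hY1)) (ρ' := δ + 14 * (δ / 2 ^ (n + 1))) (by positivity) (by rw [hdn']; linarith) (by linarith [pm.Yk]) (hN (by linarith))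
  refine ⟨⟨_, w', x', Tx', P', E', Eh'⟩, ⟨hDD.trans iv.iD, f.up le_rfl (by linarith), b1.mono ?_, b2.mono ?_, fun j =>
    (((b4 j).add (hw j)).congr fun σ _ => by ring).mono (by linarith)⟩, rfl, (b3.mono h1).mono_rho hd.le (by linarith [show 0 < δ / 2 ^ (n + 1) by positivity]),
    fun j => (b4 j).mono h1⟩ <;> gcongr

lemma Pm.seq (pm : Pm ω la m V κ C g Λ T δ Q Y s) {S : St r l} (iv : Inv ω la m V s δ Q Y T 0 S) :
    ∃ F : ℕ → St r l, F 0 = S ∧ ∀ n, Inv ω la m V s δ Q Y T n (F n) ∧ Rel ω g s δ Y T n (F n) (F (n + 1)) := by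
  choose! G hG using fun (n : ℕ) (S : St r l) (h : Inv ω la m V s δ Q Y T n S) => pm.step h
  have h : ∀ n, Inv ω la m V s δ Q Y T n (Nat.rec S G n) := fun n => by
    induction n with
    | zero => exact iv
    | succ n ih => exact (hG n _ ih).1
  exact ⟨fun n => Nat.rec S G n, rfl, fun n => ⟨h n, (hG n _ (h n)).2⟩⟩

end

end KAM


open MeasureTheory Real Filter

namespace KAM

noncomputable section

variable {r l : ℕ} {ω : Fin r → ℝ} {D : Set ℝ} {s δ Q : ℝ} {w : Fin l → ℝ → ℝ} {ρ κ C g Λ Y c : ℝ} {T : ℕ}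
variable {V : (JJ r l → ℝ) → ℝ} {m : JJ r l → ℝ} {la : Fin l → ℝ} {u : ℝ → (Fin r → ℝ) → ℝ}

lemma RB.analytic (h : RB D s ρ u C) (hρ : 0 < ρ) {σ : ℝ} (hσ : σ ∈ D) : AnalyticOnNhd ℝ (u σ) Set.univ := by
  obtain ⟨P, hP, φ, c, K, S, hK, hc, hS, hSC, hu⟩ := h
  rw [abs_of_pos hρ] at hS
  have key : AnalyticOnNhd ℝ (fun ψ => (u σ ψ : ℂ)) Set.univ := fun ψ₀ _ => by
    let L : P → (Fin r → ℝ) →L[ℝ] ℂ := fun p => Complex.I • ∑ k, ((φ p k : ℝ) : ℂ) • (Complex.ofRealCLM.comp (ContinuousLinearMap.proj k))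
    have hL : ∀ p y, L p y = Complex.I * ((∑ k, (φ p k : ℝ) * y k : ℝ) : ℂ) := fun p y => by simp [L]
    have hLn : ∀ p y, ‖L p y‖ ≤ nrm (φ p) * ‖y‖ := fun p y => by
      rw [hL, norm_mul, Complex.norm_I, one_mul, Complex.norm_real, Real.norm_eq_abs, nrm, Finset.sum_mul]
      refine (Finset.abs_sum_le_sum_abs _ _).trans (Finset.sum_le_sum fun k _ => ?_)
      rw [abs_mul]; gcongr; exact norm_le_pi_norm y k
    let M : (n : ℕ) → P → ContinuousMultilinearMap ℝ (fun _ : Fin n => Fin r → ℝ) ℂ := fun n p =>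
      (c p σ * ch (φ p) ψ₀) • (NormedSpace.expSeries ℝ ℂ n).compContinuousLinearMap (fun _ => L p)
    have ha : ∀ p, ‖c p σ * ch (φ p) ψ₀‖ ≤ K p := fun p => by
      rw [norm_mul, norm_ch, mul_one]; exact (hc p).norm_le hσ
    have hM : ∀ n p, ‖M n p‖ ≤ K p * exp (ρ * nrm (φ p)) * (ρ ^ n)⁻¹ := fun n p => by
      have e0 : ‖NormedSpace.expSeries ℝ ℂ n‖ ≤ (n.factorial : ℝ)⁻¹ := by
        simp [NormedSpace.expSeries, norm_smul]
      have e1 := (ContinuousMultilinearMap.norm_compContinuousLinearMap_le (NormedSpace.expSeries ℝ ℂ n) (fun _ => L p)).trans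
        (mul_le_mul e0 (Finset.prod_le_prod (fun _ _ => norm_nonneg _) fun _ _ => (L p).opNorm_le_bound (nrm_nonneg _) (hLn p))
          (by positivity) (by positivity))
      have e2 := Real.pow_div_factorial_le_exp (ρ * nrm (φ p)) (by have := nrm_nonneg (φ p); positivity) n
      rw [norm_smul, mul_assoc]
      refine mul_le_mul (ha p) (e1.trans ?_) (norm_nonneg _) (hK p)
      rw [← div_eq_mul_inv, le_div_iff₀ (by positivity)]
      refine le_trans (le_of_eq ?_) e2
      simp [mul_pow]; field_simp
    have hs1 : ∀ n, Summable (fun p => K p * exp (ρ * nrm (φ p)) * (ρ ^ n)⁻¹) := fun n => hS.summable.mul_right _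
    have hs2 : ∀ n, Summable (M n) := fun n => Summable.of_norm_bounded (hs1 n) (hM n)
    have hE : ∀ n p y, M n p (fun _ => y) = (c p σ * ch (φ p) ψ₀) * (((n.factorial : ℝ)⁻¹ • (L p y) ^ n)) := fun n p y => by
      rw [← NormedSpace.expSeries_apply_eq (𝕂 := ℝ)]; rfl
    refine ⟨fun n => ∑' p, M n p, ENNReal.ofReal ρ, ?_, by simpa using hρ, ?_⟩
    · refine FormalMultilinearSeries.le_radius_of_bound _ S fun n => ?_
      have := tsum_of_norm_bounded ((hS.mul_right (ρ ^ n)⁻¹)) (hM n)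
      refine (mul_le_mul_of_nonneg_right this (by positivity)).trans (le_of_eq ?_)
      rw [Real.coe_toNNReal _ hρ.le]; field_simp
    · intro y hy
      have hy' : ‖y‖ < ρ := by
        rw [Metric.mem_eball, edist_zero_right, ← ofReal_norm, ENNReal.ofReal_lt_ofReal_iff hρ] at hy; exact hy
      have fib : ∀ p, HasSum (fun n => M n p fun _ => y) (c p σ * ch (φ p) (ψ₀ + y)) := fun p => by
        have e := (NormedSpace.expSeries_hasSum_exp (𝕂 := ℝ) (L p y)).mul_left (c p σ * ch (φ p) ψ₀)
        have : ch (φ p) (ψ₀ + y) = ch (φ p) ψ₀ * NormedSpace.exp (L p y) := by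
          rw [← Complex.exp_eq_exp_ℂ, hL, ch, ch, ← Complex.exp_add, ← mul_add, ← Complex.ofReal_add, ← Finset.sum_add_distrib]
          simp only [Pi.add_apply, mul_add]
        rw [this, ← mul_assoc]; exact e
      have sn : Summable (fun q : P × ℕ => ‖M q.2 q.1 fun _ => y‖) := by
        have hle : ∀ p n, ‖M n p fun _ => y‖ ≤ K p * ((ρ * nrm (φ p)) ^ n / n.factorial) := fun p n => by
          rw [hE, norm_mul, norm_smul, norm_pow]
          refine mul_le_mul (ha p) ?_ (by positivity) (hK p)
          rw [div_eq_inv_mul]; simp only [norm_inv, Real.norm_natCast]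
          gcongr
          exact (hLn p y).trans (by rw [mul_comm]; gcongr; exact nrm_nonneg _)
        have hx : ∀ p, HasSum (fun n : ℕ => K p * ((ρ * nrm (φ p)) ^ n / n.factorial)) (K p * exp (ρ * nrm (φ p))) := fun p => by
          have := NormedSpace.expSeries_div_hasSum_exp (ρ * nrm (φ p))
          rw [← Real.exp_eq_exp_ℝ] at this
          exact this.mul_left _
        have p0 : ∀ p (n : ℕ), 0 ≤ K p * ((ρ * nrm (φ p)) ^ n / n.factorial) := fun p n =>
          (norm_nonneg _).trans (hle p n)
        refine Summable.of_nonneg_of_le (fun _ => norm_nonneg _) (fun q => hle q.1 q.2) ?_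
        rw [summable_prod_of_nonneg fun q => p0 q.1 q.2]
        exact ⟨fun p => (hx p).summable, by simpa only [(hx _).tsum_eq] using hS.summable⟩
      have tot := sn.of_norm.hasSum
      have h1 := tot.prod_fiberwise fib
      rw [h1.unique (hu σ hσ (ψ₀ + y))] at tot
      have tot2 : HasSum (fun q : ℕ × P => M q.1 q.2 fun _ => y) _ := (Equiv.prodComm ℕ P).hasSum_iff.mpr tot
      have fb : ∀ n, HasSum (fun p => M n p fun _ => y) ((∑' p, M n p) fun _ => y) := fun n =>
        ContinuousMultilinearMap.hasSum_eval (hs2 n).hasSum _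
      exact tot2.prod_fiberwise (g := fun n => (∑' p, M n p) fun _ => y) fb
  exact fun ψ hψ => by
    have := (Complex.reCLM.analyticAt _).comp (key ψ hψ)
    exact this

lemma RB.per (h : RB D s ρ u C) {σ : ℝ} (hσ : σ ∈ D) (ψ i) : u σ (ψ + Pi.single i (2 * π)) = u σ ψ := by
  obtain ⟨P, hP, φ, c, K, S, hK, hc, hS, hSC, hu⟩ := h
  have e : ∀ p, ch (φ p) (ψ + Pi.single i (2 * π)) = ch (φ p) ψ := fun p => by
    have : Complex.I * ((∑ k, (φ p k : ℝ) * (ψ + Pi.single i (2 * π) : Fin r → ℝ) k : ℝ) : ℂ) =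
        Complex.I * ((∑ k, (φ p k : ℝ) * ψ k : ℝ) : ℂ) + (φ p i : ℤ) * (2 * π * Complex.I) := by
      simp only [Pi.add_apply, mul_add, Finset.sum_add_distrib]
      simp [Pi.single_apply]; ring
    rw [ch, this, Complex.exp_add, Complex.exp_int_mul_two_pi_mul_I, mul_one, ch]
  have h1 := hu σ hσ (ψ + Pi.single i (2 * π))
  simp only [e] at h1
  exact Complex.ofReal_injective (h1.unique (hu σ hσ ψ))

end

end KAM


open MeasureTheory Real Filter

namespace KAM

noncomputable section

variable {r l : ℕ} {ω : Fin r → ℝ} {D : Set ℝ} {s δ Q : ℝ} {w : Fin l → ℝ → ℝ} {ρ κ C g Λ Y c : ℝ} {T : ℕ}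
variable {V : (JJ r l → ℝ) → ℝ} {m : JJ r l → ℝ} {la : Fin l → ℝ} {σ : ℝ}

lemma RB.lim {u : ℕ → ℝ → (Fin r → ℝ) → ℝ} (h : ∀ n, RB D s δ (fun σ ψ => u (n + 1) σ ψ - u n σ ψ) ((1 / 2) ^ n)) :
    ∃ v : ℝ → (Fin r → ℝ) → ℝ, ∀ n, RB D s δ (fun σ ψ => v σ ψ - u n σ ψ) (2 * (1 / 2) ^ n) := by
  refine ⟨fun σ ψ => u 0 σ ψ + ∑' n, (u (n + 1) σ ψ - u n σ ψ), fun n => RB.tsum (fun k => h (k + n)) (T := 2 * (1 / 2) ^ n) ?_ ?_⟩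
  · simpa only [pow_add] using hasSum_geometric_two.mul_right ((1 / 2 : ℝ) ^ n)
  · intro σ hσ ψ
    have hs : Summable (fun n => u (n + 1) σ ψ - u n σ ψ) := Summable.of_norm_bounded summable_geometric_two fun n => (h n).abs_le hσ ψ
    refine (hasSum_nat_add_iff (f := fun n => u (n + 1) σ ψ - u n σ ψ) n).mpr ?_
    rw [Finset.sum_range_sub (fun n => u n σ ψ)]
    simpa using hs.hasSum

def Sol (ω : Fin r → ℝ) (m : JJ r l → ℝ) (V : (JJ r l → ℝ) → ℝ) (σ : ℝ) : Prop :=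
  ∃ x : II r l → (Fin r → ℝ) → ℝ, (∀ i, AnalyticOnNhd ℝ (x i) Set.univ) ∧ (∀ i ψ k, x i (ψ + Pi.single k (2 * π)) = x i ψ) ∧
    ∀ ψ j, HasDerivAt (fun t : ℝ => x (Sum.inl j) (ψ + t • ω)) (σ * (m j * x (Sum.inr j) ψ)) 0 ∧
      HasDerivAt (fun t : ℝ => x (Sum.inr j) (ψ + t • ω)) (-(σ * Gd V j (fun i => Sum.elim ψ (fun _ => 0) i + x (Sum.inl i) ψ))) 0

lemma Pm.sol (pm : Pm ω la m V κ C g Λ T δ Q Y s) {F : ℕ → St r l}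
    (hF : ∀ n, Inv ω la m V s δ Q Y T n (F n) ∧ Rel ω g s δ Y T n (F n) (F (n + 1))) (hσ : ∀ n, σ ∈ (F n).D) : Sol ω m V σ := by
  have hd := pm.d0
  have hY := pm.Y0
  have hs := pm.s0
  have hYp : ∀ n : ℕ, Y ^ (n + 1) ≤ (1 / 2) ^ n := fun n => by
    rw [pow_succ, ← mul_one ((1 / 2 : ℝ) ^ n)]
    exact mul_le_mul (pow_le_pow_left₀ hY pm.Y1 n) (by linarith [pm.Y1]) hY (by positivity)
  have hsub : ∀ n, ({σ} : Set ℝ) ⊆ (F n).D := fun n => Set.singleton_subset_iff.mpr (hσ n)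
  have hm : σ ∈ ({σ} : Set ℝ) := rfl
  choose v hv using fun i => RB.lim (D := {σ}) (s := s) (δ := δ) (u := fun n σ ψ => (F n).x σ ψ i ()) fun n =>
    ((((hF n).2.rx.2 i ()).mono_set (hsub (n + 1))).mono (hYp n))
  have hb0 : ∀ i, RB {σ} s δ (v i) (2 + cc Y 0) := fun i => by
    have h1 := (((hF 0).1.fr.bx.2 i ()).mono_set (hsub 0)).mono_rho hd.le (show δ ≤ δ + 14 * (δ / 2 ^ 0) by simp [hd.le])
    exact (((hv i 0).add h1).congr fun σ _ ψ => by ring).mono (by simp)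
  obtain ⟨W, hW0, hW⟩ := exV ω
  have hg0 : Tendsto (fun n : ℕ => (1 / 2 : ℝ) ^ n) atTop (nhds 0) := tendsto_pow_atTop_nhds_zero_of_lt_one (by norm_num) (by norm_num)
  have hz : ∀ a : ℝ, Tendsto (fun n : ℕ => a * (1 / 2 : ℝ) ^ n) atTop (nhds 0) := fun a => by simpa using hg0.const_mul a
  have hx : ∀ i ψ, Tendsto (fun n => (F n).x σ ψ i ()) atTop (nhds (v i σ ψ)) := fun i ψ => by
    rw [tendsto_iff_norm_sub_tendsto_zero]
    refine squeeze_zero (fun _ => norm_nonneg _) (fun n => ?_) (hz 2)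
    rw [norm_sub_rev, Real.norm_eq_abs]; exact (hv i n).abs_le hm ψ
  have hE : ∀ i ψ, Tendsto (fun n => (F n).E σ ψ i ()) atTop (nhds 0) := fun i ψ => by
    refine squeeze_zero_norm (fun n => ?_) (hz s)
    refine (((hF n).1.bE.2 i ()).abs_le (hσ n) ψ).trans ?_
    refine mul_le_mul_of_nonneg_left (le_trans ?_ (hYp n)) hs.le
    have h8 : 1 ≤ Q := by linarith [pm.Q8]
    exact div_le_self (by positivity) (one_le_mul_of_one_le_of_one_le (one_le_pow₀ h8) (one_le_pow₀ (one_le_pow₀ (one_le_pow₀ (by norm_num)))))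
  have hX : ∀ i ψ, Tendsto (fun n => Xh m V (F n).x σ ψ i ()) atTop (nhds (Xh m V (fun σ ψ => Matrix.of fun i _ => v i σ ψ) σ ψ i ())) := by
    rintro (j | j) ψ
    · exact ((hx (Sum.inr j) ψ).const_mul (m j)).const_mul σ
    · refine ((((pm.md.dG j).continuous.tendsto _).comp ?_).const_mul σ).neg
      exact tendsto_pi_nhds.mpr fun k => (hx (Sum.inl k) ψ).const_add _
  have key : ∀ i, HL {σ} ω (v i) (fun σ ψ => Xh m V (fun σ ψ => Matrix.of fun i _ => v i σ ψ) σ ψ i ()) := fun i => by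
    obtain ⟨v', h1, -⟩ := (hb0 i).deriv le_rfl hd (by simp) hW hW0
    refine h1.congr (fun _ _ _ => rfl) fun σ' hσ' ψ => ?_
    obtain rfl : σ' = σ := hσ'
    refine tendsto_nhds_unique (hX i ψ) ?_
    have h2 : Tendsto (fun n => Xh m V (F n).x σ' ψ i () + (F n).E σ' ψ i ()) atTop (nhds (v' σ' ψ)) := by
      rw [tendsto_iff_norm_sub_tendsto_zero]
      refine squeeze_zero (fun _ => norm_nonneg _) (fun n => ?_) (hz (W / δ * 2))
      rw [norm_sub_rev, Real.norm_eq_abs, mul_assoc]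
      exact ((hv i n).deriv_bd le_rfl hd (by simp) hW hW0 (h1.sub (((hF n).1.fr.hx i ()).mono_set (hsub n)))).abs_le hm ψ
    simpa using h2.sub (hE i ψ)
  exact ⟨fun i => v i σ, fun i => (hb0 i).analytic hd hm, fun i ψ k => (hb0 i).per hm ψ k, fun ψ j =>
    ⟨key (Sum.inl j) σ hm ψ, key (Sum.inr j) σ hm ψ⟩⟩

end

end KAM


open MeasureTheory Real Filter

namespace KAM

noncomputable section

variable {r l : ℕ} {ω : Fin r → ℝ} {D : Set ℝ} {s δ Q : ℝ} {w : Fin l → ℝ → ℝ} {ρ κ C g Λ Y c : ℝ} {T : ℕ}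
variable {V : (JJ r l → ℝ) → ℝ} {m : JJ r l → ℝ} {la : Fin l → ℝ} {σ : ℝ}

lemma MB.blocks {a b a' b' : Type} {A : MF r a a'} {B : MF r a b'} {M : MF r b a'} {N : MF r b b'}
    (h1 : MB D s ρ A C) (h2 : MB D s ρ B C) (h3 : MB D s ρ M C) (h4 : MB D s ρ N C) :
    MB D s ρ (fun σ ψ => Matrix.fromBlocks (A σ ψ) (B σ ψ) (M σ ψ) (N σ ψ)) C :=
  ⟨h1.1, by rintro (i | i) (k | k); exacts [h1.2 i k, h2.2 i k, h3.2 i k, h4.2 i k]⟩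

lemma HM.blocks {a b a' b' : Type} {A A' : MF r a a'} {B B' : MF r a b'} {M M' : MF r b a'} {N N' : MF r b b'}
    (h1 : HM D ω A A') (h2 : HM D ω B B') (h3 : HM D ω M M') (h4 : HM D ω N N') :
    HM D ω (fun σ ψ => Matrix.fromBlocks (A σ ψ) (B σ ψ) (M σ ψ) (N σ ψ))
      (fun σ ψ => Matrix.fromBlocks (A' σ ψ) (B' σ ψ) (M' σ ψ) (N' σ ψ)) := by
  rintro (i | i) (k | k); exacts [h1 i k, h2 i k, h3 i k, h4 i k]

abbrev e0 (ψ : Fin r → ℝ) : JJ r l → ℝ := em (fun _ _ _ => 0) 0 ψ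

set_option maxHeartbeats 2000000 in
lemma init (md : Md V m κ C) (hm : m = Sum.elim (fun _ => 1) la) (hG : ∀ j, avg (fun ψ => Gd V j (e0 ψ)) = 0)
    (hF : ∀ i j, avg (fun ψ => Fd V i j (e0 ψ)) = (Matrix.diagonal (Sum.elim (fun _ => 0) la) : Matrix (JJ r l) (JJ r l) ℝ) i j)
    (hC : 0 ≤ C) (hd : 0 < δ) (hd1 : δ ≤ 1) (hκ : 18 * δ ≤ κ) (g0 : 0 < g) (dio : ∀ ν : Fin r → ℤ, ν ≠ 0 → g / (1 + nrm ν) ^ T ≤ |dt ν ω|)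
    (hQ1 : 1 ≤ Q) :
    ∃ K, 0 ≤ K ∧ ∀ s Y, 0 < s → s ≤ 1 → K * s ≤ Y → ∃ S, S.D = Set.Icc s (2 * s) ∧ S.w = (fun j _ => la j) ∧ Inv ω la m V s δ Q Y T 0 S := by
  obtain ⟨Q0, hQ0⟩ : ∃ Q0, Q0 = T.factorial * 3 / (δ ^ T * g) := ⟨_, rfl⟩
  have q0 : 0 ≤ Q0 := hQ0 ▸ by positivity
  obtain ⟨Λ, L0, hΛ⟩ : ∃ Λ, 0 ≤ Λ ∧ ∀ j, |m j| ≤ Λ := ⟨∑ j, |m j|, Finset.sum_nonneg fun _ _ => abs_nonneg _, fun j =>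
    Finset.single_le_sum (f := fun j => |m j|) (fun _ _ => abs_nonneg _) (Finset.mem_univ j)⟩
  have hne : ∀ ν : Fin r → ℤ, ν ≠ 0 → dt ν ω ≠ 0 := fun ν hν h => by
    have := dio ν hν
    rw [h, abs_zero] at this
    have : 0 < g / (1 + nrm ν) ^ T := by have := nrm_nonneg ν; positivity
    linarith
  obtain ⟨A, hA⟩ : ∃ A, A = Q0 * C := ⟨_, rfl⟩
  have A0 : 0 ≤ A := hA ▸ by positivity
  obtain ⟨N, hN⟩ : ∃ N : ℝ, N = Fintype.card (JJ r l) := ⟨_, rfl⟩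
  have N0 : 0 ≤ N := hN ▸ by positivity
  obtain ⟨N', hN'⟩ : ∃ N : ℝ, N = Fintype.card (II r l) := ⟨_, rfl⟩
  have N0' : 0 ≤ N' := hN' ▸ by positivity
  obtain ⟨B, hB⟩ : ∃ B : ℝ, B = N' * ((1 + 3 * A) * (9 * (N * (Λ * A)))) := ⟨_, rfl⟩
  have B0 : 0 ≤ B := hB ▸ by positivity
  obtain ⟨K, hK⟩ : ∃ K : ℝ, K = 3 * A + 3 * A / δ + 9 * (Λ * A) + B := ⟨_, rfl⟩
  have K0 : 0 ≤ K := hK ▸ by positivity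
  obtain ⟨Z, hZ⟩ : ∃ Z : ℝ, Z = Q ^ 67 * (2 ^ (2 * T + 2)) ^ 67 := ⟨_, rfl⟩
  have Z1 : 1 ≤ Z := hZ ▸ one_le_mul_of_one_le_of_one_le (one_le_pow₀ hQ1) (one_le_pow₀ (one_le_pow₀ (by norm_num)))
  refine ⟨K * Z, by positivity, fun s Y hs hs1 hY => ?_⟩
  obtain ⟨D, hD⟩ : ∃ D, D = Set.Icc s (2 * s) := ⟨_, rfl⟩
  have hXX : K * (s * s) ≤ s * XX Q Y T 0 := by
    have : XX Q Y T 0 = Y / Z := by simp [XX, hZ]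
    rw [this, mul_left_comm]
    refine mul_le_mul_of_nonneg_left ?_ hs.le
    rw [le_div_iff₀ (by linarith)]; linarith
  have hcc : K * s ≤ cc Y 0 := by
    have : cc Y 0 = Y := by simp [cc]; ring
    rw [this]
    exact le_trans (by gcongr; exact le_mul_of_one_le_right K0 Z1) hY
  have hSD : SD ω D s (fun _ => 0) δ Q0 := fun ν => by
    refine LB.mono ((LB.const ((Complex.I * ((dt ν ω : ℝ) : ℂ))⁻¹)).congr fun σ _ => by simp) ?_
    rw [norm_inv, norm_mul, Complex.norm_I, one_mul, Complex.norm_real, Real.norm_eq_abs]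
    by_cases hν : ν = 0
    · subst hν; simp [dt]; positivity
    · have n0 := nrm_nonneg ν
      refine (inv_anti₀ (by positivity) (dio ν hν)).trans ?_
      rw [inv_div, hQ0, div_mul_eq_mul_div, div_le_div_iff₀ g0 (by positivity)]
      have := pow_exp n0 hd hd1 T
      nlinarith
  have hLs : LR D s (fun σ => σ) (3 * s) := by
    have := LR.of_le (D := D) (s := s) (c := fun σ => σ) (A := 2 * s) (B := s)
      (fun σ hσ => by rw [hD] at hσ; rw [abs_of_pos (by linarith [hσ.1])]; exact hσ.2) hs.le (fun σ _ σ' _ => by rw [abs_of_pos hs])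
    exact this.mono (by linarith)
  have hG' : ∀ j, RB D s (17 * δ) (fun _ ψ => Gd V j (e0 ψ)) C := fun j =>
    (md.fG j).comp (η := 0) (q := fun _ _ _ => 0) (fun _ => RB.zero) le_rfl (by positivity) (by linarith)
  have hF' : ∀ i j, RB D s (17 * δ) (fun _ ψ => Fd V i j (e0 ψ)) C := fun i j =>
    (md.fF i j).comp (η := 0) (q := fun _ _ _ => 0) (fun _ => RB.zero) le_rfl (by positivity) (by linarith)
  have hρ : δ + 14 * (δ / 2 ^ 0) = 15 * δ := by simp; ring
  choose p hp _ hp' using fun j => (hG' j).solve0 hSD q0 hd.le (ρ' := 16 * δ) (by positivity) (by linarith) hne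
  choose k hk _ hk' using fun i j => (hF' i j).solve0 hSD q0 hd.le (ρ' := 16 * δ) (by positivity) (by linarith) hne
  simp only [hG, hF, ← hA] at hp hp' hk hk'
  obtain ⟨x, hx⟩ : ∃ x : MF r (II r l) Unit, x = fun σ ψ => Matrix.of fun i _ => Sum.elim (fun _ => 0) (fun j => -(σ * p j σ ψ)) i := ⟨_, rfl⟩
  obtain ⟨E, hE⟩ : ∃ E : MF r (II r l) Unit, E = fun σ ψ => Matrix.of fun i _ => Sum.elim (fun j => σ * σ * (m j * p j σ ψ)) (fun _ => 0) i := ⟨_, rfl⟩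
  have bx : MB D s (16 * δ) x (3 * s * A) := by
    refine ⟨by positivity, ?_⟩
    rintro (j | j) _ <;> subst hx
    · exact RB.zero.mono (by positivity)
    · exact ((RB.ofLR hLs (by positivity)).mul (hp j)).neg
  have bE : MB D s (16 * δ) E (9 * (Λ * A) * (s * s)) := by
    refine ⟨by positivity, ?_⟩
    rintro (j | j) _ <;> subst hE
    · refine ((RB.ofLR (hLs.mul hLs) (by positivity)).mul ((hp j).const_mul (m j))).mono ?_
      calc _ ≤ 3 * s * (3 * s) * (Λ * A) := by gcongr; exact hΛ j
        _ = _ := by ring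
    · exact RB.zero.mono (by positivity)
  choose t ht ht' using fun i (j : Fin r) => (bx.2 i ()).deriv (ρ' := 15 * δ) (by positivity) hd (by linarith) (w := Pi.single j 1) (V := 1)
    (fun k => by rw [Pi.single_apply]; split_ifs <;> simp) zero_le_one
  obtain ⟨M, hM⟩ : ∃ M : MF r (JJ r l) (JJ r l), M = fun σ ψ => Matrix.of fun i j => 1 / 2 * (k i j σ ψ + k j i σ ψ) := ⟨_, rfl⟩
  have bM : MB D s (15 * δ) M A := ⟨A0, fun i j => by
    subst hM
    refine ((((hk i j).add (hk j i)).const_mul (1 / 2)).mono_rho (by positivity) (by linarith)).mono (le_of_eq ?_)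
    rw [abs_of_pos (by norm_num)]; ring⟩
  have hMt : ∀ σ ψ, (M σ ψ).transpose = M σ ψ := fun σ ψ => by
    ext i j; simp [hM, add_comm]
  obtain ⟨F, hFF⟩ : ∃ F : (Fin r → ℝ) → Matrix (JJ r l) (JJ r l) ℝ, F = fun ψ => Matrix.of fun i j => Fd V i j (e0 ψ) := ⟨_, rfl⟩
  obtain ⟨U, hU⟩ : ∃ U : Matrix (JJ r l) (JJ r l) ℝ, U = Matrix.diagonal (Sum.elim (fun _ => 0) la) := ⟨_, rfl⟩
  have dM : HM D ω M (fun _ ψ => F ψ - U) := fun i j => by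
    refine ((HL.const (fun _ => (1 / 2 : ℝ))).mul ((hk' i j).add (hk' j i))).congr (fun _ _ _ => by rw [hM]; rfl) fun σ _ ψ => ?_
    beta_reduce
    have e : U j i = U i j := hU ▸ congrFun (congrFun (Matrix.diagonal_transpose (Sum.elim (fun _ => (0 : ℝ)) la)) i) j
    rw [← hU, e, md.sy j i, hFF, Matrix.sub_apply]; beta_reduce; rw [Matrix.of_apply]; ring
  obtain ⟨dm, hdm⟩ : ∃ U : Matrix (JJ r l) (JJ r l) ℝ, U = Matrix.diagonal m := ⟨_, rfl⟩
  have bdm : MB D s (15 * δ) (fun _ (_ : Fin r → ℝ) => dm) Λ := MB.ofConst L0 fun i k => (LR.const (dm i k)).mono (by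
    rw [hdm, Matrix.diagonal_apply]; split_ifs <;> simp [hΛ, L0])
  obtain ⟨P, hP⟩ : ∃ P : MF r (II r l) (II r l), P = fun σ ψ => Matrix.fromBlocks 1 0 (-(σ • M σ ψ)) 1 := ⟨_, rfl⟩
  obtain ⟨P', hP'⟩ : ∃ P : MF r (II r l) (II r l), P = fun σ ψ => Matrix.fromBlocks 1 0 (σ • M σ ψ) 1 := ⟨_, rfl⟩
  obtain ⟨R, hR⟩ : ∃ P : MF r (II r l) (II r l), P = fun σ ψ => Matrix.fromBlocks ((σ * σ) • (dm * M σ ψ)) 0 0 (-((σ * σ) • (M σ ψ * dm))) := ⟨_, rfl⟩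
  have bsM := bM.smulL hLs (by positivity)
  have s3 : 3 * s * A ≤ 1 + 3 * A := by nlinarith
  have bP' : MB D s (15 * δ) P' (1 + 3 * A) := by
    subst hP'
    exact MB.blocks (MB.one.mono (by linarith)) (MB.zero.mono (by linarith)) (bsM.mono s3) (MB.one.mono (by linarith))
  have bR : MB D s (15 * δ) R (3 * s * (3 * s) * (N * (Λ * A))) := by
    subst hR
    have c0 : 0 ≤ 3 * s * (3 * s) * (N * (Λ * A)) := by positivity
    refine MB.blocks ?_ (MB.zero.mono c0) (MB.zero.mono c0) ?_
    · exact (((bdm.mul bM).smulL (hLs.mul hLs) (by positivity)).mono (by rw [hN]))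
    · exact (((bM.mul bdm).smulL (hLs.mul hLs) (by positivity)).neg.mono (by rw [hN, mul_comm A]))
  have mm : ∀ σ, (Matrix.diagonal fun j => σ * m j) = σ • dm := fun σ => by rw [hdm, ← Matrix.diagonal_smul]; rfl
  have hBB : ∀ σ, BB r (fun j _ => la j) σ = Matrix.fromBlocks 0 (σ • dm) (-(σ • U)) 0 := fun σ => by
    rw [BB, hdm, hU, ← Matrix.diagonal_smul, ← Matrix.diagonal_smul, Matrix.diagonal_neg, hm]
    congr 2 <;> ext (i | i) <;> simp
  have hAm : ∀ σ ψ, Am m V x σ ψ = Matrix.fromBlocks 0 (σ • dm) (-(σ • F ψ)) 0 := fun σ ψ => by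
    rw [Am, mm, hFF, hx]; rfl
  have le1 : 3 * s * A ≤ K * s := by
    have : 0 ≤ (3 * A / δ + 9 * (Λ * A) + B) * s := by positivity
    rw [hK]; nlinarith
  have le2 : 1 / δ * (3 * s * A) ≤ K * s := by
    have : 0 ≤ (3 * A + 9 * (Λ * A) + B) * s := by positivity
    have e : 1 / δ * (3 * s * A) = 3 * A / δ * s := by ring
    rw [hK, e]; nlinarith
  have le3 : 9 * (Λ * A) ≤ K := by
    have : 0 ≤ 3 * A / δ := by positivity
    rw [hK]; linarith
  have le4 : B ≤ K := by
    have : 0 ≤ 3 * A / δ := by positivity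
    have : 0 ≤ 9 * (Λ * A) := by positivity
    rw [hK]; linarith
  refine ⟨⟨D, fun j _ => la j, x, fun σ ψ => Matrix.of fun i j => t i j σ ψ, P, E, fun σ ψ => P' σ ψ * R σ ψ⟩, hD, rfl, hD.le, ⟨?_, ?_, ?_, ?_, ?_, ?_, ?_⟩, ?_, ?_, ?_⟩
  all_goals try rw [hρ]
  all_goals try dsimp only
  · exact (bx.mono_rho (by positivity) (by linarith)).mono (le1.trans hcc)
  · exact ht
  · exact ⟨le_trans (by positivity) hcc, fun i j => (ht' i j).mono (le2.trans hcc)⟩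
  · intro σ _ ψ
    subst hP
    simp [Jm, Matrix.fromBlocks_transpose, Matrix.fromBlocks_multiply, hMt]
  · refine ((MB.blocks (A := fun _ _ => 0) (B := fun _ _ => 0) (N := fun _ _ => 0) (MB.zero.mono bsM.1) (MB.zero.mono bsM.1) bsM.neg (MB.zero.mono bsM.1)).congr fun σ _ ψ => ?_).mono (le1.trans hcc)
    rw [hP]; ext (i | i) (j | j) <;> simp [Matrix.one_apply]
  · rintro (j | j) _ σ hσ ψ <;> subst hx hE
    · refine (HL.const (v := ω) (fun _ => (0 : ℝ)) σ hσ ψ).congr_deriv ?_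
      simp [Xh]; ring
    · refine (((HL.const (fun σ : ℝ => σ)).mul (hp' j)).neg σ hσ ψ).congr_deriv ?_
      simp [Xh]; exact Or.inl rfl
  · rw [hP]
    refine (HM.blocks (HM.const fun _ => 1) (HM.const fun _ => 0) (dM.csmul fun σ => σ).neg (HM.const fun _ => 1)).congr' fun σ _ ψ => ?_
    have ePP : ∀ X : Matrix (II r l) (II r l) ℝ, Matrix.fromBlocks 1 0 (-(σ • M σ ψ)) 1 * (P' σ ψ * X) = X := fun X => by
      rw [← Matrix.mul_assoc, hP', Matrix.fromBlocks_multiply]; simp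
    rw [ePP, hAm, hBB, hR]
    simp only [Matrix.fromBlocks_multiply, sub_eq_add_neg, Matrix.fromBlocks_neg, Matrix.fromBlocks_add]
    simp [smul_smul, smul_add]
    exact add_comm _ _
  · exact (bE.mono_rho (by positivity) (by linarith)).mono (le_trans (by gcongr) hXX)
  · refine (bP'.mul bR).mono (le_trans (le_of_eq_of_le ?_ (mul_le_mul_of_nonneg_right le4 (mul_nonneg hs.le hs.le))) hXX)
    rw [hB, ← hN']; ring
  · intro j
    exact ((LR.const 0).congr fun σ _ => by simp).mono (by simpa using le_trans (by positivity) hcc)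

end

end KAM


open MeasureTheory Real Filter

namespace KAM

noncomputable section

variable {r l : ℕ} {ω : Fin r → ℝ} {D : Set ℝ} {s δ Q : ℝ} {w : Fin l → ℝ → ℝ} {ρ κ C g Λ Y c : ℝ} {T T0 : ℕ}
variable {V : (JJ r l → ℝ) → ℝ} {m : JJ r l → ℝ} {la : Fin l → ℝ}

lemma sumPi {ι : Type*} [Fintype ι] {f : ℤ → ℝ} (h0 : ∀ n, 0 ≤ f n) (hf : Summable f) : Summable fun ν : ι → ℤ => ∏ k, f (ν k) := by
  classical
  refine summable_of_sum_le (c := ∏ _k : ι, ∑' n, f n) (fun ν => Finset.prod_nonneg fun _ _ => h0 _) fun u => ?_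
  calc ∑ ν ∈ u, ∏ k, f (ν k) ≤ ∑ ν ∈ Fintype.piFinset fun k => u.image (fun ν => ν k), ∏ k, f (ν k) :=
        Finset.sum_le_sum_of_subset_of_nonneg (fun ν hν => Fintype.mem_piFinset.mpr fun k => Finset.mem_image_of_mem _ hν)
          fun _ _ _ => Finset.prod_nonneg fun _ _ => h0 _
    _ = ∏ k, ∑ n ∈ u.image (fun ν => ν k), f n := (Finset.prod_univ_sum _ _).symm
    _ ≤ _ := Finset.prod_le_prod (fun _ _ => Finset.sum_nonneg fun _ _ => h0 _) fun k _ => hf.sum_le_tsum _ fun _ _ => h0 _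

lemma sum2 : Summable fun n : ℤ => ((1 + |(n : ℝ)|) ^ 2)⁻¹ := by
  have h : Summable fun n : ℕ => ((1 + (n : ℝ)) ^ 2)⁻¹ := by
    have := (summable_nat_add_iff 1).mpr (Real.summable_nat_pow_inv.mpr (by norm_num : 1 < 2))
    simpa [add_comm] using this
  refine Summable.of_nat_of_neg ?_ ?_ <;> simpa using h

def FF (l r : ℕ) (p : ℕ × Tl l × (Fin r → ℤ)) : ℝ := (1 / 2) ^ p.1 * (1 * ∏ k, ((1 + |(p.2.2 k : ℝ)|) ^ 2)⁻¹)

lemma FF_nn (p) : 0 ≤ FF l r p := by unfold FF; positivity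

lemma FF_sum : Summable (FF l r) := by
  have h := sumPi (ι := Fin r) (fun _ => by positivity) sum2
  generalize hu : (fun ν : Fin r → ℤ => ∏ k, ((1 + |(ν k : ℝ)|) ^ 2)⁻¹) = u at h
  have hu0 : 0 ≤ u := fun ν => hu ▸ Finset.prod_nonneg fun _ _ => by positivity
  have h1 : Summable fun p : Tl l × (Fin r → ℤ) => 1 * u p.2 :=
    Summable.mul_of_nonneg (f := fun _ : Tl l => (1 : ℝ)) (Summable.of_finite) h (fun _ => zero_le_one) hu0
  have h2 := Summable.mul_of_nonneg summable_geometric_two h1 (fun _ => by positivity) fun p => by rw [Pi.zero_apply, one_mul]; exact hu0 _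
  subst hu
  exact h2

lemma Pm.bad (pm : Pm ω la m V κ C g Λ T δ Q Y s) {F : ℕ → St r l}
    (hF : ∀ n, Inv ω la m V s δ Q Y T n (F n) ∧ Rel ω g s δ Y T n (F n) (F (n + 1))) (hD : (F 0).D = Set.Icc s (2 * s))
    (hc : 0 < c) (hg : g ≤ c / 2) (dio : ∀ ν : Fin r → ℤ, ν ≠ 0 → c / (1 + nrm ν) ^ T0 ≤ |dt ν ω|) (hT : T = 2 * T0 + 2 * r) :
    volume (Set.Icc s (2 * s) \ {σ | Sol ω m V σ}) ≤ ENNReal.ofReal (4 * (8 * Λ / c) ^ 2 * (∑' p, FF l r p) * s ^ 2) := by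
  have hs := pm.s0
  have g0 := pm.g0
  have hL := pm.L1
  let B : ℕ × Tl l × (Fin r → ℤ) → Set ℝ := fun p => {σ | σ ∈ (F p.1).D ∧ p.2.2 ≠ 0 ∧ |dt p.2.2 ω - σ * th (F p.1).w p.2.1 σ| < g / 2 ^ p.1 / (1 + nrm p.2.2) ^ T}
  have hB : Set.Icc s (2 * s) \ {σ | Sol ω m V σ} ⊆ ⋃ p, B p := by
    rintro σ ⟨h1, h2⟩
    by_contra h3
    refine h2 (pm.sol hF fun n => ?_)
    induction n with
    | zero => rwa [hD]
    | succ n ih =>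
      rw [(hF n).2.rD]
      refine ⟨ih, fun t ν hν => ?_⟩
      by_contra h4
      exact h3 (Set.mem_iUnion.mpr ⟨(n, t, ν), ih, hν, not_le.mp h4⟩)
  have hb : ∀ p, volume (B p) ≤ ENNReal.ofReal (4 * (8 * Λ / c) ^ 2 * s ^ 2 * FF l r p) := by
    rintro ⟨n, t, ν⟩
    rcases (B (n, t, ν)).eq_empty_or_nonempty with h | ⟨σ₀, h0, hν, h1⟩
    · rw [h, measure_empty]; exact bot_le
    dsimp only at h0 hν h1
    have iv := (hF n).1
    have hN := nrm_nonneg' ν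
    have hw : ∀ j, LR (F n).D s (fun σ => (F n).w j σ - la j) (3 * Y) := fun j => (iv.iw j).mono (cc_le pm.Y0 n)
    have hη := th_LR hw (by linarith [pm.Y0]) t
    have e : ∀ σ, th (fun j σ => (F n).w j σ - la j) t σ = th (F n).w t σ - th (fun j _ => la j) t 0 := fun σ => by
      rw [th_sub (F n).w (fun j _ => la j), th_const la t σ]
    have hlip : ∀ σ ∈ (F n).D, ∀ σ' ∈ (F n).D, g / 2 * |σ - σ'| ≤ |σ * th (F n).w t σ - σ' * th (F n).w t σ'| := fun σ hσ σ' hσ' => by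
      have a1 := hη.abs_le hσ
      have a2 := hη.lip hσ hσ'
      rw [e, e, abs_of_pos hs, sub_sub_sub_cancel_right] at a2
      rw [e] at a1
      have a3 := pm.gap t
      have a4 := (iv.iD hσ').2
      have a5 := pm.Yg
      have a6 : g ≤ |th (F n).w t σ| := pm.gapw (fun j => (hw j).mono pm.Yg) t hσ
      have a7 : |th (fun j _ => la j) t 0| ≤ |th (F n).w t σ| + |th (F n).w t σ - th (fun j _ => la j) t 0| := by
        have := abs_sub (th (F n).w t σ) (th (F n).w t σ - th (fun j _ => la j) t 0)
        rwa [sub_sub_cancel] at this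
      have a8 : |(σ - σ') * th (F n).w t σ| - |σ' * (th (F n).w t σ' - th (F n).w t σ)| ≤ |σ * th (F n).w t σ - σ' * th (F n).w t σ'| := by
        have := abs_sub_abs_le_abs_sub ((σ - σ') * th (F n).w t σ) (σ' * (th (F n).w t σ' - th (F n).w t σ))
        have e8 : σ * th (F n).w t σ - σ' * th (F n).w t σ' = (σ - σ') * th (F n).w t σ - σ' * (th (F n).w t σ' - th (F n).w t σ) := by ring
        rwa [e8]
      rw [abs_mul, abs_mul, abs_of_pos (hs.trans_le (iv.iD hσ').1), abs_sub_comm (th (F n).w t σ')] at a8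
      have b1 : σ' * |th (F n).w t σ - th (F n).w t σ'| ≤ 2 * (2 * (3 * Y) * |σ - σ'|) := by
        refine (mul_le_mul_of_nonneg_right a4 (abs_nonneg _)).trans ?_
        linarith
      have b2 : (2 * g - 6 * Y) * |σ - σ'| ≤ |σ - σ'| * |th (F n).w t σ| := by
        rw [mul_comm]; gcongr; linarith
      nlinarith [abs_nonneg (σ - σ')]
    have h2 : volume (B (n, t, ν)) ≤ ENNReal.ofReal (4 / 2 ^ n / (1 + nrm ν) ^ T) := by
      refine (Real.volume_le_diam _).trans (Metric.ediam_le fun σ hσ σ' hσ' => ?_)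
      obtain ⟨x1, -, x2⟩ := hσ
      obtain ⟨y1, -, y2⟩ := hσ'
      dsimp only at x1 x2 y1 y2
      rw [edist_dist, Real.dist_eq]
      refine ENNReal.ofReal_le_ofReal ?_
      have h3 := hlip σ x1 σ' y1
      have h5 : |σ * th (F n).w t σ - σ' * th (F n).w t σ'| ≤ 2 * (g / 2 ^ n / (1 + nrm ν) ^ T) := by
        have := abs_sub (dt ν ω - σ' * th (F n).w t σ') (dt ν ω - σ * th (F n).w t σ)
        rw [sub_sub_sub_cancel_left] at this
        linarith
      have h6 : g / 2 * (4 / 2 ^ n / (1 + nrm ν) ^ T) = 2 * (g / 2 ^ n / (1 + nrm ν) ^ T) := by ring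
      exact le_of_mul_le_mul_left ((h3.trans h5).trans_eq h6.symm) (by positivity)
    refine h2.trans (ENNReal.ofReal_le_ofReal ?_)
    have h3 : ((1 + nrm ν) ^ T0)⁻¹ ≤ 8 * Λ / c * s := by
      have a1 := dio ν hν
      have a2 : |σ₀ * th (F n).w t σ₀| ≤ 2 * s * (2 * Λ) := by
        rw [abs_mul, abs_of_pos (hs.trans_le (iv.iD h0).1)]
        exact mul_le_mul (iv.iD h0).2 ((th_LR (pm.w1 fun j => (hw j).mono pm.Yg) (by linarith) t).abs_le h0) (abs_nonneg _) (by positivity)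
      have a3 : g / 2 ^ n / (1 + nrm ν) ^ T ≤ c / 2 / (1 + nrm ν) ^ T0 := by
        have x1 : g / 2 ^ n ≤ c / 2 := (div_le_self g0.le (one_le_pow₀ (by norm_num))).trans hg
        have x2 : (1 + nrm ν) ^ T0 ≤ (1 + nrm ν) ^ T := pow_le_pow_right₀ (by linarith) (by omega)
        exact div_le_div₀ (by positivity) x1 (by positivity) x2
      have a4 := abs_sub_abs_le_abs_sub (dt ν ω) (σ₀ * th (F n).w t σ₀)
      have a5 : c / (1 + nrm ν) ^ T0 - c / 2 / (1 + nrm ν) ^ T0 ≤ 4 * Λ * s := by linarith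
      rw [div_mul_eq_mul_div, le_div_iff₀ hc]
      have a6 : c / (1 + nrm ν) ^ T0 - c / 2 / (1 + nrm ν) ^ T0 = ((1 + nrm ν) ^ T0)⁻¹ * c / 2 := by ring
      linarith
    have h4 : ((1 + nrm ν) ^ (2 * r))⁻¹ ≤ ∏ k, ((1 + |(ν k : ℝ)|) ^ 2)⁻¹ := by
      rw [pow_mul, ← inv_pow]
      calc (((1 + nrm ν) ^ 2)⁻¹) ^ r = ∏ _k : Fin r, ((1 + nrm ν) ^ 2)⁻¹ := by simp
        _ ≤ _ := Finset.prod_le_prod (fun _ _ => by positivity) fun k _ => by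
          gcongr
          exact Finset.single_le_sum (f := fun k => |(ν k : ℝ)|) (fun _ _ => abs_nonneg _) (Finset.mem_univ k)
    calc 4 / 2 ^ n / (1 + nrm ν) ^ T = 4 * (1 / 2) ^ n * ((((1 + nrm ν) ^ T0)⁻¹) ^ 2 * ((1 + nrm ν) ^ (2 * r))⁻¹) := by
          rw [hT, pow_add, mul_comm 2 T0, pow_mul, one_div, inv_pow]; field_simp
      _ ≤ 4 * (1 / 2) ^ n * ((8 * Λ / c * s) ^ 2 * ∏ k, ((1 + |(ν k : ℝ)|) ^ 2)⁻¹) := by gcongr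
      _ = _ := by simp only [FF]; ring
  calc _ ≤ volume (⋃ p, B p) := measure_mono hB
    _ ≤ ∑' p, volume (B p) := measure_iUnion_le _
    _ ≤ ∑' p, ENNReal.ofReal (4 * (8 * Λ / c) ^ 2 * s ^ 2 * FF l r p) := ENNReal.tsum_le_tsum hb
    _ = _ := by
      rw [← ENNReal.ofReal_tsum_of_nonneg (fun p => mul_nonneg (by positivity) (FF_nn p)) (FF_sum.mul_left _), tsum_mul_left]
      congr 1; ring

end

end KAM


open MeasureTheory Real Filter

namespace KAM

noncomputable section

lemma volsq {A : Set ℝ} {t : ℝ} (ht : 0 ≤ t) (hA : A ⊆ Set.Icc 0 t) : volume ((fun x => x ^ 2) '' A) ≤ ENNReal.ofReal (2 * t) * volume A := by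
  have hl : LipschitzOnWith (2 * t).toNNReal (fun x : ℝ => x ^ 2) A := LipschitzOnWith.of_dist_le_mul fun x hx y hy => by
    rw [Real.dist_eq, Real.dist_eq, Real.coe_toNNReal _ (by positivity), show x ^ 2 - y ^ 2 = (x + y) * (x - y) by ring, abs_mul]
    have := hA hx
    have := hA hy
    gcongr
    rw [abs_of_nonneg (by linarith [(hA hx).1, (hA hy).1])]
    linarith [(hA hx).2, (hA hy).2]
  have := hl.hausdorffMeasure_image_le (d := 1) zero_le_one
  rwa [hausdorffMeasure_real, ENNReal.rpow_one] at this

lemma dens {G : Set ℝ} {K S : ℝ} (hK : 0 ≤ K) (hS : 0 < S)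
    (h : ∀ s, 0 < s → s ≤ S → volume (Set.Icc s (2 * s) \ G) ≤ ENNReal.ofReal (K * s ^ 2)) :
    ∃ E, MeasurableSet E ∧ E ⊆ Set.Ioo 0 (S ^ 2) ∧ (∀ ε ∈ E, 0 < ε ∧ √ε ∈ G) ∧
      Tendsto (fun ε => (volume (E ∩ Set.Ioo 0 ε)).toReal / ε) (nhdsWithin 0 (Set.Ioi 0)) (nhds 1) := by
  have h1 : ∀ t, 0 < t → t ≤ S → volume (Set.Ioc 0 t \ G) ≤ ENNReal.ofReal (K * t ^ 2) := fun t ht hS => by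
    have hsub : Set.Ioc 0 t \ G ⊆ ⋃ k : ℕ, Set.Icc (t / 2 / 2 ^ k) (2 * (t / 2 / 2 ^ k)) \ G := by
      rintro x ⟨⟨x0, x1⟩, x2⟩
      obtain ⟨k, k1, k2⟩ := exists_nat_pow_near (x := t / x) ((one_le_div x0).mpr x1) (y := 2) (by norm_num)
      refine Set.mem_iUnion.mpr ⟨k, ⟨?_, ?_⟩, x2⟩
      · rw [div_lt_iff₀ x0, pow_succ] at k2
        rw [div_div, div_le_iff₀ (by positivity)]; linarith
      · rw [le_div_iff₀ x0] at k1
        rw [← mul_div_assoc, mul_div_cancel₀ _ (by norm_num), le_div_iff₀ (by positivity)]; linarith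
    calc _ ≤ _ := measure_mono hsub
      _ ≤ _ := measure_iUnion_le _
      _ ≤ ∑' k : ℕ, ENNReal.ofReal (K * t ^ 2 / 4 * (1 / 4) ^ k) := ENNReal.tsum_le_tsum fun k => by
        refine (h _ (by positivity) (le_trans ?_ hS)).trans_eq ?_
        · rw [div_div]; exact div_le_self ht.le (by nlinarith [one_le_pow₀ (M₀ := ℝ) (a := 2) (n := k) (by norm_num)])
        · congr 1
          rw [div_pow, div_pow, ← pow_mul, mul_comm k, pow_mul, one_div, inv_pow]; norm_num; ring
      _ = ENNReal.ofReal (K * t ^ 2 / 4 * (1 - 1 / 4)⁻¹) := by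
        rw [← ENNReal.ofReal_tsum_of_nonneg (fun k => by positivity) ((summable_geometric_of_lt_one (by norm_num) (by norm_num)).mul_left _), tsum_mul_left,
          tsum_geometric_of_lt_one (by norm_num) (by norm_num)]
      _ ≤ _ := ENNReal.ofReal_le_ofReal (by norm_num; nlinarith [mul_nonneg hK (sq_nonneg t)])
  let B : Set ℝ := {ε | 0 < ε ∧ √ε ∉ G}
  have h2 : ∀ ε, 0 < ε → ε ≤ S ^ 2 → volume (B ∩ Set.Ioo 0 ε) ≤ ENNReal.ofReal (2 * K * √ε * ε) := fun ε e0 e1 => by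
    have hsub : B ∩ Set.Ioo 0 ε ⊆ (fun x => x ^ 2) '' (Set.Ioc 0 √ε \ G) := fun x hx =>
      ⟨√x, ⟨⟨Real.sqrt_pos.mpr hx.1.1, Real.sqrt_le_sqrt hx.2.2.le⟩, hx.1.2⟩, Real.sq_sqrt hx.1.1.le⟩
    calc _ ≤ _ := measure_mono hsub
      _ ≤ _ := volsq (Real.sqrt_nonneg ε) fun x hx => ⟨hx.1.1.le, hx.1.2⟩
      _ ≤ ENNReal.ofReal (2 * √ε) * ENNReal.ofReal (K * √ε ^ 2) := by
        gcongr; exact h1 _ (Real.sqrt_pos.mpr e0) ((Real.sqrt_le_left hS.le).mpr e1)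
      _ = _ := by rw [← ENNReal.ofReal_mul (by positivity), Real.sq_sqrt e0.le]; congr 1; ring
  obtain ⟨M, hM⟩ : ∃ M, M = toMeasurable volume B := ⟨_, rfl⟩
  have mM : MeasurableSet M := hM ▸ measurableSet_toMeasurable _ _
  refine ⟨Set.Ioo 0 (S ^ 2) \ M, measurableSet_Ioo.diff mM, Set.diff_subset, fun ε he => ⟨he.1.1, ?_⟩, ?_⟩
  · by_contra h3
    exact he.2 (hM ▸ subset_toMeasurable _ _ ⟨he.1.1, h3⟩)
  have hlow : Tendsto (fun ε => 1 - 2 * K * √ε) (nhdsWithin 0 (Set.Ioi 0)) (nhds 1) := by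
    have : Continuous fun ε => 1 - 2 * K * √ε := by fun_prop
    have h3 := (this.tendsto 0).mono_left (nhdsWithin_le_nhds (s := Set.Ioi 0))
    simpa using h3
  refine tendsto_of_tendsto_of_tendsto_of_le_of_le' hlow tendsto_const_nhds ?_ ?_
  · filter_upwards [Ioo_mem_nhdsGT (show (0 : ℝ) < S ^ 2 by positivity)] with ε he
    rw [le_div_iff₀ he.1]
    have h3 : (volume (M ∩ Set.Ioo 0 ε)) ≤ ENNReal.ofReal (2 * K * √ε * ε) := by
      rw [hM, Measure.measure_toMeasurable_inter_of_sFinite measurableSet_Ioo]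
      exact h2 ε he.1 he.2.le
    have h4 : volume (Set.Ioo 0 ε) ≤ volume ((Set.Ioo 0 (S ^ 2) \ M) ∩ Set.Ioo 0 ε) + volume (M ∩ Set.Ioo 0 ε) := by
      refine (measure_mono fun x hx => ?_).trans (measure_union_le _ _)
      by_cases hx' : x ∈ M
      · exact Or.inr ⟨hx', hx⟩
      · exact Or.inl ⟨⟨⟨hx.1, hx.2.trans he.2⟩, hx'⟩, hx⟩
    have h5 : volume ((Set.Ioo 0 (S ^ 2) \ M) ∩ Set.Ioo 0 ε) ≠ ⊤ := ((measure_mono Set.inter_subset_right).trans_lt measure_Ioo_lt_top).ne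
    have h6 := ENNReal.toReal_mono (ENNReal.add_ne_top.mpr ⟨h5, ENNReal.ofReal_ne_top⟩) (h4.trans (add_le_add_right h3 _))
    rw [ENNReal.toReal_add h5 ENNReal.ofReal_ne_top, ENNReal.toReal_ofReal (by have := he.1; positivity), Real.volume_Ioo, ENNReal.toReal_ofReal (by linarith [he.1])] at h6
    linarith
  · filter_upwards [self_mem_nhdsWithin] with ε he
    have he : 0 < ε := he
    rw [div_le_one he]
    have := ENNReal.toReal_mono measure_Ioo_lt_top.ne (measure_mono (μ := volume) (Set.inter_subset_right (s := Set.Ioo 0 (S ^ 2) \ M) (t := Set.Ioo 0 ε)))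
    rwa [Real.volume_Ioo, sub_zero, ENNReal.toReal_ofReal he.le] at this

end

end KAM


open MeasureTheory Real Filter

namespace KAM

noncomputable section

variable {r l : ℕ} {ω : Fin r → ℝ} {κ C c : ℝ} {T0 : ℕ} {V : (JJ r l → ℝ) → ℝ} {m : JJ r l → ℝ} {la : Fin l → ℝ}

lemma big (hr : 0 < r) (hl : 0 < l) (md : Md V m κ C) (hκ : 0 < κ) (hC : 0 ≤ C) (hm : m = Sum.elim (fun _ => 1) la) (hG : ∀ j, avg (fun ψ => Gd V j (e0 ψ)) = 0)
    (hF : ∀ i j, avg (fun ψ => Fd V i j (e0 ψ)) = (Matrix.diagonal (Sum.elim (fun _ => 0) la) : Matrix (JJ r l) (JJ r l) ℝ) i j)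
    (hla : ∀ j, 0 < la j) (hinj : Function.Injective la) (hc : 0 < c) (dio : ∀ ν : Fin r → ℤ, ν ≠ 0 → c / (1 + nrm ν) ^ T0 ≤ |dt ν ω|) :
    ∃ K S, 0 ≤ K ∧ 0 < S ∧ ∀ s, 0 < s → s ≤ S → volume (Set.Icc s (2 * s) \ {σ | Sol ω m V σ}) ≤ ENNReal.ofReal (K * s ^ 2) := by
  haveI : Nonempty (Fin l) := ⟨⟨0, hl⟩⟩
  obtain ⟨t₀, ht₀⟩ := Finite.exists_min fun t : Tl l => |th (fun j _ => la j) t 0|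
  have hth : ∀ t, th (fun j _ => la j) t 0 ≠ 0 := fun t => by
    rcases t with j | p | p <;> simp only [th]
    · exact neg_ne_zero.mpr (hla j).ne'
    · exact neg_ne_zero.mpr (add_pos (hla _) (hla _)).ne'
    · split_ifs with h
      · exact neg_ne_zero.mpr (hla _).ne'
      · exact sub_ne_zero.mpr fun e => h (hinj e)
  have hθ := abs_pos.mpr (hth t₀)
  obtain ⟨g, g0, g1, g2, g3⟩ : ∃ g : ℝ, 0 < g ∧ g ≤ 1 ∧ g ≤ c / 2 ∧ 2 * g ≤ |th (fun j _ => la j) t₀ 0| :=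
    ⟨min 1 (min (c / 2) (|th (fun j _ => la j) t₀ 0| / 2)), by positivity, min_le_left _ _, (min_le_right _ _).trans (min_le_left _ _), by
      linarith [(min_le_right 1 (min (c / 2) (|th (fun j _ => la j) t₀ 0| / 2))).trans (min_le_right _ _)]⟩
  obtain ⟨δ, d0, d1, d2⟩ : ∃ δ : ℝ, 0 < δ ∧ δ ≤ 1 ∧ 18 * δ ≤ κ :=
    ⟨min 1 (κ / 18), by positivity, min_le_left _ _, by linarith [min_le_right 1 (κ / 18)]⟩
  obtain ⟨T, hT⟩ : ∃ T, T = 2 * T0 + 2 * r := ⟨_, rfl⟩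
  obtain ⟨Λ, hΛ⟩ : ∃ Λ, Λ = 1 + ∑ j, |la j| := ⟨_, rfl⟩
  have hΛ1 : 1 ≤ Λ := by rw [hΛ]; linarith [Finset.sum_nonneg fun j (_ : j ∈ Finset.univ) => abs_nonneg (la j)]
  have hΛ2 : ∀ j, |la j| ≤ Λ - 1 := fun j => by
    rw [hΛ, add_sub_cancel_left]; exact Finset.single_le_sum (f := fun j => |la j|) (fun _ _ => abs_nonneg _) (Finset.mem_univ j)
  obtain ⟨W, hW⟩ : ∃ W, W = ∑ k, |ω k| := ⟨_, rfl⟩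
  have hW2 : ∀ k, |ω k| ≤ W := fun k => hW ▸ Finset.single_le_sum (f := fun k => |ω k|) (fun _ _ => abs_nonneg _) (Finset.mem_univ k)
  have hW0 : 0 ≤ W := hW ▸ Finset.sum_nonneg fun _ _ => abs_nonneg _
  obtain ⟨n, hn⟩ : ∃ n : ℝ, n = Fintype.card (II r l) := ⟨_, rfl⟩
  have hn0 : 0 ≤ n := hn ▸ Nat.cast_nonneg _
  obtain ⟨q, hq⟩ : ∃ q : ℝ, q = 7 * Λ / g ^ 2 * ((2 * T).factorial * 3) := ⟨_, rfl⟩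
  have hq0 : 0 ≤ q := hq ▸ by positivity
  obtain ⟨Q, hQ⟩ : ∃ Q : ℝ, Q = Λ + C + 8 + n + 1 / δ + W / δ + q / δ ^ (2 * T) := ⟨_, rfl⟩
  have p1 : 0 ≤ 1 / δ := by positivity
  have p2 : 0 ≤ W / δ := by positivity
  have p3 : 0 ≤ q / δ ^ (2 * T) := by positivity
  have dio' : ∀ ν : Fin r → ℤ, ν ≠ 0 → g / (1 + nrm ν) ^ T ≤ |dt ν ω| := fun ν hν => by
    refine le_trans ?_ (dio ν hν)
    have := nrm_nonneg' ν
    exact div_le_div₀ hc.le (by linarith) (by positivity) (pow_le_pow_right₀ (by linarith) (by omega))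
  obtain ⟨K, K0, hK⟩ := init (T := T) (Q := Q) md hm hG hF hC d0 d1 d2 g0 dio' (by linarith)
  obtain ⟨y, y0, y1, y2, y3, y4⟩ : ∃ y : ℝ, 0 < y ∧ y ≤ 1 / 2 ∧ y ≤ g / 12 ∧ y ≤ 1 / (18 * n ^ 2 + 1) ∧ y ≤ δ / 2 :=
    ⟨min (min (1 / 2) (g / 12)) (min (1 / (18 * n ^ 2 + 1)) (δ / 2)), by positivity, (min_le_left _ _).trans (min_le_left _ _),
      (min_le_left _ _).trans (min_le_right _ _), (min_le_right _ _).trans (min_le_left _ _), (min_le_right _ _).trans (min_le_right _ _)⟩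
  refine ⟨4 * (8 * Λ / c) ^ 2 * ∑' p, FF l r p, min 1 (y / (K + 1)), mul_nonneg (by positivity) (tsum_nonneg FF_nn), by positivity, fun s s0 s1 => ?_⟩
  have s2 : K * s ≤ y := by
    have := s1.trans (min_le_right _ _)
    rw [le_div_iff₀ (by positivity)] at this
    linarith
  obtain ⟨S, S1, -, S3⟩ := hK s (K * s) s0 (s1.trans (min_le_left _ _)) le_rfl
  have pm : Pm ω la m V κ C g Λ T δ Q (K * s) s :=
    { hr := hr, g0 := g0, g1 := g1, gap := fun t => g3.trans (ht₀ t), L1 := hΛ1, LQ := by linarith, la1 := hΛ2, dio := dio', T1 := by omega, md := md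
      C0 := hC, CQ := by linarith, Q8 := by linarith, card := by rw [← hn]; linarith, d0 := d0, d1 := d1
      dQ := (div_le_iff₀ d0).mp (by linarith)
      om := fun k => (hW2 k).trans ((div_le_iff₀ d0).mp (by linarith))
      hQ := hq ▸ (div_le_iff₀ (by positivity)).mp (by linarith)
      s0 := s0, s1 := s1.trans (min_le_left _ _), Y0 := by positivity, Y1 := s2.trans y1, Yg := by linarith, Yk := by linarith
      YN := by
        rw [← hn]
        have := s2.trans y3
        rw [le_div_iff₀ (by positivity)] at this
        nlinarith [mul_nonneg K0 s0.le] }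
  obtain ⟨F, F0, hF⟩ := pm.seq S3
  exact pm.bad hF (F0 ▸ S1) hc g2 dio hT

end

end KAM


open MeasureTheory Real Filter

namespace KAM

noncomputable section

lemma ana_bd {E : Type} [NormedAddCommGroup E] [NormedSpace ℝ E] {F : E → ℝ} (hF : AnalyticOnNhd ℝ F Set.univ) {S : Set E} (hS : IsCompact S) :
    ∃ C R : ℝ, 0 ≤ C ∧ 0 < R ∧ ∀ y ∈ S, ∀ (k : ℕ) v, |iteratedFDeriv ℝ k F y (fun _ => v)| ≤ C * k.factorial * (R * ‖v‖) ^ k := by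
  refine hS.induction_on (p := fun S => ∃ C R : ℝ, 0 ≤ C ∧ 0 < R ∧ ∀ y ∈ S, ∀ (k : ℕ) v, |iteratedFDeriv ℝ k F y (fun _ => v)| ≤ C * k.factorial * (R * ‖v‖) ^ k)
    ⟨0, 1, le_rfl, one_pos, by simp⟩ ?_ ?_ fun y₀ _ => ?_
  · rintro s t hst ⟨C, R, h1, h2, h3⟩
    exact ⟨C, R, h1, h2, fun y hy => h3 y (hst hy)⟩
  · rintro s t ⟨C, R, h1, h2, h3⟩ ⟨C', R', h1', h2', h3'⟩
    refine ⟨C + C', R + R', by positivity, by positivity, fun y hy k v => ?_⟩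
    rcases hy with hy | hy
    · refine (h3 y hy k v).trans ?_
      gcongr <;> linarith
    · refine (h3' y hy k v).trans ?_
      gcongr <;> linarith
  · obtain ⟨p, ρ, hp⟩ := hF y₀ (Set.mem_univ _)
    obtain ⟨q, q0, q1⟩ := ENNReal.lt_iff_exists_nnreal_btwn.mp hp.r_pos
    have q0 : 0 < q := by exact_mod_cast q0
    have hr : ((q / 2 : NNReal) + (q / 2 : NNReal) : ENNReal) < p.radius := by
      rw [← ENNReal.coe_add, add_halves]; exact q1.trans_le hp.r_le
    have hs := p.changeOriginSeries_summable_aux₁ hr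
    generalize hr2 : q / 2 = r at *
    have r0 : 0 < r := hr2 ▸ half_pos q0
    have rr : (r : ENNReal) < ρ := lt_of_le_of_lt (by rw [← hr2]; exact_mod_cast half_le_self q0.le) q1
    refine ⟨Metric.ball y₀ r, mem_nhdsWithin_of_mem_nhds (Metric.ball_mem_nhds _ (by exact_mod_cast r0)), (∑' s : Σ k l : ℕ, { s : Finset (Fin (k + l)) // s.card = l }, ‖p (s.1 + s.2.1)‖₊ * r ^ s.2.1 * r ^ s.1 : NNReal), (r : ℝ)⁻¹, NNReal.coe_nonneg _, by positivity, fun y hy k v => ?_⟩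
    have hx : ‖y - y₀‖₊ < r := by rw [Metric.mem_ball, dist_eq_norm] at hy; exact_mod_cast hy
    have hx' : (‖y - y₀‖₊ : ENNReal) < r := by exact_mod_cast hx
    have h1 := hp.changeOrigin (hx'.trans rr)
    rw [add_sub_cancel] at h1
    rw [← h1.factorial_smul, nsmul_eq_mul, abs_mul, Nat.abs_cast]
    have h2 : ‖p.changeOrigin (y - y₀) k‖₊ * r ^ k ≤ ∑' s : Σ k l : ℕ, { s : Finset (Fin (k + l)) // s.card = l }, ‖p (s.1 + s.2.1)‖₊ * r ^ s.2.1 * r ^ s.1 := by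
      refine le_trans ?_ (NNReal.tsum_comp_le_tsum_of_inj hs (i := Sigma.mk k) sigma_mk_injective)
      simp only [Function.comp_def]
      rw [NNReal.tsum_mul_right]
      gcongr
      refine (p.nnnorm_changeOrigin_le k ((hx'.trans rr).trans_le hp.r_le)).trans ?_
      have a := p.changeOriginSeries_summable_aux₂ (rr.trans_le hp.r_le) k
      have b : ∀ s : Σ l : ℕ, { s : Finset (Fin (k + l)) // s.card = l }, ‖p (k + s.1)‖₊ * ‖y - y₀‖₊ ^ s.1 ≤ ‖p (k + s.1)‖₊ * r ^ s.1 := fun s => by gcongr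
      exact (NNReal.summable_of_le b a).tsum_le_tsum b a
    generalize (∑' s : Σ k l : ℕ, { s : Finset (Fin (k + l)) // s.card = l }, ‖p (s.1 + s.2.1)‖₊ * r ^ s.2.1 * r ^ s.1) = Z at h2
    have h3 : ‖p.changeOrigin (y - y₀) k‖ * (r : ℝ) ^ k ≤ Z := by exact_mod_cast h2
    have h4 := (p.changeOrigin (y - y₀) k).le_opNorm fun _ => v
    rw [Finset.prod_const, Finset.card_univ, Fintype.card_fin, Real.norm_eq_abs] at h4
    rw [← le_div_iff₀ (by positivity)] at h3
    calc _ ≤ (k.factorial : ℝ) * (Z / (r : ℝ) ^ k * ‖v‖ ^ k) := by gcongr; exact h4.trans (by gcongr)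
      _ = _ := by rw [mul_pow, inv_pow]; ring

end

end KAM


open MeasureTheory Real Filter

namespace KAM

noncomputable section

variable {ι : Type} [Fintype ι] [DecidableEq ι] {u u' F : (ι → ℝ) → ℝ}

def Pr (u : (ι → ℝ) → ℝ) : Prop := ∀ y i, u (y + Pi.single i (2 * π)) = u y

def tl (u : (ι → ℝ) → ℝ) (x : UnitAddTorus ι) : ℂ := (u fun i => 2 * π * (AddCircle.equivIco 1 0 (x i)).1 : ℝ)

def pj (y : ι → ℝ) : UnitAddTorus ι := fun i => ((y i / (2 * π) : ℝ) : UnitAddCircle)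

lemma pj_add (y z : ι → ℝ) : pj (y + z) = pj y + pj z := funext fun i => by
  simp only [pj, Pi.add_apply, add_div, AddCircle.coe_add]

lemma pj_q : IsOpenQuotientMap (pj (ι := ι)) :=
  IsOpenQuotientMap.piMap fun _ => (QuotientAddGroup.isOpenQuotientMap_mk (N := AddSubgroup.zmultiples (1 : ℝ))).comp
    (Homeomorph.mulRight₀ (2 * π)⁻¹ (by positivity)).isOpenQuotientMap

lemma tl_pj (h : Pr u) (y : ι → ℝ) : tl u (pj y) = u y := by
  have h1 : ∀ i, ∃ n : ℤ, 2 * π * (AddCircle.equivIco 1 0 (pj y i)).1 = y i + n * (2 * π) := fun i => by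
    have a : (((AddCircle.equivIco 1 0 (pj y i)).1 : ℝ) : UnitAddCircle) = ((y i / (2 * π) : ℝ) : UnitAddCircle) := AddCircle.coe_equivIco
    obtain ⟨n, hn⟩ := AddSubgroup.mem_zmultiples_iff.mp (QuotientAddGroup.eq_iff_sub_mem.mp a)
    refine ⟨n, ?_⟩
    rw [zsmul_eq_mul, mul_one, eq_sub_iff_add_eq] at hn
    rw [← hn]; field_simp; ring
  choose n hn using h1
  have h2 : Function.Periodic u (∑ i, n i • (Pi.single i (2 * π) : ι → ℝ)) :=
    Finset.sum_induction _ (Function.Periodic u) (fun _ _ => Function.Periodic.add_period) (by simp [Function.Periodic]) fun i _ => (show Function.Periodic u (Pi.single i (2 * π)) from fun y => h y i).zsmul _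
  rw [tl, ← h2 y]
  congr 2
  funext i
  rw [hn]
  simp [Finset.sum_apply, Pi.single_apply]

lemma tl_cont (h : Pr u) (hc : Continuous u) : Continuous (tl u) := by
  rw [pj_q.isQuotientMap.continuous_iff]
  exact (Complex.continuous_ofReal.comp hc).congr fun y => (tl_pj h y).symm

lemma mF_pj (n : ι → ℤ) (y : ι → ℝ) : UnitAddTorus.mFourier n (pj y) = Complex.exp (Complex.I * ((∑ i, (n i : ℝ) * y i : ℝ) : ℂ)) := by
  simp only [UnitAddTorus.mFourier, ContinuousMap.coe_mk, pj, fourier_coe_apply]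
  rw [← Complex.exp_sum]
  push_cast
  rw [Finset.mul_sum]
  congr 1
  refine Finset.sum_congr rfl fun i _ => ?_
  have : (π : ℂ) ≠ 0 := Complex.ofReal_ne_zero.mpr pi_ne_zero
  field_simp

abbrev mH (ι : Type) [Fintype ι] : Measure (UnitAddTorus ι) := Measure.pi fun _ => AddCircle.haarAddCircle

lemma mc (v : UnitAddTorus ι → ℂ) (n) : UnitAddTorus.mFourierCoeff v n = ∫ x, UnitAddTorus.mFourier (-n) x * v x ∂mH ι := rfl

lemma coefD (hu : Pr u) (hu' : Pr u') (cu : Continuous u) (cu' : Continuous u') (j : ι)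
    (hd : ∀ (y : ι → ℝ) (t : ℝ), HasDerivAt (fun t => u (y + Pi.single j t)) (u' (y + Pi.single j t)) t) (n : ι → ℤ) :
    UnitAddTorus.mFourierCoeff (tl u') n = Complex.I * n j * UnitAddTorus.mFourierCoeff (tl u) n := by
  let sh : ℝ → UnitAddTorus ι := fun t => pj (Pi.single j t)
  have h1 : ∀ t : ℝ, ∫ x, UnitAddTorus.mFourier (-n) x * tl u (x + sh t) ∂mH ι = Complex.exp (Complex.I * n j * t) * UnitAddTorus.mFourierCoeff (tl u) n := fun t => by
    have a := integral_add_right_eq_self (μ := mH ι) (f := fun x : UnitAddTorus ι => (UnitAddTorus.mFourier (-n) (x - sh t) * tl u x : ℂ)) (sh t)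
    simp only [add_sub_cancel_right] at a
    rw [a, mc, ← integral_const_mul]
    refine integral_congr_ae (ae_of_all _ fun x => ?_)
    beta_reduce
    obtain ⟨y, rfl⟩ := pj_q.surjective x
    have e : pj y - sh t = pj (y - Pi.single j t) := by rw [sub_eq_iff_eq_add, ← pj_add, sub_add_cancel]
    rw [e, mF_pj, mF_pj, ← mul_assoc, ← Complex.exp_add]
    congr 2
    simp [mul_sub, Finset.sum_sub_distrib, Pi.single_apply]
    ring
  obtain ⟨M, hM⟩ := isCompact_univ.exists_bound_of_continuousOn (tl_cont hu' cu').continuousOn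
  have hsh : Continuous sh := pj_q.continuous.comp (continuous_pi fun i => by simp only [Pi.single_apply]; split_ifs <;> fun_prop)
  have h2 := (hasDerivAt_integral_of_dominated_loc_of_deriv_le (μ := mH ι) (𝕜 := ℝ) (s := Set.univ) (x₀ := 0) (bound := fun _ => M)
    (F := fun t x => UnitAddTorus.mFourier (-n) x * tl u (x + sh t)) (F' := fun t x => UnitAddTorus.mFourier (-n) x * tl u' (x + sh t)) univ_mem
    (Eventually.of_forall fun t => ((ContinuousMap.continuous _).mul ((tl_cont hu cu).comp (continuous_id.add continuous_const))).aestronglyMeasurable)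
    (((ContinuousMap.continuous _).mul ((tl_cont hu cu).comp (continuous_id.add continuous_const))).integrable_of_hasCompactSupport (HasCompactSupport.of_compactSpace _))
    ((ContinuousMap.continuous _).mul ((tl_cont hu' cu').comp (continuous_id.add continuous_const))).aestronglyMeasurable
    (ae_of_all _ fun x t _ => by
      obtain ⟨y, rfl⟩ := pj_q.surjective x
      rw [norm_mul, mF_pj, mul_comm Complex.I, Complex.norm_exp_ofReal_mul_I, one_mul]
      exact hM _ (Set.mem_univ _)) (integrable_const _)
    (ae_of_all _ fun x t _ => by
      obtain ⟨y, rfl⟩ := pj_q.surjective x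
      simp only [sh, ← pj_add, tl_pj hu, tl_pj hu']
      exact (hd y t).ofReal_comp.const_mul _)).2
  have e0 : sh 0 = 0 := by simp only [sh, Pi.single_zero]; funext i; simp [pj]
  simp only [h1, e0, add_zero] at h2
  have h3 : HasDerivAt (fun t : ℝ => Complex.exp (Complex.I * n j * t) * UnitAddTorus.mFourierCoeff (tl u) n) (Complex.I * n j * UnitAddTorus.mFourierCoeff (tl u) n) 0 := by
    have a := (((hasDerivAt_id (0 : ℝ)).ofReal_comp.const_mul (Complex.I * n j)).cexp).mul_const (UnitAddTorus.mFourierCoeff (tl u) n)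
    exact a.congr_deriv (by simp)
  rw [mc, h2.unique h3]

lemma four [Nonempty ι] (hF : AnalyticOnNhd ℝ F Set.univ) (hp : Pr F) : ∃ κ > 0, ∃ c : (ι → ℤ) → ℂ, Summable (fun n => ‖c n‖ * exp (κ * ∑ i, |(n i : ℝ)|)) ∧
    ∀ y, HasSum (fun n => c n * Complex.exp (Complex.I * ((∑ i, (n i : ℝ) * y i : ℝ) : ℂ))) (F y : ℂ) := by
  obtain ⟨C, R, C0, R0, hb⟩ := ana_bd hF (isCompact_univ_pi fun _ : ι => isCompact_Icc (a := (0 : ℝ)) (b := 2 * π))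
  have hcd := hF.contDiff (n := ⊤)
  let U : ι → ℕ → (ι → ℝ) → ℝ := fun j k y => iteratedFDeriv ℝ k F y fun _ => Pi.single j 1
  have hU0 : ∀ k, Differentiable ℝ (iteratedFDeriv ℝ k F) := fun k => hcd.differentiable_iteratedFDeriv (by simp)
  have hU1 : ∀ j k, Continuous (U j k) := fun j k => by
    have := (hU0 k).continuous
    fun_prop
  have hU2 : ∀ j k, Pr (U j k) := fun j k y i => by
    have : (fun y => F (y + Pi.single i (2 * π))) = F := funext fun y => hp y i
    conv_rhs => simp only [U]; rw [← this, iteratedFDeriv_comp_add_right]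
  have hU3 : ∀ j k (y : ι → ℝ) (t : ℝ), HasDerivAt (fun t => U j k (y + Pi.single j t)) (U j (k + 1) (y + Pi.single j t)) t := fun j k y t => by
    have a : HasDerivAt (fun t : ℝ => y + Pi.single j t) (Pi.single j 1) t := by
      have := ((hasDerivAt_id t).smul_const (Pi.single j (1 : ℝ) : ι → ℝ)).const_add y
      simpa [← Pi.single_smul] using this
    have b := ((hU0 k) (y + Pi.single j t)).hasFDerivAt.comp_hasDerivAt t a
    have c := ((ContinuousMultilinearMap.apply ℝ (fun _ : Fin k => ι → ℝ) ℝ fun _ => Pi.single j 1).hasFDerivAt).comp_hasDerivAt t b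
    refine c.congr_deriv ?_
    simp only [U, iteratedFDeriv_succ_apply_left]
    rfl
  obtain ⟨c, hc⟩ : ∃ c, c = UnitAddTorus.mFourierCoeff (tl F) := ⟨_, rfl⟩
  have hk : ∀ j k n, UnitAddTorus.mFourierCoeff (tl (U j k)) n = (Complex.I * n j) ^ k * c n := fun j k n => by
    induction k with
    | zero => rw [pow_zero, one_mul, hc]; rfl
    | succ k ih => rw [coefD (hU2 j k) (hU2 j (k + 1)) (hU1 j k) (hU1 j _) j (hU3 j k), ih]; ring
  have hk2 : ∀ j (k : ℕ) n, |(n j : ℝ)| ^ k * ‖c n‖ ≤ C * k.factorial * R ^ k := fun j k n => by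
    have a := hk j k n
    have b : ‖UnitAddTorus.mFourierCoeff (tl (U j k)) n‖ ≤ C * k.factorial * R ^ k := by
      have := norm_integral_le_of_norm_le_const (μ := mH ι) (f := fun x => UnitAddTorus.mFourier (-n) x * tl (U j k) x) (C := C * k.factorial * R ^ k) (ae_of_all _ fun x => by
        obtain ⟨y, hy⟩ := pj_q.surjective x
        rw [norm_mul, ← hy, mF_pj, mul_comm Complex.I, Complex.norm_exp_ofReal_mul_I, one_mul, hy, tl, Complex.norm_real, Real.norm_eq_abs]
        refine (hb _ (fun i _ => ?_) k (Pi.single j 1)).trans_eq (by rw [Pi.norm_single, norm_one, mul_one])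
        have := (AddCircle.equivIco 1 0 (x i)).2
        have hπ := pi_pos
        exact ⟨by have := this.1; positivity, by nlinarith [this.2]⟩)
      rwa [← mc, probReal_univ, mul_one] at this
    rw [a, norm_mul, norm_pow, norm_mul, Complex.norm_I, one_mul, Complex.norm_intCast] at b
    exact b
  have hk3 : ∀ j n, ‖c n‖ * exp (|(n j : ℝ)| / (2 * R)) ≤ 2 * C := fun j n => by
    have a := NormedSpace.expSeries_div_hasSum_exp (𝔸 := ℝ) (|(n j : ℝ)| / (2 * R))
    rw [← Real.exp_eq_exp_ℝ] at a
    have b := hasSum_geometric_two.mul_left C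
    rw [mul_comm C] at b
    refine hasSum_le (fun k => ?_) (a.mul_left ‖c n‖) b
    have d := hk2 j k n
    rw [div_pow, mul_pow, one_div, inv_pow, ← mul_div_assoc, ← mul_div_assoc, div_div, div_le_iff₀ (by positivity)]
    calc _ = _ := mul_comm _ _
      _ ≤ _ := d
      _ = _ := by field_simp
  obtain ⟨N, hN⟩ : ∃ N : ℝ, N = Fintype.card ι := ⟨_, rfl⟩
  have hN0 : 0 < N := by rw [hN]; exact_mod_cast Fintype.card_pos
  obtain ⟨κ, hκ⟩ : ∃ κ, κ = 1 / (4 * R * N) := ⟨_, rfl⟩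
  have κ0 : 0 < κ := by rw [hκ]; positivity
  have hk4 : ∀ n, ‖c n‖ * exp (κ * ∑ i, |(n i : ℝ)|) ≤ 2 * C * ∏ i, exp (-κ * |(n i : ℝ)|) := fun n => by
    obtain ⟨j, hj⟩ := Finite.exists_max fun i => |(n i : ℝ)|
    have a : ∑ i, |(n i : ℝ)| ≤ N * |(n j : ℝ)| := by
      have := Finset.sum_le_card_nsmul Finset.univ (fun i => |(n i : ℝ)|) _ fun i _ => hj i
      rwa [nsmul_eq_mul, Finset.card_univ, ← hN] at this
    rw [← exp_sum, ← Finset.mul_sum]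
    have b : κ * ∑ i, |(n i : ℝ)| ≤ |(n j : ℝ)| / (2 * R) + -κ * ∑ i, |(n i : ℝ)| := by
      have e : |(n j : ℝ)| / (2 * R) = 2 * κ * (N * |(n j : ℝ)|) := by rw [hκ]; field_simp; norm_num
      rw [e]; nlinarith
    calc _ ≤ ‖c n‖ * exp (|(n j : ℝ)| / (2 * R) + -κ * ∑ i, |(n i : ℝ)|) := by gcongr
      _ = ‖c n‖ * exp (|(n j : ℝ)| / (2 * R)) * exp (-κ * ∑ i, |(n i : ℝ)|) := by rw [exp_add]; ring
      _ ≤ _ := by exact mul_le_mul_of_nonneg_right (hk3 j n) (exp_pos _).le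
  have hsm : Summable fun n : ℤ => exp (-κ * |(n : ℝ)|) := by
    have h : Summable fun n : ℕ => exp (-κ * (n : ℝ)) := by
      simpa [mul_comm] using Real.summable_exp_nat_mul_iff.mpr (neg_neg_of_pos κ0)
    refine Summable.of_nat_of_neg ?_ ?_ <;> simpa using h
  have hS : Summable fun n => ‖c n‖ * exp (κ * ∑ i, |(n i : ℝ)|) :=
    Summable.of_nonneg_of_le (fun _ => by positivity) hk4 ((sumPi (fun _ => (exp_pos _).le) hsm).mul_left _)
  refine ⟨κ, κ0, c, hS, fun y => ?_⟩
  have hS' : Summable c := Summable.of_norm (Summable.of_nonneg_of_le (fun _ => norm_nonneg _) (fun n => le_mul_of_one_le_right (norm_nonneg _) (one_le_exp (by positivity))) hS)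
  have := UnitAddTorus.hasSum_mFourier_series_apply_of_summable (f := ⟨tl F, tl_cont hp hF.continuous⟩) (hc ▸ hS') (pj y)
  simp only [ContinuousMap.coe_mk, tl_pj hp, mF_pj, smul_eq_mul, ← hc] at this
  exact this

end

end KAM


open MeasureTheory Real Filter

namespace KAM

noncomputable section

variable {r l : ℕ}

lemma avd {g : (Fin r → ℝ) × (Fin l → ℝ) → ℝ} (hg : ContDiff ℝ 1 g) (β v : Fin l → ℝ) :
    DifferentiableAt ℝ (fun β => avg fun α => g (α, β)) β ∧
      fderiv ℝ (fun β => avg fun α => g (α, β)) β v = avg fun α => fderiv ℝ g (α, β) (0, v) := by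
  have c1 := hg.continuous_fderiv one_ne_zero
  obtain ⟨C, hC⟩ := ((isCompact_bx r).prod (isCompact_closedBall β 1)).exists_bound_of_continuousOn
    (f := fun p => (fderiv ℝ g p).comp (ContinuousLinearMap.inr ℝ (Fin r → ℝ) (Fin l → ℝ))) (by fun_prop)
  have hc : Continuous fun α => (fderiv ℝ g (α, β)).comp (ContinuousLinearMap.inr ℝ (Fin r → ℝ) (Fin l → ℝ)) := by fun_prop
  have hm : MeasurableSet (bx r) := (isCompact_bx r).measurableSet
  have h := hasFDerivAt_integral_of_dominated_of_fderiv_le (μ := volume.restrict (bx r)) (F := fun β α => g (α, β))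
    (F' := fun β α => (fderiv ℝ g (α, β)).comp (ContinuousLinearMap.inr ℝ (Fin r → ℝ) (Fin l → ℝ))) (bound := fun _ => C) (x₀ := β)
    (Metric.closedBall_mem_nhds β one_pos)
    (Eventually.of_forall fun x => (hg.continuous.comp (by fun_prop : Continuous fun α : Fin r → ℝ => (α, x))).aestronglyMeasurable)
    ((hg.continuous.comp (by fun_prop : Continuous fun α : Fin r → ℝ => (α, β))).continuousOn.integrableOn_compact (isCompact_bx r))
    hc.aestronglyMeasurable
    ((ae_restrict_iff' hm).mpr (ae_of_all _ fun α hα x hx => hC (α, x) ⟨hα, hx⟩))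
    (continuous_const.continuousOn.integrableOn_compact (isCompact_bx r))
    (ae_of_all _ fun α x _ => (hg.differentiable one_ne_zero (α, x)).hasFDerivAt.comp x (hasFDerivAt_prodMk_right α x))
  have h2 := h.const_smul ((2 * π) ^ r)⁻¹
  refine ⟨h2.differentiableAt, ?_⟩
  have h3 : fderiv ℝ (fun β => avg fun α => g (α, β)) β = _ := h2.fderiv
  rw [h3, ContinuousLinearMap.smul_apply, ContinuousLinearMap.integral_apply (hc.continuousOn.integrableOn_compact (isCompact_bx r))]
  simp [avg]

lemma sd {E : Type*} [NormedAddCommGroup E] [NormedSpace ℝ E] {g : E → ℝ} (hg : ContDiff ℝ 2 g) (x u v : E) :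
    fderiv ℝ (fun y => fderiv ℝ g y u) x v = fderiv ℝ (fun y => fderiv ℝ g y v) x u := by
  have h : DifferentiableAt ℝ (fderiv ℝ g) x := (hg.fderiv_right (m := 1) (by norm_num)).differentiable one_ne_zero x
  have k : ∀ u, HasFDerivAt (fun y => fderiv ℝ g y u) _ x := fun u => h.hasFDerivAt.clm_apply (hasFDerivAt_const u x)
  rw [(k u).fderiv, (k v).fderiv]
  simpa using hg.contDiffAt.isSymmSndFDerivAt (by simp) v u

lemma sd2 {E : Type*} [NormedAddCommGroup E] [NormedSpace ℝ E] {g : E → ℝ} (hg : ContDiff ℝ 2 g) (u : E) :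
    ContDiff ℝ 1 fun y => fderiv ℝ g y u :=
  (hg.fderiv_right (m := 1) (by norm_num)).clm_apply contDiff_const

lemma FE.mono {κ κ' C C' : ℝ} {g : (JJ r l → ℝ) → ℝ} (h : FE κ g C) (hκ : κ' ≤ κ) (hC : C ≤ C') : FE κ' g C' := by
  obtain ⟨P, hP, ℓ, ν, c, hν, hS, hC', hg'⟩ := h
  have a : ∀ p, ‖c p‖ * exp (κ' * l1 (ℓ p)) ≤ ‖c p‖ * exp (κ * l1 (ℓ p)) := fun p => by
    have := l1_nonneg (ℓ p)
    gcongr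
  have b := hS.of_nonneg_of_le (fun p => by positivity) a
  exact ⟨P, hP, ℓ, ν, c, hν, b, (b.tsum_le_tsum a hS).trans (hC'.trans hC), hg'⟩

lemma FE.md {κ C : ℝ} {V : (JJ r l → ℝ) → ℝ} {m : JJ r l → ℝ} (h : FE κ V C) (hV : ContDiff ℝ 2 V) (hκ : 0 < κ) (hC : 0 ≤ C) :
    ∃ C', 0 ≤ C' ∧ Md V m (κ / 4) C' := by
  have dV := hV.differentiable two_ne_zero
  have dG : ∀ i, Differentiable ℝ (Gd V i) := fun i => (sd2 hV _).differentiable one_ne_zero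
  have fG : ∀ i, FE (κ / 2) (Gd V i) (C / (κ / 2)) := fun i => h.partial dV (by positivity) (by linarith) (by positivity) i
  have a : 0 ≤ C / (κ / 2) := by positivity
  have b : 0 ≤ C / (κ / 2) / (κ / 4) := by positivity
  exact ⟨C + C / (κ / 2) + C / (κ / 2) / (κ / 4), by positivity, dV, dG, h.mono (by linarith) (by linarith),
    fun i => (fG i).mono (by linarith) (by linarith), fun i j => ((fG i).partial (dG i) (δ := κ / 4) (κ' := κ / 4) (by positivity) (by linarith) (by positivity) j).mono le_rfl (by linarith),
    fun i j y => sd hV y _ _⟩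

lemma tv {κ C : ℝ} {g : (JJ r l → ℝ) → ℝ} (h : FE κ g C) (hg : Differentiable ℝ g) (hκ : 0 < κ) (k : Fin r) :
    avg (fun ψ => fderiv ℝ g (e0 ψ) (Pi.single (Sum.inl k) 1)) = 0 := by
  have a := h.comp (D := Set.univ) (s := 1) (ρ := κ / 2) (q := fun _ _ _ => 0) (fun j => RB.zero) le_rfl (by positivity) (by linarith)
  refine RB.avg_deriv (σ := 0) (w := Pi.single k 1) (u' := fun _ ψ => fderiv ℝ g (e0 ψ) (Pi.single (Sum.inl k) 1)) a (by positivity) (fun σ _ ψ => ?_) (Set.mem_univ _)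
  have e : (fun t : ℝ => g (em (fun _ _ _ => 0) σ (ψ + t • Pi.single k 1))) = fun t : ℝ => g (e0 ψ + t • (Pi.single (Sum.inl k) 1 : JJ r l → ℝ)) := by
    funext t; congr 1; funext j
    rcases j with j | j <;> simp [em, e0, Pi.single_apply]
  beta_reduce
  rw [e]
  exact (hg (e0 ψ)).hasFDerivAt.hasLineDerivAt _

lemma lin {H : Matrix (Fin l) (Fin l) ℝ} (hH : ∀ i j, H i j = H j i) {a : Fin l → ℝ} (hpos : ∀ i, 0 < a i) (hmono : StrictMono a)
    (heig : ∀ i, Module.End.HasEigenvalue (Matrix.toLin' H) (a i)) :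
    ∃ (L : Matrix (Fin l) (Fin l) ℝ) (la : Fin l → ℝ), (∀ j, 0 < la j) ∧ Function.Injective la ∧
      (∀ i k, ∑ j, L i j * (la j * L k j) = if i = k then 1 else 0) ∧
      ∀ i j, ∑ k, ∑ n, L n i * (L k j * H k n) = if i = j then la i else 0 := by
  choose v hv using fun i => (heig i).exists_hasEigenvector
  have e : ∀ i, H.mulVec (v i) = a i • v i := fun i => by simpa using (hv i).apply_eq_smul
  have n0 : ∀ i, 0 < dotProduct (v i) (v i) := fun i =>
    (Finset.sum_nonneg fun k _ => mul_self_nonneg (v i k)).lt_of_ne' fun q => (hv i).2 (dotProduct_self_eq_zero.mp q)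
  have hHt : H.transpose = H := Matrix.ext fun i j => hH j i
  have o : ∀ i j, dotProduct (v i) (H.mulVec (v j)) = if i = j then a i * dotProduct (v i) (v i) else 0 := fun i j => by
    have q1 : dotProduct (v i) (H.mulVec (v j)) = a j * dotProduct (v i) (v j) := by rw [e, dotProduct_smul, smul_eq_mul]
    split_ifs with h
    · rw [q1, h]
    · have q2 : dotProduct (v i) (H.mulVec (v j)) = a i * dotProduct (v i) (v j) := by
        rw [Matrix.dotProduct_mulVec, ← Matrix.mulVec_transpose, hHt, e, smul_dotProduct, smul_eq_mul]
      have q3 : (a i - a j) * dotProduct (v i) (v j) = 0 := by rw [sub_mul, ← q1, ← q2, sub_self]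
      rcases mul_eq_zero.mp q3 with q | q
      · exact absurd (hmono.injective (sub_eq_zero.mp q)) h
      · rw [q1, q, mul_zero]
  have o2 : ∀ i j, dotProduct (v i) (v j) = if i = j then dotProduct (v i) (v i) else 0 := fun i j => by
    have := o i j
    rw [e, dotProduct_smul, smul_eq_mul] at this
    split_ifs at this ⊢ with h
    · rw [h]
    · exact (mul_eq_zero.mp this).resolve_left (hpos j).ne'
  obtain ⟨d, hd⟩ : ∃ d : Fin l → ℝ, ∀ j, d j ^ 2 * (√(a j) * dotProduct (v j) (v j)) = 1 :=
    ⟨fun j => √(√(a j) * dotProduct (v j) (v j))⁻¹, fun j => by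
      have := mul_pos (sqrt_pos.mpr (hpos j)) (n0 j)
      rw [sq_sqrt (by positivity), inv_mul_cancel₀ this.ne']⟩
  refine ⟨fun i j => v j i * d j, fun j => √(a j), fun j => sqrt_pos.mpr (hpos j), fun i j h => hmono.injective ((sqrt_inj (hpos i).le (hpos j).le).mp h), fun i k => ?_, fun i j => ?_⟩
  · have p : (Matrix.of fun j k => √(a j) * (v j k * d j)) * (Matrix.of fun i j => v j i * d j) = 1 := Matrix.ext fun i j => by
      have := o2 i j
      rw [Matrix.mul_apply, Matrix.one_apply]
      calc _ = √(a i) * d i * d j * dotProduct (v i) (v j) := by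
            rw [dotProduct, Finset.mul_sum]; exact Finset.sum_congr rfl fun k _ => by simp only [Matrix.of_apply]; ring
        _ = _ := by
            rw [this]; split_ifs with h
            · rw [← h, ← hd i]; ring
            · rw [mul_zero]
    have := congrArg (fun M => M i k) (mul_eq_one_comm.mp p)
    beta_reduce at this
    rw [Matrix.mul_apply, Matrix.one_apply] at this
    exact this
  · calc _ = d i * d j * dotProduct (v i) (H.mulVec (v j)) := by
          simp only [dotProduct, Matrix.mulVec, Finset.mul_sum]
          rw [Finset.sum_comm]
          exact Finset.sum_congr rfl fun n _ => Finset.sum_congr rfl fun k _ => by rw [hH n k]; ring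
      _ = _ := by
          rw [o]; split_ifs with h
          · rw [← h]
            have := hd i
            nth_rewrite 1 [← mul_self_sqrt (hpos i).le]
            linear_combination √(a i) * this
          · rw [mul_zero]

lemma sh {E : Type*} [NormedAddCommGroup E] [NormedSpace ℝ E] {ω : Fin r → ℝ} {g g' : (Fin r → ℝ) → E}
    (h : ∀ ψ, HasDerivAt (fun t : ℝ => g (ψ + t • ω)) (g' ψ) 0) (ψ : Fin r → ℝ) (t : ℝ) :
    HasDerivAt (fun u : ℝ => g (ψ + u • ω)) (g' (ψ + t • ω)) t := by
  have a := h (ψ + t • ω)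
  rw [← sub_self t] at a
  refine (a.comp_sub_const t t).congr_of_eventuallyEq (Eventually.of_forall fun u => ?_)
  beta_reduce
  congr 1
  rw [add_assoc, ← add_smul, add_sub_cancel]

end

end KAM


open MeasureTheory Real Filter

namespace KAM

noncomputable section

variable {r l : ℕ}

lemma feV [Nonempty (JJ r l)] {F : (JJ r l → ℝ) → ℝ} (hF : AnalyticOnNhd ℝ F Set.univ) (hp : Pr F) (L : Matrix (Fin l) (Fin l) ℝ) :
    ∃ κ C, 0 < κ ∧ 0 ≤ C ∧ FE κ (fun y => F (Sum.elim (fun k => y (Sum.inl k)) fun i => ∑ j, L i j * y (Sum.inr j))) C := by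
  obtain ⟨κ, κ0, c, hS, hc⟩ := four hF hp
  obtain ⟨Λ, hΛ⟩ : ∃ Λ, Λ = ∑ i, ∑ j, |L i j| := ⟨_, rfl⟩
  have hΛ0 : 0 ≤ Λ := hΛ ▸ Finset.sum_nonneg fun i _ => Finset.sum_nonneg fun j _ => abs_nonneg _
  have hL : ∀ i, ∑ j, |L i j| ≤ 1 + Λ := fun i => by
    have := Finset.single_le_sum (f := fun i => ∑ j, |L i j|) (fun i _ => Finset.sum_nonneg fun j _ => abs_nonneg _) (Finset.mem_univ i)
    rw [hΛ]; linarith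
  obtain ⟨ℓ, hℓ⟩ : ∃ ℓ : (JJ r l → ℤ) → JJ r l → ℝ, ℓ = fun n => Sum.elim (fun k => (n (Sum.inl k) : ℝ)) fun j => ∑ i, (n (Sum.inr i) : ℝ) * L i j := ⟨_, rfl⟩
  have hl : ∀ n, l1 (ℓ n) ≤ (1 + Λ) * ∑ i, |(n i : ℝ)| := fun n => by
    rw [l1, Fintype.sum_sum_type, Fintype.sum_sum_type, mul_add, hℓ]
    simp only [Sum.elim_inl, Sum.elim_inr]
    refine add_le_add (le_mul_of_one_le_left (Finset.sum_nonneg fun _ _ => abs_nonneg _) (by linarith)) ?_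
    calc _ ≤ ∑ j, ∑ i, |(n (Sum.inr i) : ℝ)| * |L i j| := Finset.sum_le_sum fun j _ =>
          (Finset.abs_sum_le_sum_abs _ _).trans_eq (Finset.sum_congr rfl fun i _ => abs_mul _ _)
      _ = ∑ i, |(n (Sum.inr i) : ℝ)| * ∑ j, |L i j| := by simp only [Finset.mul_sum]; exact Finset.sum_comm
      _ ≤ _ := by
        rw [Finset.mul_sum]
        exact Finset.sum_le_sum fun i _ => (mul_le_mul_of_nonneg_left (hL i) (abs_nonneg _)).trans_eq (mul_comm _ _)
  have b : Summable fun n => ‖c n‖ * exp (κ / (1 + Λ) * l1 (ℓ n)) := hS.of_nonneg_of_le (fun n => by positivity) fun n => by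
    have : κ / (1 + Λ) * l1 (ℓ n) ≤ κ * ∑ i, |(n i : ℝ)| := by
      rw [div_mul_eq_mul_div, div_le_iff₀ (by positivity), mul_assoc]
      exact mul_le_mul_of_nonneg_left ((hl n).trans_eq (mul_comm _ _)) κ0.le
    gcongr
  refine ⟨κ / (1 + Λ), _, by positivity, tsum_nonneg fun n => by positivity, JJ r l → ℤ, inferInstance, ℓ, fun n k => n (Sum.inl k), c, fun n k => by rw [hℓ]; rfl, b, le_rfl, fun y => ?_⟩
  refine hsc (hc _) (fun n => ?_) rfl
  rw [ec]
  congr 4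
  rw [Fintype.sum_sum_type, Fintype.sum_sum_type, hℓ]
  simp only [Sum.elim_inl, Sum.elim_inr, Finset.sum_mul, Finset.mul_sum]
  congr 1
  rw [Finset.sum_comm]
  exact Finset.sum_congr rfl fun i _ => Finset.sum_congr rfl fun j _ => by ring

lemma dioph {ω : Fin r → ℝ} {C₀ τ₀ : ℝ} (hr : 1 ≤ r) (hC₀ : 0 < C₀) (hτ₀ : (r : ℝ) - 1 ≤ τ₀)
    (hdio : ∀ ν : Fin r → ℤ, ν ≠ 0 → C₀ * (∑ k, |(ν k : ℝ)|) ^ (-τ₀) ≤ |∑ k, ω k * (ν k : ℝ)|) (ν : Fin r → ℤ) (hν : ν ≠ 0) :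
    C₀ / (1 + nrm ν) ^ ⌈τ₀⌉₊ ≤ |dt ν ω| := by
  have e : dt ν ω = ∑ k, ω k * (ν k : ℝ) := Finset.sum_congr rfl fun k _ => mul_comm _ _
  rw [e]
  refine le_trans ?_ (hdio ν hν)
  have hτ : 0 ≤ τ₀ := le_trans (by rw [sub_nonneg]; exact_mod_cast hr) hτ₀
  obtain ⟨k, hk⟩ := Function.ne_iff.mp hν
  have h0 : 0 < nrm ν := (abs_pos.mpr (Int.cast_ne_zero.mpr hk)).trans_le
    (Finset.single_le_sum (f := fun k => |(ν k : ℝ)|) (fun _ _ => abs_nonneg _) (Finset.mem_univ k))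
  change _ ≤ C₀ * nrm ν ^ (-τ₀)
  rw [rpow_neg h0.le, ← div_eq_mul_inv, ← rpow_natCast]
  have := rpow_pos_of_pos h0 τ₀
  gcongr
  exact (rpow_le_rpow h0.le (by linarith) hτ).trans (rpow_le_rpow_of_exponent_le (by linarith) (Nat.le_ceil _))

end

end KAM


open MeasureTheory Real Filter

theorem elliptic_resonant_tori_exist (r s : ℕ) (hr : 1 ≤ r) (hs : 1 ≤ s)
    (ω : Fin r → ℝ) (C₀ τ₀ : ℝ) (hC₀ : 0 < C₀) (hτ₀ : (r : ℝ) - 1 ≤ τ₀)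
    (hdio : ∀ ν : Fin r → ℤ, ν ≠ 0 →
      C₀ * (∑ k, |(ν k : ℝ)|) ^ (-τ₀) ≤ |∑ k, ω k * (ν k : ℝ)|)
    (f : (Fin r → ℝ) × (Fin s → ℝ) → ℝ)
    (hfa : AnalyticOnNhd ℝ f Set.univ)
    (hper₁ : ∀ p : (Fin r → ℝ) × (Fin s → ℝ), ∀ i : Fin r,
      f (p.1 + Pi.single i (2 * π), p.2) = f p)
    (hper₂ : ∀ p : (Fin r → ℝ) × (Fin s → ℝ), ∀ j : Fin s,
      f (p.1, p.2 + Pi.single j (2 * π)) = f p)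
    (f₀ : (Fin s → ℝ) → ℝ)
    (hf₀ : ∀ β, f₀ β = ((2 * π) ^ r)⁻¹ *
      ∫ α in Set.univ.pi fun _ : Fin r => Set.Icc (0 : ℝ) (2 * π), f (α, β))
    (β₀ : Fin s → ℝ)
    (hcrit : fderiv ℝ f₀ β₀ = 0)
    (a : Fin s → ℝ) (hpos : ∀ i, 0 < a i) (hmono : StrictMono a)
    (heig : ∀ i, Module.End.HasEigenvalue
      (Matrix.toLin' fun i' j' : Fin s =>
        fderiv ℝ (fun β => fderiv ℝ f₀ β (Pi.single j' 1)) β₀ (Pi.single i' 1)) (a i)) :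
    ∃ (εbar : ℝ) (E : Set ℝ), 0 < εbar ∧ MeasurableSet E ∧ E ⊆ Set.Ioo 0 εbar ∧
      (∀ ε ∈ E,
        ∃ (A : (Fin r → ℝ) → Fin r → ℝ) (B : (Fin r → ℝ) → Fin s → ℝ),
          AnalyticOnNhd ℝ A Set.univ ∧ AnalyticOnNhd ℝ B Set.univ ∧
          (∀ ψ i, A (ψ + Pi.single i (2 * π)) = A ψ) ∧
          (∀ ψ i, B (ψ + Pi.single i (2 * π)) = B ψ) ∧
          (∀ ψ : Fin r → ℝ, ∀ t : ℝ,
            deriv (deriv fun u : ℝ => ψ + u • ω + A (ψ + u • ω)) t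
              = (fun i => -ε * fderiv ℝ f
                  (ψ + t • ω + A (ψ + t • ω), β₀ + B (ψ + t • ω)) (Pi.single i 1, 0)) ∧
            deriv (deriv fun u : ℝ => β₀ + B (ψ + u • ω)) t
              = (fun j => -ε * fderiv ℝ f
                  (ψ + t • ω + A (ψ + t • ω), β₀ + B (ψ + t • ω)) (0, Pi.single j 1)))) ∧
      Tendsto (fun ε => (volume (E ∩ Set.Ioo 0 ε)).toReal / ε)
        (nhdsWithin 0 (Set.Ioi 0)) (nhds 1) := by
  have hf2 : ContDiff ℝ 2 f := contDiffOn_univ.mp hfa.contDiffOn_of_completeSpace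
  have hf0 : f₀ = fun β => KAM.avg fun α => f (α, β) := funext hf₀
  have d1 : ∀ v, (fun β => fderiv ℝ f₀ β v) = fun β => KAM.avg fun α => fderiv ℝ f (α, β) (0, v) := fun v => by
    funext β; rw [hf0]; exact (KAM.avd (hf2.of_le one_le_two) β v).2
  have d2 : ∀ u v, fderiv ℝ (fun β => fderiv ℝ f₀ β u) β₀ v = KAM.avg fun α => fderiv ℝ (fun p => fderiv ℝ f p (0, u)) (α, β₀) (0, v) := fun u v => by
    rw [d1]; exact (KAM.avd (KAM.sd2 hf2 (0, u)) β₀ v).2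
  obtain ⟨L, la, la0, lai, L1, L2⟩ := KAM.lin (fun i j => by
    rw [d2, d2]; congr 1; funext α; exact KAM.sd hf2 _ _ _) hpos hmono heig
  obtain ⟨w, hw⟩ : ∃ w : KAM.JJ r s → (Fin r → ℝ) × (Fin s → ℝ), w = Sum.elim (fun k => (Pi.single k 1, 0)) fun j => (0, fun i => L i j) := ⟨_, rfl⟩
  obtain ⟨Φ, hΦ⟩ : ∃ Φ : (KAM.JJ r s → ℝ) → (Fin r → ℝ) × (Fin s → ℝ), Φ = fun y => (0, β₀) + ∑ i, y i • w i := ⟨_, rfl⟩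
  have hΦ1 : ∀ y, Φ y = (fun k => y (Sum.inl k), β₀ + fun i => ∑ j, L i j * y (Sum.inr j)) := fun y => by
    rw [hΦ, hw]
    refine Prod.ext (funext fun k => ?_) (funext fun i => ?_)
    · simp [Fintype.sum_sum_type, Prod.fst_sum, Finset.sum_apply, Pi.single_apply]
    · simp [Fintype.sum_sum_type, Prod.snd_sum, Finset.sum_apply, mul_comm]
  have hΦ2 : ContDiff ℝ 2 Φ := by rw [hΦ]; fun_prop
  have hch : ∀ g : (Fin r → ℝ) × (Fin s → ℝ) → ℝ, Differentiable ℝ g → ∀ i y, fderiv ℝ (fun y => g (Φ y)) y (Pi.single i 1) = fderiv ℝ g (Φ y) (w i) := fun g hg i y => by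
    have a : HasFDerivAt Φ (∑ i, (ContinuousLinearMap.proj (R := ℝ) (φ := fun _ : KAM.JJ r s => ℝ) i).smulRight (w i)) y := by
      rw [hΦ]
      exact (HasFDerivAt.fun_sum fun i _ => (hasFDerivAt_apply i y).smul_const (w i)).const_add _
    rw [show fderiv ℝ (fun y => g (Φ y)) y = _ from ((hg (Φ y)).hasFDerivAt.comp y a).fderiv]
    simp [-Fintype.sum_sum_type, -map_sum, ContinuousLinearMap.sum_apply, Pi.single_apply]
  obtain ⟨V, hV⟩ : ∃ V : (KAM.JJ r s → ℝ) → ℝ, V = fun y => f (Φ y) := ⟨_, rfl⟩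
  have hG : ∀ i, KAM.Gd V i = fun y => fderiv ℝ f (Φ y) (w i) := fun i => by
    funext y; rw [KAM.Gd, hV, hch f (hf2.differentiable two_ne_zero)]
  have hF : ∀ i j y, KAM.Fd V i j y = fderiv ℝ (fun p => fderiv ℝ f p (w i)) (Φ y) (w j) := fun i j y => by
    rw [KAM.Fd, hG]; exact hch _ ((KAM.sd2 hf2 (w i)).differentiable one_ne_zero) j y
  have he : ∀ ψ, Φ (KAM.e0 ψ) = (ψ, β₀) := fun ψ => by
    rw [hΦ1]; simp [KAM.e0, KAM.em]; rfl
  haveI : Nonempty (KAM.JJ r s) := ⟨Sum.inl ⟨0, hr⟩⟩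
  obtain ⟨κ, C, κ0, C0, fe⟩ := KAM.feV (F := fun y : KAM.JJ r s → ℝ => f (fun k => y (Sum.inl k), β₀ + fun i => y (Sum.inr i))) (by
    intro y _
    have : AnalyticAt ℝ (fun y : KAM.JJ r s → ℝ => (fun k => y (Sum.inl k), β₀ + fun i => y (Sum.inr i))) y :=
      (AnalyticAt.pi fun k => (ContinuousLinearMap.proj (R := ℝ) (φ := fun _ : KAM.JJ r s => ℝ) (Sum.inl k)).analyticAt y).prod
        (analyticAt_const.add (AnalyticAt.pi fun k => (ContinuousLinearMap.proj (R := ℝ) (φ := fun _ : KAM.JJ r s => ℝ) (Sum.inr k)).analyticAt y))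
    exact (hfa _ (Set.mem_univ _)).comp this) (by
    rintro y (k | j) <;> beta_reduce
    · rw [← hper₁ (fun k => y (Sum.inl k), _) k]; congr 2
      · funext i; simp [Pi.single_apply]
      · funext i; simp
    · rw [← hper₂ (fun k => y (Sum.inl k), _) j]; congr 2
      · funext i; simp
      · funext i; simp [Pi.single_apply, add_assoc]) L
  have fe : KAM.FE κ V C := by
    rw [hV]; refine (congrArg (fun g => KAM.FE κ g C) (funext fun y => ?_)).mp fe
    rw [hΦ1]; rfl
  have hV2 : ContDiff ℝ 2 V := by rw [hV]; exact hf2.comp hΦ2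
  obtain ⟨C', C'0, md⟩ := fe.md (m := Sum.elim (fun _ => 1) la) hV2 κ0 C0
  have κ4 : 0 < κ / 4 := by positivity
  have aG : ∀ j, KAM.avg (fun ψ => KAM.Gd V j (KAM.e0 ψ)) = 0 := by
    rintro (k | j)
    · exact KAM.tv md.fV md.dV κ4 k
    · have := congrFun (d1 fun i => L i j) β₀
      rw [hcrit] at this
      rw [hG]; simp only [he, hw, Sum.elim_inr]; exact this.symm
  have aF0 : ∀ i k, KAM.avg (fun ψ => KAM.Fd V i (Sum.inl k) (KAM.e0 ψ)) = 0 := fun i k => KAM.tv (md.fG i) (md.dG i) κ4 k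
  have aF : ∀ i j, KAM.avg (fun ψ => KAM.Fd V i j (KAM.e0 ψ)) = (Matrix.diagonal (Sum.elim (fun _ => 0) la) : Matrix (KAM.JJ r s) (KAM.JJ r s) ℝ) i j := by
    rintro i (k | j)
    · rw [aF0, Matrix.diagonal_apply]; rcases i with i | i <;> simp
    · rcases i with k | i
      · simp only [md.sy (Sum.inl k)]; rw [aF0]; simp
      · simp only [hF, he, hw, Sum.elim_inr]
        rw [← d2, Matrix.diagonal_apply]
        simp only [Sum.inr.injEq, Sum.elim_inr]
        rw [← L2 i j]
        have q : ∀ u : Fin s → ℝ, u = ∑ n, u n • (Pi.single n 1 : Fin s → ℝ) := fun u => by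
          funext i; simp [Finset.sum_apply, Pi.single_apply]
        have q1 : (fun β => fderiv ℝ f₀ β fun k => L k i) = fun β => ∑ n, L n i • fderiv ℝ f₀ β (Pi.single n 1) := by
          funext β; conv_lhs => rw [q fun k => L k i]
          simp only [map_sum, map_smul]
        have q2 : ∀ n, DifferentiableAt ℝ (fun β => fderiv ℝ f₀ β (Pi.single n 1)) β₀ := fun n => by
          rw [d1]; exact (KAM.avd (KAM.sd2 hf2 (0, Pi.single n 1)) β₀ 0).1
        rw [q1, fderiv_fun_sum fun n _ => (q2 n).fun_const_smul _, q fun k => L k j]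
        simp only [map_sum, map_smul, ContinuousLinearMap.sum_apply, Finset.mul_sum, smul_eq_mul]
        refine Finset.sum_congr rfl fun k _ => Finset.sum_congr rfl fun n _ => ?_
        rw [fderiv_const_mul (q2 n), ContinuousLinearMap.smul_apply, smul_eq_mul]
        ring
  obtain ⟨K, S, K0, S0, hK⟩ := KAM.big hr hs md κ4 C'0 rfl aG aF la0 lai hC₀ (KAM.dioph hr hC₀ hτ₀ hdio)
  obtain ⟨E, E1, E2, E3, E4⟩ := KAM.dens K0 S0 hK
  refine ⟨S ^ 2, E, by positivity, E1, E2, fun ε hε => ?_, E4⟩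
  obtain ⟨ε0, x, xa, xp, xd⟩ := E3 ε hε
  obtain ⟨A, hA⟩ : ∃ A : (Fin r → ℝ) → Fin r → ℝ, A = fun ψ k => x (Sum.inl (Sum.inl k)) ψ := ⟨_, rfl⟩
  obtain ⟨B, hB⟩ : ∃ B : (Fin r → ℝ) → Fin s → ℝ, B = fun ψ i => ∑ j, L i j * x (Sum.inl (Sum.inr j)) ψ := ⟨_, rfl⟩
  have hσ : √ε * √ε = ε := mul_self_sqrt ε0.le
  have hX : ∀ ψ, Φ (fun i => Sum.elim ψ (fun _ => 0) i + x (Sum.inl i) ψ) = (ψ + A ψ, β₀ + B ψ) := fun ψ => by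
    rw [hΦ1, hA, hB]; simp only [Sum.elim_inl, Sum.elim_inr, zero_add]; rfl
  have gG : ∀ i ψ, KAM.Gd V i (fun i => Sum.elim ψ (fun _ => 0) i + x (Sum.inl i) ψ) = fderiv ℝ f (ψ + A ψ, β₀ + B ψ) (w i) := fun i ψ => by
    rw [hG]; beta_reduce; rw [hX]
  refine ⟨A, B, fun ψ _ => ?_, fun ψ _ => ?_, fun ψ i => ?_, fun ψ i => ?_, fun ψ t => ⟨?_, ?_⟩⟩
  · rw [hA]; exact AnalyticAt.pi fun k => xa _ ψ (Set.mem_univ _)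
  · rw [hB]; exact AnalyticAt.pi fun k => Finset.analyticAt_fun_sum _ fun j _ => analyticAt_const.mul (xa _ ψ (Set.mem_univ _))
  · rw [hA]; simp only [xp]
  · rw [hB]; simp only [xp]
  · have a1 : ∀ ψ : Fin r → ℝ, HasDerivAt (fun t : ℝ => ψ + t • ω + A (ψ + t • ω)) (ω + fun k => √ε * x (Sum.inr (Sum.inl k)) ψ) 0 := fun ψ => by
      rw [hA]
      refine (((hasDerivAt_id (0 : ℝ)).smul_const ω).const_add ψ).congr_deriv (one_smul ℝ ω) |>.add (hasDerivAt_pi.mpr fun k => ?_)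
      simpa using (xd ψ (Sum.inl k)).1
    have a2 : ∀ ψ : Fin r → ℝ, HasDerivAt (fun t : ℝ => ω + fun k => √ε * x (Sum.inr (Sum.inl k)) (ψ + t • ω))
        (fun i => -ε * fderiv ℝ f (ψ + A ψ, β₀ + B ψ) (Pi.single i 1, 0)) 0 := fun ψ => by
      refine (hasDerivAt_pi.mpr fun k => ?_).const_add ω
      refine ((xd ψ (Sum.inl k)).2.const_mul (√ε)).congr_deriv ?_
      rw [gG, hw, Sum.elim_inl]; linear_combination (-fderiv ℝ f (ψ + A ψ, β₀ + B ψ) (Pi.single k 1, 0)) * hσ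
    have a3 := KAM.sh (g := fun ψ => ψ + A ψ) a1 ψ
    rw [show deriv (fun u : ℝ => ψ + u • ω + A (ψ + u • ω)) = _ from funext fun u => (a3 u).deriv]
    exact (KAM.sh (g := fun ψ => ω + fun k => √ε * x (Sum.inr (Sum.inl k)) ψ) a2 ψ t).deriv
  · have a1 : ∀ ψ : Fin r → ℝ, HasDerivAt (fun t : ℝ => β₀ + B (ψ + t • ω)) (fun i => ∑ j, L i j * (√ε * (la j * x (Sum.inr (Sum.inr j)) ψ))) 0 := fun ψ => by
      rw [hB]
      exact (hasDerivAt_pi.mpr fun k => HasDerivAt.fun_sum fun j _ => (xd ψ (Sum.inr j)).1.const_mul (L k j)).const_add β₀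
    have a2 : ∀ ψ : Fin r → ℝ, HasDerivAt (fun t : ℝ => fun i => ∑ j, L i j * (√ε * (la j * x (Sum.inr (Sum.inr j)) (ψ + t • ω))))
        (fun i => -ε * fderiv ℝ f (ψ + A ψ, β₀ + B ψ) (0, Pi.single i 1)) 0 := fun ψ => by
      refine hasDerivAt_pi.mpr fun i => ?_
      refine (HasDerivAt.fun_sum fun j _ => (((xd ψ (Sum.inr j)).2.const_mul (la j)).const_mul (√ε)).const_mul (L i j)).congr_deriv ?_
      have q : ∀ j, w (Sum.inr j) = ∑ k, L k j • ((0, Pi.single k 1) : (Fin r → ℝ) × (Fin s → ℝ)) := fun j => by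
        rw [hw]; refine Prod.ext (funext fun k => ?_) (funext fun i => ?_)
        · simp [Prod.fst_sum]
        · simp [Prod.snd_sum, Finset.sum_apply, Pi.single_apply]
      simp only [gG, q, map_sum, map_smul, smul_eq_mul]
      calc _ = -ε * ∑ k, (∑ j, L i j * (la j * L k j)) * fderiv ℝ f (ψ + A ψ, β₀ + B ψ) (0, Pi.single k 1) := by
            simp only [Finset.mul_sum, Finset.sum_mul, ← Finset.sum_neg_distrib]
            rw [Finset.sum_comm]
            exact Finset.sum_congr rfl fun k _ => Finset.sum_congr rfl fun j _ => by
              linear_combination (-(L i j * (la j * L k j) * fderiv ℝ f (ψ + A ψ, β₀ + B ψ) (0, Pi.single k 1))) * hσ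
        _ = _ := by simp [L1]
    have a3 := KAM.sh (g := fun ψ => β₀ + B ψ) a1 ψ
    rw [show deriv (fun u : ℝ => β₀ + B (ψ + u • ω)) = _ from funext fun u => (a3 u).deriv]
    exact (KAM.sh (g := fun ψ => fun i => ∑ j, L i j * (√ε * (la j * x (Sum.inr (Sum.inr j)) ψ))) a2 ψ t).deriv
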